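/- There exist c > 0 and ε₀ > 0 such that for all 0 < ε < ε₀ the standard map T_ε has two C¹, homotopically non-trivial, invariant circles with rotation numbers ω_l and ω_b satisfying ω_l < 0 < ω_b and |ω_b − ω_l| < c ε; consequently |ω⁺(ε)| < c ε and |ω⁻(ε)| < c ε, i.e. ln ε − ln |ω^±(ε)| > − ln c. -/

import Mathlib

open Real Filter Set Classical

noncomputable section

/-- The standard map (lift to `ℝ²`): `T_ε(x,y) = (x + y + ε sin x, y + ε sin x)`. -/
def stdMap (ε : ℝ) (p : ℝ × ℝ) : ℝ × ℝ :=
  (p.1 + p.2 + ε * Real.sin p.1, p.2 + ε * Real.sin p.1)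

/-- `γ : ℝ → ℝ²` is (the lift of) a `C¹`, homotopically non-trivial, invariant circle of
`T_ε` with rotation number `ω`: a `C¹` embedding with `γ(s+2π) = γ(s) + (2π,0)`, whose image
is invariant under `T_ε` and on which the translation number is `2πω`. -/
def IsInvCircle (ε ω : ℝ) (γ : ℝ → ℝ × ℝ) : Prop :=
  ContDiff ℝ 1 γ ∧
  (∀ s, deriv γ s ≠ 0) ∧
  (∀ s t : ℝ, γ s = γ t → ∃ k : ℤ, t = s + 2 * π * k) ∧
  (∀ s, γ (s + 2 * π) = γ s + (2 * π, 0)) ∧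
  stdMap ε '' Set.range γ = Set.range γ ∧
  (∀ p ∈ Set.range γ,
    Filter.Tendsto (fun n : ℕ => (((stdMap ε)^[n] p).1 - p.1) / n)
      Filter.atTop (nhds (2 * π * ω)))

/-- `T_ε` has a `C¹`, homotopically non-trivial, invariant circle of rotation number `ω`. -/
def HasInvCircle (ε ω : ℝ) : Prop := ∃ γ : ℝ → ℝ × ℝ, IsInvCircle ε ω γ

/-- `ω⁺(ε) = inf{ω > 0 : T_ε has a C¹, homotopically non-trivial, invariant circle of
rotation number ω}`. -/
def omegaPlus (ε : ℝ) : ℝ := sInf {ω : ℝ | 0 < ω ∧ HasInvCircle ε ω}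

/-- `ω⁻(ε) = sup{ω < 0 : T_ε has a C¹, homotopically non-trivial, invariant circle of
rotation number ω}`. -/
def omegaMinus (ε : ℝ) : ℝ := sSup {ω : ℝ | ω < 0 ∧ HasInvCircle ε ω}

theorem exists_multiplier {ε : ℝ} (hε : 0 < ε) : ∃ l : ℝ, 1 < l ∧ l + 1 / l = 2 + ε := by
  have h := Real.sq_sqrt (show 0 ≤ ε ^ 2 + 4 * ε by positivity)
  have h0 : 0 < √(ε ^ 2 + 4 * ε) := Real.sqrt_pos.2 (by positivity)
  set r := √(ε ^ 2 + 4 * ε)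
  refine ⟨(2 + ε + r) / 2, by linarith, ?_⟩
  have : 2 + ε + r ≠ 0 := by positivity
  field_simp
  nlinarith

/-- The position coordinate in the eigenbasis of the saddle. -/
def saddlePos (l : ℝ) (p : ℂ × ℂ) : ℂ := (l * p.1 - p.2 / l) / (l - 1 / l)

/-- The complexified standard map in the eigenbasis of the saddle. -/
def saddleMap (ε l : ℝ) (p : ℂ × ℂ) : ℂ × ℂ :=
  (l * p.1 + ε * (Complex.sin (saddlePos l p) - saddlePos l p),
   p.2 / l + ε * (Complex.sin (saddlePos l p) - saddlePos l p))

theorem differentiable_saddlePos (l : ℝ) : Differentiable ℂ (saddlePos l) := by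
  unfold saddlePos
  fun_prop

theorem differentiable_saddleMap (ε l : ℝ) : Differentiable ℂ (saddleMap ε l) := by
  unfold saddleMap saddlePos
  fun_prop

theorem exists_lipschitz_sin_sub {c : ℝ} (hc : 0 < c) :
    ∃ δ > 0, ∀ a b : ℂ, ‖a‖ < δ → ‖b‖ < δ →
      ‖(Complex.sin a - a) - (Complex.sin b - b)‖ ≤ c * ‖a - b‖ := by
  have h : HasStrictFDerivAt (fun z : ℂ => Complex.sin z - z) (0 : ℂ →L[ℂ] ℂ) 0 := by
    have := (Complex.hasStrictDerivAt_sin 0).sub (hasStrictDerivAt_id (0 : ℂ))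
    rw [Complex.cos_zero, sub_self] at this
    have h' := this.hasStrictFDerivAt
    rwa [ContinuousLinearMap.toSpanSingleton_zero] at h'
  have h2 := (h.isLittleO).def hc
  rw [nhds_prod_eq, Filter.eventually_prod_self_iff'] at h2
  obtain ⟨t, ht, h3⟩ := h2
  obtain ⟨δ, hδ, h4⟩ := Metric.mem_nhds_iff.1 ht
  refine ⟨δ, hδ, fun a b ha hb => ?_⟩
  simpa using h3 a (h4 (by simpa using ha)) b (h4 (by simpa using hb))

theorem norm_sin_sub_le {a : ℂ} (ha : ‖a‖ ≤ 1) : ‖Complex.sin a - a‖ ≤ ‖a‖ ^ 2 := by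
  have h := Complex.sin_bound ha
  have h1 : Complex.sin a - a = (Complex.sin a - (a - a ^ 3 / 6)) - a ^ 3 / 6 := by ring
  have h2 : ‖Complex.sin a - a‖ ≤ ‖a‖ ^ 5 / 100 + ‖a‖ ^ 3 / 6 := by
    rw [h1]
    refine (norm_sub_le _ _).trans (add_le_add h ?_)
    simp
  have h0 := norm_nonneg a
  have h3 : ‖a‖ ^ 3 ≤ ‖a‖ ^ 2 := pow_le_pow_of_le_one h0 ha (by norm_num)
  have h5 : ‖a‖ ^ 5 ≤ ‖a‖ ^ 2 := pow_le_pow_of_le_one h0 ha (by norm_num)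
  nlinarith [sq_nonneg ‖a‖]

theorem exists_saddlePos_bound {l : ℝ} (hl : 1 < l) :
    ∃ A > 0, ∀ p q : ℂ × ℂ, ‖saddlePos l p - saddlePos l q‖ ≤ A * ‖p - q‖ := by
  have hd : 0 < l - 1 / l := by
    rw [sub_pos, div_lt_iff₀ (by linarith)]; nlinarith
  refine ⟨(l + 1 / l) / (l - 1 / l), by positivity, fun p q => ?_⟩
  have h1 : saddlePos l p - saddlePos l q =
      ((l : ℂ) * (p - q).1 - (p - q).2 / l) / (l - 1 / l) := by
    simp only [saddlePos, Prod.fst_sub, Prod.snd_sub]; ring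
  have h2 : ‖((l : ℂ) - 1 / l)‖ = l - 1 / l := by
    rw [show ((l : ℂ) - 1 / l) = ((l - 1 / l : ℝ) : ℂ) by push_cast; ring,
      Complex.norm_real, Real.norm_of_nonneg hd.le]
  rw [h1, norm_div, h2, div_mul_eq_mul_div]
  refine div_le_div_of_nonneg_right ?_ hd.le
  refine (norm_sub_le _ _).trans ?_
  rw [norm_mul, norm_div, Complex.norm_real, Real.norm_of_nonneg (by linarith : 0 ≤ l), add_mul]
  refine add_le_add (mul_le_mul_of_nonneg_left (norm_fst_le _) (by linarith)) ?_
  rw [one_div, div_eq_inv_mul]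
  exact mul_le_mul_of_nonneg_left (norm_snd_le _) (by positivity)

theorem exists_lipschitz_saddleMap {ε l μ : ℝ} (hε : 0 < ε) (hl : 1 < l) (hμ : l < μ) :
    ∃ δ > 0, ∀ p q : ℂ × ℂ, ‖p‖ < δ → ‖q‖ < δ →
      ‖saddleMap ε l p - saddleMap ε l q‖ ≤ μ * ‖p - q‖ := by
  obtain ⟨A, hA, hA2⟩ := exists_saddlePos_bound hl
  obtain ⟨δ, hδ, h⟩ := exists_lipschitz_sin_sub (c := (μ - l) / (ε * A))
    (div_pos (by linarith) (by positivity))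
  have hz : saddlePos l 0 = 0 := by simp [saddlePos]
  have hn : ∀ p : ℂ × ℂ, ‖p‖ < δ / A → ‖saddlePos l p‖ < δ := fun p hp => by
    have := hA2 p 0
    rw [hz, sub_zero, sub_zero] at this
    rw [lt_div_iff₀ hA] at hp
    linarith
  refine ⟨δ / A, by positivity, fun p q hp hq => ?_⟩
  have key := h _ _ (hn p hp) (hn q hq)
  have key2 : ε * ‖(Complex.sin (saddlePos l p) - saddlePos l p) -
      (Complex.sin (saddlePos l q) - saddlePos l q)‖ ≤ (μ - l) * ‖p - q‖ := by
    calc _ ≤ ε * ((μ - l) / (ε * A) * (A * ‖p - q‖)) := by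
          refine mul_le_mul_of_nonneg_left (key.trans ?_) hε.le
          exact mul_le_mul_of_nonneg_left (hA2 p q)
            (div_nonneg (by linarith) (by positivity))
      _ = (μ - l) * ‖p - q‖ := by field_simp
  set S := (Complex.sin (saddlePos l p) - saddlePos l p) -
      (Complex.sin (saddlePos l q) - saddlePos l q) with hS
  have h1 : saddleMap ε l p - saddleMap ε l q =
      ((l : ℂ) * (p - q).1 + ε * S, (p - q).2 / l + ε * S) := by
    simp only [saddleMap, hS]
    ext <;> simp <;> ring
  rw [h1]
  have f1 := norm_fst_le (p - q)
  have f2 := norm_snd_le (p - q)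
  have hεS : ‖(ε : ℂ) * S‖ ≤ (μ - l) * ‖p - q‖ := by
    rw [norm_mul, Complex.norm_real, Real.norm_of_nonneg hε.le]; exact key2
  refine max_le ?_ ?_
  · refine (norm_add_le _ _).trans ?_
    have : ‖(l : ℂ) * (p - q).1‖ ≤ l * ‖p - q‖ := by
      rw [norm_mul, Complex.norm_real, Real.norm_of_nonneg (by linarith : 0 ≤ l)]
      exact mul_le_mul_of_nonneg_left f1 (by linarith)
    linarith
  · refine (norm_add_le _ _).trans ?_
    have : ‖(p - q).2 / (l : ℂ)‖ ≤ l * ‖p - q‖ := by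
      rw [norm_div, Complex.norm_real, Real.norm_of_nonneg (by linarith : 0 ≤ l)]
      rw [div_le_iff₀ (by linarith)]
      nlinarith [norm_nonneg (p - q), mul_nonneg (norm_nonneg (p-q)) (sq_nonneg (l - 1))]
    linarith

theorem saddlePos_saddleMap {ε l : ℝ} (hl : 1 < l) (hle : l + 1 / l = 2 + ε) (p : ℂ × ℂ) :
    saddlePos l (saddleMap ε l (saddleMap ε l p)) + saddlePos l p =
      2 * saddlePos l (saddleMap ε l p) + ε * Complex.sin (saddlePos l (saddleMap ε l p)) := by
  have h0 : (l : ℂ) ≠ 0 := by exact_mod_cast (by linarith : l ≠ 0)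
  have hd : (l : ℂ) - 1 / l ≠ 0 := by
    have : l - 1 / l ≠ 0 := by
      have : 1 / l < l := by rw [div_lt_iff₀ (by linarith)]; nlinarith
      linarith
    exact_mod_cast this
  have he : (ε : ℂ) = l + 1 / l - 2 := by
    have : ε = l + 1 / l - 2 := by linarith
    rw [this]; push_cast; ring
  set q := saddleMap ε l p with hq
  have e1 : saddlePos l (saddleMap ε l q) =
      (l ^ 2 * q.1 - q.2 / l ^ 2) / (l - 1 / l) + ε * (Complex.sin (saddlePos l q) - saddlePos l q) := by
    have : saddlePos l (saddleMap ε l q) = (l * (l * q.1 + ε * (Complex.sin (saddlePos l q) - saddlePos l q)) -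
      (q.2 / l + ε * (Complex.sin (saddlePos l q) - saddlePos l q)) / l) / (l - 1 / l) := rfl
    rw [this, eq_comm, div_add' _ _ _ hd]
    congr 1
    field_simp
    ring
  have e2 : saddlePos l p = (q.1 - q.2) / (l - 1 / l) := by
    rw [hq]; simp only [saddleMap]
    rw [saddlePos]; ring
  have e3 : ((l : ℂ) + 1 / l) * saddlePos l q = (l ^ 2 * q.1 - q.2 / l ^ 2) / (l - 1 / l) + (q.1 - q.2) / (l - 1 / l) := by
    rw [saddlePos, ← mul_div_assoc, ← add_div]
    congr 1
    field_simp
    ring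
  rw [e1, e2]
  have : (2 : ℂ) * saddlePos l q = ((l : ℂ) + 1 / l) * saddlePos l q - ε * saddlePos l q := by
    rw [he]; ring
  rw [this, e3]
  ring

theorem saddleMap_iterate_diff {ε l μ δ C r r0 : ℝ} (hl : 1 < l)
    (hlip : ∀ p q : ℂ × ℂ, ‖p‖ < δ → ‖q‖ < δ →
      ‖saddleMap ε l p - saddleMap ε l q‖ ≤ μ * ‖p - q‖)
    (hμ : 0 < μ) (hr : r = μ / l ^ 2) (hr1 : r < 1) (hC : 0 ≤ C)
    (hstart : ∀ z : ℂ, ‖z‖ ≤ r0 → ‖saddleMap ε l (z / l, 0) - (z, 0)‖ ≤ C * ‖z‖ ^ 2)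
    (hδ : 2 * r0 < δ) (hCr : C * r0 / (1 - r) ≤ 1) (n : ℕ) :
    (∀ z : ℂ, ‖z‖ ≤ r0 → ‖(saddleMap ε l)^[n] (z / l ^ n, 0)‖ ≤
        ‖z‖ + C * ‖z‖ ^ 2 * ∑ i ∈ Finset.range n, r ^ i) ∧
    (∀ z : ℂ, ‖z‖ ≤ r0 → ‖(saddleMap ε l)^[n + 1] (z / l ^ (n + 1), 0) -
        (saddleMap ε l)^[n] (z / l ^ n, 0)‖ ≤ C * ‖z‖ ^ 2 * r ^ n) := by
  have hr0' : 0 < r := by rw [hr]; positivity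
  have hl0 : (l : ℂ) ≠ 0 := by exact_mod_cast (by linarith : l ≠ 0)
  have hgeom : ∀ n, ∑ i ∈ Finset.range n, r ^ i ≤ 1 / (1 - r) := fun n => by
    rw [one_div, ← tsum_geometric_of_lt_one hr0'.le hr1]
    exact (summable_geometric_of_lt_one hr0'.le hr1).sum_le_tsum _ (fun i _ => by positivity)
  have hnorm : ∀ z : ℂ, ‖z / l‖ = ‖z‖ / l := fun z => by
    rw [norm_div, Complex.norm_real, Real.norm_of_nonneg (by linarith : 0 ≤ l)]
  have hdiv : ∀ z : ℂ, ‖z‖ ≤ r0 → ‖z / l‖ ≤ r0 := fun z hz => by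
    rw [hnorm]
    exact (div_le_self (norm_nonneg _) hl.le).trans hz
  have hsmall : ∀ z : ℂ, ‖z‖ ≤ r0 → ∀ n, ‖z‖ + C * ‖z‖ ^ 2 * ∑ i ∈ Finset.range n, r ^ i < δ := by
    intro z hz n
    have h0 := norm_nonneg z
    have h1 : C * ‖z‖ ^ 2 * ∑ i ∈ Finset.range n, r ^ i ≤ C * (r0 * ‖z‖) * (1 / (1 - r)) := by
      refine mul_le_mul (mul_le_mul_of_nonneg_left ?_ hC) (hgeom n)
        (Finset.sum_nonneg fun i _ => by positivity)
        (mul_nonneg hC (mul_nonneg (h0.trans hz) h0))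
      nlinarith
    have h2 : C * (r0 * ‖z‖) * (1 / (1 - r)) = (C * r0 / (1 - r)) * ‖z‖ := by ring
    nlinarith
  have hstep : ∀ (n : ℕ) (z : ℂ), (saddleMap ε l)^[n + 1] (z / l ^ (n + 1), 0) =
      saddleMap ε l ((saddleMap ε l)^[n] ((z / l) / l ^ n, 0)) := fun n z => by
    rw [Function.iterate_succ_apply', div_div, ← pow_succ']
  induction n with
  | zero => 
    refine ⟨fun z hz => ?_, fun z hz => ?_⟩
    · simp
    · simpa using hstart z hz
  | succ n ih =>
    obtain ⟨ih1, ih2⟩ := ih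
    have hS : ∀ z : ℂ, ‖z‖ ≤ r0 → ‖(saddleMap ε l)^[n + 1] (z / l ^ (n + 1), 0)‖ ≤
        ‖z‖ + C * ‖z‖ ^ 2 * ∑ i ∈ Finset.range (n + 1), r ^ i := fun z hz => by
      rw [Finset.sum_range_succ, mul_add, ← add_assoc]
      have := norm_add_le ((saddleMap ε l)^[n] (z / l ^ n, 0)) 
        ((saddleMap ε l)^[n + 1] (z / l ^ (n + 1), 0) - (saddleMap ε l)^[n] (z / l ^ n, 0))
      rw [add_sub_cancel] at this
      exact this.trans (add_le_add (ih1 z hz) (ih2 z hz))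
    refine ⟨hS, fun z hz => ?_⟩
    rw [hstep (n + 1) z, hstep n z]
    refine (hlip _ _ ((hS _ (hdiv z hz)).trans_lt (hsmall _ (hdiv z hz) _))
      ((ih1 _ (hdiv z hz)).trans_lt (hsmall _ (hdiv z hz) _))).trans ?_
    refine (mul_le_mul_of_nonneg_left (ih2 _ (hdiv z hz)) hμ.le).trans (le_of_eq ?_)
    rw [hnorm, pow_succ r n, hr]
    have : l ≠ 0 := by linarith
    field_simp

theorem saddleMap_start {ε l : ℝ} (hε : 0 < ε) (hl : 1 < l) : ∃ C > 0, ∃ ρ > 0, ∀ z : ℂ, ‖z‖ ≤ ρ →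
    ‖saddleMap ε l (z / l, 0) - (z, 0)‖ ≤ C * ‖z‖ ^ 2 := by
  obtain ⟨A, hA, hA2⟩ := exists_saddlePos_bound hl
  have hl0 : (l : ℂ) ≠ 0 := by exact_mod_cast (by linarith : l ≠ 0)
  refine ⟨ε * A ^ 2, by positivity, 1 / A, by positivity, fun z hz => ?_⟩
  have hz2 : saddlePos l 0 = 0 := by simp [saddlePos]
  have h1 : ‖saddlePos l (z / l, 0)‖ ≤ A * ‖z‖ := by
    have := hA2 (z / l, 0) 0
    rw [hz2, sub_zero, sub_zero] at this
    refine this.trans (mul_le_mul_of_nonneg_left ?_ hA.le)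
    rw [Prod.norm_def]; simp
    rw [abs_of_pos (by linarith)]
    exact (div_le_self (norm_nonneg _) hl.le)
  have h2 : A * ‖z‖ ≤ 1 := by rw [le_div_iff₀ hA] at hz; linarith
  have h3 := norm_sin_sub_le (h1.trans h2)
  have h4 : saddleMap ε l (z / l, 0) - (z, 0) =
      (ε * (Complex.sin (saddlePos l (z / l, 0)) - saddlePos l (z / l, 0)),
       ε * (Complex.sin (saddlePos l (z / l, 0)) - saddlePos l (z / l, 0))) := by
    simp only [saddleMap]
    ext <;> simp
    field_simp; ring
  rw [h4, Prod.norm_def]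
  simp only [max_self, norm_mul, Complex.norm_real, Real.norm_of_nonneg hε.le]
  rw [mul_assoc]
  refine mul_le_mul_of_nonneg_left (h3.trans ?_) hε.le
  rw [← mul_pow]
  exact pow_le_pow_left₀ (norm_nonneg _) h1 2

/-- Entire parametrization of the unstable manifold of the saddle `(0, 0)`. -/
theorem exists_unstable_param {ε l : ℝ} (hε : 0 < ε) (hl : 1 < l) (hle : l + 1 / l = 2 + ε) :
    ∃ X : ℂ → ℂ, Differentiable ℂ X ∧ X 0 = 0 ∧ (∃ κ : ℝ, 0 < κ ∧ HasDerivAt X κ 0) ∧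
      (∀ z, X (l * z) + X (z / l) = 2 * X z + ε * Complex.sin (X z)) ∧
      ∀ t : ℝ, (X t).im = 0 := by
  have hl0 : (l : ℂ) ≠ 0 := by exact_mod_cast (by linarith : l ≠ 0)
  have hlR : l ≠ 0 := by linarith
  have hd : 0 < l - 1 / l := by
    rw [sub_pos, div_lt_iff₀ (by linarith)]; nlinarith
  set μ := (l + l ^ 2) / 2 with hμ
  have hμl : l < μ := by rw [hμ]; nlinarith
  have hμ2 : μ < l ^ 2 := by rw [hμ]; nlinarith
  have hμ0 : 0 < μ := by linarith
  obtain ⟨δ, hδ, hlip⟩ := exists_lipschitz_saddleMap hε hl hμl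
  obtain ⟨C, hC, ρ, hρ, hst⟩ := saddleMap_start hε hl
  set r := μ / l ^ 2 with hr
  have hr0' : 0 < r := by rw [hr]; positivity
  have hr1 : r < 1 := by rw [hr, div_lt_one (by positivity)]; exact hμ2
  obtain ⟨r0, hr0, hr0ρ, hr0δ, hr0C⟩ : ∃ r0 > 0, r0 ≤ ρ ∧ 2 * r0 < δ ∧ C * r0 / (1 - r) ≤ 1 := by
    refine ⟨min ρ (min (δ / 3) ((1 - r) / C)), lt_min hρ (lt_min (by positivity)
      (div_pos (by linarith) hC)), min_le_left _ _, ?_, ?_⟩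
    · have : min ρ (min (δ / 3) ((1 - r) / C)) ≤ δ / 3 := (min_le_right _ _).trans (min_le_left _ _)
      linarith
    · have : min ρ (min (δ / 3) ((1 - r) / C)) ≤ (1 - r) / C :=
        (min_le_right _ _).trans (min_le_right _ _)
      rw [le_div_iff₀ hC] at this
      rw [div_le_one (by linarith)]
      linarith
  have key := saddleMap_iterate_diff hl hlip hμ0 hr hr1 hC.le
    (fun z hz => hst z (hz.trans hr0ρ)) hr0δ hr0C
  set T := saddleMap ε l with hT
  have hTd : Differentiable ℂ T := differentiable_saddleMap ε l
  have hTnd : ∀ n, Differentiable ℂ (T^[n]) := fun n => hTd.iterate n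
  -- convergence in the small disc
  have hdist : ∀ z : ℂ, ‖z‖ ≤ r0 → ∀ n, dist (T^[n] (z / l ^ n, 0)) (T^[n + 1] (z / l ^ (n + 1), 0))
      ≤ C * ‖z‖ ^ 2 * r ^ n := fun z hz n => by
    rw [dist_comm, dist_eq_norm]; exact (key n).2 z hz
  have hconv0 : ∀ z : ℂ, ‖z‖ ≤ r0 → ∃ p, Tendsto (fun n => T^[n] (z / l ^ n, (0 : ℂ))) atTop (nhds p) :=
    fun z hz => cauchySeq_tendsto_of_complete
      (cauchySeq_of_le_geometric r (C * ‖z‖ ^ 2) hr1 (hdist z hz))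
  have hscale : ∀ (N n : ℕ) (z : ℂ), T^[n + N] (z / l ^ (n + N), (0 : ℂ)) =
      T^[N] (T^[n] ((z / l ^ N) / l ^ n, 0)) := fun N n z => by
    rw [← Function.iterate_add_apply, div_div, ← pow_add, add_comm n N]
  have hsm : ∀ z : ℂ, ∃ N : ℕ, ‖z / l ^ N‖ < r0 := fun z => by
    obtain ⟨N, hN⟩ := pow_unbounded_of_one_lt (‖z‖ / r0) hl
    refine ⟨N, ?_⟩
    rw [norm_div, norm_pow, Complex.norm_real, Real.norm_of_nonneg (by linarith : 0 ≤ l),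
      div_lt_iff₀ (by positivity)]
    rwa [div_lt_iff₀ hr0, mul_comm] at hN
  have hconv : ∀ z : ℂ, ∃ p, Tendsto (fun n => T^[n] (z / l ^ n, (0 : ℂ))) atTop (nhds p) := fun z => by
    obtain ⟨N, hN⟩ := hsm z
    obtain ⟨p, hp⟩ := hconv0 _ hN.le
    refine ⟨T^[N] p, (tendsto_add_atTop_iff_nat N).1 ?_⟩
    simp_rw [hscale]
    exact ((hTnd N).continuous.tendsto p).comp hp
  choose P hP using hconv
  have hPN : ∀ (N : ℕ) (z : ℂ), P z = T^[N] (P (z / l ^ N)) := fun N z => by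
    refine tendsto_nhds_unique ((tendsto_add_atTop_iff_nat N).2 (hP z)) ?_
    simp_rw [hscale]
    exact ((hTnd N).continuous.tendsto _).comp (hP _)
  have hPT : ∀ z, P (l * z) = T (P z) := fun z => by
    have := hPN 1 (l * z)
    rwa [pow_one, mul_div_cancel_left₀ _ hl0] at this
  have hPdiff0 : DifferentiableOn ℂ P (Metric.ball 0 r0) := by
    refine TendstoLocallyUniformlyOn.differentiableOn (F := fun n z => T^[n] (z / l ^ n, (0 : ℂ)))
      (φ := atTop) ?_ (Eventually.of_forall fun n => ?_) Metric.isOpen_ball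
    · refine TendstoUniformlyOn.tendstoLocallyUniformlyOn ?_
      rw [Metric.tendstoUniformlyOn_iff]
      intro e he
      have h1 : Tendsto (fun n => C * r0 ^ 2 * r ^ n / (1 - r)) atTop (nhds 0) := by
        have := (tendsto_pow_atTop_nhds_zero_of_lt_one hr0'.le hr1).const_mul (C * r0 ^ 2 / (1 - r))
        rw [mul_zero] at this
        refine this.congr fun n => by ring
      filter_upwards [h1.eventually (gt_mem_nhds he)] with n hn z hz
      rw [mem_ball_zero_iff] at hz
      rw [dist_comm]
      refine lt_of_le_of_lt (dist_le_of_le_geometric_of_tendsto r (C * ‖z‖ ^ 2) hr1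
        (hdist z hz.le) (hP z) n) (lt_of_le_of_lt ?_ hn)
      have : ‖z‖ ^ 2 ≤ r0 ^ 2 := pow_le_pow_left₀ (norm_nonneg _) hz.le 2
      have h1r : 0 < 1 - r := by linarith
      gcongr
    · refine Differentiable.differentiableOn ((hTnd n).comp ?_)
      fun_prop
  have hPdiff : Differentiable ℂ P := fun z => by
    obtain ⟨N, hN⟩ := hsm z
    have h1 : P = fun z => T^[N] (P (z / l ^ N)) := funext (hPN N)
    rw [h1]
    refine DifferentiableAt.comp z (f := fun z => P (z / l ^ N)) (hTnd N _) ?_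
    refine DifferentiableAt.comp z (f := fun z : ℂ => z / l ^ N) (g := P) ?_ (by fun_prop)
    exact hPdiff0.differentiableAt (Metric.isOpen_ball.mem_nhds (by simpa using hN))
  have hP0 : ∀ z : ℂ, ‖z‖ ≤ r0 → ‖P z - (z, 0)‖ ≤ C / (1 - r) * ‖z‖ ^ 2 := fun z hz => by
    have := dist_le_of_le_geometric_of_tendsto r (C * ‖z‖ ^ 2) hr1 (hdist z hz) (hP z) 0
    rw [dist_comm, dist_eq_norm] at this
    simp only [Function.iterate_zero, id, pow_zero, div_one, mul_one] at this
    convert this using 1; ring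
  have hP00 : P 0 = 0 := by
    have := hP0 0 (by simpa using hr0.le)
    simpa [Prod.norm_def, Prod.ext_iff] using this
  have hPderiv : HasDerivAt P (1, 0) 0 := by
    rw [hasDerivAt_iff_isLittleO_nhds_zero]
    have h1 : (fun h : ℂ => P (0 + h) - P 0 - h • ((1 : ℂ), (0 : ℂ))) =O[nhds 0] fun h : ℂ => ‖h‖ ^ 2 := by
      refine Asymptotics.IsBigO.of_bound (C / (1 - r)) ?_
      filter_upwards [Metric.closedBall_mem_nhds (0 : ℂ) hr0] with h hh
      have := hP0 h (by simpa using hh)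
      simpa [hP00] using this
    refine h1.trans_isLittleO ?_
    have := Asymptotics.isLittleO_norm_pow_id (E' := ℂ) (n := 2) (by norm_num)
    exact this
  refine ⟨fun z => saddlePos l (P z), (differentiable_saddlePos l).comp hPdiff, ?_, ⟨l / (l - 1 / l),
    by positivity, ?_⟩, fun z => ?_, fun t => ?_⟩
  · simp [hP00, saddlePos]
  · have h1 : HasDerivAt (fun z => (P z).1) 1 0 := hPderiv.fst
    have h2 : HasDerivAt (fun z => (P z).2) 0 0 := hPderiv.snd
    have := ((h1.const_mul (l : ℂ)).sub (h2.div_const (l : ℂ))).div_const ((l : ℂ) - 1 / l)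
    refine this.congr_deriv ?_
    push_cast; simp
  · have h1 : P (l * z) = T (T (P (z / l))) := by
      rw [hPT, ← hPT (z / l), mul_div_cancel₀ _ hl0]
    have h2 : P z = T (P (z / l)) := by rw [← hPT (z / l), mul_div_cancel₀ _ hl0]
    dsimp only
    rw [h1, h2]
    exact saddlePos_saddleMap hl hle _
  · have hreal : ∀ x y : ℝ, ∃ x' y' : ℝ, T ((x : ℂ), (y : ℂ)) = ((x' : ℂ), (y' : ℂ)) := fun x y => by
      refine ⟨l * x + ε * (Real.sin ((l * x - y / l) / (l - 1 / l)) - (l * x - y / l) / (l - 1 / l)),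
        y / l + ε * (Real.sin ((l * x - y / l) / (l - 1 / l)) - (l * x - y / l) / (l - 1 / l)), ?_⟩
      simp only [hT, saddleMap, saddlePos]
      push_cast
      rfl
    have hreal2 : ∀ (n : ℕ) (x y : ℝ), ∃ x' y' : ℝ, T^[n] ((x : ℂ), (y : ℂ)) = ((x' : ℂ), (y' : ℂ)) := fun n => by
      induction n with
      | zero => exact fun x y => ⟨x, y, rfl⟩
      | succ n ih =>
        intro x y
        obtain ⟨a, b, hab⟩ := hreal x y
        rw [Function.iterate_succ_apply, hab]
        exact ih a b
    have hcl : IsClosed {p : ℂ × ℂ | p.1.im = 0 ∧ p.2.im = 0} :=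
      (isClosed_eq (by fun_prop) continuous_const).inter (isClosed_eq (by fun_prop) continuous_const)
    have hmem : P t ∈ {p : ℂ × ℂ | p.1.im = 0 ∧ p.2.im = 0} := by
      refine hcl.mem_of_tendsto (hP t) (Eventually.of_forall fun n => ?_)
      obtain ⟨a, b, hab⟩ := hreal2 n (t / l ^ n) 0
      push_cast at hab
      rw [hab]; simp
    obtain ⟨m1, m2⟩ := hmem
    have e1 : ((P t).1.re : ℂ) = (P t).1 := Complex.ext rfl (by simp [m1])
    have e2 : ((P t).2.re : ℂ) = (P t).2 := Complex.ext rfl (by simp [m2])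
    have : saddlePos l (P t) = (((l * (P t).1.re - (P t).2.re / l) / (l - 1 / l) : ℝ) : ℂ) := by
      rw [saddlePos]; push_cast; rw [e1, e2]
    dsimp only
    rw [this, Complex.ofReal_im]

theorem exists_analytic_localInverse {X : ℂ → ℂ} (hX : Differentiable ℂ X) {κ : ℂ} (hκ : κ ≠ 0)
    (h0 : HasDerivAt X κ 0) :
    ∃ Ψ : ℂ → ℂ, ∃ ρ > 0, ∀ w, ‖w‖ < ρ →
      Ψ (X w) = w ∧ AnalyticAt ℂ Ψ (X w) ∧ ∀ᶠ ζ in nhds (X w), X (Ψ ζ) = ζ := by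
  have ha : AnalyticAt ℂ X 0 := hX.analyticAt 0
  have hd : deriv X 0 ≠ 0 := by rwa [h0.deriv]
  set Ψ := ha.hasStrictDerivAt.localInverse _ _ _ hd
  have h1 : AnalyticAt ℂ Ψ (X 0) := ha.analyticAt_localInverse hd
  have h2 : ∀ᶠ ζ in nhds (X 0), X (Ψ ζ) = ζ := HasStrictDerivAt.eventually_right_inverse ..
  have h3 : ∀ᶠ w in nhds 0, Ψ (X w) = w := HasStrictDerivAt.eventually_left_inverse ..
  have hc : Tendsto X (nhds 0) (nhds (X 0)) := hX.continuous.tendsto 0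
  have h4 := (h3.and ((hc.eventually h1.eventually_analyticAt).and
    (hc.eventually h2.eventually_nhds)))
  obtain ⟨ρ, hρ, h5⟩ := Metric.eventually_nhds_iff.1 h4
  exact ⟨Ψ, ρ, hρ, fun w hw => h5 (by simpa using hw)⟩

/-- Two homoclinic parametrizations match at `z` and `w`. -/
def Matched (X : ℂ → ℂ) (l : ℝ) (z w : ℂ) : Prop :=
  X z = 2 * π - X w ∧ X (l * z) = 2 * π - X (w / l)

theorem matched_scale {X : ℂ → ℂ} {l ε : ℝ} (hl : 1 < l)
    (hXe : ∀ z, X (l * z) + X (z / l) = 2 * X z + ε * Complex.sin (X z))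
    {z w : ℂ} (h : Matched X l z w) : Matched X l (l * z) (w / l) := by
  have hl0 : (l : ℂ) ≠ 0 := by exact_mod_cast (by linarith : l ≠ 0)
  obtain ⟨h1, h2⟩ := h
  refine ⟨h2, ?_⟩
  have e1 := hXe (l * z)
  have e2 := hXe (w / l)
  rw [mul_div_cancel_left₀ _ hl0] at e1
  rw [mul_div_cancel₀ _ hl0] at e2
  have : Complex.sin (2 * π - X (w / l)) = - Complex.sin (X (w / l)) := by
    rw [Complex.sin_two_pi_sub]
  rw [h2, this, h1] at e1
  linear_combination e1 + e2

theorem matched_unscale {X : ℂ → ℂ} {l ε : ℝ} (hl : 1 < l)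
    (hXe : ∀ z, X (l * z) + X (z / l) = 2 * X z + ε * Complex.sin (X z))
    {z w : ℂ} (h : Matched X l z w) : Matched X l (z / l) (l * w) := by
  have hl0 : (l : ℂ) ≠ 0 := by exact_mod_cast (by linarith : l ≠ 0)
  obtain ⟨h1, h2⟩ := h
  refine ⟨?_, ?_⟩
  · have e1 := hXe z
    have e2 := hXe w
    have : Complex.sin (2 * π - X w) = - Complex.sin (X w) := by
      rw [Complex.sin_two_pi_sub]
    rw [h1, this, h2] at e1
    linear_combination e1 + e2
  · rw [mul_div_cancel₀ _ hl0, mul_div_cancel_left₀ _ hl0]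
    exact h1

theorem matched_scale_pow {X : ℂ → ℂ} {l ε : ℝ} (hl : 1 < l)
    (hXe : ∀ z, X (l * z) + X (z / l) = 2 * X z + ε * Complex.sin (X z))
    {z w : ℂ} (h : Matched X l z w) (n : ℕ) :
    Matched X l (l ^ n * z) (w / l ^ n) := by
  induction n with
  | zero => simpa using h
  | succ n ih =>
    have := matched_scale hl hXe ih
    rwa [← mul_assoc, ← pow_succ', div_div, ← pow_succ] at this

theorem matched_unscale_pow {X : ℂ → ℂ} {l ε : ℝ} (hl : 1 < l)
    (hXe : ∀ z, X (l * z) + X (z / l) = 2 * X z + ε * Complex.sin (X z))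
    {z w : ℂ} (h : Matched X l z w) (n : ℕ) :
    Matched X l (z / l ^ n) (l ^ n * w) := by
  induction n with
  | zero => simpa using h
  | succ n ih =>
    have := matched_unscale hl hXe ih
    rwa [← mul_assoc, ← pow_succ', div_div, ← pow_succ] at this

theorem tendsto_div_multiplier_pow {l : ℝ} (hl : 1 < l) (z : ℂ) : Tendsto (fun n : ℕ => z / l ^ n) atTop (nhds 0) := by
  have h : Tendsto (fun n : ℕ => z * ((l : ℂ)⁻¹) ^ n) atTop (nhds (z * 0)) := by
    refine (tendsto_pow_atTop_nhds_zero_of_norm_lt_one ?_).const_mul z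
    rw [norm_inv, Complex.norm_real, Real.norm_of_nonneg (by linarith)]
    exact inv_lt_one_of_one_lt₀ hl
  rw [mul_zero] at h
  exact h.congr fun n => by rw [inv_pow, div_eq_mul_inv]

theorem matched_ne_zero {X : ℂ → ℂ} {l ε : ℝ} (hl : 1 < l)
    (hXe : ∀ z, X (l * z) + X (z / l) = 2 * X z + ε * Complex.sin (X z))
    (hX : Continuous X) (hX0 : X 0 = 0) {z w : ℂ} (h : Matched X l z w) :
    z ≠ 0 ∧ w ≠ 0 := by
  have hpi : (2 * π : ℂ) ≠ 0 := by exact_mod_cast (by positivity : (2 * π) ≠ 0)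
  constructor
  · rintro rfl
    have h1 : ∀ n : ℕ, X (w / l ^ n) = 2 * π := fun n => by
      have := (matched_scale_pow hl hXe h n).1
      rw [mul_zero, hX0] at this
      linear_combination this
    have h2 := (hX.tendsto 0).comp (tendsto_div_multiplier_pow hl w)
    have h3 : Tendsto (X ∘ fun n : ℕ => w / l ^ n) atTop (nhds (2 * π)) :=
      tendsto_const_nhds.congr fun n => (h1 n).symm
    have := tendsto_nhds_unique h2 h3
    rw [hX0] at this
    exact hpi this.symm
  · rintro rfl
    have h1 : ∀ n : ℕ, X (z / l ^ n) = 2 * π := fun n => by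
      have := (matched_unscale_pow hl hXe h n).1
      rwa [mul_zero, hX0, sub_zero] at this
    have h2 := (hX.tendsto 0).comp (tendsto_div_multiplier_pow hl z)
    have h3 : Tendsto (X ∘ fun n : ℕ => z / l ^ n) atTop (nhds (2 * π)) :=
      tendsto_const_nhds.congr fun n => (h1 n).symm
    have := tendsto_nhds_unique h2 h3
    rw [hX0] at this
    exact hpi this.symm

theorem matched_unique {X : ℂ → ℂ} {l ε : ℝ} (hl : 1 < l)
    (hXe : ∀ z, X (l * z) + X (z / l) = 2 * X z + ε * Complex.sin (X z))
    {ρ : ℝ} (hρ : 0 < ρ) {Ψ : ℂ → ℂ} (hΨ : ∀ w, ‖w‖ < ρ → Ψ (X w) = w) {z w w' : ℂ}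
    (h : Matched X l z w) (h' : Matched X l z w') : w = w' := by
  have hl0 : (l : ℂ) ≠ 0 := by exact_mod_cast (by linarith : l ≠ 0)
  have e : ∀ n : ℕ, X (w / l ^ n) = X (w' / l ^ n) := fun n => by
    have h1 := (matched_scale_pow hl hXe h n).1
    have h2 := (matched_scale_pow hl hXe h' n).1
    linear_combination h1 - h2
  have t1 := (tendsto_div_multiplier_pow hl w).norm.eventually (gt_mem_nhds (by simpa using hρ))
  have t2 := (tendsto_div_multiplier_pow hl w').norm.eventually (gt_mem_nhds (by simpa using hρ))
  obtain ⟨n, n1, n2⟩ := (t1.and t2).exists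
  have := hΨ _ n1
  rw [e n, hΨ _ n2] at this
  have hln : (l : ℂ) ^ n ≠ 0 := pow_ne_zero _ hl0
  field_simp at this
  exact this.symm

/-- The points of the unstable manifold that lie analytically on the opposite manifold. -/
def matchedDomain (X : ℂ → ℂ) (l : ℝ) : Set ℂ :=
  {z | ∃ σ : ℂ → ℂ, AnalyticAt ℂ σ z ∧ ∀ᶠ ζ in nhds z, Matched X l ζ (σ ζ)}

theorem no_matched_point {X : ℂ → ℂ} {l ε : ℝ} (hl : 1 < l)
    (hXe : ∀ z, X (l * z) + X (z / l) = 2 * X z + ε * Complex.sin (X z))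
    (hX : Differentiable ℂ X) (hX0 : X 0 = 0) {κ : ℂ} (hκ : κ ≠ 0) (hd : HasDerivAt X κ 0) :
    matchedDomain X l = ∅ := by
  by_contra hne
  obtain ⟨p, hp⟩ := nonempty_iff_ne_empty.2 hne
  have hl0 : (l : ℂ) ≠ 0 := by exact_mod_cast (by linarith : l ≠ 0)
  have hlp : 0 < l := by linarith
  have hnl : ‖(l : ℂ)‖ = l := by rw [Complex.norm_real, Real.norm_of_nonneg hlp.le]
  obtain ⟨Ψ, ρ, hρ, hΨ⟩ := exists_analytic_localInverse hX hκ hd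
  have huniq : ∀ {z w w' : ℂ}, Matched X l z w → Matched X l z w' → w = w' :=
    fun h h' => matched_unique hl hXe hρ (fun w hw => (hΨ w hw).1) h h'
  set O := matchedDomain X l with hO
  -- the matching function
  have hex : ∀ z ∈ O, ∃ w, Matched X l z w := fun z ⟨σ, _, h⟩ => ⟨σ z, h.self_of_nhds⟩
  choose! S hS using hex
  have hOopen : IsOpen O := by
    rw [isOpen_iff_mem_nhds]
    rintro z ⟨σ, h1, h2⟩
    filter_upwards [h1.eventually_analyticAt, h2.eventually_nhds] with ζ a b
    exact ⟨σ, a, b⟩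
  have hSan : ∀ z ∈ O, AnalyticAt ℂ S z := by
    intro z hz
    obtain ⟨σ, h1, h2⟩ := id hz
    refine h1.congr ?_
    filter_upwards [h2, hOopen.mem_nhds hz] with ζ a b
    exact huniq a (hS ζ b)
  have hO0 : ∀ z ∈ O, z ≠ 0 ∧ S z ≠ 0 := fun z hz =>
    matched_ne_zero hl hXe hX.continuous hX0 (hS z hz)
  have hOscale : ∀ z : ℂ, (l : ℂ) * z ∈ O ↔ z ∈ O := by
    intro z
    constructor
    · rintro ⟨σ, h1, h2⟩
      refine ⟨fun ζ => l * σ (l * ζ), ?_, ?_⟩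
      · refine analyticAt_const.mul (AnalyticAt.fun_comp (f := fun ζ : ℂ => l * ζ) h1 (by fun_prop))
      · have hc : Tendsto (fun ζ : ℂ => l * ζ) (nhds z) (nhds (l * z)) :=
          (continuous_const.mul continuous_id).tendsto z
        filter_upwards [hc.eventually h2] with ζ h
        have := matched_unscale hl hXe h
        rwa [mul_div_cancel_left₀ _ hl0] at this
    · rintro ⟨σ, h1, h2⟩
      have e : (l * z) / l = z := mul_div_cancel_left₀ _ hl0
      refine ⟨fun ζ => σ (ζ / l) / l, ?_, ?_⟩
      · refine AnalyticAt.div (AnalyticAt.fun_comp (f := fun ζ : ℂ => ζ / l) (by rwa [e]) ?_)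
          analyticAt_const hl0
        exact analyticAt_id.div analyticAt_const hl0
      · have hc : Tendsto (fun ζ : ℂ => ζ / l) (nhds (l * z)) (nhds z) := by
          have := (continuous_id.div_const (l : ℂ)).tendsto (l * z)
          simpa [e] using this
        filter_upwards [hc.eventually h2] with ζ h
        have := matched_scale hl hXe h
        rwa [mul_div_cancel₀ _ hl0] at this
  have hSscale : ∀ z ∈ O, S (l * z) = S z / l := fun z hz =>
    huniq (hS _ ((hOscale z).2 hz)) (matched_scale hl hXe (hS z hz))
  -- sequential closedness, small target
  have hclosed0 : ∀ (u : ℕ → ℂ) (z w : ℂ), (∀ n, u n ∈ O) → Tendsto u atTop (nhds z) →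
      Tendsto (fun n => S (u n)) atTop (nhds w) → ‖w‖ < ρ → z ∈ O := by
    intro u z w hu huz huw hw
    by_contra hzO
    obtain ⟨a1, a2, a3⟩ := hΨ w hw
    have hm1 : X z = 2 * π - X w := by
      refine tendsto_nhds_unique ((hX.continuous.tendsto z).comp huz) ?_
      refine (tendsto_const_nhds.sub ((hX.continuous.tendsto w).comp huw)).congr fun n => ?_
      exact ((hS _ (hu n)).1).symm
    have hXw : 2 * π - X z = X w := by rw [hm1]; ring
    have hσ : AnalyticAt ℂ (fun ζ => Ψ (2 * π - X ζ)) z := by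
      refine AnalyticAt.fun_comp (f := fun ζ => 2 * π - X ζ) (by rwa [hXw]) ?_
      exact analyticAt_const.sub (hX.analyticAt z)
    have hcont : Tendsto (fun ζ => 2 * π - X ζ) (nhds z) (nhds (X w)) := by
      have h : Continuous fun ζ => 2 * (π : ℂ) - X ζ := continuous_const.sub hX.continuous
      exact hXw ▸ h.tendsto z
    refine hzO ⟨fun ζ => Ψ (2 * π - X ζ), hσ, ?_⟩
    have hF : AnalyticAt ℂ (fun ζ => X (l * ζ) - (2 * π - X (Ψ (2 * π - X ζ) / l))) z := by
      have b1 : AnalyticAt ℂ (fun ζ : ℂ => X (l * ζ)) z :=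
        AnalyticAt.fun_comp (f := fun ζ : ℂ => l * ζ) (hX.analyticAt _) (by fun_prop)
      have b2 : AnalyticAt ℂ (fun ζ : ℂ => X (Ψ (2 * π - X ζ) / l)) z :=
        AnalyticAt.fun_comp (f := fun ζ : ℂ => Ψ (2 * π - X ζ) / l) (hX.analyticAt _)
          (hσ.div analyticAt_const hl0)
      exact b1.sub (analyticAt_const.sub b2)
    have hfreq : ∃ᶠ ζ in nhdsWithin z {z}ᶜ, X (l * ζ) - (2 * π - X (Ψ (2 * π - X ζ) / l)) = 0 := by
      have hu' : Tendsto u atTop (nhdsWithin z {z}ᶜ) :=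
        tendsto_nhdsWithin_of_tendsto_nhds_of_eventually_within _ huz
          (Eventually.of_forall fun n => fun h => hzO (h ▸ hu n))
      refine hu'.frequently (Eventually.frequently ?_)
      have hball : ∀ᶠ n in atTop, ‖S (u n)‖ < ρ := huw.norm.eventually (gt_mem_nhds hw)
      filter_upwards [hball] with n hn
      obtain ⟨c1, c2⟩ := hS _ (hu n)
      have : Ψ (2 * π - X (u n)) = S (u n) := by
        rw [c1, sub_sub_cancel]; exact (hΨ _ hn).1
      rw [this, c2]; ring
    have hev := hF.frequently_zero_iff_eventually_zero.1 hfreq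
    filter_upwards [hev, hcont.eventually a3] with ζ d1 d2
    refine ⟨?_, ?_⟩
    · rw [d2]; ring
    · linear_combination d1
  have hscalepow : ∀ (k : ℕ) (z : ℂ), (l : ℂ) ^ k * z ∈ O ↔ z ∈ O := by
    intro k
    induction k with
    | zero => simp
    | succ k ih => intro z; rw [pow_succ', mul_assoc, hOscale, ih]
  have hSpow : ∀ (k : ℕ), ∀ z ∈ O, S ((l : ℂ) ^ k * z) = S z / l ^ k := by
    intro k
    induction k with
    | zero => simp
    | succ k ih => 
      intro z hz
      rw [pow_succ', mul_assoc, hSscale _ ((hscalepow k z).2 hz), ih z hz, div_div, mul_comm]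
  have hclosed : ∀ (u : ℕ → ℂ) (z w : ℂ), (∀ n, u n ∈ O) → Tendsto u atTop (nhds z) →
      Tendsto (fun n => S (u n)) atTop (nhds w) → z ∈ O := by
    intro u z w hu huz huw
    obtain ⟨k, hk⟩ := ((tendsto_div_multiplier_pow hl w).norm.eventually
      (gt_mem_nhds (by simpa using hρ))).exists
    rw [← hscalepow k]
    refine hclosed0 (fun n => l ^ k * u n) _ (w / l ^ k) (fun n => (hscalepow k _).2 (hu n))
      (huz.const_mul _) ?_ hk
    exact (huw.div_const _).congr fun n => (hSpow k _ (hu n)).symm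
  -- the invariant function
  set h : ℂ → ℂ := fun z => if z ∈ O then 1 / (z * S z) else 0 with hh
  have hhO : ∀ z ∈ O, h z = 1 / (z * S z) := fun z hz => if_pos hz
  have hhan : ∀ z ∈ O, AnalyticAt ℂ h z := by
    intro z hz
    have : AnalyticAt ℂ (fun z => 1 / (z * S z)) z :=
      analyticAt_const.div (analyticAt_id.mul (hSan z hz)) (mul_ne_zero (hO0 z hz).1 (hO0 z hz).2)
    refine this.congr ?_
    filter_upwards [hOopen.mem_nhds hz] with ζ hζ
    exact (hhO ζ hζ).symm
  have hhcont : ∀ z ≠ 0, ContinuousAt h z := by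
    intro z hz0
    by_cases hz : z ∈ O
    · exact (hhan z hz).continuousAt
    have hz2 : h z = 0 := if_neg hz
    rw [ContinuousAt, hz2, tendsto_iff_seq_tendsto]
    intro u hu
    by_contra hnot
    rw [Metric.tendsto_atTop] at hnot
    push Not at hnot
    obtain ⟨δ, hδ, hN⟩ := hnot
    have hfr : ∃ᶠ n in atTop, δ ≤ ‖h (u n)‖ := by
      rw [frequently_atTop]
      intro N
      obtain ⟨n, hn, hn2⟩ := hN N
      exact ⟨n, hn, by simpa using hn2⟩
    obtain ⟨φ, hφ, hφ2⟩ := extraction_of_frequently_atTop hfr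
    have hmem : ∀ n, u (φ n) ∈ O := fun n => by
      by_contra hc
      have := hφ2 n
      rw [show h (u (φ n)) = 0 from if_neg hc, norm_zero] at this
      linarith
    have huφ : Tendsto (fun n => u (φ n)) atTop (nhds z) := hu.comp hφ.tendsto_atTop
    have hbd : ∀ᶠ n in atTop, S (u (φ n)) ∈ Metric.closedBall (0 : ℂ) (2 / (δ * ‖z‖)) := by
      have hzn : 0 < ‖z‖ := norm_pos_iff.2 hz0
      have : ∀ᶠ n in atTop, ‖z‖ / 2 < ‖u (φ n)‖ := huφ.norm.eventually (lt_mem_nhds (by linarith))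
      filter_upwards [this] with n hn
      have h1 := hφ2 n
      rw [hhO _ (hmem n), norm_div, norm_one, norm_mul] at h1
      have hs : 0 < ‖S (u (φ n))‖ := norm_pos_iff.2 (hO0 _ (hmem n)).2
      rw [le_div_iff₀ (mul_pos (by linarith) hs)] at h1
      rw [mem_closedBall_zero_iff, le_div_iff₀ (by positivity)]
      nlinarith [mul_pos hδ hs]
    obtain ⟨w, -, θ, hθ, hw⟩ := (isCompact_closedBall (0 : ℂ) (2 / (δ * ‖z‖))).tendsto_subseq'
      hbd.frequently
    exact hz (hclosed (fun n => u (φ (θ n))) z w (fun n => hmem _) (huφ.comp hθ.tendsto_atTop) hw)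
  have hhinv : ∀ z, h (l * z) = h z := by
    intro z
    by_cases hz : z ∈ O
    · rw [hhO z hz, hhO _ ((hOscale z).2 hz), hSscale z hz]
      congr 1
      field_simp
    · have h2 : ¬ (l * z ∈ O) := fun hc => hz ((hOscale z).1 hc)
      simp only [hh, if_neg hz, if_neg h2]
  have hhinvpow : ∀ (k : ℕ) z, h (l ^ k * z) = h z := by
    intro k
    induction k with
    | zero => simp
    | succ k ih => intro z; rw [pow_succ', mul_assoc, hhinv, ih]
  -- maximum over a fundamental annulus
  set K : Set ℂ := Metric.closedBall 0 l ∩ {z | 1 ≤ ‖z‖} with hK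
  have hKc : IsCompact K := (isCompact_closedBall _ _).inter_right
    (isClosed_le continuous_const continuous_norm)
  have hK0 : ∀ z ∈ K, z ≠ 0 := fun z hz h0 => by
    have := hz.2
    simp only [mem_ofPred_eq, h0, norm_zero] at this
    linarith
  have hKscale : ∀ z : ℂ, z ≠ 0 → ∃ z' ∈ K, h z' = h z := by
    intro z hz
    have hzn : 0 < ‖z‖ := norm_pos_iff.2 hz
    rcases le_or_gt 1 ‖z‖ with hge | hlt
    · obtain ⟨n, hn1, hn2⟩ := exists_nat_pow_near hge hl
      refine ⟨z / l ^ n, ⟨?_, ?_⟩, ?_⟩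
      · rw [mem_closedBall_zero_iff, norm_div, norm_pow, hnl, div_le_iff₀ (by positivity)]
        rw [pow_succ] at hn2; linarith
      · rw [mem_ofPred_eq, norm_div, norm_pow, hnl, le_div_iff₀ (by positivity)]
        linarith
      · rw [← hhinvpow n, mul_div_cancel₀ _ (pow_ne_zero _ hl0)]
    · have h1 : 1 ≤ ‖z‖⁻¹ := (one_le_inv₀ hzn).2 hlt.le
      obtain ⟨n, hn1, hn2⟩ := exists_nat_pow_near h1 hl
      refine ⟨l ^ (n + 1) * z, ⟨?_, ?_⟩, hhinvpow _ _⟩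
      · rw [mem_closedBall_zero_iff, norm_mul, norm_pow, hnl, pow_succ]
        have : l ^ n * ‖z‖ ≤ 1 := by
          rwa [le_inv_comm₀ (by positivity) hzn, ← one_div, le_div_iff₀ (by positivity), mul_comm] at hn1
        nlinarith
      · rw [mem_ofPred_eq, norm_mul, norm_pow, hnl]
        rw [inv_lt_iff_one_lt_mul₀ hzn, mul_comm] at hn2
        linarith
  have hKne : K.Nonempty := ⟨1, by simpa [hK] using hl.le⟩
  obtain ⟨m, hmK, hmax⟩ := hKc.exists_isMaxOn hKne (f := fun z => ‖h z‖)
    (fun z hz => ((hhcont z (hK0 z hz)).norm).continuousWithinAt)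
  have hmaxall : ∀ z : ℂ, z ≠ 0 → ‖h z‖ ≤ ‖h m‖ := fun z hz => by
    obtain ⟨z', hz', e⟩ := hKscale z hz
    rw [← e]; exact hmax hz'
  have hMpos : 0 < ‖h m‖ := by
    refine lt_of_lt_of_le ?_ (hmaxall p (hO0 p hp).1)
    rw [hhO p hp]
    exact norm_pos_iff.2 (one_div_ne_zero (mul_ne_zero (hO0 p hp).1 (hO0 p hp).2))
  have hOofM : ∀ z, ‖h z‖ = ‖h m‖ → z ∈ O := fun z hz => by
    by_contra hc
    rw [show h z = 0 from if_neg hc, norm_zero] at hz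
    linarith
  -- connectedness
  have hall : ∀ z : ℂ, z ≠ 0 → ‖h z‖ = ‖h m‖ := by
    have hconn : IsPreconnected ({0}ᶜ : Set ℂ) :=
      (isConnected_compl_singleton_of_one_lt_rank (by simp) 0).isPreconnected
    set A : Set ℂ := {z | ‖h z‖ = ‖h m‖} with hA
    have hAopen : IsOpen A := by
      rw [isOpen_iff_mem_nhds]
      intro z hz
      have hzO := hOofM z hz
      have hloc : IsLocalMax (norm ∘ h) z := by
        filter_upwards [isOpen_ne.mem_nhds (hO0 z hzO).1] with ζ hζ
        simp only [Function.comp]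
        rw [show ‖h z‖ = ‖h m‖ from hz]
        exact hmaxall ζ hζ
      have := Complex.norm_eventually_eq_of_isLocalMax
        ((hhan z hzO).eventually_analyticAt.mono fun ζ hζ => hζ.differentiableAt) hloc
      filter_upwards [this] with ζ hζ
      exact hζ.trans hz
    have hBopen : IsOpen ({z | ‖h z‖ ≠ ‖h m‖} ∩ ({0}ᶜ : Set ℂ)) := by
      rw [isOpen_iff_mem_nhds]
      rintro z ⟨hz1, hz2⟩
      have hc := (hhcont z hz2).norm
      filter_upwards [hc.eventually (isOpen_ne.mem_nhds hz1), isOpen_ne.mem_nhds hz2] with ζ a b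
      exact ⟨a, b⟩
    intro z hz
    by_contra hcon
    obtain ⟨q, -, hqA, hqB⟩ := hconn A _ hAopen hBopen (fun ζ hζ => by
      by_cases hc : ‖h ζ‖ = ‖h m‖
      · exact Or.inl hc
      · exact Or.inr ⟨hc, hζ⟩) ⟨m, hK0 m hmK, rfl⟩ ⟨z, hz, hcon, hz⟩
    exact hqB.1 hqA
  have hSn : ∀ z : ℂ, 1 ≤ ‖z‖ → ‖S z‖ ≤ 1 / ‖h m‖ := fun z hz => by
    have hz0 : z ≠ 0 := fun h => by rw [h, norm_zero] at hz; linarith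
    have h1 := hall z hz0
    have h2 := hOofM z h1
    have hs : 0 < ‖S z‖ := norm_pos_iff.2 (hO0 _ h2).2
    rw [← h1, hhO z h2, norm_div, norm_one, one_div_one_div, norm_mul]
    nlinarith
  obtain ⟨B, hB⟩ := (isCompact_closedBall (0 : ℂ) (1 / ‖h m‖)).exists_bound_of_continuousOn
    hX.continuous.continuousOn
  obtain ⟨B', hB'⟩ := (isCompact_closedBall (0 : ℂ) 1).exists_bound_of_continuousOn
    hX.continuous.continuousOn
  have hbdd : Bornology.IsBounded (range X) := by
    rw [isBounded_iff_forall_norm_le]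
    refine ⟨max B' (‖(2 * π : ℂ)‖ + B), ?_⟩
    rintro _ ⟨z, rfl⟩
    rcases le_or_gt ‖z‖ 1 with hz | hz
    · exact (hB' z (by simpa using hz)).trans (le_max_left _ _)
    · have hz0 : z ≠ 0 := fun h => by rw [h, norm_zero] at hz; linarith
      have h2 := hS z (hOofM z (hall z hz0))
      rw [h2.1]
      refine ((norm_sub_le _ _).trans (add_le_add le_rfl ?_)).trans (le_max_right _ _)
      exact hB _ (by rw [mem_closedBall_zero_iff]; exact hSn z hz.le)
  obtain ⟨c, hc⟩ := hX.exists_eq_const_of_bounded hbdd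
  rw [hc] at hd
  exact hκ (hd.unique (hasDerivAt_const 0 c))

theorem recurrence_le_of_tendsto {ε : ℝ} (hε : 0 < ε) {z y : ℕ → ℝ}
    (hz : ∀ k, z k ∈ Icc 0 (π / 2)) (hy : ∀ k, y k ∈ Icc 0 (π / 2))
    (hzr : ∀ k, z (k + 2) + z k = 2 * z (k + 1) + ε * sin (z (k + 1)))
    (hyr : ∀ k, y (k + 2) + y k = 2 * y (k + 1) + ε * sin (y (k + 1)))
    (h0 : z 0 = y 0) (hzl : Tendsto z atTop (nhds 0)) (hyl : Tendsto y atTop (nhds 0)) :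
    y 1 ≤ z 1 := by
  by_contra hlt
  push Not at hlt
  have key : ∀ k, 0 < y (k + 1) - z (k + 1) ∧ y k - z k ≤ y (k + 1) - z (k + 1) := by
    intro k
    induction k with
    | zero => exact ⟨by simpa using hlt, by simp [h0]; linarith⟩
    | succ k ih =>
      have hs : sin (z (k + 1)) ≤ sin (y (k + 1)) :=
        Real.sin_le_sin_of_le_of_le_pi_div_two (by linarith [(hz (k + 1)).1, pi_pos])
          (hy (k + 1)).2 (by linarith [ih.1])
      have hs' : ε * sin (z (k + 1)) ≤ ε * sin (y (k + 1)) := by gcongr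
      have h1 := hzr k
      have h2 := hyr k
      constructor <;> rw [show k + 1 + 1 = k + 2 from rfl] <;> linarith [ih.1, ih.2]
  have key2 : ∀ k, y 1 - z 1 ≤ y (k + 1) - z (k + 1) := by
    intro k
    induction k with
    | zero => simp
    | succ k ih => exact ih.trans (key (k + 1)).2
  have hlim : Tendsto (fun k => y (k + 1) - z (k + 1)) atTop (nhds (0 - 0)) :=
    ((tendsto_add_atTop_iff_nat 1).2 hyl).sub ((tendsto_add_atTop_iff_nat 1).2 hzl)
  have := ge_of_tendsto' hlim key2
  linarith

theorem recurrence_eq_of_tendsto {ε : ℝ} (hε : 0 < ε) {z y : ℕ → ℝ}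
    (hz : ∀ k, z k ∈ Icc 0 (π / 2)) (hy : ∀ k, y k ∈ Icc 0 (π / 2))
    (hzr : ∀ k, z (k + 2) + z k = 2 * z (k + 1) + ε * sin (z (k + 1)))
    (hyr : ∀ k, y (k + 2) + y k = 2 * y (k + 1) + ε * sin (y (k + 1)))
    (h0 : z 0 = y 0) (hzl : Tendsto z atTop (nhds 0)) (hyl : Tendsto y atTop (nhds 0)) :
    y 1 = z 1 :=
  le_antisymm (recurrence_le_of_tendsto hε hz hy hzr hyr h0 hzl hyl)
    (recurrence_le_of_tendsto hε hy hz hyr hzr h0.symm hyl hzl)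

/-- The standard map has no invariant graph containing a saddle connection. -/
theorem no_saddle_connection {ε : ℝ} (hε : 0 < ε) {g : ℝ → ℝ} (hg : Continuous g)
    (g0 : g 0 = 0) (g2 : g (2 * π) = 2 * π) (hgl : ∀ x ∈ Ioo 0 (2 * π), x < g x ∧ g x < 2 * π)
    (hge : ∀ x, g (g x) + x = 2 * g x + ε * sin (g x)) : False := by
  obtain ⟨l, hl, hle⟩ := exists_multiplier hε
  have hl0 : (l : ℂ) ≠ 0 := by exact_mod_cast (by linarith : l ≠ 0)
  have hlR : l ≠ 0 := by linarith
  have hlp : 0 < l := by linarith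
  obtain ⟨X, hX, hX0, ⟨κ, hκ, hd⟩, hXe, hXr⟩ := exists_unstable_param hε hl hle
  have hκ' : (κ : ℂ) ≠ 0 := by exact_mod_cast hκ.ne'
  have hpi := pi_pos
  have hempty := no_matched_point hl hXe hX hX0 hκ' hd
  obtain ⟨Ψ, ρ, hρ, hΨ⟩ := exists_analytic_localInverse hX hκ' hd
  set x : ℝ → ℝ := fun t => (X t).re with hx
  have hxX : ∀ t : ℝ, X t = (x t : ℂ) := fun t => Complex.ext rfl (by simp [hXr t])
  have hxc : Continuous x := Complex.continuous_re.comp (hX.continuous.comp Complex.continuous_ofReal)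
  have hx0 : x 0 = 0 := by simp [hx, hX0]
  have hxe : ∀ t, x (l * t) + x (t / l) = 2 * x t + ε * sin (x t) := fun t => by
    have := hXe t
    rw [← Complex.ofReal_mul, ← Complex.ofReal_div, hxX, hxX, hxX] at this
    exact_mod_cast this
  have hxd : HasDerivAt x κ 0 := by
    have h := HasDerivAt.real_of_complex (e := X) (z := 0) (e' := κ) (by simpa using hd)
    simpa using h
  obtain ⟨t0, ht0, ht0p⟩ : ∃ t0 > 0, ∀ t ∈ Ioc 0 t0, x t ∈ Ioc 0 (π / 2) := by
    have h1 : ∀ᶠ t in nhds (0 : ℝ), x t < π / 2 :=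
      (hxc.tendsto 0).eventually (gt_mem_nhds (by rw [hx0]; positivity))
    have h2 : ∀ᶠ t in nhdsWithin (0 : ℝ) (Ioi 0), 0 < x t := by
      have := (hasDerivAt_iff_tendsto_slope.1 hxd).eventually (lt_mem_nhds hκ)
      filter_upwards [this.filter_mono (nhdsWithin_mono 0 (fun y (hy : 0 < y) => ne_of_gt hy)),
        self_mem_nhdsWithin] with t ht htp
      rw [slope_def_field, hx0, sub_zero, sub_zero] at ht
      have htp' : (0 : ℝ) < t := htp
      rw [lt_div_iff₀ htp', zero_mul] at ht
      exact ht
    obtain ⟨u, hu, hu2⟩ := mem_nhdsGT_iff_exists_Ioc_subset.1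
      (h2.and (h1.filter_mono nhdsWithin_le_nhds))
    exact ⟨u, hu, fun t ht => ⟨(hu2 ht).1, (hu2 ht).2.le⟩⟩
  have hdiv : ∀ {t : ℝ}, t ∈ Ioc 0 t0 → ∀ k : ℕ, t / l ^ k ∈ Ioc 0 t0 := fun {t} ht k =>
    ⟨div_pos ht.1 (by positivity), (div_le_self ht.1.le (one_le_pow₀ hl.le)).trans ht.2⟩
  have hdiv0 : ∀ t : ℝ, Tendsto (fun k : ℕ => t / l ^ k) atTop (nhds 0) := fun t => by
    have := (tendsto_pow_atTop_nhds_zero_of_lt_one (inv_nonneg.2 hlp.le)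
      (inv_lt_one_of_one_lt₀ hl)).const_mul t
    rw [mul_zero] at this
    exact this.congr fun k => by rw [inv_pow, div_eq_mul_inv]
  have hxseq : ∀ t : ℝ, Tendsto (fun k : ℕ => x (t / l ^ k)) atTop (nhds 0) := fun t => by
    have := (hxc.tendsto 0).comp (hdiv0 t)
    rwa [hx0] at this
  have hxrec : ∀ (t : ℝ) (k : ℕ), x (t / l ^ (k + 2)) + x (t / l ^ k) =
      2 * x (t / l ^ (k + 1)) + ε * sin (x (t / l ^ (k + 1))) := fun t k => by
    rw [← hxe, add_comm]
    congr 2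
    · field_simp; ring
    · field_simp; ring
  -- backward orbits of `g`
  have hpre : ∀ y ∈ Ioo 0 (2 * π), ∃ w ∈ Ioo 0 (2 * π), g w = y := fun y hy => by
    have := intermediate_value_Icc (by positivity : (0 : ℝ) ≤ 2 * π) hg.continuousOn
    rw [g0, g2] at this
    obtain ⟨w, hw, hwy⟩ := this ⟨hy.1.le, hy.2.le⟩
    refine ⟨w, ⟨lt_of_le_of_ne hw.1 ?_, lt_of_le_of_ne hw.2 ?_⟩, hwy⟩
    · rintro rfl; rw [g0] at hwy; linarith [hy.1]
    · rintro rfl; rw [g2] at hwy; linarith [hy.2]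
  choose! b hb hgb using hpre
  have hbiter : ∀ y ∈ Ioo 0 (2 * π), ∀ k, b^[k] y ∈ Ioo 0 (2 * π) := fun y hy k => by
    induction k with
    | zero => exact hy
    | succ k ih => rw [Function.iterate_succ_apply']; exact hb _ ih
  have hbanti : ∀ y ∈ Ioo 0 (2 * π), Antitone fun k => b^[k] y := fun y hy =>
    antitone_nat_of_succ_le fun k => by
      rw [Function.iterate_succ_apply']
      have h1 := hbiter y hy k
      have h2 := (hgl _ (hb _ h1)).1
      rw [hgb _ h1] at h2
      exact h2.le
  have hblim : ∀ y ∈ Ioo 0 (2 * π), Tendsto (fun k => b^[k] y) atTop (nhds 0) := fun y hy => by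
    have hbb : BddBelow (range fun k => b^[k] y) := ⟨0, by rintro _ ⟨k, rfl⟩; exact (hbiter y hy k).1.le⟩
    have h1 := tendsto_atTop_ciInf (hbanti y hy) hbb
    set L := ⨅ k, b^[k] y
    have hL0 : 0 ≤ L := ge_of_tendsto' h1 fun k => (hbiter y hy k).1.le
    have hLy : L ≤ y := ciInf_le hbb 0
    have h2 : g L = L := by
      refine tendsto_nhds_unique (((hg.tendsto L).comp ((tendsto_add_atTop_iff_nat 1).2 h1)).congr
        fun k => ?_) h1
      simp only [Function.comp, Function.iterate_succ_apply']
      exact hgb _ (hbiter y hy k)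
    rcases hL0.eq_or_lt with h | h
    · rwa [← h] at h1
    · have := (hgl L ⟨h, by linarith [hy.2]⟩).1
      linarith
  have hloc : ∀ t ∈ Ioc 0 t0, x t = g (x (t / l)) := by
    intro t ht
    have hxt := ht0p t ht
    have hmem : x t ∈ Ioo 0 (2 * π) := ⟨hxt.1, by linarith [hxt.2]⟩
    have := recurrence_eq_of_tendsto hε (z := fun k => b^[k] (x t)) (y := fun k => x (t / l ^ k))
      (fun k => ⟨(hbiter _ hmem k).1.le, (hbanti _ hmem (Nat.zero_le k)).trans hxt.2⟩)
      (fun k => ⟨(ht0p _ (hdiv ht k)).1.le, (ht0p _ (hdiv ht k)).2⟩)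
      (fun k => by
        have h1 := hge (b^[k + 2] (x t))
        rw [show g (b^[k + 2] (x t)) = b^[k + 1] (x t) by
          rw [Function.iterate_succ_apply' b (k + 1)]; exact hgb _ (hbiter _ hmem _),
          show g (b^[k + 1] (x t)) = b^[k] (x t) by
          rw [Function.iterate_succ_apply' b k]; exact hgb _ (hbiter _ hmem _)] at h1
        linarith)
      (hxrec t) (by simp) (hblim _ hmem) (hxseq t)
    simp only [pow_one, Function.iterate_one] at this
    rw [this, hgb _ hmem]
  have hgmem : ∀ y ∈ Ioo 0 (2 * π), g y ∈ Ioo 0 (2 * π) := fun y hy =>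
    ⟨hy.1.trans (hgl y hy).1, (hgl y hy).2⟩
  have hglobn : ∀ (n : ℕ), ∀ t ∈ Ioc 0 t0, x (l ^ n * t) ∈ Ioo 0 (2 * π) ∧
      x (l ^ (n + 1) * t) = g (x (l ^ n * t)) := by
    intro n t ht
    induction n with
    | zero =>
      have hxt := ht0p t ht
      refine ⟨by simpa using ⟨hxt.1, by linarith [hxt.2]⟩, ?_⟩
      have h1 := hxe t
      have h2 := hge (x (t / l))
      rw [← hloc t ht] at h2
      simp only [zero_add, pow_one, pow_zero, one_mul]
      linarith
    | succ n ih =>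
      refine ⟨by rw [ih.2]; exact hgmem _ ih.1, ?_⟩
      have h1 := hxe (l ^ (n + 1) * t)
      have h2 := hge (x (l ^ n * t))
      rw [← ih.2] at h2
      rw [show l * (l ^ (n + 1) * t) = l ^ (n + 1 + 1) * t by ring,
        show l ^ (n + 1) * t / l = l ^ n * t by rw [pow_succ]; field_simp] at h1
      linarith
  have hglob : ∀ t, 0 < t → x t ∈ Ioo 0 (2 * π) ∧ x (l * t) = g (x t) := by
    intro t ht
    obtain ⟨n, hn⟩ := ((hdiv0 t).eventually (gt_mem_nhds ht0)).exists
    have := hglobn n (t / l ^ n) ⟨by positivity, hn.le⟩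
    rw [show l ^ n * (t / l ^ n) = t by field_simp,
      show l ^ (n + 1) * (t / l ^ n) = l * t by rw [pow_succ]; field_simp] at this
    exact this
  -- forward convergence to `2π`
  have hfwd : ∀ t, 0 < t → Tendsto (fun k : ℕ => x (l ^ k * t)) atTop (nhds (2 * π)) := by
    intro t ht
    have hm : Monotone fun k : ℕ => x (l ^ k * t) := monotone_nat_of_le_succ fun k => by
      have := hglob (l ^ k * t) (by positivity)
      rw [pow_succ', mul_assoc, this.2]
      exact (hgl _ this.1).1.le
    have hbb : BddAbove (range fun k : ℕ => x (l ^ k * t)) :=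
      ⟨2 * π, by rintro _ ⟨k, rfl⟩; exact (hglob _ (by positivity)).1.2.le⟩
    have h1 := tendsto_atTop_ciSup hm hbb
    set L := ⨆ k : ℕ, x (l ^ k * t)
    have hL2 : L ≤ 2 * π := le_of_tendsto' h1 fun k => (hglob _ (by positivity)).1.2.le
    have hL0 : 0 < L := by
      refine lt_of_lt_of_le (hglob t ht).1.1 ?_
      have := le_ciSup hbb 0
      simpa using this
    have h2 : g L = L := by
      refine tendsto_nhds_unique ((hg.tendsto L).comp h1) 
        (((tendsto_add_atTop_iff_nat 1).2 h1).congr fun k => ?_)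
      simp only [Function.comp]
      rw [pow_succ', mul_assoc]
      exact (hglob _ (by positivity)).2
    rcases hL2.eq_or_lt with h | h
    · rwa [h] at h1
    · have := (hgl L ⟨hL0, h⟩).1
      linarith
  -- a small real interval on which the local inverse is available
  obtain ⟨t1, ht1, ht1t0, ht1ρ⟩ : ∃ t1 > 0, t1 ≤ t0 ∧ t1 < ρ :=
    ⟨min t0 (ρ / 2), lt_min ht0 (by positivity), min_le_left _ _,
      (min_le_right _ _).trans_lt (by linarith)⟩
  have ht1m : ∀ w ∈ Ioc 0 t1, w ∈ Ioc 0 t0 := fun w hw => ⟨hw.1, hw.2.trans ht1t0⟩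
  set η := min (x t1) (π / 2) with hη
  have hηp : 0 < η := lt_min (ht0p t1 (ht1m t1 ⟨ht1, le_rfl⟩)).1 (by positivity)
  have hmatch : ∀ t, 0 < t → 2 * π - x t < η →
      ∃ w ∈ Ioc 0 t1, x w = 2 * π - x t ∧ x (l * t) = 2 * π - x (w / l) := by
    intro t ht htη
    have hy0 : 0 < 2 * π - x t := by linarith [(hglob t ht).1.2]
    have := intermediate_value_Icc ht1.le hxc.continuousOn
    rw [hx0] at this
    obtain ⟨w, hw, hwy⟩ := this ⟨hy0.le, htη.le.trans (min_le_left _ _)⟩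
    have hw0 : 0 < w := lt_of_le_of_ne hw.1 (by rintro rfl; rw [hx0] at hwy; linarith)
    have hwm := ht1m w ⟨hw0, hw.2⟩
    refine ⟨w, ⟨hw0, hw.2⟩, hwy, ?_⟩
    have hinc : ∀ k : ℕ, x t ≤ x (l ^ k * t) := fun k => by
      induction k with
      | zero => simp
      | succ k ih =>
        have := hglob (l ^ k * t) (by positivity)
        rw [pow_succ', mul_assoc, this.2]
        exact ih.trans (hgl _ this.1).1.le
    have := recurrence_eq_of_tendsto hε (z := fun k => 2 * π - x (l ^ k * t))
      (y := fun k => x (w / l ^ k))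
      (fun k => ⟨by linarith [(hglob (l ^ k * t) (by positivity)).1.2],
        by linarith [hinc k, min_le_right (x t1) (π / 2)]⟩)
      (fun k => ⟨(ht0p _ (hdiv hwm k)).1.le, (ht0p _ (hdiv hwm k)).2⟩)
      (fun k => by
        have h1 := hxe (l ^ (k + 1) * t)
        rw [show l * (l ^ (k + 1) * t) = l ^ (k + 2) * t by ring,
          show l ^ (k + 1) * t / l = l ^ k * t by rw [pow_succ]; field_simp] at h1
        rw [Real.sin_two_pi_sub]
        linarith)
      (hxrec w) (by simp [hwy])
      (by simpa using (hfwd t ht).const_sub (2 * π)) (hxseq w)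
    simp only [pow_one] at this
    linarith
  obtain ⟨k, hk⟩ := ((hfwd t0 ht0).eventually (lt_mem_nhds (by linarith : 2 * π - η < 2 * π))).exists
  set ts := l ^ k * t0 with hts
  have htsp : 0 < ts := by positivity
  have hnear : ∀ᶠ t in nhds ts, 0 < t ∧ 2 * π - x t < η := by
    have h3 : ∀ᶠ t in nhds ts, 2 * π - η < x t := (hxc.tendsto ts).eventually (lt_mem_nhds hk)
    filter_upwards [lt_mem_nhds htsp, h3] with t a b
    exact ⟨a, by linarith⟩
  have hreal : ∀ t : ℝ, 0 < t → 2 * π - x t < η →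
      X (l * t) - (2 * π - X (Ψ (2 * π - X t) / l)) = 0 := by
    intro t h1 h2
    obtain ⟨w, hw, e1, e2⟩ := hmatch t h1 h2
    have : (2 * π - X t : ℂ) = X w := by
      rw [hxX, hxX, e1]; push_cast; ring
    rw [this, (hΨ w (by rw [Complex.norm_real, Real.norm_of_nonneg hw.1.le]; linarith [hw.2])).1,
      ← Complex.ofReal_mul, ← Complex.ofReal_div, hxX, hxX, e2]
    push_cast; ring
  obtain ⟨w, hw, e1, -⟩ := hmatch ts htsp hnear.self_of_nhds.2
  have hXw : (2 * π - X ts : ℂ) = X w := by rw [hxX, hxX, e1]; push_cast; ring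
  obtain ⟨-, a2, a3⟩ := hΨ w (by rw [Complex.norm_real, Real.norm_of_nonneg hw.1.le]; linarith [hw.2])
  have hσ : AnalyticAt ℂ (fun ζ => Ψ (2 * π - X ζ)) ts := by
    refine AnalyticAt.fun_comp (f := fun ζ => 2 * π - X ζ) (by rwa [hXw]) ?_
    exact analyticAt_const.sub (hX.analyticAt _)
  have hF : AnalyticAt ℂ (fun ζ => X (l * ζ) - (2 * π - X (Ψ (2 * π - X ζ) / l))) ts := by
    have b1 : AnalyticAt ℂ (fun ζ : ℂ => X (l * ζ)) ts :=
      AnalyticAt.fun_comp (f := fun ζ : ℂ => l * ζ) (hX.analyticAt _) (by fun_prop)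
    have b2 : AnalyticAt ℂ (fun ζ : ℂ => X (Ψ (2 * π - X ζ) / l)) ts :=
      AnalyticAt.fun_comp (f := fun ζ : ℂ => Ψ (2 * π - X ζ) / l) (hX.analyticAt _)
        (hσ.div analyticAt_const hl0)
    exact b1.sub (analyticAt_const.sub b2)
  have hfreq : ∃ᶠ ζ in nhdsWithin (ts : ℂ) {(ts : ℂ)}ᶜ,
      X (l * ζ) - (2 * π - X (Ψ (2 * π - X ζ) / l)) = 0 := by
    have hc : Tendsto (fun t : ℝ => (t : ℂ)) (nhdsWithin ts {ts}ᶜ) (nhdsWithin (ts : ℂ) {(ts : ℂ)}ᶜ) := by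
      refine tendsto_nhdsWithin_of_tendsto_nhds_of_eventually_within _
        ((Complex.continuous_ofReal.tendsto ts).mono_left nhdsWithin_le_nhds) ?_
      filter_upwards [self_mem_nhdsWithin] with t ht
      simpa using ht
    refine hc.frequently (Eventually.frequently ?_)
    filter_upwards [hnear.filter_mono nhdsWithin_le_nhds] with t ht
    exact hreal t ht.1 ht.2
  have hev := hF.frequently_zero_iff_eventually_zero.1 hfreq
  have hcont : Tendsto (fun ζ => 2 * π - X ζ) (nhds (ts : ℂ)) (nhds (X w)) := by
    have h : Continuous fun ζ => 2 * (π : ℂ) - X ζ := continuous_const.sub hX.continuous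
    exact hXw ▸ h.tendsto _
  have : (ts : ℂ) ∈ matchedDomain X l := by
    refine ⟨fun ζ => Ψ (2 * π - X ζ), hσ, ?_⟩
    filter_upwards [hev, hcont.eventually a3] with ζ d1 d2
    refine ⟨?_, ?_⟩
    · rw [d2]; ring
    · linear_combination d1
  rw [hempty] at this
  exact this

/-- `θ` is an argument of `z`. -/
def IsAngle (z : ℂ) (θ : ℝ) : Prop := z.re = ‖z‖ * cos θ ∧ z.im = ‖z‖ * sin θ

namespace IsAngle
variable {z w : ℂ} {θ : ℝ}

theorem cos_neg_iff (h : IsAngle z θ) (hz : z ≠ 0) : cos θ < 0 ↔ z.re < 0 := by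
  have := norm_pos_iff.2 hz
  rw [h.1]
  exact ⟨fun h => mul_neg_of_pos_of_neg this h, fun h => by_contra fun h' => by
    push Not at h'; nlinarith⟩

theorem sin_neg_iff (h : IsAngle z θ) (hz : z ≠ 0) : sin θ < 0 ↔ z.im < 0 := by
  have := norm_pos_iff.2 hz
  rw [h.2]
  exact ⟨fun h => mul_neg_of_pos_of_neg this h, fun h => by_contra fun h' => by
    push Not at h'; nlinarith⟩

theorem cos_pos_iff (h : IsAngle z θ) (hz : z ≠ 0) : 0 < cos θ ↔ 0 < z.re := by
  rw [h.1, mul_pos_iff_of_pos_left (norm_pos_iff.2 hz)]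

theorem sin_pos_iff (h : IsAngle z θ) (hz : z ≠ 0) : 0 < sin θ ↔ 0 < z.im := by
  rw [h.2, mul_pos_iff_of_pos_left (norm_pos_iff.2 hz)]

theorem eq_exp (h : IsAngle z θ) : z = ‖z‖ * Complex.exp (θ * Complex.I) := by
  apply Complex.ext
  · rw [Complex.re_ofReal_mul, Complex.exp_ofReal_mul_I_re]; exact h.1
  · rw [Complex.im_ofReal_mul, Complex.exp_ofReal_mul_I_im]; exact h.2

theorem of_eq_mul_exp {r : ℝ} (hr : 0 ≤ r) (h : z = r * Complex.exp (θ * Complex.I)) :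
    IsAngle z θ := by
  have hn : ‖z‖ = r := by rw [h, norm_mul, Complex.norm_exp_ofReal_mul_I, mul_one,
    Complex.norm_real, Real.norm_of_nonneg hr]
  constructor
  · rw [hn, h, Complex.re_ofReal_mul, Complex.exp_ofReal_mul_I_re]
  · rw [hn, h, Complex.im_ofReal_mul, Complex.exp_ofReal_mul_I_im]

theorem add_arg_div (h : IsAngle z θ) (hz : z ≠ 0) : IsAngle w (θ + (w / z).arg) := by
  refine of_eq_mul_exp (norm_nonneg w) ?_
  have h1 := h.eq_exp
  have h2 := Complex.norm_mul_exp_arg_mul_I (w / z)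
  have h3 : (‖z‖ : ℂ) ≠ 0 := by exact_mod_cast norm_ne_zero_iff.2 hz
  have e : w = (w / z) * z := by field_simp
  calc w = (‖w / z‖ * Complex.exp ((w / z).arg * Complex.I)) *
        (‖z‖ * Complex.exp (θ * Complex.I)) := by rw [h2, ← h1, ← e]
    _ = _ := by
      rw [Complex.ofReal_add, add_mul, Complex.exp_add, norm_div]
      push_cast
      field_simp

end IsAngle

theorem exists_angle_lift {Z : ℝ × ℝ → ℂ} (hZ : Continuous Z) (h0 : ∀ q, Z q ≠ 0) :
    ∃ θ : ℝ × ℝ → ℝ, Continuous θ ∧ ∀ q, IsAngle (Z q) (θ q) := by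
  have hU : IsSimplyConnected (univ : Set ℂ) := by
    have : ContractibleSpace (univ : Set ℂ) :=
      (Homeomorph.Set.univ ℂ).contractibleSpace
    exact (inferInstance : SimplyConnectedSpace (univ : Set ℂ))
  have hg : Continuous fun z : ℂ => Z (z.re, z.im) :=
    hZ.comp (Complex.continuous_re.prodMk Complex.continuous_im)
  obtain ⟨f, hf, hfe⟩ := Complex.exists_continuousOn_eqOn_exp_comp hU isOpen_univ
    hg.continuousOn (by rintro ⟨z, -, hz⟩; exact h0 _ hz)
  rw [continuousOn_univ] at hf
  refine ⟨fun q => (f ⟨q.1, q.2⟩).im, Complex.continuous_im.comp (hf.comp ?_), fun q => ?_⟩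
  · exact Complex.equivRealProdCLM.symm.continuous
  · have := hfe (mem_univ (⟨q.1, q.2⟩ : ℂ))
    simp only [Function.comp] at this
    refine IsAngle.of_eq_mul_exp (exp_nonneg (f ⟨q.1, q.2⟩).re) ?_
    rw [← this, Complex.ofReal_exp, ← Complex.exp_add, Complex.re_add_im]

/-- Two angles in the same left or right half-plane stay on the same side of `π/2`. -/
theorem half_pi_lt_of_cos {a b : ℝ} (h : |b - a| < π) (hc : cos a < 0 → cos b < 0)
    (ha : π / 2 < a) : π / 2 < b := by
  by_contra hb
  push Not at hb
  rw [abs_lt] at h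
  have := hc (cos_neg_of_pi_div_two_lt_of_lt ha (by linarith))
  linarith [cos_nonneg_of_neg_pi_div_two_le_of_le (x := b) (by linarith) hb]

theorem neg_of_sin {a b : ℝ} (h : |b - a| < π) (h2 : sin b < 0) (ha : a < 0) :
    b < 0 := by
  by_contra hb
  push Not at hb
  rw [abs_lt] at h
  linarith [sin_nonneg_of_nonneg_of_le_pi hb (by linarith)]

theorem shear_div_mem {z : ℂ} (hz : z ≠ 0) :
    (z - z.im) / z ∈ Complex.slitPlane ∧ 0 ≤ ((z - z.im) / z).arg := by
  have hn : 0 < Complex.normSq z := Complex.normSq_pos.2 hz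
  have him : ((z - z.im) / z).im = z.im ^ 2 / Complex.normSq z := by
    rw [Complex.div_im]; simp; field_simp; ring
  have hre : ((z - z.im) / z).re = (z.re ^ 2 + z.im ^ 2 - z.im * z.re) / Complex.normSq z := by
    rw [Complex.div_re]; simp; field_simp; ring
  refine ⟨?_, Complex.arg_nonneg_iff.2 (by rw [him]; positivity)⟩
  rw [Complex.mem_slitPlane_iff, him, hre]
  by_cases h : z.im = 0
  · left
    have : z.re ≠ 0 := fun h' => hz (Complex.ext h' h)
    rw [h]
    have : 0 < z.re ^ 2 := by positivity
    apply div_pos _ hn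
    linarith
  · right; positivity

theorem kick_div_mem {z w : ℂ} (hz : z ≠ 0) (h : w.re = z.re)
    (h0 : z.re = 0 → 0 < w.im * z.im) : w / z ∈ Complex.slitPlane := by
  have hn : 0 < Complex.normSq z := Complex.normSq_pos.2 hz
  have him : (w / z).im = (w.im * z.re - z.re * z.im) / Complex.normSq z := by
    rw [Complex.div_im, h]; field_simp
  have hre : (w / z).re = (z.re ^ 2 + w.im * z.im) / Complex.normSq z := by
    rw [Complex.div_re, h]; field_simp
  rw [Complex.mem_slitPlane_iff, him, hre]
  by_cases h1 : z.re = 0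
  · left
    rw [h1]
    have := h0 h1
    apply div_pos _ hn
    linarith
  · by_cases h2 : w.im = z.im
    · left
      have : 0 < z.re ^ 2 := by positivity
      rw [h2]
      apply div_pos _ hn
      nlinarith [sq_nonneg z.im]
    · right
      have : w.im * z.re - z.re * z.im = z.re * (w.im - z.im) := by ring
      rw [this]
      exact div_ne_zero (mul_ne_zero h1 (sub_ne_zero.2 h2)) hn.ne'

theorem abs_arg_lt_pi_of_mem_slitPlane {z : ℂ} (h : z ∈ Complex.slitPlane) : |z.arg| < π := by
  rw [abs_lt]
  exact ⟨Complex.neg_pi_lt_arg z,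
    lt_of_le_of_ne (Complex.arg_le_pi z) (Complex.mem_slitPlane_iff_arg.1 h).1⟩

theorem kick_angle {z w : ℂ} {θ : ℝ} (hz : z ≠ 0) (hw : w ≠ 0) (h : w.re = z.re)
    (h0 : z.re = 0 → 0 < w.im * z.im) (hθ : IsAngle z θ) :
    (θ + (w / z).arg ≤ π / 2 ↔ θ ≤ π / 2) := by
  have h1 := abs_arg_lt_pi_of_mem_slitPlane (kick_div_mem hz h h0)
  have h2 := hθ.add_arg_div (w := w) hz
  have h3 : cos θ < 0 ↔ cos (θ + (w / z).arg) < 0 := by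
    rw [hθ.cos_neg_iff hz, h2.cos_neg_iff hw, h]
  rw [← not_lt, ← not_lt, not_iff_not]
  constructor
  · exact half_pi_lt_of_cos (by rw [sub_add_cancel_left, abs_neg]; exact h1) h3.2
  · exact half_pi_lt_of_cos (by rw [add_sub_cancel_left]; exact h1) h3.1

/-- The inverse of the standard map. -/
def stdInv (ε : ℝ) (p : ℝ × ℝ) : ℝ × ℝ := (p.1 - p.2, p.2 - ε * Real.sin (p.1 - p.2))

theorem stdInv_stdMap (ε : ℝ) (p : ℝ × ℝ) : stdInv ε (stdMap ε p) = p := by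
  have : p.1 + p.2 + ε * Real.sin p.1 - (p.2 + ε * Real.sin p.1) = p.1 := by ring
  simp only [stdInv, stdMap, this]
  ext <;> simp

theorem stdMap_stdInv (ε : ℝ) (p : ℝ × ℝ) : stdMap ε (stdInv ε p) = p := by
  simp only [stdInv, stdMap]
  ext <;> simp

theorem continuous_stdMap (ε : ℝ) : Continuous (stdMap ε) := by unfold stdMap; fun_prop

theorem continuous_stdInv (ε : ℝ) : Continuous (stdInv ε) := by unfold stdInv; fun_prop

/-- The vector from `q` to `p` as a complex number. -/
def toVec (p q : ℝ × ℝ) : ℂ := ⟨p.1 - q.1, p.2 - q.2⟩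

@[simp] theorem toVec_re (p q : ℝ × ℝ) : (toVec p q).re = p.1 - q.1 := rfl
@[simp] theorem toVec_im (p q : ℝ × ℝ) : (toVec p q).im = p.2 - q.2 := rfl

theorem toVec_ne_zero {p q : ℝ × ℝ} : toVec p q ≠ 0 ↔ p ≠ q := by
  rw [not_iff_not]
  constructor
  · intro h
    have h1 := congrArg Complex.re h
    have h2 := congrArg Complex.im h
    simp at h1 h2
    exact Prod.ext (by linarith) (by linarith)
  · rintro rfl; apply Complex.ext <;> simp

theorem continuous_toVec : Continuous fun q : (ℝ × ℝ) × (ℝ × ℝ) => toVec q.1 q.2 := by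
  have : (fun q : (ℝ × ℝ) × (ℝ × ℝ) => toVec q.1 q.2) = fun q =>
    Complex.equivRealProdCLM.symm (q.1.1 - q.2.1, q.1.2 - q.2.2) := rfl
  rw [this]
  exact Complex.equivRealProdCLM.symm.continuous.comp (by fun_prop)

theorem stdInv_injective (ε : ℝ) : Function.Injective (stdInv ε) :=
  fun p q h => by rw [← stdMap_stdInv ε p, h, stdMap_stdInv]

/-- The inverse of the standard map turns difference vectors counterclockwise. -/
theorem exists_angle_stdInv {ε : ℝ} {r : ℝ → ℝ × ℝ} (hr : Continuous r) {c : ℝ × ℝ}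
    (hne : ∀ t, r t ≠ c) :
    ∃ δ : ℝ → ℝ, Continuous δ ∧ ∀ t a, IsAngle (toVec (r t) c) a →
      IsAngle (toVec (stdInv ε (r t)) (stdInv ε c)) (a + δ t) ∧
      (a + δ t ≤ π / 2 → a ≤ π / 2) ∧
      ((r t).2 < c.2 → (stdInv ε (r t)).2 < (stdInv ε c).2 → a < 0 → a + δ t < 0) := by
  set v : ℝ → ℂ := fun t => toVec (r t) c with hv
  set w : ℝ → ℂ := fun t => v t - (v t).im with hw
  set u : ℝ → ℂ := fun t => toVec (stdInv ε (r t)) (stdInv ε c) with hu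
  have hv0 : ∀ t, v t ≠ 0 := fun t => toVec_ne_zero.2 (hne t)
  have hu0 : ∀ t, u t ≠ 0 := fun t => toVec_ne_zero.2 fun h => hne t (stdInv_injective ε h)
  have hw0 : ∀ t, w t ≠ 0 := fun t h => by
    have := (shear_div_mem (hv0 t)).1
    rw [show v t - (v t).im = 0 from h, zero_div] at this
    simp at this
  have hvc : Continuous v := continuous_toVec.comp (hr.prodMk continuous_const)
  have huc : Continuous u :=
    continuous_toVec.comp (((continuous_stdInv ε).comp hr).prodMk continuous_const)
  have hwc : Continuous w := hvc.sub (Complex.continuous_ofReal.comp (Complex.continuous_im.comp hvc))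
  have hre : ∀ t, (u t).re = (w t).re := fun t => by
    simp only [hu, hw, hv, toVec_re, Complex.sub_re, toVec_im, Complex.ofReal_re, stdInv]; ring
  have him : ∀ t, (w t).im = (v t).im := fun t => by simp [hw]
  have hvert : ∀ t, (w t).re = 0 → 0 < (u t).im * (w t).im := fun t h => by
    have h1 : (r t).1 - (r t).2 = c.1 - c.2 := by
      simp only [hw, hv, Complex.sub_re, toVec_re, toVec_im, Complex.ofReal_re] at h
      linarith
    have h2 : (u t).im = (w t).im := by
      rw [him]; simp only [hu, hv, toVec_im, stdInv, h1]; ring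
    rw [h2]
    exact mul_self_pos.2 fun h' => hw0 t (Complex.ext h h')
  have h1 := fun t => shear_div_mem (hv0 t)
  have h2 := fun t => kick_div_mem (hw0 t) (hre t) (hvert t)
  refine ⟨fun t => (w t / v t).arg + (u t / w t).arg, ?_, fun t a ha => ?_⟩
  · refine Continuous.add ?_ ?_
    · exact continuous_iff_continuousAt.2 fun t => (Complex.continuousAt_arg (h1 t).1).comp
        (f := fun t => w t / v t) (hwc.continuousAt.div hvc.continuousAt (hv0 t))
    · exact continuous_iff_continuousAt.2 fun t => (Complex.continuousAt_arg (h2 t)).comp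
        (f := fun t => u t / w t) (huc.continuousAt.div hwc.continuousAt (hw0 t))
  have a1 : IsAngle (w t) (a + (w t / v t).arg) := ha.add_arg_div (hv0 t)
  have a2 : IsAngle (u t) (a + (w t / v t).arg + (u t / w t).arg) := a1.add_arg_div (hw0 t)
  simp only [← add_assoc]
  refine ⟨a2, fun h => ?_, fun hlt hlt' hneg => ?_⟩
  · have := (kick_angle (hw0 t) (hu0 t) (hre t) (hvert t) a1).1 h
    have h3 : 0 ≤ (w t / v t).arg := (h1 t).2
    linarith
  · have b2 : (w t).im < 0 := by rw [him]; simp only [hv, toVec_im]; linarith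
    have b3 : (u t).im < 0 := by simp only [hu, toVec_im]; linarith
    have c2 := (a1.sin_neg_iff (hw0 t)).2 b2
    have c3 := (a2.sin_neg_iff (hu0 t)).2 b3
    refine neg_of_sin (a := a + (w t / v t).arg) ?_ c3 (neg_of_sin (a := a) ?_ c2 hneg)
    · rw [add_sub_cancel_left]; exact abs_arg_lt_pi_of_mem_slitPlane (h2 t)
    · rw [add_sub_cancel_left]; exact abs_arg_lt_pi_of_mem_slitPlane (h1 t).1

theorem exists_angle_stdInv_iterate {ε : ℝ} (m : ℕ) : ∀ {r : ℝ → ℝ × ℝ} (_ : Continuous r)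
    {c : ℝ × ℝ} (_ : ∀ t, r t ≠ c),
    ∃ δ : ℝ → ℝ, Continuous δ ∧ ∀ t a, IsAngle (toVec (r t) c) a →
      IsAngle (toVec ((stdInv ε)^[m] (r t)) ((stdInv ε)^[m] c)) (a + δ t) ∧
      (a + δ t ≤ π / 2 → a ≤ π / 2) ∧
      ((∀ j ≤ m, ((stdInv ε)^[j] (r t)).2 < ((stdInv ε)^[j] c).2) → a < 0 → a + δ t < 0) := by
  induction m with
  | zero => intro r _ c _; exact ⟨fun _ => 0, continuous_const, fun t a h => by simpa using h⟩
  | succ m ih =>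
    intro r hr c hne
    obtain ⟨δ1, e1, e2⟩ := exists_angle_stdInv (ε := ε) hr hne
    obtain ⟨δ2, f1, f2⟩ := ih ((continuous_stdInv ε).comp hr)
      (fun t h => hne t (stdInv_injective ε h))
    refine ⟨fun t => δ1 t + δ2 t, e1.add f1, fun t a ha => ?_⟩
    obtain ⟨e3, e4, e5⟩ := e2 t a ha
    obtain ⟨f3, f4, f5⟩ := f2 t _ e3
    simp only [← add_assoc]
    exact ⟨f3, fun h => e4 (f4 h), fun h h0 => f5 (fun j hj => h (j + 1) (by omega))
      (e5 (h 0 (by omega)) (h 1 (by omega)) h0)⟩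

theorem exists_eq_of_le_of_le {f : ℝ → ℝ} (hf : Continuous f) {a b v : ℝ} (ha : f a ≤ v)
    (hb : v ≤ f b) : ∃ x ∈ uIcc a b, f x = v :=
  intermediate_value_uIcc hf.continuousOn (mem_uIcc_of_le ha hb)

/-- Angles along a vertical line never cross `π/2`. -/
theorem vertical_angle_le {r : ℝ → ℝ × ℝ} {c : ℝ × ℝ} (hx : ∀ t, (r t).1 = (r 0).1)
    (hne : ∀ t, r t ≠ c) {θ : ℝ → ℝ} (hθ : Continuous θ) (ha : ∀ t, IsAngle (toVec (r t) c) (θ t))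
    (h0 : θ 0 ≤ π / 2) (t : ℝ) : θ t ≤ π / 2 := by
  by_contra hlt
  push Not at hlt
  have hv0 : ∀ t, toVec (r t) c ≠ 0 := fun t => toVec_ne_zero.2 (hne t)
  have hre : ∀ s, (toVec (r s) c).re = (toVec (r 0) c).re := fun s => by simp [hx s]
  obtain ⟨s, -, hs⟩ := exists_eq_of_le_of_le hθ h0 hlt.le
  obtain ⟨v, hv1, hv2⟩ := exists_between (lt_min hlt (by linarith [pi_pos] : π / 2 < π))
  obtain ⟨s', -, hs'⟩ := exists_eq_of_le_of_le hθ (h0.trans hv1.le) (hv2.le.trans (min_le_left _ _))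
  have h1 := (ha s).1
  rw [hs, cos_pi_div_two, mul_zero, hre] at h1
  have h2 := ((ha s').cos_neg_iff (hv0 s')).1 (by
    rw [hs']; exact cos_neg_of_pi_div_two_lt_of_lt hv1 (by linarith [hv2.trans_le (min_le_right _ _)]))
  rw [hre, h1] at h2
  exact lt_irrefl _ h2

/-- A continuous curve winding once around the cylinder, invariant under the standard map. -/
structure EssCurve (ε : ℝ) (γ : ℝ → ℝ × ℝ) : Prop where
  cont : Continuous γ
  per : ∀ s, γ (s + 2 * π) = γ s + (2 * π, 0)
  inv : stdMap ε '' range γ = range γ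

/-- The points whose downward vertical ray avoids the curve. -/
def belowSet (γ : ℝ → ℝ × ℝ) : Set (ℝ × ℝ) := {p | ∀ t, 0 ≤ t → (p.1, p.2 - t) ∉ range γ}

namespace EssCurve
variable {ε : ℝ} {γ : ℝ → ℝ × ℝ}

theorem stdMap_mem_iff (h : EssCurve ε γ) {p : ℝ × ℝ} : stdMap ε p ∈ range γ ↔ p ∈ range γ := by
  constructor
  · intro hp
    rw [← h.inv] at hp
    obtain ⟨q, hq, e⟩ := hp
    rwa [← stdInv_stdMap ε p, ← e, stdInv_stdMap]
  · intro hp; rw [← h.inv]; exact mem_image_of_mem _ hp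

theorem stdInv_mem_iff (h : EssCurve ε γ) {p : ℝ × ℝ} : stdInv ε p ∈ range γ ↔ p ∈ range γ := by
  rw [← h.stdMap_mem_iff, stdMap_stdInv]

theorem stdInv_iterate_mem_iff (h : EssCurve ε γ) (m : ℕ) {p : ℝ × ℝ} :
    (stdInv ε)^[m] p ∈ range γ ↔ p ∈ range γ := by
  induction m with
  | zero => rfl
  | succ m ih => rw [Function.iterate_succ', Function.comp, h.stdInv_mem_iff, ih]

theorem stdMap_iterate_mem_iff (h : EssCurve ε γ) (m : ℕ) {p : ℝ × ℝ} :
    (stdMap ε)^[m] p ∈ range γ ↔ p ∈ range γ := by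
  induction m with
  | zero => rfl
  | succ m ih => rw [Function.iterate_succ', Function.comp, h.stdMap_mem_iff, ih]

theorem exists_bound (h : EssCurve ε γ) :
    ∃ M, ∀ s, |(γ s).2| ≤ M ∧ |(γ s).1 - s| ≤ M := by
  have h1 : Function.Periodic (fun s => |(γ s).2| + |(γ s).1 - s|) (2 * π) := fun s => by
    simp only [h.per, Prod.snd_add, Prod.fst_add, add_zero, add_sub_add_right_eq_sub]
  have hc : Continuous (fun s => |(γ s).2| + |(γ s).1 - s|) := by
    have := h.cont
    fun_prop
  obtain ⟨M, hM⟩ := (isCompact_Icc (a := (0 : ℝ)) (b := 2 * π)).exists_bound_of_continuousOn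
    hc.continuousOn
  refine ⟨M, fun s => ?_⟩
  obtain ⟨y, hy, e⟩ := h1.exists_mem_Ico₀ two_pi_pos s
  have h2 := hM y ⟨hy.1, hy.2.le⟩
  rw [← e, Real.norm_of_nonneg (by positivity)] at h2
  exact ⟨by linarith [abs_nonneg ((γ s).1 - s)], by linarith [abs_nonneg (γ s).2]⟩

theorem exists_vertical (h : EssCurve ε γ) (x : ℝ) : ∃ s, (γ s).1 = x := by
  obtain ⟨M, hM⟩ := h.exists_bound
  have h1 := abs_le.1 (hM (x + M)).2
  have h2 := abs_le.1 (hM (x - M)).2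
  obtain ⟨s, -, hs⟩ := exists_eq_of_le_of_le (f := fun s => (γ s).1) (by have := h.cont; fun_prop)
    (a := x - M) (b := x + M) (v := x) (by linarith) (by linarith)
  exact ⟨s, hs⟩

end EssCurve

theorem stdInv_iterate_snd (ε : ℝ) (m : ℕ) (p : ℝ × ℝ) :
    |((stdInv ε)^[m] p).2 - p.2| ≤ m * |ε| := by
  induction m with
  | zero => simp
  | succ m ih =>
    rw [Function.iterate_succ', Function.comp]
    have : |(stdInv ε ((stdInv ε)^[m] p)).2 - ((stdInv ε)^[m] p).2| ≤ |ε| := by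
      simp only [stdInv, sub_sub_cancel_left, abs_neg, abs_mul]
      exact mul_le_of_le_one_right (abs_nonneg _) (abs_sin_le_one _)
    calc _ ≤ _ := abs_sub_le _ ((stdInv ε)^[m] p).2 _
      _ ≤ _ := add_le_add this ih
      _ = _ := by push_cast; ring

theorem IsAngle.cos_sub_eq_one {z : ℂ} {a b : ℝ} (hz : z ≠ 0) (ha : IsAngle z a)
    (hb : IsAngle z b) : cos (a - b) = 1 := by
  have hn := norm_pos_iff.2 hz
  have h1 : cos a = cos b := mul_left_cancel₀ hn.ne' (ha.1.symm.trans hb.1)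
  have h2 : sin a = sin b := mul_left_cancel₀ hn.ne' (ha.2.symm.trans hb.2)
  rw [cos_sub, h1, h2]
  nlinarith [sin_sq_add_cos_sq b]

theorem IsAngle.sub_int_mul {z : ℂ} {a : ℝ} (ha : IsAngle z a) (k : ℤ) :
    IsAngle z (a - k * (2 * π)) := by
  unfold IsAngle
  rw [cos_sub_int_mul_two_pi, sin_sub_int_mul_two_pi]
  exact ha

theorem nonpos_of_cos_eq_one {d : ℝ → ℝ} (hd : Continuous d) (h : ∀ t, cos (d t) = 1) {t : ℝ}
    (h0 : d 0 = 0) : d t ≤ 0 := by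
  by_contra hlt
  push Not at hlt
  obtain ⟨s, -, hs⟩ := exists_eq_of_le_of_le hd (a := 0) (b := t) (v := min (d t) π)
    (by rw [h0]; exact le_min hlt.le pi_pos.le) (min_le_left _ _)
  have h1 := cos_lt_cos_of_nonneg_of_le_pi le_rfl (min_le_right (d t) π) (lt_min hlt pi_pos)
  rw [cos_zero, ← hs, h] at h1
  exact lt_irrefl _ h1

theorem angle_lift_unique {z : ℝ → ℂ} (hz : ∀ t, z t ≠ 0) {a b : ℝ → ℝ} (ha : Continuous a)
    (hb : Continuous b) (hza : ∀ t, IsAngle (z t) (a t)) (hzb : ∀ t, IsAngle (z t) (b t))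
    (h0 : a 0 = b 0) (t : ℝ) : a t = b t := by
  have h1 := nonpos_of_cos_eq_one (ha.sub hb) (fun t => (hza t).cos_sub_eq_one (hz t) (hzb t))
    (t := t) (by simp [h0])
  have h2 := nonpos_of_cos_eq_one (hb.sub ha) (fun t => (hzb t).cos_sub_eq_one (hz t) (hza t))
    (t := t) (by simp [h0])
  simp only [Pi.sub_apply] at h1 h2
  linarith

theorem IsAngle.exists_eq_half_pi {z : ℂ} {a : ℝ} (ha : IsAngle z a) (h1 : z.re = 0)
    (h2 : 0 < z.im) : ∃ k : ℤ, a - k * (2 * π) = π / 2 := by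
  have hz : z ≠ 0 := by rintro rfl; simp at h2
  have h3 : cos a = 0 := by
    have := ha.1
    rw [h1] at this
    exact (mul_eq_zero.1 this.symm).resolve_left (norm_ne_zero_iff.2 hz)
  have h4 := (ha.sin_pos_iff hz).2 h2
  have h5 : sin a = 1 := by nlinarith [sin_sq_add_cos_sq a]
  obtain ⟨k, hk⟩ := Real.sin_eq_one_iff.1 h5
  exact ⟨k, by linarith⟩

theorem exists_angle_lift_path {z : ℝ → ℂ} (hz : Continuous z) (h0 : ∀ t, z t ≠ 0) :
    ∃ θ : ℝ → ℝ, Continuous θ ∧ ∀ t, IsAngle (z t) (θ t) := by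
  obtain ⟨θ, h1, h2⟩ := exists_angle_lift (Z := fun q => z q.1) (hz.comp continuous_fst)
    (fun q => h0 _)
  exact ⟨fun t => θ (t, 0), h1.comp (by fun_prop), fun t => h2 (t, 0)⟩

namespace EssCurve
variable {ε : ℝ} {γ : ℝ → ℝ × ℝ}

/-- The image of a descending vertical ray under a backward iterate passes to the right. -/
theorem angle_neg_of_right (m : ℕ) {P c : ℝ × ℝ} (hne : ∀ t, 0 ≤ t → (P.1, P.2 - t) ≠ c)
    {Θ : ℝ → ℝ} (hΘ : Continuous Θ)
    (hΘa : ∀ t, IsAngle (toVec ((stdInv ε)^[m] (P.1, P.2 - max t 0)) ((stdInv ε)^[m] c)) (Θ t))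
    (h0 : Θ 0 = π / 2) {τ : ℝ} (hτ0 : 0 ≤ τ)
    (hτ : ∀ j ≤ m, ((stdInv ε)^[j] (P.1, P.2 - τ)).2 < ((stdInv ε)^[j] c).2) : Θ τ < 0 := by
  set r : ℝ → ℝ × ℝ := fun t => (P.1, P.2 - max t 0)
  have hr : Continuous r := by fun_prop
  have hrc : ∀ t, r t ≠ c := fun t => hne _ (le_max_right _ _)
  obtain ⟨θ, h1, h2⟩ := exists_angle_lift_path (z := fun t => toVec (r t) c)
    (continuous_toVec.comp (hr.prodMk continuous_const)) (fun t => toVec_ne_zero.2 (hrc t))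
  have hinj : Function.Injective ((stdInv ε)^[m]) := (stdInv_injective ε).iterate m
  have hn0 : ∀ t, toVec ((stdInv ε)^[m] (r t)) ((stdInv ε)^[m] c) ≠ 0 := fun t =>
    toVec_ne_zero.2 fun h => hrc t (hinj h)
  obtain ⟨δ, f1, f2⟩ := exists_angle_stdInv_iterate (ε := ε) m hr hrc
  obtain ⟨k, hk⟩ : ∃ k : ℤ, θ 0 + δ 0 - k * (2 * π) = π / 2 := by
    have hre := hΘa 0
    rw [h0] at hre
    have hre0 := hre.1
    rw [cos_pi_div_two, mul_zero] at hre0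
    exact (f2 0 _ (h2 0)).1.exists_eq_half_pi hre0 ((hre.sin_pos_iff (hn0 0)).1 (by simp))
  have h2k := fun t => (h2 t).sub_int_mul k
  have f3 := fun t => f2 t _ (h2k t)
  have hu := angle_lift_unique hn0 hΘ ((h1.sub continuous_const).add f1) hΘa
    (fun t => (f3 t).1) (by simp only [Pi.add_apply, Pi.sub_apply]; linarith) τ
  rw [hu]
  have hrτ : r τ = (P.1, P.2 - τ) := by simp [r, hτ0]
  refine (f3 τ).2.2 (by rwa [hrτ]) ?_
  have g1 := vertical_angle_le (r := r) (θ := fun t => θ t - k * (2 * π)) (fun t => rfl) hrc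
    (h1.sub continuous_const) h2k ((f3 0).2.1 (by linarith)) τ
  by_contra hc
  push Not at hc
  have g2 := ((h2k τ).sin_neg_iff (toVec_ne_zero.2 (hrc τ))).2 (by
    have := hτ 0 (Nat.zero_le _)
    simp only [Function.iterate_zero, id] at this
    rw [hrτ]; simp only [toVec_im]; linarith)
  linarith [sin_nonneg_of_nonneg_of_le_pi hc (by linarith [pi_pos])]

end EssCurve

theorem stdInv_iterate_stdMap_iterate (ε : ℝ) (m : ℕ) (p : ℝ × ℝ) :
    (stdInv ε)^[m] ((stdMap ε)^[m] p) = p :=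
  Function.LeftInverse.iterate (stdInv_stdMap ε) m p

namespace EssCurve
variable {ε : ℝ} {γ : ℝ → ℝ × ℝ}

theorem exists_lift (h : EssCurve ε γ) {β : ℝ → ℝ × ℝ} (hβ : Continuous β)
    (hne : ∀ t, β t ∉ range γ) : ∃ F : ℝ → ℝ → ℝ, (∀ t, Continuous (F t)) ∧
      (∀ σ, Continuous fun t => F t σ) ∧ ∀ t σ, IsAngle (toVec (β t) (γ σ)) (F t σ) := by
  obtain ⟨θ, h1, h2⟩ := exists_angle_lift (Z := fun q => toVec (β q.1) (γ q.2))
    (continuous_toVec.comp ((hβ.comp continuous_fst).prodMk (h.cont.comp continuous_snd)))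
    (fun q => toVec_ne_zero.2 fun e => hne q.1 ⟨q.2, e.symm⟩)
  exact ⟨fun t σ => θ (t, σ), fun t => h1.comp (by fun_prop), fun σ => h1.comp (by fun_prop),
    fun t σ => h2 (t, σ)⟩

theorem exists_far_right (h : EssCurve ε γ) {β : ℝ → ℝ × ℝ} (hβ : Continuous β) (τ : ℝ) :
    ∃ σ, ∀ t ∈ uIcc (-τ) τ, (β t).1 < (γ σ).1 := by
  obtain ⟨M, hM⟩ := h.exists_bound
  obtain ⟨K, hK⟩ := (isCompact_uIcc (a := -τ) (b := τ)).exists_bound_of_continuousOn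
    (f := fun t => (β t).1) (by fun_prop)
  refine ⟨K + M + 1, fun t ht => ?_⟩
  have h1 := hK t ht
  rw [Real.norm_eq_abs] at h1
  linarith [(abs_le.1 h1).2, (abs_le.1 (hM (K + M + 1)).2).1]

theorem exists_far_left (h : EssCurve ε γ) {β : ℝ → ℝ × ℝ} (hβ : Continuous β) (τ : ℝ) :
    ∃ σ, ∀ t ∈ uIcc (-τ) τ, (γ σ).1 < (β t).1 := by
  obtain ⟨M, hM⟩ := h.exists_bound
  obtain ⟨K, hK⟩ := (isCompact_uIcc (a := -τ) (b := τ)).exists_bound_of_continuousOn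
    (f := fun t => (β t).1) (by fun_prop)
  refine ⟨-(K + M + 1), fun t ht => ?_⟩
  have h1 := hK t ht
  rw [Real.norm_eq_abs] at h1
  linarith [(abs_le.1 h1).1, (abs_le.1 (hM (-(K + M + 1))).2).2]

/-- A point whose preimage and one of whose forward images have free downward rays has a free
downward ray. -/
theorem mem_belowSet_of_stdInv (h : EssCurve ε γ) (m : ℕ) {P : ℝ × ℝ} (hP : P ∈ belowSet γ)
    (hL : stdInv ε ((stdInv ε)^[m] P) ∈ belowSet γ) : (stdInv ε)^[m] P ∈ belowSet γ := by
  set p := (stdInv ε)^[m] P with hp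
  rintro t0 ht0 ⟨σc, hσ⟩
  have hpC : p ∉ range γ := by
    rw [hp, h.stdInv_iterate_mem_iff]
    simpa using hP 0 le_rfl
  have ht0' : 0 < t0 := lt_of_le_of_ne ht0 (by rintro rfl; exact hpC ⟨σc, by simpa using hσ⟩)
  set β : ℝ → ℝ × ℝ := fun t =>
    if 0 ≤ t then (p.1 - t, p.2 - t) else (stdInv ε)^[m] (P.1, P.2 - max (-t) 0) with hβd
  have hβ : Continuous β := by
    refine Continuous.if_le (by fun_prop) ?_ continuous_const continuous_id ?_
    · exact ((continuous_stdInv ε).iterate m).comp (by fun_prop)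
    · rintro t rfl; simp [hp]
  have hβL : ∀ t, 0 ≤ t → β t = (p.1 - t, p.2 - t) := fun t ht => by simp [hβd, ht]
  have hβR : ∀ t, 0 ≤ t → β (-t) = (stdInv ε)^[m] (P.1, P.2 - max t 0) := fun t ht => by
    rcases ht.eq_or_lt with rfl | ht
    · simp [hβd, hp]
    · simp [hβd, not_le.2 ht]
  have hβR' : ∀ t, β (-(max t 0)) = (stdInv ε)^[m] (P.1, P.2 - max t 0) := fun t => by
    rw [hβR _ (le_max_right _ _)]; simp
  have hne : ∀ t, β t ∉ range γ := by
    intro t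
    rcases le_total 0 t with ht | ht
    · rw [hβL t ht]
      have := hL t ht
      rw [← h.stdMap_mem_iff] at this
      have e : stdMap ε ((stdInv ε p).1, (stdInv ε p).2 - t) = (p.1 - t, p.2 - t) := by
        simp only [stdMap, stdInv, Prod.mk.injEq]
        constructor <;> ring
      rwa [e] at this
    · rw [← neg_neg t, hβR (-t) (by linarith), h.stdInv_iterate_mem_iff]
      exact hP _ (le_max_right _ _)
  obtain ⟨F, hF1, hF2, hF3⟩ := h.exists_lift hβ hne
  have hz : ∀ t σ, toVec (β t) (γ σ) ≠ 0 := fun t σ => toVec_ne_zero.2 fun e => hne t ⟨σ, e.symm⟩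
  have hβ0 : β 0 = p := by rw [hβL 0 le_rfl]; simp
  obtain ⟨k, hk⟩ := (hF3 0 σc).exists_eq_half_pi (by simp [hβ0, hσ]) (by simp [hβ0, hσ, ht0'])
  set G : ℝ → ℝ → ℝ := fun t σ => F t σ - k * (2 * π) with hG
  have hGa : ∀ t σ, IsAngle (toVec (β t) (γ σ)) (G t σ) := fun t σ => (hF3 t σ).sub_int_mul k
  have hG1 : ∀ t, Continuous (G t) := fun t => (hF1 t).sub continuous_const
  have hG2 : ∀ σ, Continuous fun t => G t σ := fun σ => (hF2 σ).sub continuous_const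
  obtain ⟨M, hM⟩ := h.exists_bound
  set τ := |p.2| + |P.2| + M + m * |ε| + 1 with hτ
  have hM0 : 0 ≤ M := (abs_nonneg _).trans (hM 0).1
  have hτ0 : 0 < τ := by positivity
  have hlowL : ∀ σ, (β τ).2 < (γ σ).2 := fun σ => by
    rw [hβL τ hτ0.le]
    have := (abs_le.1 (hM σ).1).1
    have : 0 ≤ (m : ℝ) * |ε| := by positivity
    simp only
    linarith [le_abs_self p.2, abs_nonneg P.2]
  have hlowR : ∀ j ≤ m, ∀ σ, ((stdInv ε)^[j] (P.1, P.2 - τ)).2 < (γ σ).2 := fun j hj σ => by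
    have h1 := (abs_le.1 (hM σ).1).1
    have h2 := (abs_le.1 (stdInv_iterate_snd ε j (P.1, P.2 - τ))).2
    have h3 : (j : ℝ) * |ε| ≤ m * |ε| := by gcongr
    simp only at h2
    linarith [le_abs_self P.2, abs_nonneg p.2]
  have hlowR' : ∀ σ, (β (-τ)).2 < (γ σ).2 := fun σ => by
    have := hlowR m le_rfl σ
    rwa [hβR τ hτ0.le, max_eq_left hτ0.le]
  have hsinL : ∀ σ, sin (G τ σ) < 0 := fun σ =>
    ((hGa τ σ).sin_neg_iff (hz _ _)).2 (by simp only [toVec_im]; linarith [hlowL σ])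
  have hsinR : ∀ σ, sin (G (-τ) σ) < 0 := fun σ =>
    ((hGa (-τ) σ).sin_neg_iff (hz _ _)).2 (by simp only [toVec_im]; linarith [hlowR' σ])
  have hR : G (-τ) σc < 0 := by
    have hc : (stdInv ε)^[m] ((stdMap ε)^[m] (γ σc)) = γ σc := stdInv_iterate_stdMap_iterate ..
    have := angle_neg_of_right (ε := ε) m (P := P) (c := (stdMap ε)^[m] (γ σc))
      (fun t ht e => hP t ht (by rw [e, h.stdMap_iterate_mem_iff]; exact mem_range_self _))
      (Θ := fun t => G (-(max t 0)) σc) ((hG2 σc).comp (by fun_prop))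
      (fun t => by rw [hc, ← hβR']; exact hGa _ _) (by simp [hG, hk]) hτ0.le
      (fun j hj => by
        obtain ⟨σ, hσ⟩ : (stdInv ε)^[j] ((stdMap ε)^[m] (γ σc)) ∈ range γ := by
          rw [h.stdInv_iterate_mem_iff, h.stdMap_iterate_mem_iff]; exact mem_range_self _
        rw [← hσ]; exact hlowR j hj σ)
    simpa [hτ0.le] using this
  have hL' : π < G τ σc := by
    by_contra hc
    push Not at hc
    have h1 : G τ σc < 0 := by
      by_contra hc'
      push Not at hc'
      linarith [hsinL σc, sin_nonneg_of_nonneg_of_le_pi hc' hc]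
    obtain ⟨t, ht, e⟩ := exists_eq_of_le_of_le (hG2 σc) (a := τ) (b := 0) h1.le
      (by simp only [hG, hk]; positivity : (0 : ℝ) ≤ G 0 σc)
    rw [uIcc_of_ge hτ0.le] at ht
    have h2 := (hGa t σc).1
    rw [e, cos_zero, mul_one, toVec_re, hβL t ht.1, hσ] at h2
    have h3 := norm_pos_iff.2 (hz t σc)
    rw [hβL t ht.1, hσ] at h3
    simp only at h2
    linarith [ht.1]
  obtain ⟨σi, hσi⟩ := h.exists_far_right hβ τ
  have hL'' : π < G τ σi := by
    by_contra hc
    push Not at hc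
    obtain ⟨σ, -, e⟩ := exists_eq_of_le_of_le (hG1 τ) hc hL'.le
    have := hsinL σ
    rw [e, sin_pi] at this
    exact lt_irrefl _ this
  have hR'' : G (-τ) σi < 0 := by
    by_contra hc
    push Not at hc
    obtain ⟨σ, -, e⟩ := exists_eq_of_le_of_le (hG1 (-τ)) hR.le hc
    have := hsinR σ
    rw [e, sin_zero] at this
    exact lt_irrefl _ this
  obtain ⟨t, ht, e⟩ := exists_eq_of_le_of_le (hG2 σi) (a := -τ) (b := τ) (v := π / 2)
    (by linarith [pi_pos]) (by linarith [pi_pos])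
  have h2 := (hGa t σi).1
  rw [e, cos_pi_div_two, mul_zero, toVec_re] at h2
  linarith [hσi t ht]

/-- A path from high above the curve to far below it meets the curve. -/
theorem path_meets (h : EssCurve ε γ) {β : ℝ → ℝ × ℝ} (hβ : Continuous β) {τ : ℝ}
    (h1 : ∀ σ, (γ σ).2 < (β τ).2) (h2 : ∀ σ, (β (-τ)).2 < (γ σ).2) : ∃ t, β t ∈ range γ := by
  by_contra hne
  push Not at hne
  obtain ⟨F, hF1, hF2, hF3⟩ := h.exists_lift hβ hne
  have hz : ∀ t σ, toVec (β t) (γ σ) ≠ 0 := fun t σ => toVec_ne_zero.2 fun e => hne t ⟨σ, e.symm⟩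
  obtain ⟨σr, hr⟩ := h.exists_far_right hβ τ
  obtain ⟨σl, hl⟩ := h.exists_far_left hβ τ
  obtain ⟨k, ⟨hk1, hk2⟩, -⟩ := existsUnique_sub_zsmul_mem_Ioc two_pi_pos (F τ σr) (-π)
  rw [zsmul_eq_mul] at hk1 hk2
  set G : ℝ → ℝ → ℝ := fun t σ => F t σ - k * (2 * π) with hG
  have hGa : ∀ t σ, IsAngle (toVec (β t) (γ σ)) (G t σ) := fun t σ => (hF3 t σ).sub_int_mul k
  have hG1 : ∀ t, Continuous (G t) := fun t => (hF1 t).sub continuous_const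
  have hG2 : ∀ σ, Continuous fun t => G t σ := fun σ => (hF2 σ).sub continuous_const
  have hs1 : ∀ σ, 0 < sin (G τ σ) := fun σ =>
    ((hGa τ σ).sin_pos_iff (hz _ _)).2 (by simp only [toVec_im]; linarith [h1 σ])
  have hs2 : ∀ σ, sin (G (-τ) σ) < 0 := fun σ =>
    ((hGa (-τ) σ).sin_neg_iff (hz _ _)).2 (by simp only [toVec_im]; linarith [h2 σ])
  have hcr : ∀ t ∈ uIcc (-τ) τ, cos (G t σr) < 0 := fun t ht =>
    ((hGa t σr).cos_neg_iff (hz _ _)).2 (by simp only [toVec_re]; linarith [hr t ht])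
  have hcl : ∀ t ∈ uIcc (-τ) τ, 0 < cos (G t σl) := fun t ht =>
    ((hGa t σl).cos_pos_iff (hz _ _)).2 (by simp only [toVec_re]; linarith [hl t ht])
  have a1 : G τ σr < π := lt_of_le_of_ne (by simp only [hG]; linarith) fun e => by
    have := hs1 σr; rw [e, sin_pi] at this; exact lt_irrefl _ this
  have a0 : 0 < G τ σr := by
    by_contra hc
    push Not at hc
    linarith [hs1 σr, sin_nonpos_of_nonpos_of_neg_pi_le hc (by simp only [hG]; linarith)]
  have a2 : π / 2 < G τ σr := by
    by_contra hc
    push Not at hc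
    linarith [hcr τ right_mem_uIcc,
      cos_nonneg_of_neg_pi_div_two_le_of_le (x := G τ σr) (by linarith [pi_pos]) hc]
  have a3 : π / 2 < G (-τ) σr := by
    by_contra hc
    push Not at hc
    obtain ⟨t, ht, e⟩ := exists_eq_of_le_of_le (hG2 σr) hc a2.le
    have := hcr t ht
    rw [e, cos_pi_div_two] at this
    exact lt_irrefl _ this
  have a4 : π < G (-τ) σr := by
    by_contra hc
    push Not at hc
    linarith [hs2 σr, sin_nonneg_of_nonneg_of_le_pi (by linarith [pi_pos]) hc]
  have b1 : G τ σl < π := by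
    by_contra hc
    push Not at hc
    obtain ⟨σ, -, e⟩ := exists_eq_of_le_of_le (hG1 τ) a1.le hc
    have := hs1 σ; rw [e, sin_pi] at this; exact lt_irrefl _ this
  have b2 : π < G (-τ) σl := by
    by_contra hc
    push Not at hc
    obtain ⟨σ, -, e⟩ := exists_eq_of_le_of_le (hG1 (-τ)) hc a4.le
    have := hs2 σ; rw [e, sin_pi] at this; exact lt_irrefl _ this
  obtain ⟨t, ht, e⟩ := exists_eq_of_le_of_le (hG2 σl) b1.le b2.le
  have := hcl t (by rwa [uIcc_comm])
  rw [e, cos_pi] at this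
  linarith

end EssCurve

namespace EssCurve
variable {ε : ℝ} {γ : ℝ → ℝ × ℝ}

theorem snd_le_of_mem_belowSet (h : EssCurve ε γ) {A : ℝ × ℝ → ℝ × ℝ} (hA : Continuous A)
    (hAC : ∀ q, A q ∈ range γ → q ∈ range γ) {K : ℝ} (hK : ∀ q, |(A q).2 - q.2| ≤ K) {M : ℝ}
    (hM : ∀ s, |(γ s).2| ≤ M) {p : ℝ × ℝ} (hp : p ∈ belowSet γ) : (A p).2 ≤ M := by
  by_contra hc
  push Not at hc
  have hM0 : 0 ≤ M := (abs_nonneg _).trans (hM 0)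
  have hK0 : 0 ≤ K := (abs_nonneg _).trans (hK 0)
  set β : ℝ → ℝ × ℝ := fun t => ((A (p.1, p.2 - max (-t) 0)).1, (A (p.1, p.2 - max (-t) 0)).2 + max t 0)
  have hβ : Continuous β := by fun_prop
  obtain ⟨t, ht⟩ := h.path_meets hβ (τ := K + M + |p.2| + 1) (fun σ => by
    have h1 := (abs_le.1 (hM σ)).2
    have h2 : 0 ≤ K + M + |p.2| + 1 := by positivity
    simp only [β, max_eq_left h2, max_eq_right (neg_nonpos.2 h2), sub_zero]
    linarith) (fun σ => by
    have h1 := (abs_le.1 (hM σ)).1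
    have h2 : 0 ≤ K + M + |p.2| + 1 := by positivity
    simp only [β, neg_neg, max_eq_left h2, max_eq_right (neg_nonpos.2 h2), add_zero]
    have h3 := (abs_le.1 (hK (p.1, p.2 - (K + M + |p.2| + 1)))).2
    simp only at h3
    linarith [le_abs_self p.2])
  rcases le_total 0 t with h0 | h0
  · obtain ⟨σ, hσ⟩ := ht
    have h1 := (abs_le.1 (hM σ)).2
    rw [hσ] at h1
    simp only [β, max_eq_left h0, max_eq_right (neg_nonpos.2 h0), sub_zero] at h1
    linarith
  · simp only [β, max_eq_right h0, add_zero] at ht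
    exact hp _ (le_max_right _ _) (hAC _ ht)

theorem le_snd_of_lt (h : EssCurve ε γ) {A : ℝ × ℝ → ℝ × ℝ} (hA : Continuous A)
    (hAC : ∀ q, A q ∈ range γ → q ∈ range γ) {K : ℝ} (hK : ∀ q, |(A q).2 - q.2| ≤ K) {a b : ℝ}
    (hM : ∀ s, (γ s).2 ∈ Icc a b) {p : ℝ × ℝ} (hp : b < p.2) : a ≤ (A p).2 := by
  by_contra hc
  push Not at hc
  have hK0 : 0 ≤ K := (abs_nonneg _).trans (hK 0)
  set β : ℝ → ℝ × ℝ := fun t => ((A (p.1, p.2 + max t 0)).1, (A (p.1, p.2 + max t 0)).2 - max (-t) 0)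
  have hβ : Continuous β := by fun_prop
  obtain ⟨t, ht⟩ := h.path_meets hβ (τ := K) (fun σ => by
    have h1 := (hM σ).2
    simp only [β, max_eq_left hK0, max_eq_right (neg_nonpos.2 hK0), sub_zero]
    have h3 := (abs_le.1 (hK (p.1, p.2 + K))).1
    simp only at h3
    linarith) (fun σ => by
    have h1 := (hM σ).1
    simp only [β, neg_neg, max_eq_left hK0, max_eq_right (neg_nonpos.2 hK0), add_zero]
    linarith)
  rcases le_total 0 t with h0 | h0
  · simp only [β, max_eq_right (neg_nonpos.2 h0), sub_zero] at ht
    obtain ⟨σ, hσ⟩ := hAC _ ht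
    have h1 := (hM σ).2
    rw [hσ] at h1
    simp only at h1
    linarith [le_max_right t 0]
  · obtain ⟨σ, hσ⟩ := ht
    have h1 := (hM σ).1
    rw [hσ] at h1
    simp only [β, max_eq_right h0, add_zero] at h1
    linarith [le_max_right (-t) 0]

theorem mem_add_two_pi_mul (h : EssCurve ε γ) (k : ℤ) {p : ℝ × ℝ} :
    (p.1 + k * (2 * π), p.2) ∈ range γ ↔ p ∈ range γ := by
  have h1 : ∀ (k : ℤ) s, γ (s + k * (2 * π)) = ((γ s).1 + k * (2 * π), (γ s).2) := by
    have hp : Function.Periodic (fun s => γ s - (s, 0)) (2 * π) := fun s => by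
      simp only [h.per]
      ext <;> simp
    intro k s
    have := hp.int_mul k s
    have h1 := congrArg Prod.fst this
    have h2 := congrArg Prod.snd this
    simp at h1 h2
    exact Prod.ext (by simp; linarith) (by simp; linarith)
  constructor
  · rintro ⟨s, hs⟩
    refine ⟨s + (-k : ℤ) * (2 * π), ?_⟩
    rw [h1, hs]
    ext <;> simp
  · rintro ⟨s, rfl⟩
    exact ⟨s + k * (2 * π), by rw [h1]⟩

theorem mem_belowSet_add (h : EssCurve ε γ) (k : ℤ) {p : ℝ × ℝ} :
    (p.1 + k * (2 * π), p.2) ∈ belowSet γ ↔ p ∈ belowSet γ :=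
  forall₂_congr fun t _ => not_congr (h.mem_add_two_pi_mul k (p := (p.1, p.2 - t)))

theorem shift (h : EssCurve ε γ) (k : ℤ) : EssCurve ε (fun s => γ s - (0, k * (2 * π))) := by
  refine ⟨h.cont.sub continuous_const, fun s => by rw [h.per]; abel, ?_⟩
  have h1 : ∀ p : ℝ × ℝ, p ∈ range (fun s => γ s - (0, (k : ℝ) * (2 * π))) ↔
      (p.1, p.2 + k * (2 * π)) ∈ range γ := fun p => by
    constructor
    · rintro ⟨s, rfl⟩; exact ⟨s, by ext <;> simp⟩
    · rintro ⟨s, hs⟩; exact ⟨s, by simp only [hs]; ext <;> simp⟩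
  have h2 : ∀ p : ℝ × ℝ, stdMap ε p ∈ range (fun s => γ s - (0, (k : ℝ) * (2 * π))) ↔
      p ∈ range (fun s => γ s - (0, (k : ℝ) * (2 * π))) := fun p => by
    rw [h1, h1, ← h.stdMap_mem_iff (p := (p.1, p.2 + k * (2 * π))),
      ← h.mem_add_two_pi_mul k (p := ((stdMap ε p).1, (stdMap ε p).2 + k * (2 * π)))]
    simp only [stdMap]
    ring_nf
  ext p
  constructor
  · rintro ⟨q, hq, rfl⟩; exact (h2 q).2 hq
  · intro hp
    exact ⟨stdInv ε p, (h2 _).1 (by rwa [stdMap_stdInv]), stdMap_stdInv ε p⟩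

theorem notMem_belowSet_iff {p : ℝ × ℝ} :
    p ∉ belowSet γ ↔ ∃ s, (γ s).1 = p.1 ∧ (γ s).2 ≤ p.2 := by
  simp only [belowSet, mem_ofPred_eq, not_forall, not_not]
  constructor
  · rintro ⟨t, ht, s, hs⟩
    exact ⟨s, by rw [hs], by rw [hs]; simp only; linarith⟩
  · rintro ⟨s, h1, h2⟩
    exact ⟨p.2 - (γ s).2, by linarith, s, by ext <;> simp [h1]⟩

theorem isClosed_exists (h : EssCurve ε γ) {W : Set (ℝ × ℝ)} (hW : IsClosed W) :
    IsClosed {p : ℝ × ℝ | ∃ s, (γ s).1 = p.1 ∧ ((γ s).2, p.2) ∈ W} := by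
  obtain ⟨M, hM⟩ := h.exists_bound
  refine IsSeqClosed.isClosed fun u p hu hup => ?_
  choose s hs1 hs2 using hu
  have hu1 : Tendsto (fun n => (u n).1) atTop (nhds p.1) := (continuous_fst.tendsto p).comp hup
  have hu2 : Tendsto (fun n => (u n).2) atTop (nhds p.2) := (continuous_snd.tendsto p).comp hup
  have hb : Bornology.IsBounded (range s) := by
    obtain ⟨R, hR⟩ := (Metric.isBounded_range_of_tendsto _ hu1).subset_closedBall 0
    refine (Metric.isBounded_closedBall (x := (0 : ℝ)) (r := R + M)).subset ?_
    rintro _ ⟨n, rfl⟩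
    have h1 := hR (mem_range_self n)
    have h2 := (hM (s n)).2
    rw [Metric.mem_closedBall, dist_zero_right, Real.norm_eq_abs] at h1 ⊢
    rw [hs1] at h2
    have := abs_sub_abs_le_abs_sub (s n) (u n).1
    rw [abs_sub_comm] at h2
    linarith
  obtain ⟨s', -, φ, hφ, hs'⟩ := tendsto_subseq_of_bounded hb (fun n => mem_range_self n)
  have hγ := (h.cont.tendsto s').comp hs'
  have hγ1 := (continuous_fst.tendsto _).comp hγ
  have hγ2 := (continuous_snd.tendsto _).comp hγ
  refine ⟨s', tendsto_nhds_unique hγ1 ((hu1.comp hφ.tendsto_atTop).congr fun n => ?_),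
    hW.mem_of_tendsto (hγ2.prodMk_nhds (hu2.comp hφ.tendsto_atTop))
      (Filter.Eventually.of_forall fun n => hs2 _)⟩
  exact (hs1 _).symm

theorem isClosed_above (h : EssCurve ε γ) :
    IsClosed {p : ℝ × ℝ | ∃ s, (γ s).1 = p.1 ∧ (γ s).2 ≤ p.2} :=
  h.isClosed_exists (isClosed_le continuous_fst continuous_snd)

theorem isClosed_range (h : EssCurve ε γ) : IsClosed (range γ) := by
  have := h.isClosed_exists (isClosed_eq continuous_fst continuous_snd)
  convert this using 1
  ext p
  constructor
  · rintro ⟨s, rfl⟩; exact ⟨s, rfl, rfl⟩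
  · rintro ⟨s, h1, h2⟩; exact ⟨s, Prod.ext h1 h2⟩

theorem isOpen_belowSet (h : EssCurve ε γ) : IsOpen (belowSet γ) := by
  have : belowSet γ = {p : ℝ × ℝ | ∃ s, (γ s).1 = p.1 ∧ (γ s).2 ≤ p.2}ᶜ := by
    ext p
    rw [mem_compl_iff, mem_ofPred_eq, ← notMem_belowSet_iff, not_not]
  rw [this]
  exact h.isClosed_above.isOpen_compl

end EssCurve

instance fact_two_pi_pos : Fact (0 < 2 * π) := ⟨Real.two_pi_pos⟩

/-- Projection of the plane to the cylinder. -/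
def toCyl (p : ℝ × ℝ) : AddCircle (2 * π) × ℝ := ((p.1 : AddCircle (2 * π)), p.2)

/-- The kick part of the standard map on the cylinder. -/
def cylKick (ε : ℝ) (q : AddCircle (2 * π) × ℝ) : AddCircle (2 * π) × ℝ :=
  (q.1, q.2 + ε * Real.sin_periodic.lift q.1)

/-- The shear part of the standard map on the cylinder. -/
def cylShear (q : AddCircle (2 * π) × ℝ) : AddCircle (2 * π) × ℝ := (q.1 + (q.2 : AddCircle (2 * π)), q.2)

theorem continuous_sin_lift : Continuous (Real.sin_periodic.lift : AddCircle (2 * π) → ℝ) :=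
  continuous_coinduced_dom.mpr Real.continuous_sin

theorem cylShear_cylKick_toCyl (ε : ℝ) (p : ℝ × ℝ) :
    cylShear (cylKick ε (toCyl p)) = toCyl (stdMap ε p) := by
  simp [cylShear, cylKick, toCyl, stdMap, Function.Periodic.lift_coe, add_assoc]

theorem measurePreserving_cylKick (ε : ℝ) : MeasureTheory.MeasurePreserving (cylKick ε) := by
  have hm : Continuous (Function.uncurry fun (θ : AddCircle (2 * π)) (y : ℝ) =>
      y + ε * Real.sin_periodic.lift θ) := by
    have := continuous_sin_lift
    simp only [Function.uncurry_def]
    fun_prop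
  exact (MeasureTheory.MeasurePreserving.id _).skew_product hm.measurable
    (Filter.Eventually.of_forall fun θ => (MeasureTheory.measurePreserving_add_right _ _).map_eq)

theorem measurePreserving_cylShear : MeasureTheory.MeasurePreserving cylShear := by
  have hm : Continuous (Function.uncurry fun (y : ℝ) (θ : AddCircle (2 * π)) =>
      θ + (y : AddCircle (2 * π))) := by
    simp only [Function.uncurry_def]
    exact continuous_snd.add ((AddCircle.continuous_mk' _).comp continuous_fst)
  have h := (MeasureTheory.MeasurePreserving.id (MeasureTheory.volume : MeasureTheory.Measure ℝ)).skew_product hm.measurable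
    (μc := MeasureTheory.volume) (μd := MeasureTheory.volume)
    (Filter.Eventually.of_forall fun θ => (MeasureTheory.measurePreserving_add_right _ _).map_eq)
  exact (MeasureTheory.Measure.measurePreserving_swap.comp h).comp MeasureTheory.Measure.measurePreserving_swap

theorem exists_return {ε : ℝ} {U : Set (ℝ × ℝ)} (hU : IsOpen U) (hne : U.Nonempty) {a b : ℝ}
    (hb : ∀ n, ∀ p, (stdMap ε)^[n] p ∈ U → p.2 ∈ Icc a b) :
    ∃ p ∈ U, ∃ n : ℕ, ∃ k : ℤ, (((stdMap ε)^[n + 1] p).1 + k * (2 * π), ((stdMap ε)^[n + 1] p).2) ∈ U := by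
  set T : AddCircle (2 * π) × ℝ → AddCircle (2 * π) × ℝ := cylShear ∘ cylKick ε
  have hT : MeasureTheory.MeasurePreserving T := measurePreserving_cylShear.comp (measurePreserving_cylKick ε)
  have hsemi : ∀ n p, T^[n] (toCyl p) = toCyl ((stdMap ε)^[n] p) := by
    intro n p
    have : Function.Semiconj toCyl (stdMap ε) T := fun p => (cylShear_cylKick_toCyl ε p).symm
    exact ((this.iterate_right n) p).symm
  have hlift : ∀ p q, toCyl p = toCyl q → ∃ k : ℤ, q = (p.1 + k * (2 * π), p.2) := by
    intro p q h
    simp only [toCyl, Prod.mk.injEq] at h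
    obtain ⟨h1, h2⟩ := h
    rw [eq_comm, ← sub_eq_zero, ← AddCircle.coe_sub, AddCircle.coe_eq_zero_iff] at h1
    obtain ⟨k, hk⟩ := h1
    refine ⟨k, Prod.ext ?_ h2.symm⟩
    simp only [zsmul_eq_mul] at hk
    simp only
    linarith
  have hsurj : Function.Surjective toCyl := by
    rintro ⟨θ, y⟩
    obtain ⟨x, rfl⟩ := QuotientAddGroup.mk_surjective θ
    exact ⟨(x, y), rfl⟩
  set V : Set (AddCircle (2 * π) × ℝ) := toCyl '' U
  have hV : IsOpen V := by
    have : IsOpenMap toCyl := (QuotientAddGroup.isOpenMap_coe (G := ℝ) (N := AddSubgroup.zmultiples (2 * π))).prodMap IsOpenMap.id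
    exact this _ hU
  have hVpos : 0 < MeasureTheory.volume V := hV.measure_pos _ (hne.image _)
  set S : Set (AddCircle (2 * π) × ℝ) := univ ×ˢ Icc a b
  have hS : MeasureTheory.volume S ≠ ⊤ := by
    have : MeasureTheory.volume S = MeasureTheory.volume (univ : Set (AddCircle (2 * π))) * MeasureTheory.volume (Icc a b) :=
      MeasureTheory.Measure.prod_prod _ _
    rw [this]
    exact ENNReal.mul_ne_top (MeasureTheory.measure_ne_top _ _) (by simp)
  have hVS : ∀ n, T^[n] ⁻¹' V ⊆ S := by
    intro n q hq
    obtain ⟨p, rfl⟩ := hsurj q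
    obtain ⟨u, hu, hu2⟩ := hq
    rw [hsemi] at hu2
    obtain ⟨k, hk⟩ := hlift _ _ hu2.symm
    refine ⟨mem_univ _, ?_⟩
    have hp : toCyl p = toCyl (p.1 + k * (2 * π), p.2) := by
      simp only [toCyl, Prod.mk.injEq, and_true]
      rw [eq_comm, ← sub_eq_zero, ← AddCircle.coe_sub, AddCircle.coe_eq_zero_iff]
      exact ⟨k, by simp⟩
    have hsh : ∀ (n : ℕ) (p : ℝ × ℝ), (stdMap ε)^[n] (p.1 + k * (2 * π), p.2) =
        (((stdMap ε)^[n] p).1 + k * (2 * π), ((stdMap ε)^[n] p).2) := by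
      intro n
      induction n with
      | zero => intro p; rfl
      | succ n ih =>
        intro p
        rw [Function.iterate_succ_apply, Function.iterate_succ_apply, ← ih]
        congr 1
        simp only [stdMap, Real.sin_add_int_mul_two_pi, Prod.mk.injEq, and_true]
        ring
    have := hb n (p.1 + k * (2 * π), p.2) (by rw [hsh, ← hk]; exact hu)
    exact this
  have hmeas : ∀ n, MeasurableSet (T^[n] ⁻¹' V) := fun n => (hT.iterate n).measurable hV.measurableSet
  have : MeasureTheory.IsFiniteMeasure (MeasureTheory.volume.restrict S) :=
    ⟨by rw [MeasureTheory.Measure.restrict_apply_univ]; exact lt_top_iff_ne_top.2 hS⟩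
  obtain ⟨i, j, hij, q, hqi, hqj⟩ := MeasureTheory.exists_nonempty_inter_of_measure_univ_lt_tsum_measure
    (MeasureTheory.volume.restrict S) (s := fun n : ℕ => T^[n] ⁻¹' V) (fun n => (hmeas n).nullMeasurableSet) (by
      have : ∀ n, (MeasureTheory.volume.restrict S) (T^[n] ⁻¹' V) = MeasureTheory.volume V := by
        intro n
        rw [MeasureTheory.Measure.restrict_apply (hmeas n), inter_eq_left.2 (hVS n),
          (hT.iterate n).measure_preimage hV.measurableSet.nullMeasurableSet]
      simp only [this]
      rw [ENNReal.tsum_const_eq_top_of_ne_zero hVpos.ne', lt_top_iff_ne_top]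
      exact MeasureTheory.measure_ne_top _ _)
  wlog hlt : i < j generalizing i j
  · exact this j i hij.symm hqj hqi (lt_of_le_of_ne (not_lt.1 hlt) hij.symm)
  obtain ⟨p, hp, hpq⟩ := hqi
  obtain ⟨p', hp', hpq'⟩ := hqj
  obtain ⟨n, rfl⟩ : ∃ n, j = n + 1 + i := ⟨j - i - 1, by omega⟩
  rw [Function.iterate_add_apply, ← hpq, hsemi] at hpq'
  obtain ⟨k, hk⟩ := hlift _ _ hpq'.symm
  exact ⟨p, hp, n, k, hk ▸ hp'⟩

namespace EssCurve
variable {ε : ℝ} {γ : ℝ → ℝ × ℝ}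

theorem exists_mem_stdMap_mem (h : EssCurve ε γ) {U : Set (ℝ × ℝ)} (hU : IsOpen U)
    (hne : U.Nonempty) (hUD : U ⊆ belowSet γ) : ∃ p ∈ U, stdMap ε p ∈ belowSet γ := by
  obtain ⟨M, hM⟩ := h.exists_bound
  obtain ⟨u, hu⟩ := hne
  set U' := U ∩ {p : ℝ × ℝ | u.2 - 1 < p.2}
  have hU' : IsOpen U' := hU.inter (isOpen_lt continuous_const continuous_snd)
  obtain ⟨j, hj⟩ := exists_nat_gt ((M + 1 + |u.2|) / (2 * π))
  rw [div_lt_iff₀ Real.two_pi_pos] at hj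
  have hinv : ∀ n, ∀ (q : ℝ × ℝ), (stdInv ε)^[n] ((stdMap ε)^[n] q) = q :=
    fun n q => stdInv_iterate_stdMap_iterate ε n q
  have hb : ∀ n, ∀ p, (stdMap ε)^[n] p ∈ U' → p.2 ∈ Icc (-M - j * (2 * π)) M := by
    intro n p hp
    constructor
    · have := (h.shift j).le_snd_of_lt ((continuous_stdInv ε).iterate n)
        (fun q hq => ((h.shift j).stdInv_iterate_mem_iff n).1 hq) (K := n * |ε|)
        (fun q => stdInv_iterate_snd ε n q) (a := -M - j * (2 * π)) (b := M - j * (2 * π))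
        (fun s => by
          have := abs_le.1 (hM s).1
          simp only [Prod.snd_sub, Int.cast_natCast]
          constructor <;> linarith) (p := (stdMap ε)^[n] p) (by
          have := hp.2
          simp only [mem_ofPred_eq] at this
          linarith [neg_abs_le u.2])
      rwa [hinv] at this
    · have := h.snd_le_of_mem_belowSet ((continuous_stdInv ε).iterate n)
        (fun q hq => (h.stdInv_iterate_mem_iff n).1 hq) (K := n * |ε|)
        (fun q => stdInv_iterate_snd ε n q) (fun s => (hM s).1) (hUD hp.1)
      rwa [hinv] at this
  obtain ⟨p, hp, n, k, hk⟩ := exists_return hU' ⟨u, hu, by simp⟩ hb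
  refine ⟨p, hp.1, ?_⟩
  have hP : (stdMap ε)^[n + 1] p ∈ belowSet γ := (h.mem_belowSet_add k).1 (hUD hk.1)
  have h1 : (stdInv ε)^[n] ((stdMap ε)^[n + 1] p) = stdMap ε p := by
    rw [Function.iterate_succ_apply, hinv]
  have := h.mem_belowSet_of_stdInv n hP (by rw [h1, stdInv_stdMap]; exact hUD hp.1)
  rwa [h1] at this

theorem stdMap_mem_closure (h : EssCurve ε γ) {p : ℝ × ℝ} (hp : p ∈ closure (belowSet γ)) :
    stdMap ε p ∈ closure (belowSet γ) := by
  rw [_root_.mem_closure_iff]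
  intro O hO hpO
  obtain ⟨q, hq1, hq2⟩ := _root_.mem_closure_iff.1 hp (stdMap ε ⁻¹' O) (hO.preimage (continuous_stdMap ε)) hpO
  obtain ⟨r, hr, hr2⟩ := h.exists_mem_stdMap_mem ((hO.preimage (continuous_stdMap ε)).inter h.isOpen_belowSet)
    ⟨q, hq1, hq2⟩ inter_subset_right
  exact ⟨stdMap ε r, hr.1, hr2⟩

end EssCurve

/-- A reversor of the standard map. -/
def stdRev (ε : ℝ) (p : ℝ × ℝ) : ℝ × ℝ := (-p.1, p.2 + ε * Real.sin p.1)

theorem stdRev_stdRev (ε : ℝ) (p : ℝ × ℝ) : stdRev ε (stdRev ε p) = p := by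
  simp [stdRev]

theorem stdRev_stdMap_stdRev (ε : ℝ) (p : ℝ × ℝ) : stdRev ε (stdMap ε (stdRev ε p)) = stdInv ε p := by
  simp only [stdRev, stdMap, stdInv, Real.sin_neg, Prod.mk.injEq]
  constructor
  · ring
  · rw [show -p.1 + (p.2 + ε * Real.sin p.1) + ε * -Real.sin p.1 = -(p.1 - p.2) by ring, Real.sin_neg]
    ring

theorem continuous_stdRev (ε : ℝ) : Continuous (stdRev ε) := by unfold stdRev; fun_prop

namespace EssCurve
variable {ε : ℝ} {γ : ℝ → ℝ × ℝ}

theorem mem_range_rev {p : ℝ × ℝ} : p ∈ range (fun s => stdRev ε (γ (-s))) ↔ stdRev ε p ∈ range γ := by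
  constructor
  · rintro ⟨s, rfl⟩; exact ⟨-s, by simp [stdRev_stdRev]⟩
  · rintro ⟨s, hs⟩; exact ⟨-s, by simp only [neg_neg, hs, stdRev_stdRev]⟩

theorem rev (h : EssCurve ε γ) : EssCurve ε (fun s => stdRev ε (γ (-s))) := by
  refine ⟨(continuous_stdRev ε).comp (h.cont.comp continuous_neg), fun s => ?_, ?_⟩
  · have := h.per (-(s + 2 * π))
    rw [show -(s + 2 * π) + 2 * π = -s by ring] at this
    rw [this]
    simp only [stdRev, Prod.fst_add, Prod.snd_add, Real.sin_add_two_pi]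
    ext <;> simp
  · have h2 : ∀ p : ℝ × ℝ, stdMap ε p ∈ range (fun s => stdRev ε (γ (-s))) ↔
      p ∈ range (fun s => stdRev ε (γ (-s))) := fun p => by
      rw [mem_range_rev, mem_range_rev, ← h.stdInv_mem_iff (p := stdRev ε p), ← stdRev_stdMap_stdRev,
        stdRev_stdRev]
    ext p
    constructor
    · rintro ⟨q, hq, rfl⟩; exact (h2 q).2 hq
    · intro hp
      exact ⟨stdInv ε p, (h2 _).1 (by rwa [stdMap_stdInv]), stdMap_stdInv ε p⟩

theorem mem_belowSet_rev {p : ℝ × ℝ} :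
    p ∈ belowSet (fun s => stdRev ε (γ (-s))) ↔ stdRev ε p ∈ belowSet γ := by
  simp only [belowSet, mem_ofPred_eq]
  refine forall₂_congr fun t _ => not_congr ?_
  rw [mem_range_rev]
  simp only [stdRev]
  rw [show p.2 - t + ε * Real.sin p.1 = p.2 + ε * Real.sin p.1 - t by ring]

theorem mem_closure_belowSet_rev {p : ℝ × ℝ} :
    p ∈ closure (belowSet (fun s => stdRev ε (γ (-s)))) ↔ stdRev ε p ∈ closure (belowSet γ) := by
  have hH : belowSet (fun s => stdRev ε (γ (-s))) = stdRev ε ⁻¹' belowSet γ := by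
    ext p; exact mem_belowSet_rev
  let H : (ℝ × ℝ) ≃ₜ (ℝ × ℝ) := 
    { toFun := stdRev ε, invFun := stdRev ε, left_inv := stdRev_stdRev ε, right_inv := stdRev_stdRev ε
      continuous_toFun := continuous_stdRev ε, continuous_invFun := continuous_stdRev ε }
  rw [hH]
  have := H.preimage_closure (belowSet γ)
  change stdRev ε ⁻¹' _ = closure (stdRev ε ⁻¹' _) at this
  rw [← this]; rfl

theorem stdInv_mem_closure (h : EssCurve ε γ) {p : ℝ × ℝ} (hp : p ∈ closure (belowSet γ)) :
    stdInv ε p ∈ closure (belowSet γ) := by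
  have h1 : stdRev ε p ∈ closure (belowSet (fun s => stdRev ε (γ (-s)))) := by
    rw [mem_closure_belowSet_rev, stdRev_stdRev]; exact hp
  have h2 := h.rev.stdMap_mem_closure h1
  rwa [mem_closure_belowSet_rev, stdRev_stdMap_stdRev] at h2

/-- **Birkhoff**: the boundary of the region below the curve is an invariant Lipschitz graph. -/
theorem exists_graph (h : EssCurve ε γ) (hε : 0 ≤ ε) : ∃ ψ : ℝ → ℝ,
    (∀ x t, 0 ≤ t → ψ x - t ≤ ψ (x - t)) ∧ (∀ x t, 0 ≤ t → ψ x - (1 + ε) * t ≤ ψ (x + t)) ∧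
    (∀ x, ψ (x + 2 * π) = ψ x) ∧ (∀ x, (x, ψ x) ∈ range γ) ∧
    ∀ x, stdMap ε (x, ψ x) = (x + ψ x + ε * Real.sin x, ψ (x + ψ x + ε * Real.sin x)) := by
  obtain ⟨M, hM⟩ := h.exists_bound
  set D := belowSet γ
  set E := closure D
  have hDdown : ∀ p : ℝ × ℝ, p ∈ D → ∀ t, 0 ≤ t → (p.1, p.2 - t) ∈ D := fun p hp t ht u hu => by
    have := hp (t + u) (by positivity)
    rwa [show p.2 - (t + u) = p.2 - t - u by ring] at this
  have hEdown : ∀ x y, (x, y) ∈ E → ∀ t, 0 ≤ t → (x, y - t) ∈ E := fun x y hp t ht => by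
    have hc : Continuous fun q : ℝ × ℝ => (q.1, q.2 - t) := by fun_prop
    exact map_mem_closure (f := fun q : ℝ × ℝ => (q.1, q.2 - t)) (t := D) hc hp (fun q hq => hDdown q hq t ht)
  have hEM : ∀ p ∈ E, p.2 ≤ M := by
    have : E ⊆ {p | p.2 ≤ M} := closure_minimal (fun p hp => by
      by_contra hc
      obtain ⟨s, hs⟩ := h.exists_vertical p.1
      simp only [mem_ofPred_eq, not_le] at hc
      exact notMem_belowSet_iff.2 ⟨s, hs, by linarith [(abs_le.1 (hM s).1).2]⟩ hp)
      (isClosed_le continuous_snd continuous_const)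
    exact this
  have hDM : ∀ p : ℝ × ℝ, p.2 < -M → p ∈ D := fun p hp => by
    by_contra hc
    obtain ⟨s, -, hs⟩ := notMem_belowSet_iff.1 hc
    linarith [(abs_le.1 (hM s).1).1]
  have hTE : ∀ p, p ∈ E → stdMap ε p ∈ E := fun p hp => h.stdMap_mem_closure hp
  have hSE : ∀ p, p ∈ E → stdInv ε p ∈ E := fun p hp => h.stdInv_mem_closure hp
  have hEc : IsClosed E := isClosed_closure
  set ψ : ℝ → ℝ := fun x => sSup {y | (x, y) ∈ E}
  have hbdd : ∀ x, BddAbove {y | (x, y) ∈ E} := fun x => ⟨M, fun y hy => hEM _ hy⟩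
  have hne : ∀ x, {y | (x, y) ∈ E}.Nonempty := fun x =>
    ⟨-M - 1, subset_closure (hDM _ (by simp))⟩
  have hmem : ∀ x, (x, ψ x) ∈ E := fun x =>
    (hEc.preimage (Continuous.prodMk_right x)).csSup_mem (hne x) (hbdd x)
  have hiff : ∀ x y, (x, y) ∈ E ↔ y ≤ ψ x := fun x y => by
    refine ⟨fun hy => le_csSup (hbdd x) hy, fun hy => ?_⟩
    have := hEdown x _ (hmem x) (ψ x - y) (by linarith)
    rwa [sub_sub_cancel] at this
  have hL : ∀ x t, 0 ≤ t → ψ x - t ≤ ψ (x - t) := fun x t ht => by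
    have h1 := hTE _ (hEdown _ _ (hSE _ (hmem x)) t ht)
    rw [← hiff]
    convert h1 using 1
    simp only [stdMap]
    ext <;> simp <;> ring
  have hR : ∀ x t, 0 ≤ t → ψ x - (1 + ε) * t ≤ ψ (x + t) := fun x t ht => by
    have h1 : stdInv ε ((stdMap ε (x, ψ x)).1, (stdMap ε (x, ψ x)).2 - t) ∈ E :=
      hSE _ (hEdown _ _ (hTE _ (hmem x)) t ht)
    have h2 : stdInv ε ((stdMap ε (x, ψ x)).1, (stdMap ε (x, ψ x)).2 - t) =
        (x + t, ψ x + ε * Real.sin x - t - ε * Real.sin (x + t)) := by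
      simp only [stdMap, stdInv]
      rw [show x + ψ x + ε * Real.sin x - (ψ x + ε * Real.sin x - t) = x + t by ring]
    rw [h2, hiff] at h1
    have h3 : Real.sin (x + t) - Real.sin x ≤ t := by
      have := Real.abs_sin_sub_sin_le (x + t) x
      simp only [add_sub_cancel_left, abs_of_nonneg ht] at this
      exact (abs_le.1 this).2
    nlinarith
  have hψc : Continuous ψ := by
    have : LipschitzWith (Real.toNNReal (1 + ε)) ψ := by
      refine LipschitzWith.of_dist_le_mul fun x y => ?_
      rw [Real.coe_toNNReal _ (by linarith), Real.dist_eq, Real.dist_eq]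
      wlog hxy : x ≤ y generalizing x y
      · rw [abs_sub_comm, abs_sub_comm x]; exact this y x (le_of_not_ge hxy)
      have h1 := hL y (y - x) (by linarith)
      have h2 := hR x (y - x) (by linarith)
      rw [sub_sub_cancel] at h1
      rw [add_sub_cancel] at h2
      rw [abs_sub_comm x, abs_of_nonneg (sub_nonneg.2 hxy), abs_le]
      constructor <;> nlinarith
    exact this.continuous
  refine ⟨ψ, hL, hR, fun x => ?_, fun x => ?_, fun x => ?_⟩
  · have h1 : ∀ (k : ℤ) x y, (x, y) ∈ E → (x + k * (2 * π), y) ∈ E := fun k x y hp => by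
      have hc : Continuous fun q : ℝ × ℝ => (q.1 + k * (2 * π), q.2) := by fun_prop
      exact map_mem_closure (f := fun q : ℝ × ℝ => (q.1 + k * (2 * π), q.2)) (t := D) hc hp (fun q hq => (h.mem_belowSet_add k).2 hq)
    refine le_antisymm ?_ ?_
    · rw [← hiff]; have := h1 (-1) _ _ (hmem (x + 2 * π)); simpa using this
    · rw [← hiff]; have := h1 1 _ _ (hmem x); simpa using this
  · by_contra hc
    obtain ⟨r, hr, hball⟩ := Metric.isOpen_iff.1 h.isClosed_range.isOpen_compl _ hc
    have h1 : ∃ q ∈ D, dist q (x, ψ x) < r ∧ |ψ q.1 - ψ x| < r / 2 := by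
      have ho : IsOpen (Metric.ball (x, ψ x) r ∩ {q : ℝ × ℝ | |ψ q.1 - ψ x| < r / 2}) :=
        Metric.isOpen_ball.inter (isOpen_lt (by fun_prop) continuous_const)
      obtain ⟨q, hq1, hq2⟩ := _root_.mem_closure_iff.1 (hmem x) _ ho ⟨Metric.mem_ball_self hr, by simp [hr]⟩
      exact ⟨q, hq2, hq1.1, hq1.2⟩
    obtain ⟨q, hqD, hq1, hq2⟩ := h1
    rw [Prod.dist_eq, max_lt_iff, Real.dist_eq, Real.dist_eq] at hq1
    simp only at hq1
    have hq3 := abs_lt.1 hq1.2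
    have hq4 := abs_lt.1 hq2
    have hqE : q.2 ≤ ψ q.1 := (hiff _ _).1 (subset_closure hqD)
    have h2 : ((q.1, ψ q.1 + r / 4) : ℝ × ℝ) ∈ D := by
      by_contra hc2
      obtain ⟨s, hs1, hs2⟩ := notMem_belowSet_iff.1 hc2
      simp only at hs1 hs2
      rcases le_or_gt (γ s).2 q.2 with h3 | h3
      · exact notMem_belowSet_iff.2 ⟨s, hs1, h3⟩ hqD
      · refine hball ?_ (mem_range_self s)
        rw [Metric.mem_ball, Prod.dist_eq, max_lt_iff, Real.dist_eq, Real.dist_eq, hs1]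
        refine ⟨hq1.1, abs_lt.2 ⟨?_, ?_⟩⟩ <;> simp only <;> linarith
    have := (hiff _ _).1 (subset_closure h2)
    linarith
  · have h1 : (stdMap ε (x, ψ x)).2 = ψ (stdMap ε (x, ψ x)).1 := by
      refine le_antisymm ((hiff _ _).1 (hTE _ (hmem x))) (not_lt.1 fun hlt => ?_)
      have ho : IsOpen (stdMap ε ⁻¹' {q : ℝ × ℝ | q.2 < ψ q.1}) :=
        (isOpen_lt continuous_snd (hψc.comp continuous_fst)).preimage (continuous_stdMap ε)
      obtain ⟨r, hr, hball⟩ := Metric.isOpen_iff.1 ho _ hlt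
      have h2 : ((x, ψ x + r / 2) : ℝ × ℝ) ∈ Metric.ball (x, ψ x) r := by
        rw [Metric.mem_ball, Prod.dist_eq, max_lt_iff, Real.dist_eq, Real.dist_eq]
        simp only [sub_self, abs_zero, add_sub_cancel_left, abs_of_pos (half_pos hr)]
        exact ⟨hr, by linarith⟩
      have h3 : stdMap ε (x, ψ x + r / 2) ∈ E := by
        have := hball h2
        exact (hiff _ _).2 (le_of_lt this)
      have h4 := hSE _ h3
      rw [stdInv_stdMap, hiff] at h4
      linarith
    exact Prod.ext rfl h1

end EssCurve

theorem IsInvCircle.essCurve {ε ω : ℝ} {γ : ℝ → ℝ × ℝ} (h : IsInvCircle ε ω γ) : EssCurve ε γ :=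
  ⟨h.1.continuous, h.2.2.2.1, h.2.2.2.2.1⟩

/-- The orbits on an invariant circle are described by a lift of a circle homeomorphism. -/
theorem HasInvCircle.exists_circle_map {ε ω : ℝ} (hε : 0 ≤ ε) (h : HasInvCircle ε ω) :
    ∃ g : ℝ → ℝ, StrictMono g ∧ (∀ x y, x ≤ y → g y - g x ≤ (2 + ε) * (y - x)) ∧
      (∀ x, g (x + 2 * π) = g x + 2 * π) ∧ (∀ x, g (g x) + x = 2 * g x + ε * Real.sin (g x)) ∧
      ∀ x, Tendsto (fun n : ℕ => (g^[n] x - x) / n) atTop (nhds (2 * π * ω)) := by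
  obtain ⟨γ, hγ⟩ := h
  obtain ⟨ψ, hL, hR, hper, hmem, hT⟩ := hγ.essCurve.exists_graph hε
  have hrec : ∀ x, ψ (x + ψ x + ε * Real.sin x) = ψ x + ε * Real.sin x := fun x => by
    have := congrArg Prod.snd (hT x)
    exact this.symm
  set g : ℝ → ℝ := fun x => x + ψ x + ε * Real.sin x
  have hlip : ∀ x y, x ≤ y → g y - g x ≤ (2 + ε) * (y - x) := by
    intro x y hxy
    have h1 := hL y (y - x) (by linarith)
    rw [sub_sub_cancel] at h1
    have h3 : Real.sin y - Real.sin x ≤ y - x := by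
      have := Real.abs_sin_sub_sin_le y x
      rw [abs_of_nonneg (sub_nonneg.2 hxy)] at this
      exact (abs_le.1 this).2
    simp only [g]
    nlinarith
  have hinj : Function.Injective g := fun x y hxy => by
    have h1 : stdMap ε (x, ψ x) = stdMap ε (y, ψ y) := by
      rw [hT, hT]; exact congrArg (fun u => (u, ψ u)) hxy
    have := congrArg (stdInv ε) h1
    rw [stdInv_stdMap, stdInv_stdMap] at this
    exact congrArg Prod.fst this
  have hψl : ∀ x y, x ≤ y → |ψ y - ψ x| ≤ (1 + ε) * (y - x) := fun x y hxy => by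
    have h1 := hL y (y - x) (by linarith)
    have h2 := hR x (y - x) (by linarith)
    rw [sub_sub_cancel] at h1
    rw [add_sub_cancel] at h2
    rw [abs_le]
    constructor <;> nlinarith
  have hψc : Continuous ψ := by
    have : LipschitzWith (Real.toNNReal (1 + ε)) ψ := by
      refine LipschitzWith.of_dist_le_mul fun x y => ?_
      rw [Real.coe_toNNReal _ (by linarith), Real.dist_eq, Real.dist_eq]
      rcases le_total x y with hxy | hxy
      · rw [abs_sub_comm, abs_sub_comm x, abs_of_nonneg (sub_nonneg.2 hxy)]; exact hψl _ _ hxy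
      · rw [abs_of_nonneg (sub_nonneg.2 hxy)]; exact hψl _ _ hxy
    exact this.continuous
  have hgc : Continuous g := by fun_prop
  have hgper : ∀ x, g (x + 2 * π) = g x + 2 * π := fun x => by
    simp only [g, hper, Real.sin_add_two_pi]; ring
  have hmono : StrictMono g := by
    rcases hgc.strictMono_of_inj hinj with h1 | h1
    · exact h1
    · have := h1 (show (0 : ℝ) < 0 + 2 * π by linarith [Real.pi_pos])
      rw [hgper] at this
      linarith [Real.pi_pos]
  refine ⟨g, hmono, hlip, hgper, fun x => ?_, fun x => ?_⟩
  · change g x + ψ (g x) + ε * Real.sin (g x) + x = _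
    have : ψ (g x) = g x - x := by rw [hrec]; simp only [g]; ring
    rw [this]; ring
  · have h1 : ∀ n : ℕ, (stdMap ε)^[n] (x, ψ x) = (g^[n] x, ψ (g^[n] x)) := by
      intro n
      induction n with
      | zero => rfl
      | succ n ih => rw [Function.iterate_succ_apply', ih, hT, Function.iterate_succ_apply']
    have := hγ.2.2.2.2.2 _ (hmem x)
    simpa only [h1] using this

theorem lt_apply_of_tendsto {g : ℝ → ℝ} (hg : Monotone g) {r : ℝ} (hr : 0 < r)
    (h : ∀ x, Tendsto (fun n : ℕ => (g^[n] x - x) / n) atTop (nhds r)) (x : ℝ) : x < g x := by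
  by_contra hc
  push Not at hc
  have h1 : ∀ n : ℕ, g^[n] x ≤ x := fun n => by
    induction n with
    | zero => rfl
    | succ n ih => rw [Function.iterate_succ_apply']; exact (hg ih).trans hc
  have h2 : r ≤ 0 := le_of_tendsto' (h x) fun n =>
    div_nonpos_of_nonpos_of_nonneg (by linarith [h1 n]) (Nat.cast_nonneg _)
  linarith

theorem exists_apply_sub_le {g : ℝ → ℝ} {r : ℝ} (hr : 0 < r)
    (h : ∀ x, Tendsto (fun n : ℕ => (g^[n] x - x) / n) atTop (nhds r)) : ∃ x, g x - x ≤ 2 * r := by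
  by_contra hc
  push Not at hc
  have h1 : ∀ n : ℕ, n * (2 * r) ≤ g^[n] 0 - 0 := fun n => by
    induction n with
    | zero => simp
    | succ n ih => rw [Function.iterate_succ_apply']; push_cast; linarith [hc (g^[n] 0)]
  have h2 : 2 * r ≤ r := ge_of_tendsto (h 0) (by
    filter_upwards [eventually_gt_atTop 0] with n hn
    rw [le_div_iff₀ (by exact_mod_cast hn)]
    linarith [h1 n])
  linarith

/-- There is no circle map with a fixed point satisfying the standard-map recursion. -/
theorem no_fixed_point {ε : ℝ} (hε : 0 < ε) {g : ℝ → ℝ} (hmono : Monotone g) (hc : Continuous g)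
    (hle : ∀ x, x ≤ g x) (hper : ∀ x, g (x + 2 * π) = g x + 2 * π)
    (hrec : ∀ x, g (g x) + x = 2 * g x + ε * Real.sin (g x)) (p : ℝ) : g p ≠ p := by
  intro hp
  have hper' : ∀ (k : ℤ) x, g (x + k * (2 * π)) = g x + k * (2 * π) := by
    have hq : Function.Periodic (fun x => g x - x) (2 * π) := fun x => by simp only [hper]; ring
    intro k x
    have := hq.int_mul k x
    linarith
  have hsin : ∀ x, g x = x → Real.sin x = 0 := fun x hx => by
    have := hrec x
    rw [hx, hx] at this
    have : ε * Real.sin x = 0 := by linarith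
    exact (mul_eq_zero.1 this).resolve_left hε.ne'
  have hinj : Function.Injective g := fun x y hxy => by
    have h1 := hrec x
    have h2 := hrec y
    rw [hxy] at h1
    linarith
  have hsm := hmono.strictMono_of_injective hinj
  have hpi : g π ≠ π := by
    intro hgp
    set d := g (π / 2) - π / 2
    have hd : 0 < d := by
      refine lt_of_le_of_ne (sub_nonneg.2 (hle _)) fun h0 => ?_
      have := hsin (π / 2) (sub_eq_zero.1 h0.symm)
      simp at this
    have h1 : ∀ n : ℕ, π / 2 + n * d ≤ g^[n] (π / 2) ∧ g^[n] (π / 2) ≤ π ∧ d ≤ g (g^[n] (π / 2)) - g^[n] (π / 2) := by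
      intro n
      induction n with
      | zero => simp [Real.pi_pos.le, d]
      | succ n ih =>
        rw [Function.iterate_succ_apply']
        set z := g^[n] (π / 2)
        have h3 : g z ≤ π := hgp ▸ hmono ih.2.1
        have h4 : 0 ≤ z := le_trans (by positivity) ih.1
        have h5 : 0 ≤ Real.sin (g z) := Real.sin_nonneg_of_nonneg_of_le_pi (h4.trans (hle z)) h3
        refine ⟨by push_cast; linarith [ih.1, ih.2.2], h3, ?_⟩
        have := hrec z
        nlinarith [ih.2.2]
    obtain ⟨n, hn⟩ := exists_nat_gt (π / d)
    rw [div_lt_iff₀ hd] at hn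
    have := h1 n
    linarith [Real.pi_pos]
  obtain ⟨m, hm⟩ := Real.sin_eq_zero_iff.1 (hsin p hp)
  rcases Int.even_or_odd m with ⟨k, hk⟩ | ⟨k, hk⟩
  · have hp2 : p = 0 + k * (2 * π) := by rw [← hm, hk]; push_cast; ring
    have g0 : g 0 = 0 := by
      rw [hp2, hper'] at hp; linarith
    have g2 : g (2 * π) = 2 * π := by have := hper 0; rw [zero_add, g0, zero_add] at this; exact this
    refine no_saddle_connection hε hc g0 g2 (fun x hx => ⟨lt_of_le_of_ne (hle x) fun h => ?_, g2 ▸ hsm hx.2⟩) hrec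
    obtain ⟨m, hm⟩ := Real.sin_eq_zero_iff.1 (hsin x h.symm)
    have h1 : (0 : ℝ) < m := by
      by_contra hcon; push Not at hcon
      have := hx.1; nlinarith [Real.pi_pos]
    have h2 : (m : ℝ) < 2 := by
      by_contra hcon; push Not at hcon
      have := hx.2; nlinarith [Real.pi_pos]
    have h3 : m = 1 := by
      have h1 : 0 < m := by exact_mod_cast h1
      have h2 : m < 2 := by exact_mod_cast h2
      omega
    rw [h3, Int.cast_one, one_mul] at hm
    exact hpi (by rw [hm]; exact h.symm)
  · have hp2 : p = π + k * (2 * π) := by rw [← hm, hk]; push_cast; ring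
    refine hpi ?_
    rw [hp2, hper'] at hp; linarith

/-- Positive rotation numbers of invariant circles are bounded away from zero. -/
theorem exists_pos_le_of_hasInvCircle {ε : ℝ} (hε : 0 < ε) :
    ∃ δ, 0 < δ ∧ ∀ ω, 0 < ω → HasInvCircle ε ω → δ ≤ ω := by
  by_contra hc
  push Not at hc
  choose ω hω hcirc hlt using fun n : ℕ => hc (1 / ((n : ℝ) + 1)) (by positivity)
  choose G hmono hlip hper hrec hrot using fun n => (hcirc n).exists_circle_map hε.le
  have hpos : ∀ n, 0 < 2 * π * ω n := fun n => by have := hω n; positivity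
  have hle : ∀ n x, x < G n x := fun n => lt_apply_of_tendsto (hmono n).monotone (hpos n) (hrot n)
  have hx : ∀ n, ∃ x ∈ Ico 0 (2 * π), G n x - x ≤ 2 * (2 * π * ω n) := fun n => by
    obtain ⟨x, hx⟩ := exists_apply_sub_le (hpos n) (hrot n)
    have hq : Function.Periodic (fun x => G n x - x) (2 * π) := fun x => by simp only [hper]; ring
    obtain ⟨y, hy, e⟩ := hq.exists_mem_Ico₀ two_pi_pos x
    exact ⟨y, hy, by rw [← e]; exact hx⟩
  choose z hz hz2 using hx
  have hω1 : ∀ n, ω n ≤ 1 := fun n => (hlt n).le.trans (by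
    rw [div_le_one (by positivity)]; linarith [(Nat.cast_nonneg n : (0 : ℝ) ≤ n)])
  let U : Ultrafilter ℕ := Filter.hyperfilter ℕ
  have hU : (U : Filter ℕ) ≤ atTop := (Nat.hyperfilter_le_atTop)
  have hcpt : ∀ (u : ℕ → ℝ) (a b : ℝ), (∀ n, u n ∈ Icc a b) → ∃ l ∈ Icc a b, Tendsto u U (nhds l) := by
    intro u a b hu
    obtain ⟨l, hl, h⟩ := (isCompact_Icc (a := a) (b := b)).ultrafilter_le_nhds (U.map u)
      (by rw [Ultrafilter.coe_map, le_principal_iff]; exact Filter.mem_map.2 (Filter.univ_mem' hu))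
    exact ⟨l, hl, h⟩
  have hbd : ∀ x, ∃ b, ∀ n, G n x ∈ Icc x b := by
    intro x
    obtain ⟨k, hk⟩ := exists_nat_gt (x / (2 * π))
    rw [div_lt_iff₀ Real.two_pi_pos] at hk
    refine ⟨2 * π + k * (2 * π) + 2 * (2 * π), fun n => ⟨(hle n x).le, ?_⟩⟩
    have hq : Function.Periodic (fun x => G n x - x) (2 * π) := fun x => by simp only [hper]; ring
    have h1 := hq.nat_mul k (z n)
    have h2 : G n x ≤ G n (z n + k * (2 * π)) := (hmono n).monotone (by linarith [(hz n).1])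
    have h3 := (hz n).2
    have h4 := hz2 n
    have : 2 * π * ω n ≤ 2 * π * 1 := mul_le_mul_of_nonneg_left (hω1 n) Real.two_pi_pos.le
    linarith
  choose b hb using hbd
  choose g hg1 hg using fun x => hcpt (fun n => G n x) x (b x) (hb x)
  have hlip' : ∀ n x y, |G n x - G n y| ≤ (2 + ε) * |x - y| := by
    intro n x y
    wlog hxy : y ≤ x generalizing x y
    · rw [abs_sub_comm, abs_sub_comm x]; exact this y x (le_of_not_ge hxy)
    rw [abs_of_nonneg (sub_nonneg.2 ((hmono n).monotone hxy)), abs_of_nonneg (sub_nonneg.2 hxy)]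
    exact hlip n _ _ hxy
  have hcomp : ∀ (u : ℕ → ℝ) l, Tendsto u U (nhds l) → Tendsto (fun n => G n (u n)) U (nhds (g l)) := by
    intro u l hu
    have h1 : Tendsto (fun n => G n (u n) - G n l) U (nhds 0) := by
      refine squeeze_zero_norm (a := fun n => (2 + ε) * |u n - l|) (fun n => hlip' n _ _) ?_
      have : Tendsto (fun n => (2 + ε) * |u n - l|) U (nhds ((2 + ε) * |l - l|)) :=
        ((hu.sub_const l).abs).const_mul _
      simpa using this
    have := h1.add (hg l)
    simpa using this
  have hgl : ∀ x y, |g x - g y| ≤ (2 + ε) * |x - y| := fun x y =>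
    le_of_tendsto' (((hg x).sub (hg y)).abs) fun n => hlip' n x y
  have hgc : Continuous g := by
    have : LipschitzWith (Real.toNNReal (2 + ε)) g := by
      refine LipschitzWith.of_dist_le_mul fun x y => ?_
      rw [Real.coe_toNNReal _ (by linarith), Real.dist_eq, Real.dist_eq]
      exact hgl x y
    exact this.continuous
  obtain ⟨p, -, hp⟩ := hcpt z 0 (2 * π) fun n => ⟨(hz n).1, (hz n).2.le⟩
  refine no_fixed_point hε (g := g) (fun x y hxy => ?_) hgc (fun x => (hg1 x).1) (fun x => ?_) (fun x => ?_) p ?_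
  · exact le_of_tendsto_of_tendsto' (hg x) (hg y) fun n => (hmono n).monotone hxy
  · refine tendsto_nhds_unique (hg (x + 2 * π)) ?_
    simp only [hper]
    exact (hg x).add_const _
  · refine tendsto_nhds_unique ((hcomp _ _ (hg x)).add_const x) ?_
    simp only [hrec]
    exact ((hg x).const_mul 2).add (((Real.continuous_sin.tendsto _).comp (hg x)).const_mul ε)
  · refine le_antisymm ?_ (hg1 p).1
    have h1 := (hcomp _ _ hp).sub hp
    have hω0 : Tendsto ω U (nhds 0) :=
      (squeeze_zero (fun n => (hω n).le) (fun n => (hlt n).le) tendsto_one_div_add_atTop_nhds_zero_nat).mono_left hU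
    have h2 : Tendsto (fun n => 2 * (2 * π * ω n)) U (nhds 0) := by
      simpa using (hω0.const_mul (2 * π)).const_mul 2
    have := le_of_tendsto_of_tendsto' h1 h2 hz2
    linarith

/-- The horizontal strip of half-width `ρ` around the real axis. -/
def strip (ρ : ℝ) : Set ℂ := {z | |z.im| < ρ}

theorem mem_strip {ρ : ℝ} {z : ℂ} : z ∈ strip ρ ↔ |z.im| < ρ := Iff.rfl

theorem isOpen_strip (ρ : ℝ) : IsOpen (strip ρ) :=
  isOpen_lt (continuous_abs.comp Complex.continuous_im) continuous_const

theorem convex_strip (ρ : ℝ) : Convex ℝ (strip ρ) := by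
  have : strip ρ = Complex.imLm ⁻¹' (Ioo (-ρ) ρ) := by
    ext z; simp [mem_strip, abs_lt]
  rw [this]
  exact (convex_Ioo _ _).linear_preimage _

theorem strip_mono {ρ σ : ℝ} (h : ρ ≤ σ) : strip ρ ⊆ strip σ := fun _ hz => lt_of_lt_of_le hz h

theorem add_ofReal_mem_strip {ρ : ℝ} {z : ℂ} (a : ℝ) : z + a ∈ strip ρ ↔ z ∈ strip ρ := by
  simp [mem_strip]

theorem sub_ofReal_mem_strip {ρ : ℝ} {z : ℂ} (a : ℝ) : z - a ∈ strip ρ ↔ z ∈ strip ρ := by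
  simp [mem_strip]

theorem ofReal_mem_strip {ρ : ℝ} (hρ : 0 < ρ) (a : ℝ) : (a : ℂ) ∈ strip ρ := by
  simpa [mem_strip] using hρ

theorem conj_mem_strip {ρ : ℝ} {z : ℂ} : (starRingEnd ℂ) z ∈ strip ρ ↔ z ∈ strip ρ := by
  simp [mem_strip]

theorem closedBall_subset_strip {ρ δ : ℝ} {z : ℂ} (hz : z ∈ strip (ρ - δ)) :
    Metric.closedBall z δ ⊆ strip ρ := fun w hw => by
  have h1 := Complex.abs_im_le_norm (w - z)
  rw [Metric.mem_closedBall, Complex.dist_eq] at hw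
  rw [mem_strip] at *
  rw [Complex.sub_im] at h1
  have := abs_sub_abs_le_abs_sub w.im z.im
  linarith

theorem norm_deriv_le_of_strip {ρ δ M : ℝ} (hδ : 0 < δ) {f : ℂ → ℂ}
    (hf : DifferentiableOn ℂ f (strip ρ)) (hM : ∀ z ∈ strip ρ, ‖f z‖ ≤ M) {z : ℂ}
    (hz : z ∈ strip (ρ - δ)) : ‖deriv f z‖ ≤ M / δ := by
  refine Complex.norm_deriv_le_of_forall_mem_sphere_norm_le hδ ?_ fun w hw =>
    hM w (closedBall_subset_strip hz (Metric.sphere_subset_closedBall hw))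
  refine DifferentiableOn.diffContOnCl (hf.mono ?_)
  rw [closure_ball _ hδ.ne']
  exact closedBall_subset_strip hz

theorem deriv_conj_of_strip {ρ : ℝ} {f : ℂ → ℂ}
    (hf : ∀ z ∈ strip ρ, f ((starRingEnd ℂ) z) = (starRingEnd ℂ) (f z)) {z : ℂ} (hz : z ∈ strip ρ) :
    deriv f ((starRingEnd ℂ) z) = (starRingEnd ℂ) (deriv f z) := by
  have h1 : (starRingEnd ℂ ∘ f ∘ starRingEnd ℂ) =ᶠ[nhds ((starRingEnd ℂ) z)] f := by
    filter_upwards [(isOpen_strip ρ).mem_nhds (conj_mem_strip.2 hz)] with w hw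
    simp only [Function.comp]
    rw [hf w hw, Complex.conj_conj]
  have h2 := h1.deriv_eq
  rw [deriv_conj_conj] at h2
  simpa using h2.symm

/-- Holomorphic functions on a strip that are `2π`-periodic and real on the real axis. -/
structure StripFun (ρ : ℝ) (f : ℂ → ℂ) : Prop where
  diff : DifferentiableOn ℂ f (strip ρ)
  per : ∀ z ∈ strip ρ, f (z + (2 * π : ℝ)) = f z
  real : ∀ z ∈ strip ρ, f ((starRingEnd ℂ) z) = (starRingEnd ℂ) (f z)

namespace StripFun
variable {ρ σ : ℝ} {f g : ℂ → ℂ}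

theorem mono (h : StripFun ρ f) (hσ : σ ≤ ρ) : StripFun σ f :=
  ⟨h.diff.mono (strip_mono hσ), fun z hz => h.per z (strip_mono hσ hz), fun z hz => h.real z (strip_mono hσ hz)⟩

theorem const (c : ℝ) : StripFun ρ (fun _ => (c : ℂ)) :=
  ⟨differentiableOn_const _, fun _ _ => rfl, fun _ _ => (Complex.conj_ofReal c).symm⟩

theorem add (hf : StripFun ρ f) (hg : StripFun ρ g) : StripFun ρ (fun z => f z + g z) :=
  ⟨hf.diff.fun_add hg.diff, fun z hz => by rw [hf.per z hz, hg.per z hz],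
    fun z hz => by rw [hf.real z hz, hg.real z hz, map_add]⟩

theorem sub (hf : StripFun ρ f) (hg : StripFun ρ g) : StripFun ρ (fun z => f z - g z) :=
  ⟨hf.diff.fun_sub hg.diff, fun z hz => by rw [hf.per z hz, hg.per z hz],
    fun z hz => by rw [hf.real z hz, hg.real z hz, map_sub]⟩

theorem mul (hf : StripFun ρ f) (hg : StripFun ρ g) : StripFun ρ (fun z => f z * g z) :=
  ⟨hf.diff.fun_mul hg.diff, fun z hz => by rw [hf.per z hz, hg.per z hz],
    fun z hz => by rw [hf.real z hz, hg.real z hz, map_mul]⟩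

theorem neg (hf : StripFun ρ f) : StripFun ρ (fun z => -f z) :=
  ⟨hf.diff.fun_neg, fun z hz => by rw [hf.per z hz],
    fun z hz => by rw [hf.real z hz, map_neg]⟩

theorem div (hf : StripFun ρ f) (hg : StripFun ρ g) (h0 : ∀ z ∈ strip ρ, g z ≠ 0) :
    StripFun ρ (fun z => f z / g z) :=
  ⟨hf.diff.fun_div hg.diff h0, fun z hz => by rw [hf.per z hz, hg.per z hz],
    fun z hz => by rw [hf.real z hz, hg.real z hz, map_div₀]⟩

theorem shift (hf : StripFun ρ f) (a : ℝ) : StripFun ρ (fun z => f (z + a)) := by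
  refine ⟨hf.diff.comp (by fun_prop) fun z hz => (add_ofReal_mem_strip a).2 hz, fun z hz => ?_, fun z hz => ?_⟩
  · rw [add_right_comm, hf.per _ ((add_ofReal_mem_strip a).2 hz)]
  · rw [← hf.real _ ((add_ofReal_mem_strip a).2 hz), map_add, Complex.conj_ofReal]

theorem deriv (hf : StripFun ρ f) : StripFun ρ (deriv f) := by
  refine ⟨hf.diff.deriv (isOpen_strip ρ), fun z hz => ?_, fun z hz => deriv_conj_of_strip hf.real hz⟩
  have : (fun w => f (w + (2 * π : ℝ))) =ᶠ[nhds z] f := by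
    filter_upwards [(isOpen_strip ρ).mem_nhds hz] with w hw using hf.per w hw
  rw [← deriv_comp_add_const]
  exact this.deriv_eq

theorem im_eq_zero (hf : StripFun ρ f) (hρ : 0 < ρ) (x : ℝ) : (f x).im = 0 := by
  have := hf.real x (ofReal_mem_strip hρ x)
  rw [Complex.conj_ofReal] at this
  exact Complex.conj_eq_iff_im.1 this.symm

theorem ofReal_re (hf : StripFun ρ f) (hρ : 0 < ρ) (x : ℝ) : ((f x).re : ℂ) = f x :=
  Complex.ext rfl (by simp [hf.im_eq_zero hρ x])

theorem continuous_real (hf : StripFun ρ f) (hρ : 0 < ρ) : Continuous fun x : ℝ => f x :=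
  hf.diff.continuousOn.comp_continuous Complex.continuous_ofReal (ofReal_mem_strip hρ)

end StripFun

/-- Two holomorphic functions on a strip that agree on the real axis agree. -/
theorem eqOn_strip_of_real {ρ : ℝ} (hρ : 0 < ρ) {f g : ℂ → ℂ} (hf : DifferentiableOn ℂ f (strip ρ))
    (hg : DifferentiableOn ℂ g (strip ρ)) (h : ∀ x : ℝ, f x = g x) : EqOn f g (strip ρ) := by
  refine (hf.analyticOnNhd (isOpen_strip ρ)).eqOn_of_preconnected_of_frequently_eq
    (hg.analyticOnNhd (isOpen_strip ρ)) (convex_strip ρ).isPreconnected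
    (z₀ := 0) (by simpa [mem_strip] using hρ) ?_
  have hmap : Tendsto (fun x : ℝ => (x : ℂ)) (nhdsWithin 0 {0}ᶜ) (nhdsWithin 0 {0}ᶜ) := by
    refine tendsto_nhdsWithin_iff.2 ⟨?_, ?_⟩
    · exact (Complex.continuous_ofReal.tendsto' 0 0 Complex.ofReal_zero).mono_left nhdsWithin_le_nhds
    · filter_upwards [self_mem_nhdsWithin] with x hx
      simpa using hx
  exact hmap.frequently (Filter.Frequently.of_forall fun x => h x)

/-- Periodic holomorphic functions have the same integral over all horizontal segments. -/
theorem StripFun.integral_shift {ρ s : ℝ} {F : ℂ → ℂ} (hd : DifferentiableOn ℂ F (strip ρ))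
    (hp : ∀ z ∈ strip ρ, F (z + (2 * π : ℝ)) = F z) (hs : |s| < ρ) :
    ∫ x in (0 : ℝ)..2 * π, F x = ∫ x in (0 : ℝ)..2 * π, F (x + s * Complex.I) := by
  have hy : ∀ y ∈ uIcc 0 s, |y| < ρ := fun y hy => by
    have := abs_sub_left_of_mem_uIcc hy
    simp only [sub_zero] at this
    exact this.trans_lt hs
  have h := Complex.integral_boundary_rect_eq_zero_of_differentiableOn F 0 ⟨2 * π, s⟩ (hd.mono (by
    rintro z ⟨-, hz⟩
    exact hy _ hz))
  simp only [Complex.zero_re, Complex.zero_im, Complex.ofReal_zero, zero_mul, add_zero, zero_add] at h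
  have h2 : ∫ y in (0 : ℝ)..s, F (((2 * π : ℝ) : ℂ) + y * Complex.I) = ∫ y in (0 : ℝ)..s, F (y * Complex.I) := by
    refine intervalIntegral.integral_congr fun y hyy => ?_
    rw [add_comm, hp _ (by simpa [mem_strip] using hy y hyy)]
  rw [h2] at h
  linear_combination h

/-- The Fourier coefficients of a function on the real line. -/
def fcoef (f : ℂ → ℂ) (k : ℤ) : ℂ := (1 / (2 * π) : ℝ) • ∫ x in (0 : ℝ)..2 * π, f x * Complex.exp (-(k * x * Complex.I))

theorem StripFun.norm_fcoef_le {ρ M : ℝ} {f : ℂ → ℂ} (hρ : 0 < ρ) (hf : StripFun ρ f)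
    (hM : ∀ z ∈ strip ρ, ‖f z‖ ≤ M) (k : ℤ) : ‖fcoef f k‖ ≤ M * Real.exp (-(|(k : ℝ)| * ρ)) := by
  have key : ∀ r, 0 ≤ r → r < ρ → ‖fcoef f k‖ ≤ M * Real.exp (-(|(k : ℝ)| * r)) := by
    intro r hr0 hr
    obtain ⟨s, hs1, hs2⟩ : ∃ s : ℝ, |s| = r ∧ k * s = -(|(k : ℝ)| * r) := by
      rcases le_total 0 (k : ℝ) with h | h
      · exact ⟨-r, by rw [abs_neg, abs_of_nonneg hr0], by rw [abs_of_nonneg h]; ring⟩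
      · exact ⟨r, by rw [abs_of_nonneg hr0], by rw [abs_of_nonpos h]; ring⟩
    have h1 := StripFun.integral_shift (F := fun z => f z * Complex.exp (-(k * z * Complex.I))) (ρ := ρ) (s := s)
      (hf.diff.fun_mul (by fun_prop)) (fun z hz => by
        rw [hf.per z hz]
        congr 1
        rw [Complex.exp_eq_exp_iff_exists_int]
        exact ⟨-k, by push_cast; ring⟩) (hs1 ▸ hr)
    rw [fcoef, h1, norm_smul]
    have h2 : ‖∫ x in (0 : ℝ)..2 * π, f (x + s * Complex.I) * Complex.exp (-(k * (x + s * Complex.I) * Complex.I))‖ ≤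
        (M * Real.exp (-(|(k : ℝ)| * r))) * |2 * π - 0| := by
      refine intervalIntegral.norm_integral_le_of_norm_le_const fun x _ => ?_
      rw [norm_mul, Complex.norm_exp]
      have h3 : (-((k : ℂ) * (x + s * Complex.I) * Complex.I)).re = k * s := by simp
      rw [h3, hs2]
      gcongr
      exact hM _ (by simpa [mem_strip, hs1] using hr)
    rw [sub_zero, abs_of_pos two_pi_pos] at h2
    rw [Real.norm_of_nonneg (by positivity)]
    calc _ ≤ 1 / (2 * π) * ((M * Real.exp (-(|(k : ℝ)| * r))) * (2 * π)) := by gcongr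
      _ = _ := by field_simp
  have hc : Tendsto (fun r => M * Real.exp (-(|(k : ℝ)| * r))) (nhdsWithin ρ (Iio ρ))
      (nhds (M * Real.exp (-(|(k : ℝ)| * ρ)))) := by
    have : Continuous (fun r => M * Real.exp (-(|(k : ℝ)| * r))) := by fun_prop
    exact (this.tendsto ρ).mono_left nhdsWithin_le_nhds
  refine ge_of_tendsto hc ?_
  filter_upwards [Ioo_mem_nhdsLT hρ] with r hr using key r hr.1.le hr.2

theorem summable_abs_mul_exp {δ : ℝ} (hδ : 0 < δ) :
    ∃ s ≤ 2 / δ ^ 2, HasSum (fun k : ℤ => |(k : ℝ)| * Real.exp (-(|(k : ℝ)| * δ))) s := by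
  set q := Real.exp (-δ)
  have hq1 : q < 1 := by rw [Real.exp_lt_one_iff]; linarith
  have hq0 : 0 < q := Real.exp_pos _
  have h := hasSum_coe_mul_geometric_of_norm_lt_one (𝕜 := ℝ) (r := q) (by rwa [Real.norm_of_nonneg hq0.le])
  have e : ∀ n : ℕ, (n : ℝ) * q ^ n = |((n : ℤ) : ℝ)| * Real.exp (-(|((n : ℤ) : ℝ)| * δ)) := fun n => by
    rw [Int.cast_natCast, abs_of_nonneg (Nat.cast_nonneg n), ← Real.exp_nat_mul]; ring_nf
  have e2 : ∀ n : ℕ, (n : ℝ) * q ^ n = |((-(n : ℤ) : ℤ) : ℝ)| * Real.exp (-(|((-(n : ℤ) : ℤ) : ℝ)| * δ)) := fun n => by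
    rw [e, Int.cast_neg, abs_neg]
  refine ⟨_, ?_, HasSum.of_nat_of_neg (by simpa only [e] using h) (by simpa only [e2] using h)⟩
  have h1 : q / (1 - q) ^ 2 ≤ 1 / δ ^ 2 := by
    rw [div_le_div_iff₀ (by have := sub_pos.2 hq1; positivity) (by positivity), one_mul]
    have h2 : δ / 2 ≤ Real.sinh (δ / 2) := Real.self_le_sinh_iff.2 (by positivity)
    rw [Real.sinh_eq] at h2
    set p := Real.exp (-(δ / 2))
    have hp0 : 0 < p := Real.exp_pos _
    have hqp : q = p ^ 2 := by rw [← Real.exp_nat_mul]; push_cast; ring_nf; rfl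
    have hpp : Real.exp (δ / 2) * p = 1 := by rw [← Real.exp_add]; simp
    have h3 : δ * p ≤ 1 - q := by rw [hqp]; nlinarith
    rw [hqp]
    calc p ^ 2 * δ ^ 2 = (δ * p) ^ 2 := by ring
      _ ≤ _ := by rw [← hqp]; exact pow_le_pow_left₀ (by positivity) h3 2
  simp only [Int.cast_zero, abs_zero, zero_mul, sub_zero]
  linarith [show 2 / δ ^ 2 = 1 / δ ^ 2 + 1 / δ ^ 2 by ring]

theorem StripFun.hasSum_fcoef {ρ M : ℝ} {f : ℂ → ℂ} (hρ : 0 < ρ) (hf : StripFun ρ f)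
    (hM : ∀ z ∈ strip ρ, ‖f z‖ ≤ M) (x : ℝ) :
    HasSum (fun k : ℤ => fcoef f k * Complex.exp (k * x * Complex.I)) (f x) := by
  have hp : Function.Periodic (fun x : ℝ => f x) (2 * π) := fun x => by
    simp only
    rw [Complex.ofReal_add, hf.per _ (ofReal_mem_strip hρ x)]
  let F : C(AddCircle (2 * π), ℂ) := ⟨hp.lift, continuous_coinduced_dom.mpr (hf.continuous_real hρ)⟩
  have hF : ∀ x : ℝ, F (x : AddCircle (2 * π)) = f x := fun x => Function.Periodic.lift_coe hp x
  have hco : ∀ k, fourierCoeff F k = fcoef f k := fun k => by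
    rw [fourierCoeff_eq_intervalIntegral F k 0, fcoef, zero_add]
    congr 1
    refine intervalIntegral.integral_congr fun x _ => ?_
    simp only [hF, fourier_coe_apply, smul_eq_mul]
    rw [mul_comm]
    congr 2
    have : (π : ℂ) ≠ 0 := by exact_mod_cast Real.pi_ne_zero
    push_cast
    field_simp
  have hM0 : 0 ≤ M := (norm_nonneg _).trans (hM 0 (by simpa [mem_strip] using hρ))
  have hs : Summable (fourierCoeff F) := by
    obtain ⟨s, -, hs⟩ := summable_abs_mul_exp hρ
    refine Summable.of_norm_bounded_eventually (g := fun k : ℤ => M * (|(k : ℝ)| * Real.exp (-(|(k : ℝ)| * ρ)))) (hs.summable.mul_left M) ?_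
    have : ∀ᶠ k : ℤ in cofinite, k ≠ 0 := Filter.eventually_cofinite_ne 0
    filter_upwards [this] with k hk
    rw [hco]
    refine (hf.norm_fcoef_le hρ hM k).trans ?_
    have h1 : (1 : ℝ) ≤ |(k : ℝ)| := by exact_mod_cast Int.one_le_abs hk
    have h2 := Real.exp_pos (-(|(k : ℝ)| * ρ))
    gcongr
    nlinarith
  have := has_pointwise_sum_fourier_series_of_summable hs (x : AddCircle (2 * π))
  rw [hF] at this
  convert this using 2 with k
  rw [hco, smul_eq_mul, fourier_coe_apply]
  congr 2
  have : (π : ℂ) ≠ 0 := by exact_mod_cast Real.pi_ne_zero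
  push_cast
  field_simp

theorem four_mul_le_norm_exp_sub_one (t : ℝ) : ∃ m : ℤ, 4 * |t - m| ≤ ‖Complex.exp (2 * π * t * Complex.I) - 1‖ := by
  refine ⟨round t, ?_⟩
  set s := t - round t
  have h1 : Complex.exp (2 * π * t * Complex.I) = Complex.exp (Complex.I * ((2 * π * s : ℝ) : ℂ)) := by
    rw [Complex.exp_eq_exp_iff_exists_int]
    exact ⟨round t, by simp only [s]; push_cast; ring⟩
  rw [h1, Complex.norm_exp_I_mul_ofReal_sub_one, norm_mul, Real.norm_two, Real.norm_eq_abs,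
    show 2 * π * s / 2 = π * s by ring]
  have h2 : |π * s| ≤ π / 2 := by
    rw [abs_mul, abs_of_pos Real.pi_pos]
    have := abs_sub_round t
    nlinarith [Real.pi_pos]
  have h3 := Real.mul_abs_le_abs_sin h2
  rw [abs_mul, abs_of_pos Real.pi_pos] at h3
  have h4 : 2 / π * (π * |s|) = 2 * |s| := by field_simp
  linarith

theorem StripFun.symmetrize {ρ : ℝ} {g : ℂ → ℂ} (hd : DifferentiableOn ℂ g (strip ρ))
    (hp : ∀ z ∈ strip ρ, g (z + (2 * π : ℝ)) = g z) :
    StripFun ρ (fun z => (g z + (starRingEnd ℂ) (g ((starRingEnd ℂ) z))) / 2) := by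
  refine ⟨?_, fun z hz => ?_, fun z hz => ?_⟩
  · refine (hd.fun_add fun z hz => ?_).div_const 2
    have h1 := (hd.differentiableAt ((isOpen_strip ρ).mem_nhds (conj_mem_strip.2 hz))).conj_conj
    rw [Complex.conj_conj] at h1
    exact h1.differentiableWithinAt
  · rw [hp z hz, map_add, Complex.conj_ofReal, hp _ (conj_mem_strip.2 hz)]
  · rw [Complex.conj_conj, map_div₀, map_add, Complex.conj_conj, add_comm, Complex.conj_ofNat]

/-- The cohomological equation over a Diophantine rotation. -/
theorem StripFun.exists_cohomology {ρ δ M Λ ω : ℝ} {f : ℂ → ℂ} (hδ : 0 < δ) (hδρ : δ < ρ) (hΛ : 0 < Λ)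
    (hf : StripFun ρ f) (hM : ∀ z ∈ strip ρ, ‖f z‖ ≤ M) (h0 : ∫ x in (0 : ℝ)..2 * π, f x = 0)
    (hω : ∀ k : ℤ, k ≠ 0 → ∀ m : ℤ, 1 / (Λ * |(k : ℝ)|) ≤ |k * ω - m|) :
    ∃ g, StripFun (ρ - δ) g ∧ (∀ z ∈ strip (ρ - δ), g (z + (2 * π * ω : ℝ)) - g z = f z) ∧
      ∀ z ∈ strip (ρ - δ), ‖g z‖ ≤ M * Λ / (2 * δ ^ 2) := by
  have hρ : 0 < ρ := hδ.trans hδρ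
  have hM0 : 0 ≤ M := (norm_nonneg _).trans (hM 0 (by simpa [mem_strip] using hρ))
  set c : ℤ → ℂ := fun k => fcoef f k / (Complex.exp (2 * π * ((k * ω : ℝ) : ℂ) * Complex.I) - 1)
  have ha0 : fcoef f 0 = 0 := by simp [fcoef, h0]
  have hden : ∀ k : ℤ, k ≠ 0 → 4 / (Λ * |(k : ℝ)|) ≤ ‖Complex.exp (2 * π * ((k * ω : ℝ) : ℂ) * Complex.I) - 1‖ := fun k hk => by
    obtain ⟨m, hm⟩ := four_mul_le_norm_exp_sub_one (k * ω)
    have := hω k hk m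
    have e : 4 / (Λ * |(k : ℝ)|) = 4 * (1 / (Λ * |(k : ℝ)|)) := by ring
    rw [e]; linarith
  have hc : ∀ k, ‖c k‖ ≤ M * Λ / 4 * (|(k : ℝ)| * Real.exp (-(|(k : ℝ)| * ρ))) := by
    intro k
    rcases eq_or_ne k 0 with rfl | hk
    · simp [c, ha0]
    · have hk' : 0 < |(k : ℝ)| := abs_pos.2 (by exact_mod_cast hk)
      rw [norm_div]
      calc _ ≤ (M * Real.exp (-(|(k : ℝ)| * ρ))) / (4 / (Λ * |(k : ℝ)|)) :=
            div_le_div₀ (by positivity) (hf.norm_fcoef_le hρ hM k) (by positivity) (hden k hk)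
        _ = _ := by field_simp
  obtain ⟨s, hs2, hs⟩ := summable_abs_mul_exp hδ
  have hterm : ∀ k : ℤ, ∀ z ∈ strip (ρ - δ), ‖c k * Complex.exp (k * z * Complex.I)‖ ≤
      M * Λ / 4 * (|(k : ℝ)| * Real.exp (-(|(k : ℝ)| * δ))) := by
    intro k z hz
    rw [norm_mul, Complex.norm_exp]
    have h1 : ((k : ℂ) * z * Complex.I).re ≤ |(k : ℝ)| * (ρ - δ) := by
      have : ((k : ℂ) * z * Complex.I).re = -(k * z.im) := by simp
      rw [this]
      refine (neg_le_abs _).trans ?_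
      rw [abs_mul]
      exact mul_le_mul_of_nonneg_left (le_of_lt hz) (abs_nonneg _)
    calc _ ≤ (M * Λ / 4 * (|(k : ℝ)| * Real.exp (-(|(k : ℝ)| * ρ)))) * Real.exp (|(k : ℝ)| * (ρ - δ)) := by
          gcongr
          exact hc k
      _ = M * Λ / 4 * (|(k : ℝ)| * (Real.exp (-(|(k : ℝ)| * ρ)) * Real.exp (|(k : ℝ)| * (ρ - δ)))) := by ring
      _ = _ := by rw [← Real.exp_add]; ring_nf
  have hsum := hs.summable.mul_left (M * Λ / 4)
  set G : ℂ → ℂ := fun z => ∑' k : ℤ, c k * Complex.exp (k * z * Complex.I)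
  have hGd : DifferentiableOn ℂ G (strip (ρ - δ)) :=
    Complex.differentiableOn_tsum_of_summable_norm hsum (fun k => by fun_prop) (isOpen_strip _) hterm
  have hGs : ∀ z ∈ strip (ρ - δ), HasSum (fun k : ℤ => c k * Complex.exp (k * z * Complex.I)) (G z) := fun z hz =>
    (Summable.of_norm_bounded hsum (fun k => hterm k z hz)).hasSum
  have hGp : ∀ z ∈ strip (ρ - δ), G (z + (2 * π : ℝ)) = G z := fun z _ => by
    refine tsum_congr fun k => ?_
    congr 1
    rw [Complex.exp_eq_exp_iff_exists_int]
    exact ⟨k, by push_cast; ring⟩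
  have hGb : ∀ z ∈ strip (ρ - δ), ‖G z‖ ≤ M * Λ / (2 * δ ^ 2) := fun z hz => by
    refine (tsum_of_norm_bounded (hs.mul_left (M * Λ / 4)) fun k => hterm k z hz).trans ?_
    calc M * Λ / 4 * s ≤ M * Λ / 4 * (2 / δ ^ 2) := by gcongr
      _ = _ := by field_simp; ring
  have hGe : ∀ z ∈ strip (ρ - δ), G (z + (2 * π * ω : ℝ)) - G z = f z := by
    refine eqOn_strip_of_real (f := fun z => G (z + (2 * π * ω : ℝ)) - G z) (by linarith) ?_
      (hf.diff.mono (strip_mono (by linarith))) fun x => ?_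
    · exact (hGd.comp (by fun_prop) fun z hz => (add_ofReal_mem_strip _).2 hz).fun_sub hGd
    · have hx : (x : ℂ) ∈ strip (ρ - δ) := ofReal_mem_strip (by linarith) x
      refine ((hGs _ ((add_ofReal_mem_strip (2 * π * ω)).2 hx)).sub (hGs _ hx)).unique ?_
      have hE : (fun k : ℤ => c k * Complex.exp (k * (x + ((2 * π * ω : ℝ) : ℂ)) * Complex.I) -
          c k * Complex.exp (k * x * Complex.I)) = fun k : ℤ => fcoef f k * Complex.exp (k * x * Complex.I) := ?_
      · rw [hE]
        exact hf.hasSum_fcoef hρ hM x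
      funext k
      rcases eq_or_ne k 0 with rfl | hk
      · simp [ha0]
      · have hne : Complex.exp (2 * π * ((k * ω : ℝ) : ℂ) * Complex.I) - 1 ≠ 0 := by
          rw [← norm_pos_iff]
          have hk' : 0 < |(k : ℝ)| := abs_pos.2 (by exact_mod_cast hk)
          exact lt_of_lt_of_le (by positivity) (hden k hk)
        have e : Complex.exp (k * (x + ((2 * π * ω : ℝ) : ℂ)) * Complex.I) =
            Complex.exp (2 * π * ((k * ω : ℝ) : ℂ) * Complex.I) * Complex.exp (k * x * Complex.I) := by
          rw [← Complex.exp_add]; push_cast; ring_nf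
        rw [e]
        simp only [c]
        field_simp
  refine ⟨_, StripFun.symmetrize hGd hGp, fun z hz => ?_, fun z hz => ?_⟩
  · have h1 := hGe z hz
    have h2 := hGe _ (conj_mem_strip.2 hz)
    rw [hf.real z (strip_mono (by linarith) hz)] at h2
    have h3 := congrArg (starRingEnd ℂ) h2
    rw [Complex.conj_conj, map_sub] at h3
    rw [map_add (starRingEnd ℂ) z, Complex.conj_ofReal]
    linear_combination h1 / 2 + h3 / 2
  · have h1 := hGb z hz
    have h2 := hGb _ (conj_mem_strip.2 hz)
    rw [norm_div, Complex.norm_ofNat]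
    have h3 := norm_add_le (G z) ((starRingEnd ℂ) (G ((starRingEnd ℂ) z)))
    rw [RCLike.norm_conj] at h3
    linarith

theorem Complex.norm_sin_le_exp (z : ℂ) : ‖Complex.sin z‖ ≤ Real.exp |z.im| := by
  rw [Complex.sin, norm_div, norm_mul, Complex.norm_I, mul_one, Complex.norm_ofNat]
  have h := norm_sub_le (Complex.exp (-z * Complex.I)) (Complex.exp (z * Complex.I))
  simp only [Complex.norm_exp] at h
  have h1 : (-z * Complex.I).re ≤ |z.im| := by simpa using le_abs_self z.im
  have h2 : (z * Complex.I).re ≤ |z.im| := by simpa using neg_le_abs z.im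
  have := Real.exp_le_exp.2 h1
  have := Real.exp_le_exp.2 h2
  linarith

theorem Complex.norm_cos_le_exp (z : ℂ) : ‖Complex.cos z‖ ≤ Real.exp |z.im| := by
  rw [Complex.cos, norm_div, Complex.norm_ofNat]
  have h := norm_add_le (Complex.exp (z * Complex.I)) (Complex.exp (-z * Complex.I))
  simp only [Complex.norm_exp] at h
  have h1 : (-z * Complex.I).re ≤ |z.im| := by simpa using le_abs_self z.im
  have h2 : (z * Complex.I).re ≤ |z.im| := by simpa using neg_le_abs z.im
  have := Real.exp_le_exp.2 h1
  have := Real.exp_le_exp.2 h2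
  linarith

theorem Complex.norm_cos_sub_one_le {v : ℂ} (hv : ‖v‖ ≤ 1) : ‖Complex.cos v - 1‖ ≤ ‖v‖ ^ 2 := by
  have h1 := Complex.norm_exp_sub_one_sub_id_le (x := v * Complex.I) (by simpa using hv)
  have h2 := Complex.norm_exp_sub_one_sub_id_le (x := -v * Complex.I) (by simpa using hv)
  have e : Complex.cos v - 1 = ((Complex.exp (v * Complex.I) - 1 - v * Complex.I) +
      (Complex.exp (-v * Complex.I) - 1 - -v * Complex.I)) / 2 := by rw [Complex.cos]; ring
  rw [e, norm_div, Complex.norm_ofNat]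
  have h3 := norm_add_le (Complex.exp (v * Complex.I) - 1 - v * Complex.I) (Complex.exp (-v * Complex.I) - 1 - -v * Complex.I)
  rw [norm_mul, Complex.norm_I, mul_one] at h1 h2
  rw [norm_neg] at h2
  linarith

theorem Complex.norm_sin_sub_self_le {v : ℂ} (hv : ‖v‖ ≤ 1) : ‖Complex.sin v - v‖ ≤ ‖v‖ ^ 2 := by
  have h1 := Complex.norm_exp_sub_one_sub_id_le (x := v * Complex.I) (by simpa using hv)
  have h2 := Complex.norm_exp_sub_one_sub_id_le (x := -v * Complex.I) (by simpa using hv)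
  have e : Complex.sin v - v = ((Complex.exp (-v * Complex.I) - 1 - -v * Complex.I) -
      (Complex.exp (v * Complex.I) - 1 - v * Complex.I)) * Complex.I / 2 := by
    rw [Complex.sin]
    linear_combination (-v) * Complex.I_mul_I
  rw [e, norm_div, Complex.norm_ofNat, norm_mul, Complex.norm_I, mul_one]
  have h3 := norm_sub_le (Complex.exp (-v * Complex.I) - 1 - -v * Complex.I) (Complex.exp (v * Complex.I) - 1 - v * Complex.I)
  rw [norm_mul, Complex.norm_I, mul_one] at h1 h2
  rw [norm_neg] at h2
  linarith

/-- Second order Taylor remainder of the complex sine. -/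
theorem Complex.norm_sin_add_sub_le {x v : ℂ} (hv : ‖v‖ ≤ 1) :
    ‖Complex.sin (x + v) - Complex.sin x - Complex.cos x * v‖ ≤ 2 * Real.exp |x.im| * ‖v‖ ^ 2 := by
  have e : Complex.sin (x + v) - Complex.sin x - Complex.cos x * v =
      Complex.sin x * (Complex.cos v - 1) + Complex.cos x * (Complex.sin v - v) := by
    rw [Complex.sin_add]; ring
  rw [e]
  refine (norm_add_le _ _).trans ?_
  rw [norm_mul, norm_mul]
  have h1 := mul_le_mul (Complex.norm_sin_le_exp x) (Complex.norm_cos_sub_one_le hv) (norm_nonneg _) (Real.exp_pos _).le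
  have h2 := mul_le_mul (Complex.norm_cos_le_exp x) (Complex.norm_sin_sub_self_le hv) (norm_nonneg _) (Real.exp_pos _).le
  linarith

/-- The defect of the parametrisation `z ↦ z + u z` in the second order difference equation of
the standard map. -/
def kamErr (ε α : ℝ) (u : ℂ → ℂ) (z : ℂ) : ℂ :=
  u (z + α) - 2 * u z + u (z - α) - ε * Complex.sin (z + u z)

namespace StripFun
variable {ρ : ℝ} {u f : ℂ → ℂ}

theorem shift_neg (hf : StripFun ρ f) (a : ℝ) : StripFun ρ (fun z => f (z - a)) := by
  have := hf.shift (-a)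
  simpa only [Complex.ofReal_neg, ← sub_eq_add_neg] using this

theorem sin_add (hu : StripFun ρ u) : StripFun ρ (fun z => Complex.sin (z + u z)) := by
  refine ⟨(differentiableOn_id.fun_add hu.diff).csin, fun z hz => ?_, fun z hz => ?_⟩
  · rw [hu.per z hz, add_right_comm]
    push_cast
    exact Complex.sin_add_two_pi _
  · rw [hu.real z hz, ← map_add, Complex.sin_conj]

theorem cos_add (hu : StripFun ρ u) : StripFun ρ (fun z => Complex.cos (z + u z)) := by
  refine ⟨(differentiableOn_id.fun_add hu.diff).ccos, fun z hz => ?_, fun z hz => ?_⟩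
  · rw [hu.per z hz, add_right_comm]
    push_cast
    exact Complex.cos_add_two_pi _
  · rw [hu.real z hz, ← map_add, Complex.cos_conj]

theorem kamErr (hu : StripFun ρ u) (ε α : ℝ) : StripFun ρ (kamErr ε α u) :=
  (((hu.shift α).sub ((StripFun.const 2).mul hu)).add (hu.shift_neg α)).sub
    ((StripFun.const ε).mul hu.sin_add)
  
theorem hasDerivAt (hf : StripFun ρ f) {z : ℂ} (hz : z ∈ strip ρ) : HasDerivAt f (_root_.deriv f z) z :=
  (hf.diff.differentiableAt ((isOpen_strip ρ).mem_nhds hz)).hasDerivAt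

theorem integral_shift_real (hρ : 0 < ρ) (hf : StripFun ρ f) (a : ℝ) :
    ∫ x in (0 : ℝ)..2 * π, f (x + a) = ∫ x in (0 : ℝ)..2 * π, f x := by
  have hp : Function.Periodic (fun x : ℝ => f x) (2 * π) := fun x => by
    have := hf.per x (ofReal_mem_strip hρ x)
    simpa using this
  have h1 := intervalIntegral.integral_comp_add_right (a := 0) (b := 2 * π) (fun x : ℝ => f x) a
  simp only [Complex.ofReal_add] at h1
  rw [h1, zero_add, add_comm (2 * π), hp.intervalIntegral_add_eq a 0, zero_add]

theorem integral_deriv_eq_zero (hρ : 0 < ρ) (hf : StripFun ρ f) :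
    ∫ x in (0 : ℝ)..2 * π, _root_.deriv f x = 0 := by
  have h := intervalIntegral.integral_eq_sub_of_hasDerivAt (a := 0) (b := 2 * π) (f := fun x : ℝ => f x)
    (f' := fun x : ℝ => _root_.deriv f x) (fun x _ => (hf.hasDerivAt (ofReal_mem_strip hρ x)).comp_ofReal)
    ((hf.deriv.continuous_real hρ).intervalIntegrable _ _)
  rw [h]
  have := hf.per 0 (by simpa using ofReal_mem_strip hρ 0)
  simpa [sub_eq_zero] using this

/-- The defect is orthogonal to the derivative of the parametrisation. -/
theorem integral_kamErr (hρ : 0 < ρ) (hu : StripFun ρ u) (ε α : ℝ) :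
    ∫ x in (0 : ℝ)..2 * π, (1 + _root_.deriv u x) * _root_.kamErr ε α u x = 0 := by
  have hD : StripFun ρ (fun z => u z * u (z + α) - u z * u z + ε * Complex.cos (z + u z)) :=
    ((hu.mul (hu.shift α)).sub (hu.mul hu)).add ((StripFun.const ε).mul hu.cos_add)
  have hk : StripFun ρ (fun z => (u z - u (z - α)) - u (z - α) * _root_.deriv u z) :=
    (hu.sub (hu.shift_neg α)).sub ((hu.shift_neg α).mul hu.deriv)
  have h1 := hD.integral_deriv_eq_zero hρ
  have h2 := hk.integral_shift_real hρ α
  have i1 := (hD.deriv.continuous_real hρ).intervalIntegrable (μ := MeasureTheory.volume) 0 (2 * π)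
  have i2 := ((hk.shift α).continuous_real hρ).intervalIntegrable (μ := MeasureTheory.volume) 0 (2 * π)
  have i3 := (hk.continuous_real hρ).intervalIntegrable (μ := MeasureTheory.volume) 0 (2 * π)
  rw [← sub_eq_zero, ← intervalIntegral.integral_sub i2 i3] at h2
  have h3 := intervalIntegral.integral_add i1 (i2.sub i3)
  rw [h1, h2, add_zero] at h3
  rw [← h3]
  refine intervalIntegral.integral_congr fun x _ => ?_
  have hx := ofReal_mem_strip hρ x
  have d1 := hu.hasDerivAt hx
  have d2 := (hu.shift α).hasDerivAt hx
  have d3 := ((hasDerivAt_id' (x : ℂ)).fun_add d1).ccos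
  have dD := ((d1.fun_mul d2).fun_sub (d1.fun_mul d1)).fun_add (d3.const_mul (ε : ℂ))
  rw [HasDerivAt.deriv dD, deriv_comp_add_const, add_sub_cancel_right]
  simp only [_root_.kamErr]
  ring

end StripFun

/-- One Newton step. -/
theorem kam_step {ε ω ρ δ P e : ℝ} {u : ℂ → ℂ} (hε0 : 0 ≤ ε) (hε1 : ε ≤ 1) (hP : 100 ≤ P)
    (hδ : 1 / P ≤ δ) (hδρ : 3 * δ < ρ) (hu : StripFun ρ u)
    (hlow : ∀ z ∈ strip ρ, 1 / P ≤ 1 + (deriv u z).re) (hup : ∀ z ∈ strip ρ, ‖1 + deriv u z‖ ≤ P)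
    (him : ∀ z ∈ strip ρ, |(z + u z).im| ≤ 2)
    (hω : ∀ k : ℤ, k ≠ 0 → ∀ m : ℤ, 1 / (P * |(k : ℝ)|) ≤ |k * ω - m|)
    (he : ∀ z ∈ strip ρ, ‖kamErr ε (2 * π * ω) u z‖ ≤ e) (heP : P ^ 15 * e ≤ 1) :
    ∃ v, StripFun (ρ - 3 * δ) v ∧ (∀ z ∈ strip (ρ - 3 * δ), ‖v z‖ ≤ P ^ 15 * e) ∧
      (∀ z ∈ strip (ρ - 3 * δ), ‖deriv v z‖ ≤ P ^ 16 * e) ∧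
      ∀ z ∈ strip (ρ - 3 * δ), ‖kamErr ε (2 * π * ω) (fun z => u z + v z) z‖ ≤ P ^ 31 * e ^ 2 := by
  have hP0 : 0 < P := by linarith
  have hP1 : 1 ≤ P := by linarith
  have hδ0 : 0 < δ := lt_of_lt_of_le (by positivity) hδ
  have hPδ : 1 / δ ≤ P := by rw [div_le_iff₀ hδ0]; rwa [div_le_iff₀ hP0, mul_comm] at hδ
  have hρ : 0 < ρ := by linarith
  set α := 2 * π * ω with hα
  have hE := hu.kamErr ε α
  have he0 : 0 ≤ e := (norm_nonneg _).trans (he 0 (by simpa using ofReal_mem_strip hρ 0))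
  have hX : StripFun ρ (fun z => 1 + deriv u z) := by
    simpa using (StripFun.const 1).add hu.deriv
  have hXlow : ∀ z ∈ strip ρ, 1 / P ≤ ‖1 + deriv u z‖ := fun z hz =>
    (hlow z hz).trans ((by simp : 1 + (deriv u z).re = (1 + deriv u z).re).trans_le (Complex.re_le_norm _))
  -- the first cohomological equation
  obtain ⟨g, hg, hgeq, hgb⟩ := StripFun.exists_cohomology (M := P * e) hδ0 (by linarith : δ < ρ) hP0 (hX.mul hE).neg
    (fun z hz => by
      rw [norm_neg, norm_mul]
      exact mul_le_mul (hup z hz) (he z hz) (norm_nonneg _) hP0.le)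
    (by rw [intervalIntegral.integral_neg, hu.integral_kamErr hρ, neg_zero]) hω
  have hcoh : ∀ M, 0 ≤ M → M * P / (2 * δ ^ 2) ≤ M * P ^ 3 / 2 := fun M hM => by
    have : M * P / (2 * δ ^ 2) = M * P / 2 * (1 / δ) ^ 2 := by field_simp
    rw [this]
    calc M * P / 2 * (1 / δ) ^ 2 ≤ M * P / 2 * P ^ 2 := by gcongr
      _ = _ := by ring
  have hψb : ∀ z ∈ strip (ρ - δ), ‖g z‖ ≤ P ^ 4 * e := fun z hz => by
    refine ((hgb z hz).trans (hcoh _ (by positivity))).trans ?_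
    have : 0 ≤ P ^ 4 * e := by positivity
    nlinarith
  have hψ : StripFun (ρ - δ) (fun z => g (z + α)) := hg.shift α
  have hρ1 : 0 < ρ - δ := by linarith
  have sub1 : strip (ρ - δ) ⊆ strip ρ := strip_mono (by linarith)
  -- normalisation
  have hQ : StripFun (ρ - δ) (fun z => (1 + deriv u z) * (1 + deriv u (z + α))) :=
    (hX.mul (hX.shift α)).mono (by linarith)
  have hQlow : ∀ z ∈ strip (ρ - δ), 1 / P ^ 2 ≤ ‖(1 + deriv u z) * (1 + deriv u (z + α))‖ := fun z hz => by
    rw [norm_mul]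
    have h1 := hXlow z (sub1 hz)
    have h2 := hXlow _ ((add_ofReal_mem_strip α).2 (sub1 hz))
    calc 1 / P ^ 2 = 1 / P * (1 / P) := by field_simp
      _ ≤ _ := mul_le_mul h1 h2 (by positivity) (norm_nonneg _)
  have hQ0 : ∀ z ∈ strip (ρ - δ), (1 + deriv u z) * (1 + deriv u (z + α)) ≠ 0 := fun z hz => by
    rw [← norm_pos_iff]
    exact lt_of_lt_of_le (by positivity) (hQlow z hz)
  have hψQ := hψ.div hQ hQ0
  have h1Q : StripFun (ρ - δ) (fun z => (1 : ℂ) / ((1 + deriv u z) * (1 + deriv u (z + α)))) := by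
    simpa using (StripFun.const 1).div hQ hQ0
  obtain ⟨a, ha⟩ : ∃ a : ℝ, ∫ x in (0 : ℝ)..2 * π, (1 : ℂ) / ((1 + deriv u x) * (1 + deriv u (x + α))) = (a : ℂ) ∧
      2 * π / P ^ 2 ≤ a := by
    refine ⟨∫ x in (0 : ℝ)..2 * π, ((1 : ℂ) / ((1 + deriv u x) * (1 + deriv u (x + α)))).re, ?_, ?_⟩
    · rw [← intervalIntegral.integral_ofReal]
      refine intervalIntegral.integral_congr fun x _ => ?_
      exact (h1Q.ofReal_re hρ1 x).symm
    · have := intervalIntegral.integral_mono_on (a := 0) (b := 2 * π) (μ := MeasureTheory.volume) (f := fun _ => 1 / P ^ 2) (by positivity)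
        intervalIntegrable_const ((Complex.continuous_re.comp (h1Q.continuous_real hρ1)).intervalIntegrable _ _) fun x _ => ?_
      · refine le_trans (le_of_eq ?_) this
        simp; ring
      · have r1 := hX.ofReal_re hρ x
        have r2 := (hX.shift α).ofReal_re hρ x
        have l1 := hlow x (ofReal_mem_strip hρ x)
        have l2 := hlow _ ((add_ofReal_mem_strip α).2 (ofReal_mem_strip hρ x))
        have u1 := (Complex.re_le_norm _).trans (hup x (ofReal_mem_strip hρ x))
        have u2 := (Complex.re_le_norm _).trans (hup _ ((add_ofReal_mem_strip α).2 (ofReal_mem_strip hρ x)))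
        simp only [Function.comp]
        rw [← r1, ← r2]
        rw [← Complex.ofReal_mul, ← Complex.ofReal_one, ← Complex.ofReal_div, Complex.ofReal_re]
        simp only [Complex.add_re, Complex.one_re, Complex.ofReal_one] at *
        have p1 : 0 < 1 / P := by positivity
        have q1 := lt_of_lt_of_le p1 l1
        have q2 := lt_of_lt_of_le p1 l2
        gcongr
        nlinarith
  obtain ⟨b, hb⟩ : ∃ b : ℝ, ∫ x in (0 : ℝ)..2 * π, g (x + α) / ((1 + deriv u x) * (1 + deriv u (x + α))) = (b : ℂ) := by
    refine ⟨∫ x in (0 : ℝ)..2 * π, (g (x + α) / ((1 + deriv u x) * (1 + deriv u (x + α)))).re, ?_⟩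
    rw [← intervalIntegral.integral_ofReal]
    refine intervalIntegral.integral_congr fun x _ => ?_
    exact (hψQ.ofReal_re hρ1 x).symm
  have hψQb : ∀ z ∈ strip (ρ - δ), ‖g (z + α) / ((1 + deriv u z) * (1 + deriv u (z + α)))‖ ≤ P ^ 6 * e := fun z hz => by
    rw [norm_div]
    have h1 := hψb _ ((add_ofReal_mem_strip α).2 hz)
    have h2 := hQlow z hz
    calc _ ≤ P ^ 4 * e / (1 / P ^ 2) := by gcongr
      _ = _ := by field_simp
  have hb1 : |b| ≤ 2 * π * (P ^ 6 * e) := by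
    have := intervalIntegral.norm_integral_le_of_norm_le_const (a := 0) (b := 2 * π) (C := P ^ 6 * e)
      (f := fun x : ℝ => g (x + α) / ((1 + deriv u x) * (1 + deriv u (x + α))))
      fun x _ => hψQb x (ofReal_mem_strip hρ1 x)
    rw [hb, Complex.norm_real, Real.norm_eq_abs, sub_zero, abs_of_pos Real.two_pi_pos] at this
    linarith
  have ha0 : 0 < a := lt_of_lt_of_le (by positivity) ha.2
  have hc : |b / a| ≤ P ^ 8 * e := by
    rw [abs_div, abs_of_pos ha0]
    calc |b| / a ≤ 2 * π * (P ^ 6 * e) / (2 * π / P ^ 2) := by gcongr; exact ha.2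
      _ = _ := by field_simp
  -- the second cohomological equation
  have hF : StripFun (ρ - δ) (fun z => (g (z + α) - (b / a : ℝ)) / ((1 + deriv u z) * (1 + deriv u (z + α)))) :=
    (hψ.sub (StripFun.const _)).div hQ hQ0
  obtain ⟨w, hw, hweq, hwb⟩ := StripFun.exists_cohomology (M := P ^ 11 * e) hδ0 (by linarith : δ < ρ - δ) hP0 hF
    (fun z hz => by
      rw [norm_div]
      have h1 := hψb _ ((add_ofReal_mem_strip α).2 hz)
      have h2 := hQlow z hz
      have h3 : ‖g (z + α) - (b / a : ℝ)‖ ≤ P ^ 4 * e + P ^ 8 * e := by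
        refine (norm_sub_le _ _).trans (add_le_add h1 ?_)
        rwa [Complex.norm_real, Real.norm_eq_abs]
      calc _ ≤ (P ^ 4 * e + P ^ 8 * e) / (1 / P ^ 2) := by gcongr
        _ = P ^ 6 * e * (1 + P ^ 4) := by field_simp
        _ ≤ P ^ 6 * e * P ^ 5 := by
          gcongr
          nlinarith [one_le_pow₀ hP1 (n := 4)]
        _ = _ := by ring)
    (by
      have e1 : (fun x : ℝ => (g (x + α) - (b / a : ℝ)) / ((1 + deriv u x) * (1 + deriv u (x + α)))) =
          fun x : ℝ => g (x + α) / ((1 + deriv u x) * (1 + deriv u (x + α))) -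
            (b / a : ℝ) * (1 / ((1 + deriv u x) * (1 + deriv u (x + α)))) := by
        funext x; ring
      rw [e1, intervalIntegral.integral_sub ((hψQ.continuous_real hρ1).intervalIntegrable _ _)
        (((h1Q.continuous_real hρ1).const_mul _).intervalIntegrable _ _),
        intervalIntegral.integral_const_mul, hb, ha.1]
      have : (a : ℂ) ≠ 0 := by exact_mod_cast ha0.ne'
      push_cast
      field_simp
      simp) hω
  have hρ2 : 0 < ρ - δ - δ := by linarith
  have sub2 : strip (ρ - δ - δ) ⊆ strip (ρ - δ) := strip_mono (by linarith)
  have sub3 : strip (ρ - 3 * δ) ⊆ strip (ρ - δ - δ) := strip_mono (by linarith)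
  have hwb' : ∀ z ∈ strip (ρ - δ - δ), ‖w z‖ ≤ P ^ 14 * e := fun z hz => by
    refine ((hwb z hz).trans (hcoh _ (by positivity))).trans ?_
    have : 0 ≤ P ^ 14 * e := by positivity
    nlinarith
  have hv : StripFun (ρ - δ - δ) (fun z => (1 + deriv u z) * w z) := (hX.mono (by linarith)).mul hw
  have hvb : ∀ z ∈ strip (ρ - δ - δ), ‖(1 + deriv u z) * w z‖ ≤ P ^ 15 * e := fun z hz => by
    rw [norm_mul]
    calc _ ≤ P * (P ^ 14 * e) := mul_le_mul (hup z (sub1 (sub2 hz))) (hwb' z hz) (norm_nonneg _) hP0.le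
      _ = _ := by ring
  refine ⟨_, hv.mono (by linarith), fun z hz => hvb z (sub3 hz), fun z hz => ?_, fun z hz => ?_⟩
  · have := norm_deriv_le_of_strip (ρ := ρ - δ - δ) hδ0 hv.diff hvb (z := z) (by convert hz using 2; ring)
    refine this.trans ?_
    calc P ^ 15 * e / δ = P ^ 15 * e * (1 / δ) := by ring
      _ ≤ P ^ 15 * e * P := by gcongr
      _ = _ := by ring
  · have hz1 := sub1 (sub2 (sub3 hz))
    have hz2 := sub2 (sub3 hz)
    have hE' : ‖deriv (kamErr ε α u) z‖ ≤ P * e := by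
      refine (norm_deriv_le_of_strip hδ0 hE.diff he hz2).trans ?_
      calc e / δ = 1 / δ * e := by ring
        _ ≤ _ := by gcongr
    have hdE : deriv (kamErr ε α u) z = deriv u (z + α) - 2 * deriv u z + deriv u (z - α) -
        ε * (Complex.cos (z + u z) * (1 + deriv u z)) := by
      have d1 := hu.hasDerivAt hz1
      have d2 := (hu.shift α).hasDerivAt hz1
      have d3 := (hu.shift_neg α).hasDerivAt hz1
      have d4 := ((hasDerivAt_id' z).fun_add d1).csin
      have := (((d2.fun_sub (d1.const_mul 2)).fun_add d3).fun_sub (d4.const_mul (ε : ℂ))).deriv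
      rw [deriv_comp_add_const, deriv_comp_sub_const] at this
      exact this
    have hzm : z - α ∈ strip (ρ - δ) := (sub_ofReal_mem_strip α).2 hz2
    have hA := hweq z (sub3 hz)
    have hB := hweq _ ((sub_ofReal_mem_strip α).2 (sub3 hz))
    have hC := hgeq z hz2
    rw [← hα] at hA hB hC
    rw [eq_div_iff (hQ0 z hz2)] at hA
    rw [eq_div_iff (hQ0 _ hzm), sub_add_cancel] at hB
    have hx0 : 1 + deriv u z ≠ 0 := left_ne_zero_of_mul (hQ0 z hz2)
    have key : kamErr ε α (fun z => u z + (1 + deriv u z) * w z) z = w z * deriv (kamErr ε α u) z -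
        ε * (Complex.sin ((z + u z) + (1 + deriv u z) * w z) - Complex.sin (z + u z) -
          Complex.cos (z + u z) * ((1 + deriv u z) * w z)) := by
      refine mul_left_cancel₀ hx0 ?_
      rw [hdE]
      simp only [kamErr] at hC ⊢
      rw [← add_assoc z]
      linear_combination hA - hB + hC
    have hv1 := hvb z (sub3 hz)
    have hR := Complex.norm_sin_add_sub_le (x := z + u z) (hv1.trans heP)
    have hexp : Real.exp |(z + u z).im| ≤ 8 := by
      refine (Real.exp_le_exp.2 (him z hz1)).trans ?_
      have h1 := Real.exp_one_lt_d9
      have h2 : Real.exp 2 = Real.exp 1 * Real.exp 1 := by rw [← Real.exp_add]; norm_num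
      have := Real.exp_pos 1
      rw [h2]
      nlinarith
    rw [key]
    refine (norm_sub_le _ _).trans ?_
    rw [norm_mul, norm_mul, Complex.norm_real, Real.norm_eq_abs, abs_of_nonneg hε0]
    have b1 := mul_le_mul (hwb' z (sub3 hz)) hE' (norm_nonneg _) (by positivity)
    have b2 := mul_le_mul hε1 (hR.trans (mul_le_mul (mul_le_mul_of_nonneg_left hexp (by norm_num))
      (pow_le_pow_left₀ (norm_nonneg _) hv1 2) (by positivity) (by norm_num))) (norm_nonneg _) zero_le_one
    refine (add_le_add b1 b2).trans ?_
    have h15 : P ^ 15 * e ^ 2 ≤ P ^ 30 * e ^ 2 := by gcongr; norm_num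
    have h30 : 0 ≤ P ^ 30 * e ^ 2 := by positivity
    nlinarith

/-- A `C¹` conjugacy to the rotation by `2πω` yields an invariant circle. -/
theorem hasInvCircle_of_conjugacy {ε ω : ℝ} {F : ℝ → ℝ} (hF : ContDiff ℝ 1 F) (hpos : ∀ s, 0 < deriv F s)
    (hper : ∀ s, F (s + 2 * π) = F s + 2 * π)
    (heq : ∀ s, F (s + 2 * π * ω) - 2 * F s + F (s - 2 * π * ω) = ε * Real.sin (F s)) :
    HasInvCircle ε ω := by
  have hmono : StrictMono F := strictMono_of_deriv_pos hpos
  have hd : Differentiable ℝ F := hF.differentiable (by norm_num)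
  set γ : ℝ → ℝ × ℝ := fun s => (F s, F s - F (s - 2 * π * ω)) with hγ
  have hγd : ContDiff ℝ 1 γ := hF.prodMk (hF.sub (hF.comp (contDiff_id.sub contDiff_const)))
  have hT : ∀ s, stdMap ε (γ s) = γ (s + 2 * π * ω) := fun s => by
    have := heq s
    simp only [stdMap, hγ, add_sub_cancel_right]
    ext <;> simp <;> linarith
  have hTn : ∀ s, ∀ n : ℕ, (stdMap ε)^[n] (γ s) = γ (s + n * (2 * π * ω)) := fun s n => by
    induction n with
    | zero => simp
    | succ n ih => rw [Function.iterate_succ_apply', ih, hT]; push_cast; ring_nf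
  refine ⟨γ, hγd, fun s h0 => ?_, fun s t hst => ⟨0, ?_⟩, fun s => ?_, ?_, ?_⟩
  · have h1 : HasDerivAt γ (deriv γ s) s := (hγd.differentiable (by norm_num) s).hasDerivAt
    have h2 := ((hasFDerivAt_fst (𝕜 := ℝ) (p := γ s)).comp_hasDerivAt s h1).deriv
    rw [h0] at h2
    exact (hpos s).ne' (by simpa [Function.comp_def, hγ] using h2)
  · have := hmono.injective (congrArg Prod.fst hst)
    simpa using this.symm
  · simp only [hγ]
    rw [hper, show s + 2 * π - 2 * π * ω = s - 2 * π * ω + 2 * π by ring, hper]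
    ext <;> simp
  · ext p
    constructor
    · rintro ⟨_, ⟨s, rfl⟩, rfl⟩
      exact ⟨_, (hT s).symm⟩
    · rintro ⟨s, rfl⟩
      exact ⟨_, ⟨s - 2 * π * ω, rfl⟩, by rw [hT]; simp⟩
  · rintro _ ⟨s, rfl⟩
    have hp : Function.Periodic (fun s => F s - s) (2 * π) := fun s => by
      simp only [hper]; ring
    have hc : Continuous fun s => F s - s := hd.continuous.sub continuous_id
    obtain ⟨C, hC⟩ := (isCompact_Icc (a := (0 : ℝ)) (b := 2 * π)).exists_bound_of_continuousOn hc.continuousOn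
    have hb : ∀ t, |F t - t| ≤ C := fun t => by
      obtain ⟨y, hy, hty⟩ := hp.exists_mem_Ico₀ Real.two_pi_pos t
      rw [hty]
      exact hC y ⟨hy.1, hy.2.le⟩
    have h1 : Tendsto (fun n : ℕ => 2 * C / (n : ℝ)) atTop (nhds 0) := tendsto_const_div_atTop_nhds_zero_nat _
    rw [tendsto_iff_norm_sub_tendsto_zero]
    refine squeeze_zero' (Eventually.of_forall fun n => norm_nonneg _) ?_ h1
    filter_upwards [eventually_gt_atTop 0] with n hn
    have hn' : (0 : ℝ) < n := by exact_mod_cast hn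
    rw [hTn]
    simp only [hγ]
    have e : (F (s + n * (2 * π * ω)) - F s) / n - 2 * π * ω =
        ((F (s + n * (2 * π * ω)) - (s + n * (2 * π * ω))) - (F s - s)) / n := by
      field_simp; ring
    rw [e, Real.norm_eq_abs, abs_div, abs_of_pos hn']
    gcongr
    refine (abs_sub _ _).trans ?_
    linarith [hb s, hb (s + n * (2 * π * ω))]

/-- The state of the Newton iteration after `n` steps. -/
structure KamInv (ε ω Λ : ℝ) (n : ℕ) (u : ℂ → ℂ) : Prop where
  fn : StripFun (1 / Λ * (5 / 8 + 3 / 8 * (1 / 2) ^ n)) u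
  low : ∀ z ∈ strip (1 / Λ * (5 / 8 + 3 / 8 * (1 / 2) ^ n)),
    1 / Λ - 1 / (2 * Λ) * (1 - (1 / 2) ^ n) ≤ 1 + (deriv u z).re
  up : ∀ z ∈ strip (1 / Λ * (5 / 8 + 3 / 8 * (1 / 2) ^ n)),
    ‖1 + deriv u z‖ ≤ Λ + 1 / (2 * Λ) * (1 - (1 / 2) ^ n)
  im : ∀ z ∈ strip (1 / Λ * (5 / 8 + 3 / 8 * (1 / 2) ^ n)),
    |(z + u z).im| ≤ 1 + 1 / (2 * Λ) * (1 - (1 / 2) ^ n)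
  err : ∀ z ∈ strip (1 / Λ * (5 / 8 + 3 / 8 * (1 / 2) ^ n)),
    ‖kamErr ε (2 * π * ω) u z‖ ≤ 1 / (32 * Λ) ^ 31 * ((1 / 2) ^ 31) ^ n

theorem KamInv.exists_next {ε ω Λ : ℝ} {n : ℕ} {u : ℂ → ℂ} (hε0 : 0 ≤ ε) (hε1 : ε ≤ 1) (hΛ : 100 ≤ Λ)
    (hω : ∀ k : ℤ, k ≠ 0 → ∀ m : ℤ, 1 / (Λ * |(k : ℝ)|) ≤ |k * ω - m|) (h : KamInv ε ω Λ n u) :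
    ∃ u', KamInv ε ω Λ (n + 1) u' ∧
      (∀ z ∈ strip (1 / Λ * (5 / 8)), ‖u' z - u z‖ ≤ 1 / (4 * Λ) * (1 / 2) ^ n) ∧
      ∀ z ∈ strip (1 / Λ * (5 / 8)), ‖deriv u' z - deriv u z‖ ≤ 1 / (4 * Λ) * (1 / 2) ^ n := by
  have hΛ0 : 0 < Λ := by linarith
  set d : ℝ := (1 / 2) ^ n with hd
  have hd0 : 0 < d := by positivity
  have hd1 : d ≤ 1 := pow_le_one₀ (by norm_num) (by norm_num)
  set P : ℝ := 16 * Λ / d with hPdef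
  have hP16 : 16 * Λ ≤ P := by rw [le_div_iff₀ hd0]; nlinarith
  set e : ℝ := 1 / (32 * Λ) ^ 31 * d ^ 31 with he
  have hee : 1 / (32 * Λ) ^ 31 * ((1 / 2) ^ 31) ^ n = e := by
    rw [he, hd, ← pow_mul, ← pow_mul, mul_comm 31 n]
  have hPe : ∀ k, k ≤ 16 → P ^ k * e ≤ 1 / (4 * Λ) * d := by
    intro k hk
    have hP1 : 1 ≤ P := by linarith
    calc P ^ k * e ≤ P ^ 16 * e := by gcongr
      _ = 1 / (2 ^ 31 * (16 * Λ) ^ 15) * d ^ 15 := by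
        rw [hPdef, he]; field_simp; norm_num
      _ ≤ 1 / (4 * Λ) * d := by
        have h1 : (1 : ℝ) ≤ 16 * Λ := by linarith
        have h2 : 16 * Λ ≤ (16 * Λ) ^ 15 := le_self_pow₀ h1 (by norm_num)
        exact mul_le_mul (one_div_le_one_div_of_le (by positivity) (by nlinarith))
          (pow_le_of_le_one hd0.le hd1 (by norm_num)) (by positivity) (by positivity)
  have hsm : 1 / (4 * Λ) * d ≤ 1 := by
    have : 1 / (4 * Λ) ≤ 1 := by rw [div_le_one (by positivity)]; linarith
    nlinarith
  have hP31 : P ^ 31 * e ^ 2 = 1 / (32 * Λ) ^ 31 * ((1 / 2) ^ 31) ^ (n + 1) := by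
    rw [pow_succ ((1 / 2 : ℝ) ^ 31) n, ← mul_assoc, hee, hPdef, he]
    field_simp
    norm_num
  set δ : ℝ := 1 / Λ * (d / 16) with hδ
  have hL : 0 < 1 / Λ := by positivity
  have hL2 : 1 / (2 * Λ) = 1 / Λ / 2 := by field_simp
  have hL4 : 1 / (4 * Λ) = 1 / Λ / 4 := by field_simp
  have hL1 : 1 / Λ ≤ 1 := by rw [div_le_one hΛ0]; linarith
  have hPinv : 1 / P = 1 / Λ * (d / 16) := by rw [hPdef]; field_simp
  have hr : 1 / Λ * (5 / 8 + 3 / 8 * d) - 3 * δ = 1 / Λ * (5 / 8 + 3 / 8 * (1 / 2) ^ (n + 1)) := by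
    rw [pow_succ, ← hd, hδ]; ring
  have hdd : (1 / 2 : ℝ) ^ (n + 1) = d / 2 := by rw [pow_succ, ← hd]; ring
  obtain ⟨v, hv, hvb, hvd, hve⟩ := kam_step (ε := ε) (ω := ω) (ρ := 1 / Λ * (5 / 8 + 3 / 8 * d)) (δ := δ) (P := P) (e := e)
    hε0 hε1 (by linarith) hPinv.le (by rw [hδ]; nlinarith) h.fn
    (fun z hz => by
      refine le_trans ?_ (h.low z hz)
      rw [hPinv, ← hd, hL2]
      nlinarith)
    (fun z hz => by
      refine (h.up z hz).trans ?_
      rw [← hd, hL2]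
      nlinarith)
    (fun z hz => by
      refine (h.im z hz).trans ?_
      rw [← hd, hL2]
      nlinarith)
    (fun k hk m => by
      refine le_trans ?_ (hω k hk m)
      have : 0 < |(k : ℝ)| := abs_pos.2 (by exact_mod_cast hk)
      gcongr
      linarith)
    (fun z hz => (h.err z hz).trans hee.le) ((hPe 15 (by norm_num)).trans hsm)
  rw [hr] at hv hvb hvd hve
  have hsub : strip (1 / Λ * (5 / 8 + 3 / 8 * (1 / 2) ^ (n + 1))) ⊆ strip (1 / Λ * (5 / 8 + 3 / 8 * (1 / 2) ^ n)) := by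
    refine strip_mono ?_
    rw [hdd, ← hd]
    nlinarith
  have hsub' : strip (1 / Λ * (5 / 8)) ⊆ strip (1 / Λ * (5 / 8 + 3 / 8 * (1 / 2) ^ (n + 1))) := by
    refine strip_mono ?_
    rw [hdd]
    nlinarith
  have hu := h.fn.mono (σ := 1 / Λ * (5 / 8 + 3 / 8 * (1 / 2) ^ (n + 1))) (by rw [hdd, ← hd]; nlinarith)
  have hder : ∀ z ∈ strip (1 / Λ * (5 / 8 + 3 / 8 * (1 / 2) ^ (n + 1))),
      deriv (fun z => u z + v z) z = deriv u z + deriv v z := fun z hz =>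
    ((hu.hasDerivAt hz).fun_add (hv.hasDerivAt hz)).deriv
  have hvb' : ∀ z ∈ strip (1 / Λ * (5 / 8 + 3 / 8 * (1 / 2) ^ (n + 1))), ‖v z‖ ≤ 1 / (4 * Λ) * d :=
    fun z hz => (hvb z hz).trans (hPe 15 (by norm_num))
  have hvd' : ∀ z ∈ strip (1 / Λ * (5 / 8 + 3 / 8 * (1 / 2) ^ (n + 1))), ‖deriv v z‖ ≤ 1 / (4 * Λ) * d :=
    fun z hz => (hvd z hz).trans (hPe 16 le_rfl)
  refine ⟨fun z => u z + v z, ⟨hu.add hv, fun z hz => ?_, fun z hz => ?_, fun z hz => ?_, fun z hz => ?_⟩, fun z hz => ?_, fun z hz => ?_⟩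
  · rw [hder z hz, Complex.add_re, hdd]
    have h1 := h.low z (hsub hz)
    have h2 := (Complex.abs_re_le_norm _).trans (hvd' z hz)
    rw [← hd] at h1
    have h3 := (abs_le.1 h2).1
    rw [hL4] at h3
    rw [hL2] at h1 ⊢
    linarith
  · rw [hder z hz, hdd]
    have h1 := h.up z (hsub hz)
    have h2 := hvd' z hz
    have h3 := norm_add_le (1 + deriv u z) (deriv v z)
    rw [← hd] at h1
    rw [hL4] at h2
    rw [hL2] at h1 ⊢
    rw [← add_assoc]
    linarith
  · rw [hdd]
    have h1 := h.im z (hsub hz)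
    have h2 := (Complex.abs_im_le_norm _).trans (hvb' z hz)
    have h3 := abs_add_le (z + u z).im (v z).im
    rw [← hd] at h1
    rw [hL4] at h2
    rw [hL2] at h1 ⊢
    rw [← add_assoc, Complex.add_im]
    linarith
  · exact (hve z hz).trans hP31.le
  · simpa using hvb' z (hsub' hz)
  · rw [hder z (hsub' hz)]
    have := hvd' z (hsub' hz); simpa using this

/-- The KAM theorem in a-posteriori form. -/
theorem hasInvCircle_of_approx {ε ω Λ : ℝ} {u : ℂ → ℂ} (hε0 : 0 ≤ ε) (hε1 : ε ≤ 1) (hΛ : 100 ≤ Λ)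
    (hω : ∀ k : ℤ, k ≠ 0 → ∀ m : ℤ, 1 / (Λ * |(k : ℝ)|) ≤ |k * ω - m|)
    (hu : StripFun (1 / Λ) u) (hlow : ∀ z ∈ strip (1 / Λ), 1 / Λ ≤ 1 + (deriv u z).re)
    (hup : ∀ z ∈ strip (1 / Λ), ‖1 + deriv u z‖ ≤ Λ) (him : ∀ z ∈ strip (1 / Λ), |(z + u z).im| ≤ 1)
    (herr : ∀ z ∈ strip (1 / Λ), ‖kamErr ε (2 * π * ω) u z‖ ≤ 1 / (32 * Λ) ^ 31) :
    HasInvCircle ε ω := by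
  have hΛ0 : 0 < Λ := by linarith
  have h0 : KamInv ε ω Λ 0 u := by
    have e1 : 1 / Λ * (5 / 8 + 3 / 8 * (1 / 2) ^ 0) = 1 / Λ := by norm_num
    constructor <;> rw [e1]
    · exact hu
    all_goals simpa only [pow_zero, sub_self, mul_zero, sub_zero, add_zero, mul_one]
  choose next hnext using fun (n : ℕ) (w : {u // KamInv ε ω Λ n u}) => w.2.exists_next hε0 hε1 hΛ hω
  let seq : ∀ n : ℕ, {u // KamInv ε ω Λ n u} := fun n =>
    Nat.rec ⟨u, h0⟩ (fun n w => ⟨next n w, (hnext n w).1⟩) n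
  have hs : ∀ n, (seq (n + 1)).1 = next n (seq n) := fun n => rfl
  have hρ : 0 < 1 / Λ * (5 / 8) := by positivity
  have hst : ∀ n, StripFun (1 / Λ * (5 / 8)) (seq n).1 := fun n => (seq n).2.fn.mono (by
    have : (0 : ℝ) < (1 / 2) ^ n := by positivity
    have : 0 < 1 / Λ := by positivity
    nlinarith)
  have hsub : ∀ n, strip (1 / Λ * (5 / 8)) ⊆ strip (1 / Λ * (5 / 8 + 3 / 8 * (1 / 2) ^ n)) := fun n => by
    refine strip_mono ?_
    have : (0 : ℝ) < (1 / 2) ^ n := by positivity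
    have : 0 < 1 / Λ := by positivity
    nlinarith
  let U : ℕ → ℝ → ℝ := fun n s => ((seq n).1 s).re
  let U' : ℕ → ℝ → ℝ := fun n s => (deriv (seq n).1 s).re
  have hUd : ∀ n s, HasDerivAt (U n) (U' n s) s := fun n s =>
    HasDerivAt.real_of_complex ((hst n).hasDerivAt (ofReal_mem_strip hρ s))
  have hU'c : ∀ n, Continuous (U' n) := fun n => Complex.continuous_re.comp ((hst n).deriv.continuous_real hρ)
  have hsum : Summable fun n : ℕ => 1 / (4 * Λ) * (1 / 2 : ℝ) ^ n :=
    (summable_geometric_of_lt_one (by norm_num) (by norm_num)).mul_left _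
  have hb : ∀ n s, ‖U (n + 1) s - U n s‖ ≤ 1 / (4 * Λ) * (1 / 2 : ℝ) ^ n := fun n s => by
    have := (Complex.abs_re_le_norm _).trans ((hnext n (seq n)).2.1 s (ofReal_mem_strip hρ s))
    simpa [U, hs] using this
  have hb' : ∀ n s, ‖U' (n + 1) s - U' n s‖ ≤ 1 / (4 * Λ) * (1 / 2 : ℝ) ^ n := fun n s => by
    have := (Complex.abs_re_le_norm _).trans ((hnext n (seq n)).2.2 s (ofReal_mem_strip hρ s))
    simpa [U', hs] using this
  let V : ℝ → ℝ := fun s => U 0 s + ∑' n, (U (n + 1) s - U n s)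
  let V' : ℝ → ℝ := fun s => U' 0 s + ∑' n, (U' (n + 1) s - U' n s)
  have hVd : ∀ s, HasDerivAt V (V' s) s := fun s =>
    (hUd 0 s).add (hasDerivAt_tsum hsum (fun n y => (hUd (n + 1) y).sub (hUd n y)) hb'
      (y₀ := 0) (Summable.of_norm_bounded hsum fun n => hb n 0) s)
  have hV'c : Continuous V' := (hU'c 0).add
    (continuous_tsum (fun n => (hU'c (n + 1)).sub (hU'c n)) hsum hb')
  have hUV : ∀ s, Tendsto (fun n => U n s) atTop (nhds (V s)) := fun s => by
    have := (Summable.of_norm_bounded hsum fun n => hb n s).hasSum.tendsto_sum_nat.const_add (U 0 s)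
    simpa [Finset.sum_range_sub (fun n => U n s)] using this
  have hUV' : ∀ s, Tendsto (fun n => U' n s) atTop (nhds (V' s)) := fun s => by
    have := (Summable.of_norm_bounded hsum fun n => hb' n s).hasSum.tendsto_sum_nat.const_add (U' 0 s)
    simpa [Finset.sum_range_sub (fun n => U' n s)] using this
  have hFd : ∀ s, HasDerivAt (fun s => s + V s) (1 + V' s) s := fun s => (hasDerivAt_id' s).add (hVd s)
  refine hasInvCircle_of_conjugacy (F := fun s => s + V s) ?_ (fun s => ?_) (fun s => ?_) fun s => ?_
  · rw [contDiff_one_iff_deriv]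
    refine ⟨fun s => (hFd s).differentiableAt, ?_⟩
    rw [funext fun s => (hFd s).deriv]
    exact continuous_const.add hV'c
  · rw [(hFd s).deriv]
    have : 1 / (2 * Λ) ≤ 1 + V' s := by
      refine ge_of_tendsto ((hUV' s).const_add 1) (Eventually.of_forall fun n => ?_)
      refine le_trans ?_ ((seq n).2.low s (hsub n (ofReal_mem_strip hρ s)))
      have h1 : (0 : ℝ) < (1 / 2) ^ n := by positivity
      have h2 : 0 < 1 / (2 * Λ) := by positivity
      have h3 : 1 / Λ = 2 * (1 / (2 * Λ)) := by field_simp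
      rw [h3]
      nlinarith
    exact lt_of_lt_of_le (by positivity) this
  · have h1 := hUV (s + 2 * π)
    have h2 : (fun n => U n (s + 2 * π)) = fun n => U n s := by
      funext n
      simp only [U]
      have := (hst n).per s (ofReal_mem_strip hρ s)
      push_cast at this ⊢
      rw [this]
    rw [h2] at h1
    rw [tendsto_nhds_unique h1 (hUV s)]
    ring
  · set α := 2 * π * ω with hα
    have h1 : Tendsto (fun n => U n (s + α) - 2 * U n s + U n (s - α) - ε * Real.sin (s + U n s)) atTop
        (nhds (V (s + α) - 2 * V s + V (s - α) - ε * Real.sin (s + V s))) :=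
      (((hUV _).sub ((hUV s).const_mul 2)).add (hUV _)).sub
        (((Real.continuous_sin.tendsto _).comp ((hUV s).const_add s)).const_mul ε)
    have h2 : Tendsto (fun n => U n (s + α) - 2 * U n s + U n (s - α) - ε * Real.sin (s + U n s)) atTop (nhds 0) := by
      have h3 : Tendsto (fun n : ℕ => 1 / (32 * Λ) ^ 31 * ((1 / 2 : ℝ) ^ 31) ^ n) atTop (nhds 0) := by
        have := (tendsto_pow_atTop_nhds_zero_of_lt_one (r := (1 / 2 : ℝ) ^ 31) (by positivity)
          (by norm_num)).const_mul (1 / (32 * Λ) ^ 31)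
        rwa [mul_zero] at this
      refine squeeze_zero_norm (fun n => ?_) h3
      have h4 := (Complex.abs_re_le_norm _).trans ((seq n).2.err s (hsub n (ofReal_mem_strip hρ s)))
      rw [Real.norm_eq_abs]
      have hr := (hst n).ofReal_re hρ
      have h5 : ((U n (s + α) - 2 * U n s + U n (s - α) - ε * Real.sin (s + U n s) : ℝ) : ℂ) =
          kamErr ε α (seq n).1 s := by
        have h6 := hr (s + α)
        have h7 := hr (s - α)
        push_cast at h6 h7 ⊢
        simp only [U, Complex.ofReal_add, Complex.ofReal_sub, hr, h6, h7, kamErr]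
      rw [← hα, ← h5, Complex.ofReal_re] at h4
      exact h4
    have := tendsto_nhds_unique h1 h2
    linarith

/-- `F` is the primitive of `f` on a strip that vanishes at `0`. -/
structure IsPrim (ρ : ℝ) (f F : ℂ → ℂ) : Prop where
  zero : F 0 = 0
  hasDerivAt : ∀ z ∈ strip ρ, HasDerivAt F (f z) z

theorem smul_mem_strip {ρ t : ℝ} {z : ℂ} (hz : z ∈ strip ρ) (ht : t ∈ Icc (0 : ℝ) 1) :
    (t : ℂ) * z ∈ strip ρ := by
  rw [mem_strip] at *
  rw [Complex.im_ofReal_mul, abs_mul, abs_of_nonneg ht.1]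
  nlinarith [abs_nonneg z.im, ht.1, ht.2]

theorem neg_mem_strip {ρ : ℝ} {z : ℂ} : -z ∈ strip ρ ↔ z ∈ strip ρ := by
  simp [mem_strip]

theorem exists_isPrim {ρ : ℝ} {f : ℂ → ℂ} (hf : DifferentiableOn ℂ f (strip ρ)) :
    ∃ F, IsPrim ρ f F := by
  refine ⟨fun z => ∫ t in (0 : ℝ)..1, z * f (t * z), by simp, fun z₀ hz₀ => ?_⟩
  have ho := isOpen_strip ρ
  have hf' := hf.deriv ho
  obtain ⟨r, hr, hrs⟩ := Metric.nhds_basis_closedBall.mem_iff.1 (ho.mem_nhds hz₀)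
  set g' : ℂ → ℝ → ℂ := fun z t => f (t * z) + z * (t * deriv f (t * z)) with hg'
  have hda : ∀ z ∈ strip ρ, ∀ t ∈ Icc (0 : ℝ) 1, HasDerivAt (fun w : ℂ => w * f (t * w)) (g' z t) z := by
    intro z hz t ht
    have h1 : HasDerivAt f (deriv f (t * z)) (t * z) :=
      (hf.differentiableAt (ho.mem_nhds (smul_mem_strip hz ht))).hasDerivAt
    have h2 := h1.comp z ((hasDerivAt_id z).const_mul (t : ℂ))
    have h3 := (hasDerivAt_id z).mul h2
    refine h3.congr_deriv ?_
    simp only [g', mul_one, id, one_mul, Function.comp]; ring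
  have hmaps : MapsTo (fun p : ℂ × ℝ => (p.2 : ℂ) * p.1) (Metric.closedBall z₀ r ×ˢ Icc (0 : ℝ) 1) (strip ρ) :=
    fun p hp => smul_mem_strip (hrs hp.1) hp.2
  have hfc : ContinuousOn (fun p : ℂ × ℝ => f (p.2 * p.1)) (Metric.closedBall z₀ r ×ˢ Icc (0 : ℝ) 1) :=
    hf.continuousOn.comp (by fun_prop) hmaps
  have hfc' : ContinuousOn (fun p : ℂ × ℝ => deriv f (p.2 * p.1)) (Metric.closedBall z₀ r ×ˢ Icc (0 : ℝ) 1) :=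
    hf'.continuousOn.comp (by fun_prop) hmaps
  have hgc : ContinuousOn (fun p : ℂ × ℝ => g' p.1 p.2) (Metric.closedBall z₀ r ×ˢ Icc (0 : ℝ) 1) := by
    refine hfc.add (ContinuousOn.mul (by fun_prop) (ContinuousOn.mul (by fun_prop) hfc'))
  obtain ⟨C, hC⟩ := ((isCompact_closedBall z₀ r).prod isCompact_Icc).exists_bound_of_continuousOn hgc
  have hslice : ∀ z ∈ Metric.closedBall z₀ r, ContinuousOn (fun t : ℝ => z * f (t * z)) (Icc 0 1) := by
    intro z hz
    refine ContinuousOn.mul (by fun_prop) (hf.continuousOn.comp (by fun_prop) fun t ht => smul_mem_strip (hrs hz) ht)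
  have hslice' : ContinuousOn (g' z₀) (Icc 0 1) :=
    hgc.comp (f := fun t : ℝ => (z₀, t)) (by fun_prop) fun t ht => ⟨Metric.mem_closedBall_self hr.le, ht⟩
  have key := intervalIntegral.hasDerivAt_integral_of_dominated_loc_of_deriv_le
    (μ := MeasureTheory.volume) (a := 0) (b := 1) (bound := fun _ => C) (F := fun z (t : ℝ) => z * f (t * z)) (F' := g')
    (x₀ := z₀) (Metric.closedBall_mem_nhds z₀ hr) ?_ ?_ ?_ ?_ (by simp) ?_
  · have h2 := key.2
    refine h2.congr_deriv ?_
    have hd : ∀ t ∈ Ioo (0 : ℝ) 1, HasDerivAt (fun t : ℝ => (t : ℂ) * f (t * z₀)) (g' z₀ t) t := by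
      intro t ht
      have h1 : HasDerivAt f (deriv f (t * z₀)) (t * z₀) :=
        (hf.differentiableAt (ho.mem_nhds (smul_mem_strip hz₀ (Ioo_subset_Icc_self ht)))).hasDerivAt
      have h4 : HasDerivAt (fun t : ℝ => (t : ℂ)) 1 t := Complex.ofRealCLM.hasDerivAt
      have h3 := h4.fun_mul (h1.comp t (h4.mul_const z₀))
      refine h3.congr_deriv ?_
      simp only [g', Function.comp]; ring
    rw [intervalIntegral.integral_eq_sub_of_hasDeriv_right_of_le zero_le_one (f := fun t : ℝ => (t : ℂ) * f (t * z₀)) ?_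
      (fun t ht => (hd t ht).hasDerivWithinAt)]
    · simp
    · exact (hslice'.mono (by simp)).intervalIntegrable
    · refine ContinuousOn.mul (by fun_prop) (hf.continuousOn.comp (by fun_prop) fun t ht => smul_mem_strip hz₀ ht)
  · filter_upwards [Metric.closedBall_mem_nhds z₀ hr] with z hz
    refine ((hslice z hz).mono ?_).aestronglyMeasurable measurableSet_uIoc
    rw [uIoc_of_le zero_le_one]; exact Ioc_subset_Icc_self
  · exact ((hslice z₀ (Metric.mem_closedBall_self hr.le)).mono (by simp)).intervalIntegrable
  · refine (hslice'.mono ?_).aestronglyMeasurable measurableSet_uIoc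
    rw [uIoc_of_le zero_le_one]; exact Ioc_subset_Icc_self
  · refine Filter.Eventually.of_forall fun t ht z hz => ?_
    rw [uIoc_of_le zero_le_one] at ht
    exact hC (z, t) ⟨hz, Ioc_subset_Icc_self ht⟩
  · refine Filter.Eventually.of_forall fun t ht z hz => ?_
    rw [uIoc_of_le zero_le_one] at ht
    exact hda z (hrs hz) t (Ioc_subset_Icc_self ht)

theorem norm_sub_le_of_norm_deriv_le {E : Type*} [NormedAddCommGroup E] [NormedSpace ℝ E]
    {F f : ℝ → E} {B b : ℝ → ℝ} {x y : ℝ} (hxy : x ≤ y)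
    (hF : ∀ t ∈ Icc x y, HasDerivAt F (f t) t) (hB : ∀ t, HasDerivAt B (b t) t)
    (hb : ∀ t ∈ Icc x y, ‖f t‖ ≤ b t) : ‖F y - F x‖ ≤ B y - B x := by
  have := image_norm_le_of_norm_deriv_right_le_deriv_boundary (f := fun t => F t - F x) (f' := f) (a := x) (b := y)
    (B := fun t => B t - B x) (B' := b)
    (fun t ht => ((hF t ht).continuousAt.continuousWithinAt).sub continuousWithinAt_const)
    (fun t ht => ((hF t (Ico_subset_Icc_self ht)).sub_const _).hasDerivWithinAt) (by simp)
    (fun t => (hB t).sub_const _) (fun t ht => hb t (Ico_subset_Icc_self ht))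
  exact this ⟨hxy, le_rfl⟩

namespace IsPrim
variable {ρ : ℝ} {f F G : ℂ → ℂ}

theorem eq_of_hasDerivAt (hF : ∀ z ∈ strip ρ, HasDerivAt F (f z) z)
    (hG : ∀ z ∈ strip ρ, HasDerivAt G (f z) z) {w : ℂ} (hw : w ∈ strip ρ) (h : F w = G w) {z : ℂ}
    (hz : z ∈ strip ρ) : F z = G z := by
  refine (isOpen_strip ρ).eqOn_of_deriv_eq (convex_strip ρ).isPreconnected
    (fun z hz => (hF z hz).differentiableAt.differentiableWithinAt)
    (fun z hz => (hG z hz).differentiableAt.differentiableWithinAt)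
    (fun z hz => ?_) hw h hz
  rw [(hF z hz).deriv, (hG z hz).deriv]

theorem conj (h : IsPrim ρ f F) (hρ : 0 < ρ)
    (hf : ∀ z ∈ strip ρ, f ((starRingEnd ℂ) z) = (starRingEnd ℂ) (f z)) {z : ℂ} (hz : z ∈ strip ρ) :
    F ((starRingEnd ℂ) z) = (starRingEnd ℂ) (F z) := by
  have h0 : (0 : ℂ) ∈ strip ρ := by simpa using ofReal_mem_strip hρ 0
  have : ∀ z ∈ strip ρ, HasDerivAt (starRingEnd ℂ ∘ F ∘ starRingEnd ℂ) (f z) z := fun z hz => by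
    have := (h.hasDerivAt _ (conj_mem_strip.2 hz)).conj_conj
    rwa [hf z hz, Complex.conj_conj, Complex.conj_conj] at this
  have h1 := eq_of_hasDerivAt this h.hasDerivAt h0 (by simp [h.zero]) (conj_mem_strip.2 hz)
  simpa using h1.symm

theorem neg_eq (h : IsPrim ρ f F) (hρ : 0 < ρ) {σ : ℂ} (hσ : σ * σ = 1)
    (hf : ∀ z ∈ strip ρ, f (-z) = σ * f z) {z : ℂ} (hz : z ∈ strip ρ) : F (-z) = -σ * F z := by
  have h0 : (0 : ℂ) ∈ strip ρ := by simpa using ofReal_mem_strip hρ 0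
  have : ∀ z ∈ strip ρ, HasDerivAt (fun z => -σ * F (-z)) (f z) z := fun z hz => by
    have := ((h.hasDerivAt _ (neg_mem_strip.2 hz)).comp z (hasDerivAt_neg z)).const_mul (-σ)
    refine this.congr_deriv ?_
    rw [hf z hz]; linear_combination (f z) * hσ
  have h1 := eq_of_hasDerivAt this h.hasDerivAt h0 (by simp [h.zero]) hz
  linear_combination (-F (-z)) * hσ - σ * h1

theorem add_period (h : ∀ z ∈ strip ρ, HasDerivAt F (f z) z) (hρ : 0 < ρ) {T : ℝ} (hf : ∀ z ∈ strip ρ, f (z + T) = f z) {z : ℂ}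
    (hz : z ∈ strip ρ) : F (z + T) = F z + (F ((T / 2 : ℝ) : ℂ) - F ((-(T / 2) : ℝ) : ℂ)) := by
  have h0 : ((-(T / 2) : ℝ) : ℂ) ∈ strip ρ := ofReal_mem_strip hρ _
  refine eq_of_hasDerivAt (f := f) (F := fun z => F (z + T))
    (G := fun z => F z + (F ((T / 2 : ℝ) : ℂ) - F ((-(T / 2) : ℝ) : ℂ))) (fun z hz => ?_) (fun z hz => ?_) h0 ?_ hz
  · have := (h _ ((add_ofReal_mem_strip T).2 hz)).comp_add_const z (T : ℂ)
    rwa [hf z hz] at this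
  · exact (h z hz).add_const _
  · rw [← Complex.ofReal_add, show -(T / 2) + T = T / 2 by ring]; ring

end IsPrim

theorem norm_sub_le_of_strip {ρ x y : ℝ} {f F : ℂ → ℂ} {B b : ℝ → ℝ} (hρ : 0 < ρ)
    (hF : ∀ z ∈ strip ρ, HasDerivAt F (f z) z) (hxy : x ≤ y) (hB : ∀ t, HasDerivAt B (b t) t)
    (hb : ∀ t ∈ Icc x y, ‖f (t : ℝ)‖ ≤ b t) : ‖F (y : ℝ) - F (x : ℝ)‖ ≤ B y - B x :=
  norm_sub_le_of_norm_deriv_le (F := fun t : ℝ => F t) (f := fun t : ℝ => f t) hxy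
    (fun t _ => (hF t (ofReal_mem_strip hρ t)).comp_ofReal) hB hb

theorem norm_sub_re_le_of_strip {ρ C : ℝ} {f F : ℂ → ℂ}
    (hF : ∀ z ∈ strip ρ, HasDerivAt F (f z) z) {z : ℂ} (hz : z ∈ strip ρ)
    (hb : ∀ w ∈ strip ρ, w.re = z.re → ‖f w‖ ≤ C) : ‖F z - F (z.re : ℝ)‖ ≤ C * |z.im| := by
  have hconv : Convex ℝ (strip ρ ∩ {w | w.re = z.re}) := by
    refine (convex_strip ρ).inter ?_
    exact (convex_singleton z.re).linear_preimage Complex.reLm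
  have hρ : 0 < ρ := (abs_nonneg _).trans_lt hz
  have := hconv.norm_image_sub_le_of_norm_hasDerivWithin_le (f := F) (f' := f) (C := C) (x := (z.re : ℂ)) (y := z)
    (fun w hw => (hF w hw.1).hasDerivWithinAt) (fun w hw => hb w hw.1 hw.2)
    ⟨ofReal_mem_strip hρ _, by simp⟩ ⟨hz, rfl⟩
  refine this.trans (le_of_eq ?_)
  congr 1
  have : z - z.re = z.im * Complex.I := by
    rw [sub_eq_iff_eq_add']; exact (Complex.re_add_im z).symm
  rw [this]; simp

/-- Holomorphic functions on a strip that are `T`-periodic, have parity `σ = ±1` and are real on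
the real axis. -/
structure CellFun (T : ℝ) (σ : ℂ) (ρ : ℝ) (f : ℂ → ℂ) : Prop where
  diff : DifferentiableOn ℂ f (strip ρ)
  per : ∀ z ∈ strip ρ, f (z + T) = f z
  par : ∀ z ∈ strip ρ, f (-z) = σ * f z
  real : ∀ z ∈ strip ρ, f ((starRingEnd ℂ) z) = (starRingEnd ℂ) (f z)

theorem exists_half_cell {T : ℝ} (hT : 0 < T) (z : ℂ) :
    ∃ w : ℂ, 0 ≤ w.re ∧ w.re ≤ T / 2 ∧ |w.im| = |z.im| ∧
      ∃ k : ℤ, z = w + (k * T : ℝ) ∨ z = -w + (k * T : ℝ) := by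
  have h := abs_sub_round (z.re / T)
  set k := round (z.re / T)
  have h1 : |z.re - k * T| ≤ T / 2 := by
    have : z.re - k * T = (z.re / T - k) * T := by field_simp
    rw [this, abs_mul, abs_of_pos hT]; nlinarith
  rw [abs_le] at h1
  rcases le_total 0 (z.re - k * T) with h2 | h2
  · refine ⟨z - (k * T : ℝ), ?_, ?_, ?_, k, Or.inl (by ring)⟩ <;> simp only [Complex.sub_re, Complex.sub_im, Complex.ofReal_re, Complex.ofReal_im, sub_zero] <;> linarith
  · refine ⟨-(z - (k * T : ℝ)), ?_, ?_, ?_, k, Or.inr (by ring)⟩ <;> simp only [Complex.neg_re, Complex.neg_im, abs_neg, Complex.sub_re, Complex.sub_im, Complex.ofReal_re, Complex.ofReal_im, sub_zero] <;> linarith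

namespace CellFun
variable {T ρ : ℝ} {σ τ : ℂ} {f g : ℂ → ℂ}

theorem mono (h : CellFun T σ ρ f) {ρ' : ℝ} (hρ : ρ' ≤ ρ) : CellFun T σ ρ' f :=
  ⟨h.diff.mono (strip_mono hρ), fun z hz => h.per z (strip_mono hρ hz), fun z hz => h.par z (strip_mono hρ hz),
    fun z hz => h.real z (strip_mono hρ hz)⟩

theorem add (hf : CellFun T σ ρ f) (hg : CellFun T σ ρ g) : CellFun T σ ρ (fun z => f z + g z) :=
  ⟨hf.diff.fun_add hg.diff, fun z hz => by rw [hf.per z hz, hg.per z hz],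
    fun z hz => by rw [hf.par z hz, hg.par z hz, mul_add],
    fun z hz => by rw [hf.real z hz, hg.real z hz, map_add]⟩

theorem neg (hf : CellFun T σ ρ f) : CellFun T σ ρ (fun z => -f z) :=
  ⟨hf.diff.fun_neg, fun z hz => by rw [hf.per z hz],
    fun z hz => by rw [hf.par z hz, mul_neg],
    fun z hz => by rw [hf.real z hz, map_neg]⟩

theorem mul (hf : CellFun T σ ρ f) (hg : CellFun T τ ρ g) : CellFun T (σ * τ) ρ (fun z => f z * g z) :=
  ⟨hf.diff.fun_mul hg.diff, fun z hz => by rw [hf.per z hz, hg.per z hz],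
    fun z hz => by rw [hf.par z hz, hg.par z hz]; ring,
    fun z hz => by rw [hf.real z hz, hg.real z hz, map_mul]⟩

theorem inv (hf : CellFun T 1 ρ f) (h0 : ∀ z ∈ strip ρ, f z ≠ 0) : CellFun T 1 ρ (fun z => (f z)⁻¹) :=
  ⟨hf.diff.fun_inv h0, fun z hz => by rw [hf.per z hz],
    fun z hz => by rw [hf.par z hz]; simp,
    fun z hz => by rw [hf.real z hz, map_inv₀]⟩

theorem per_int (hf : CellFun T σ ρ f) {z : ℂ} (hz : z ∈ strip ρ) (k : ℤ) : f (z + (k * T : ℝ)) = f z := by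
  have h : Function.Periodic (fun t : ℝ => f (z + t)) T := fun t => by
    simp only
    rw [Complex.ofReal_add, ← add_assoc, hf.per _ ((add_ofReal_mem_strip t).2 hz)]
  have := h.int_mul k 0
  simpa using this

theorem im_eq_zero (hf : CellFun T σ ρ f) (hρ : 0 < ρ) (x : ℝ) : (f x).im = 0 := by
  have := hf.real x (ofReal_mem_strip hρ x)
  rw [Complex.conj_ofReal] at this
  exact Complex.conj_eq_iff_im.1 this.symm

theorem exists_half_cell_norm_eq (hf : CellFun T σ ρ f) (hσ : ‖σ‖ = 1) (hT : 0 < T) {z : ℂ} (hz : z ∈ strip ρ) :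
    ∃ w ∈ strip ρ, 0 ≤ w.re ∧ w.re ≤ T / 2 ∧ ‖f z‖ = ‖f w‖ := by
  obtain ⟨w, h1, h2, h3, k, hk⟩ := exists_half_cell hT z
  have hw : w ∈ strip ρ := by rw [mem_strip, h3]; exact hz
  refine ⟨w, hw, h1, h2, ?_⟩
  rcases hk with rfl | rfl
  · rw [hf.per_int hw]
  · rw [hf.per_int (neg_mem_strip.2 hw), hf.par w hw, norm_mul, hσ, one_mul]

theorem norm_le (hf : CellFun T σ ρ f) (hσ : ‖σ‖ = 1) (hT : 0 < T) {M : ℝ}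
    (h : ∀ z ∈ strip ρ, 0 ≤ z.re → z.re ≤ T / 2 → ‖f z‖ ≤ M) {z : ℂ} (hz : z ∈ strip ρ) : ‖f z‖ ≤ M := by
  obtain ⟨w, hw, h1, h2, h3⟩ := hf.exists_half_cell_norm_eq hσ hT hz
  rw [h3]; exact h w hw h1 h2

end CellFun

/-- The size profile of the periodized separatrix velocity on half a period. -/
structure Profile (T ρ : ℝ) (φ : ℂ → ℂ) : Prop where
  cell : CellFun T 1 ρ φ
  lower : ∀ z ∈ strip ρ, 0 ≤ z.re → z.re ≤ T / 2 → exp (-z.re) / 2 ≤ (φ z).re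
  upper : ∀ z ∈ strip ρ, 0 ≤ z.re → z.re ≤ T / 2 → ‖φ z‖ ≤ 20 * exp (-z.re)

namespace Profile
variable {T ρ : ℝ} {φ : ℂ → ℂ}

theorem mono (h : Profile T ρ φ) {ρ' : ℝ} (hρ : ρ' ≤ ρ) : Profile T ρ' φ :=
  ⟨h.cell.mono hρ, fun z hz => h.lower z (strip_mono hρ hz), fun z hz => h.upper z (strip_mono hρ hz)⟩

theorem norm_lower (h : Profile T ρ φ) {z : ℂ} (hz : z ∈ strip ρ) (h1 : 0 ≤ z.re) (h2 : z.re ≤ T / 2) :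
    exp (-z.re) / 2 ≤ ‖φ z‖ :=
  (h.lower z hz h1 h2).trans (Complex.re_le_norm _)

theorem ne_zero (h : Profile T ρ φ) (hT : 0 < T) {z : ℂ} (hz : z ∈ strip ρ) : φ z ≠ 0 := by
  obtain ⟨w, hw, h1, h2, h3⟩ := h.cell.exists_half_cell_norm_eq (by simp) hT hz
  rw [← norm_pos_iff, h3]
  exact (by positivity : 0 < exp (-w.re) / 2).trans_le (h.norm_lower hw h1 h2)

/-- Bounded odd solutions of the linearized pendulum equation `v'' = (φ''/φ) v + f`. -/
theorem exists_solution (hφ : Profile T ρ φ) (hT : 2 ≤ T) (hρ : 0 < ρ) (hρ1 : ρ ≤ 1) {f : ℂ → ℂ}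
    (hf : CellFun T (-1) ρ f) {M : ℝ} (hM : ∀ z ∈ strip ρ, ‖f z‖ ≤ M) :
    ∃ v, CellFun T (-1) ρ v ∧ (∀ z ∈ strip ρ, ‖v z‖ ≤ 10 ^ 8 * M) ∧
      ∀ z ∈ strip ρ, deriv (deriv v) z = deriv (deriv φ) z / φ z * v z + f z := by
  have hT0 : 0 < T := by linarith
  have ho := isOpen_strip ρ
  have hM0 : 0 ≤ M := (norm_nonneg _).trans (hM _ (ofReal_mem_strip hρ 0))
  have hne : ∀ z ∈ strip ρ, φ z ≠ 0 := fun z hz => hφ.ne_zero hT0 hz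
  have hTm : ((T / 2 : ℝ) : ℂ) ∈ strip ρ := ofReal_mem_strip hρ _
  have hg : CellFun T (-1) ρ (fun z => φ z * f z) := by simpa using hφ.cell.mul hf
  obtain ⟨G₀, hG₀⟩ := exists_isPrim hg.diff
  set G : ℂ → ℂ := fun z => G₀ z - G₀ (T / 2 : ℝ) with hGdef
  have hGd : ∀ z ∈ strip ρ, HasDerivAt G (φ z * f z) z := fun z hz => (hG₀.hasDerivAt z hz).sub_const _
  have hG₀par : ∀ z ∈ strip ρ, G₀ (-z) = G₀ z := fun z hz => by
    simpa using hG₀.neg_eq hρ (by norm_num) hg.par hz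
  have hG : CellFun T 1 ρ G := by
    refine ⟨fun z hz => (hGd z hz).differentiableAt.differentiableWithinAt, fun z hz => ?_, fun z hz => ?_, fun z hz => ?_⟩
    · have := IsPrim.add_period hG₀.hasDerivAt hρ hg.per hz
      rw [Complex.ofReal_neg, hG₀par _ hTm] at this
      simp [G, this]
    · simp [G, hG₀par z hz]
    · simp only [G, map_sub]
      rw [hG₀.conj hρ hg.real hz, ← hG₀.conj hρ hg.real hTm, Complex.conj_ofReal]
  have hr : CellFun T 1 ρ (fun z => (φ z)⁻¹ * (φ z)⁻¹) := by
    simpa using (hφ.cell.inv hne).mul (hφ.cell.inv hne)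
  have hp : CellFun T 1 ρ (fun z => G z * ((φ z)⁻¹ * (φ z)⁻¹)) := by
    simpa using hG.mul hr
  obtain ⟨W₁, hW₁⟩ := exists_isPrim hp.diff
  obtain ⟨W₂, hW₂⟩ := exists_isPrim hr.diff
  set C : ℂ := -W₁ (T / 2 : ℝ) / W₂ (T / 2 : ℝ) with hC
  -- bounds on the half cell
  have hgb : ∀ z ∈ strip ρ, 0 ≤ z.re → z.re ≤ T / 2 → ‖φ z * f z‖ ≤ 20 * M * exp (-z.re) := by
    intro z hz h1 h2
    rw [norm_mul]
    calc ‖φ z‖ * ‖f z‖ ≤ (20 * exp (-z.re)) * M :=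
          mul_le_mul (hφ.upper z hz h1 h2) (hM z hz) (norm_nonneg _) (by positivity)
      _ = _ := by ring
  have hGb : ∀ z ∈ strip ρ, 0 ≤ z.re → z.re ≤ T / 2 → ‖G z‖ ≤ 40 * M * exp (-z.re) := by
    intro z hz h1 h2
    have e1 := norm_sub_re_le_of_strip hGd hz (C := 20 * M * exp (-z.re)) fun w hw hwr => by
      rw [← hwr] at h1 h2 ⊢; exact hgb w hw h1 h2
    have e2 := norm_sub_le_of_strip hρ hGd h2 (B := fun t => -(20 * M * exp (-t))) (b := fun t => 20 * M * exp (-t))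
      (fun t => by
        have := (((hasDerivAt_id t).neg.exp).const_mul (20 * M)).neg
        refine this.congr_deriv ?_; simp)
      (fun t ht => by
        have := hgb t (ofReal_mem_strip hρ t) (by simpa using h1.trans ht.1) (by simpa using ht.2)
        simpa using this)
    have e3 : G (T / 2 : ℝ) = 0 := by simp [G]
    rw [e3, zero_sub, norm_neg] at e2
    have e4 := norm_add_le (G z - G (z.re : ℝ)) (G (z.re : ℝ))
    rw [sub_add_cancel] at e4
    have : 20 * M * exp (-z.re) * |z.im| ≤ 20 * M * exp (-z.re) * 1 :=
      mul_le_mul_of_nonneg_left ((le_of_lt hz).trans hρ1) (by positivity)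
    have : 0 ≤ 20 * M * exp (-(T / 2)) := by positivity
    linarith
  have hrb : ∀ z ∈ strip ρ, 0 ≤ z.re → z.re ≤ T / 2 → ‖(φ z)⁻¹ * (φ z)⁻¹‖ ≤ 4 * exp (2 * z.re) := by
    intro z hz h1 h2
    have := hφ.norm_lower hz h1 h2
    have h3 : ‖(φ z)⁻¹‖ ≤ 2 * exp z.re := by
      rw [norm_inv]
      refine inv_le_of_inv_le₀ (by positivity) (le_trans (le_of_eq ?_) this)
      rw [mul_inv, Real.exp_neg]; ring
    rw [norm_mul]
    calc ‖(φ z)⁻¹‖ * ‖(φ z)⁻¹‖ ≤ (2 * exp z.re) * (2 * exp z.re) := by gcongr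
      _ = _ := by rw [two_mul z.re, Real.exp_add]; ring
  have hpb : ∀ z ∈ strip ρ, 0 ≤ z.re → z.re ≤ T / 2 → ‖G z * ((φ z)⁻¹ * (φ z)⁻¹)‖ ≤ 160 * M * exp z.re := by
    intro z hz h1 h2
    rw [norm_mul]
    calc _ ≤ (40 * M * exp (-z.re)) * (4 * exp (2 * z.re)) :=
          mul_le_mul (hGb z hz h1 h2) (hrb z hz h1 h2) (norm_nonneg _) (by positivity)
      _ = 160 * M * (exp (-z.re) * exp (2 * z.re)) := by ring
      _ = _ := by rw [← Real.exp_add]; ring_nf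
  have hW₁b : ∀ z ∈ strip ρ, 0 ≤ z.re → z.re ≤ T / 2 → ‖W₁ z‖ ≤ 320 * M * exp z.re := by
    intro z hz h1 h2
    have e1 := norm_sub_re_le_of_strip hW₁.hasDerivAt hz (C := 160 * M * exp z.re) fun w hw hwr => by
      rw [← hwr] at h1 h2 ⊢; exact hpb w hw h1 h2
    have e2 := norm_sub_le_of_strip hρ hW₁.hasDerivAt h1 (B := fun t => 160 * M * exp t) (b := fun t => 160 * M * exp t)
      (fun t => (Real.hasDerivAt_exp t).const_mul _)
      (fun t ht => by
        have := hpb t (ofReal_mem_strip hρ t) (by simpa using ht.1) (by simpa using ht.2.trans h2)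
        simpa using this)
    rw [Complex.ofReal_zero, hW₁.zero, sub_zero] at e2
    have e4 := norm_add_le (W₁ z - W₁ (z.re : ℝ)) (W₁ (z.re : ℝ))
    rw [sub_add_cancel] at e4
    have : 160 * M * exp z.re * |z.im| ≤ 160 * M * exp z.re * 1 :=
      mul_le_mul_of_nonneg_left ((le_of_lt hz).trans hρ1) (by positivity)
    have : 0 ≤ 160 * M * exp 0 := by positivity
    linarith
  have hW₂b : ∀ z ∈ strip ρ, 0 ≤ z.re → z.re ≤ T / 2 → ‖W₂ z‖ ≤ 6 * exp (2 * z.re) := by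
    intro z hz h1 h2
    have e1 := norm_sub_re_le_of_strip hW₂.hasDerivAt hz (C := 4 * exp (2 * z.re)) fun w hw hwr => by
      rw [← hwr] at h1 h2 ⊢; exact hrb w hw h1 h2
    have e2 := norm_sub_le_of_strip hρ hW₂.hasDerivAt h1 (B := fun t => 2 * exp (2 * t)) (b := fun t => 4 * exp (2 * t))
      (fun t => by
        have := (((hasDerivAt_id t).const_mul 2).exp).const_mul 2
        refine this.congr_deriv ?_; simp; ring)
      (fun t ht => by
        have := hrb t (ofReal_mem_strip hρ t) (by simpa using ht.1) (by simpa using ht.2.trans h2)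
        simpa using this)
    rw [Complex.ofReal_zero, hW₂.zero, sub_zero] at e2
    have e4 := norm_add_le (W₂ z - W₂ (z.re : ℝ)) (W₂ (z.re : ℝ))
    rw [sub_add_cancel] at e4
    have : 4 * exp (2 * z.re) * |z.im| ≤ 4 * exp (2 * z.re) * 1 :=
      mul_le_mul_of_nonneg_left ((le_of_lt hz).trans hρ1) (by positivity)
    have : 0 ≤ exp (2 * 0) := by positivity
    linarith
  have hexpT : 2 ≤ exp T := by linarith [Real.add_one_le_exp T]
  have hW₂T : exp T / 1600 ≤ ‖W₂ (T / 2 : ℝ)‖ := by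
    have hd : ∀ t : ℝ, HasDerivAt (fun t : ℝ => (W₂ t).re - exp (2 * t) / 800)
        (((φ t)⁻¹ * (φ t)⁻¹).re - exp (2 * t) / 400) t := by
      intro t
      have h1 : HasDerivAt (fun t : ℝ => (W₂ t).re) _ t :=
        (hW₂.hasDerivAt t (ofReal_mem_strip hρ t)).real_of_complex
      have h2 := ((((hasDerivAt_id t).const_mul 2).exp).div_const 800)
      refine (h1.sub h2).congr_deriv ?_
      simp; ring
    have hmono : MonotoneOn (fun t : ℝ => (W₂ t).re - exp (2 * t) / 800) (Icc 0 (T / 2)) := by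
      refine monotoneOn_of_deriv_nonneg (convex_Icc _ _) (fun t _ => (hd t).continuousAt.continuousWithinAt)
        (fun t _ => (hd t).differentiableAt.differentiableWithinAt) fun t ht => ?_
      rw [interior_Icc] at ht
      rw [(hd t).deriv, sub_nonneg]
      have ht' := ofReal_mem_strip hρ t
      have hre : φ t = ((φ t).re : ℝ) := Complex.ext rfl (by simp [hφ.cell.im_eq_zero hρ t])
      have hu := hφ.upper t ht' (by simpa using ht.1.le) (by simpa using ht.2.le)
      have hl := hφ.lower t ht' (by simpa using ht.1.le) (by simpa using ht.2.le)
      set x := (φ t).re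
      rw [hre, Complex.norm_real, Real.norm_eq_abs, Complex.ofReal_re] at hu
      rw [Complex.ofReal_re] at hl
      have hx : 0 < x := (by positivity : 0 < exp (-t) / 2).trans_le hl
      rw [abs_of_pos hx] at hu
      rw [hre, ← Complex.ofReal_inv, ← Complex.ofReal_mul, Complex.ofReal_re]
      have : exp t / 20 ≤ x⁻¹ := by
        rw [le_inv_comm₀ (by positivity) hx]
        refine hu.trans (le_of_eq ?_)
        rw [Real.exp_neg]; field_simp
      calc exp (2 * t) / 400 = (exp t / 20) * (exp t / 20) := by rw [two_mul, Real.exp_add]; ring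
        _ ≤ _ := by gcongr
    have := hmono (left_mem_Icc.2 (by linarith)) (right_mem_Icc.2 (by linarith)) (by linarith : (0 : ℝ) ≤ T / 2)
    simp only [Complex.ofReal_zero, hW₂.zero, Complex.zero_re, mul_zero, Real.exp_zero] at this
    rw [show 2 * (T / 2) = T by ring] at this
    have := Complex.re_le_norm (W₂ (T / 2 : ℝ))
    linarith
  have hW₂ne : W₂ (T / 2 : ℝ) ≠ 0 := by
    rw [← norm_pos_iff]; exact (by positivity : 0 < exp T / 1600).trans_le hW₂T
  have hCb : ‖C‖ ≤ 512000 * M * exp (-(T / 2)) := by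
    rw [hC, norm_div, norm_neg, div_le_iff₀ (norm_pos_iff.2 hW₂ne)]
    have h1 := hW₁b _ hTm (by simp; linarith) (by simp)
    rw [Complex.ofReal_re] at h1
    refine h1.trans ?_
    calc 320 * M * exp (T / 2) = 512000 * M * exp (-(T / 2)) * (exp T / 1600) := by
          rw [show exp (T / 2) = exp (-(T / 2)) * exp T by rw [← Real.exp_add]; ring_nf]; ring
      _ ≤ _ := by gcongr
  -- the solution
  set w : ℂ → ℂ := fun z => W₁ z + C * W₂ z with hwdef
  have hwd : ∀ z ∈ strip ρ, HasDerivAt w ((G z + C) * ((φ z)⁻¹ * (φ z)⁻¹)) z := fun z hz => by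
    refine ((hW₁.hasDerivAt z hz).fun_add ((hW₂.hasDerivAt z hz).const_mul C)).congr_deriv ?_
    ring
  have hW₁par : ∀ z ∈ strip ρ, W₁ (-z) = -W₁ z := fun z hz => by
    simpa using hW₁.neg_eq hρ (by norm_num) hp.par hz
  have hW₂par : ∀ z ∈ strip ρ, W₂ (-z) = -W₂ z := fun z hz => by
    simpa using hW₂.neg_eq hρ (by norm_num) hr.par hz
  have hwpar : ∀ z ∈ strip ρ, w (-z) = -w z := fun z hz => by
    simp only [w, hW₁par z hz, hW₂par z hz]; ring
  have hwT : w (T / 2 : ℝ) = 0 := by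
    simp only [w, hC]; field_simp; ring
  have hCr : (starRingEnd ℂ) C = C := by
    rw [hC, map_div₀, map_neg, ← hW₁.conj hρ hp.real hTm, ← hW₂.conj hρ hr.real hTm, Complex.conj_ofReal]
  have hw : CellFun T (-1) ρ w := by
    refine ⟨fun z hz => (hwd z hz).differentiableAt.differentiableWithinAt, fun z hz => ?_, fun z hz => ?_, fun z hz => ?_⟩
    · have hper : ∀ z ∈ strip ρ, (G (z + T) + C) * ((φ (z + T))⁻¹ * (φ (z + T))⁻¹) = (G z + C) * ((φ z)⁻¹ * (φ z)⁻¹) :=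
        fun z hz => by rw [hG.per z hz, hφ.cell.per z hz]
      have := IsPrim.add_period (f := fun z => (G z + C) * ((φ z)⁻¹ * (φ z)⁻¹)) hwd hρ hper hz
      rw [this, Complex.ofReal_neg, hwpar _ hTm, hwT]; simp
    · rw [hwpar z hz]; ring
    · simp only [w, map_add, map_mul, hCr]
      rw [hW₁.conj hρ hp.real hz, hW₂.conj hρ hr.real hz]
  have hv : CellFun T (-1) ρ (fun z => φ z * w z) := by simpa using hφ.cell.mul hw
  refine ⟨fun z => φ z * w z, hv, fun z hz => hv.norm_le (by simp) hT0 (fun z hz h1 h2 => ?_) hz, fun z hz => ?_⟩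
  · have hwb : ‖w z‖ ≤ 320 * M * exp z.re + 512000 * M * exp (-(T / 2)) * (6 * exp (2 * z.re)) := by
      refine (norm_add_le _ _).trans (add_le_add (hW₁b z hz h1 h2) ?_)
      rw [norm_mul]
      exact mul_le_mul hCb (hW₂b z hz h1 h2) (norm_nonneg _) (by positivity)
    rw [norm_mul]
    have e1 : exp (-z.re) * exp z.re = 1 := by rw [← Real.exp_add]; simp
    have e2 : exp (-(T / 2)) * exp z.re ≤ 1 := by rw [← Real.exp_add, Real.exp_le_one_iff]; linarith
    calc ‖φ z‖ * ‖w z‖ ≤ (20 * exp (-z.re)) * (320 * M * exp z.re + 512000 * M * exp (-(T / 2)) * (6 * exp (2 * z.re))) :=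
          mul_le_mul (hφ.upper z hz h1 h2) hwb (norm_nonneg _) (by positivity)
      _ = M * (6400 * (exp (-z.re) * exp z.re) + 61440000 * ((exp (-z.re) * exp z.re) * (exp (-(T / 2)) * exp z.re))) := by
          rw [two_mul z.re, Real.exp_add]; ring
      _ ≤ M * (6400 * 1 + 61440000 * (1 * 1)) := by rw [e1]; gcongr
      _ ≤ _ := by nlinarith
  · have hφd : ∀ z ∈ strip ρ, HasDerivAt φ (deriv φ z) z := fun z hz =>
      (hφ.cell.diff.differentiableAt (ho.mem_nhds hz)).hasDerivAt
    have hφdd : ∀ z ∈ strip ρ, HasDerivAt (deriv φ) (deriv (deriv φ) z) z := fun z hz =>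
      ((hφ.cell.diff.deriv ho).differentiableAt (ho.mem_nhds hz)).hasDerivAt
    have h1 : deriv (fun z => φ z * w z) =ᶠ[nhds z] fun z => deriv φ z * w z + (G z + C) * (φ z)⁻¹ := by
      filter_upwards [ho.mem_nhds hz] with y hy
      rw [((hφd y hy).fun_mul (hwd y hy)).deriv]
      have := hne y hy
      field_simp
    rw [h1.deriv_eq]
    have h2 := ((hφdd z hz).fun_mul (hwd z hz)).fun_add (((hGd z hz).add_const C).fun_mul ((hφd z hz).fun_inv (hne z hz)))
    rw [h2.deriv]
    have := hne z hz
    field_simp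
    ring

end Profile

/-- Periodization of `s` with real period `T`. -/
def perz (T : ℝ) (s : ℂ → ℂ) (z : ℂ) : ℂ := ∑' k : ℤ, s (z - (k * T : ℝ))

/-- Holomorphic on the strip of half-width `1`, with exponential decay. -/
structure Decay (m B : ℝ) (s : ℂ → ℂ) : Prop where
  diff : DifferentiableOn ℂ s (strip 1)
  bound : ∀ z ∈ strip 1, ‖s z‖ ≤ B * exp (-(m * |z.re|))

theorem summable_pow_natAbs {r : ℝ} (h0 : 0 ≤ r) (h1 : r < 1) : Summable fun k : ℤ => r ^ k.natAbs := by
  refine Summable.of_nat_of_neg ?_ ?_ <;> simpa using summable_geometric_of_lt_one h0 h1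

theorem hasSum_ite_pow_natAbs {r : ℝ} (h0 : 0 ≤ r) (h1 : r < 1) :
    HasSum (fun k : ℤ => if k = 0 then 0 else r ^ k.natAbs) (r / (1 - r) + r / (1 - r)) := by
  have hg := (hasSum_geometric_of_lt_one h0 h1).mul_left r
  have e : ∀ n : ℕ, r * r ^ n = r ^ (n + 1) := fun n => by rw [pow_succ]; ring
  simp only [e, ← div_eq_mul_inv] at hg
  refine HasSum.of_nat_of_neg_add_one ?_ ?_
  · refine (hasSum_nat_add_iff' 1).1 ?_
    simp only [Finset.range_one, Finset.sum_singleton, Nat.cast_zero, if_true, sub_zero]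
    have e2 : (fun n : ℕ => if ((n + 1 : ℕ) : ℤ) = 0 then 0 else r ^ ((n + 1 : ℕ) : ℤ).natAbs) = fun n => r ^ (n + 1) := by
      funext n
      rw [if_neg (by lia), Int.natAbs_natCast]
    rw [e2]; exact hg
  · have e2 : (fun n : ℕ => if -((n : ℤ) + 1) = 0 then 0 else r ^ (-((n : ℤ) + 1)).natAbs) = fun n => r ^ (n + 1) := by
      funext n
      rw [if_neg (by lia)]
      congr 1
    rw [e2]; exact hg

namespace Decay
variable {T m B : ℝ} {s s' : ℂ → ℂ}

theorem nonneg (h : Decay m B s) : 0 ≤ B := by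
  have := (norm_nonneg _).trans (h.bound 0 (by simp [mem_strip]))
  simpa using this

theorem norm_translate_le (h : Decay m B s) (hm : 0 ≤ m) (hT : 0 ≤ T) {z : ℂ} (hz : z ∈ strip 1) (k : ℤ) :
    ‖s (z - (k * T : ℝ))‖ ≤ B * exp (m * |z.re|) * exp (-(m * T)) ^ k.natAbs := by
  refine (h.bound _ ((sub_ofReal_mem_strip _).2 hz)).trans ?_
  rw [mul_assoc, ← Real.exp_nat_mul, ← Real.exp_add]
  refine mul_le_mul_of_nonneg_left (Real.exp_le_exp.2 ?_) h.nonneg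
  have h1 : |(k : ℝ) * T| = k.natAbs * T := by
    rw [abs_mul, abs_of_nonneg hT, Nat.cast_natAbs, Int.cast_abs]
  have h2 := abs_sub_abs_le_abs_sub ((k : ℝ) * T) z.re
  rw [abs_sub_comm, h1] at h2
  simp only [Complex.sub_re, Complex.ofReal_re]
  nlinarith

theorem exp_lt (hm : 1 ≤ m) (hT : 1 ≤ T) : exp (-(m * T)) ≤ 1 / 2 := by
  have h1 : 1 ≤ m * T := by nlinarith
  rw [Real.exp_neg, one_div]
  refine inv_anti₀ (by norm_num) ?_
  linarith [Real.add_one_le_exp (m * T)]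

theorem summable (h : Decay m B s) (hm : 1 ≤ m) (hT : 1 ≤ T) {z : ℂ} (hz : z ∈ strip 1) :
    Summable fun k : ℤ => s (z - (k * T : ℝ)) := by
  refine Summable.of_norm_bounded ?_ (fun k => h.norm_translate_le (by linarith) (by linarith) hz k)
  exact (summable_pow_natAbs (exp_pos _).le ((exp_lt hm hT).trans_lt (by norm_num))).mul_left _

theorem norm_perz_sub_le (h : Decay m B s) (hm : 1 ≤ m) (hT : 1 ≤ T) {z : ℂ} (hz : z ∈ strip 1) :
    ‖perz T s z - s z‖ ≤ 4 * B * exp (m * |z.re| - m * T) := by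
  have hr := exp_lt hm hT
  have hs := (hasSum_ite_pow_natAbs (exp_pos (-(m * T))).le (hr.trans_lt (by norm_num))).mul_left
    (B * exp (m * |z.re|))
  have h1 : perz T s z - s z = ∑' k : ℤ, if k = 0 then 0 else s (z - (k * T : ℝ)) := by
    rw [perz, (h.summable hm hT hz).tsum_eq_add_tsum_ite 0]
    simp
  rw [h1]
  refine (tsum_of_norm_bounded hs fun k => ?_).trans ?_
  · split_ifs with hk
    · simp
    · exact h.norm_translate_le (by linarith) (by linarith) hz k
  · have hB := h.nonneg
    rw [sub_eq_add_neg (m * |z.re|), Real.exp_add]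
    set r := exp (-(m * T))
    have hr0 : 0 < r := exp_pos _
    have : r / (1 - r) ≤ 2 * r := by
      rw [div_le_iff₀ (by linarith)]; nlinarith
    calc _ ≤ B * exp (m * |z.re|) * (2 * r + 2 * r) := by gcongr
      _ = _ := by ring

theorem hasDerivAt_perz (h : Decay m B s) (hm : 1 ≤ m) (hT : 1 ≤ T)
    (hs : ∀ z ∈ strip 1, HasDerivAt s (s' z) z) {z : ℂ} (hz : z ∈ strip 1) :
    HasDerivAt (perz T s) (perz T s' z) z := by
  set U : Set ℂ := strip 1 ∩ {w | |w.re| < |z.re| + 1} with hU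
  have hUo : IsOpen U :=
    (isOpen_strip 1).inter (isOpen_lt (continuous_abs.comp Complex.continuous_re) continuous_const)
  have hzU : z ∈ U := ⟨hz, by simp⟩
  have hsum : Summable fun k : ℤ => B * exp (m * (|z.re| + 1)) * exp (-(m * T)) ^ k.natAbs :=
    (summable_pow_natAbs (exp_pos _).le ((exp_lt hm hT).trans_lt (by norm_num))).mul_left _
  have hd : ∀ k : ℤ, ∀ w ∈ strip 1, HasDerivAt (fun w : ℂ => s (w - (k * T : ℝ))) (s' (w - (k * T : ℝ))) w :=
    fun k w hw => (hs _ ((sub_ofReal_mem_strip _).2 hw)).comp_sub_const w _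
  have hdU : ∀ k : ℤ, DifferentiableOn ℂ (fun w : ℂ => s (w - (k * T : ℝ))) U :=
    fun k w hw => (hd k w hw.1).differentiableAt.differentiableWithinAt
  have hb : ∀ k : ℤ, ∀ w ∈ U, ‖s (w - (k * T : ℝ))‖ ≤ B * exp (m * (|z.re| + 1)) * exp (-(m * T)) ^ k.natAbs := by
    intro k w hw
    refine (h.norm_translate_le (by linarith) (by linarith) hw.1 k).trans ?_
    have := h.nonneg
    have h2 : |w.re| ≤ |z.re| + 1 := le_of_lt hw.2
    have : m * |w.re| ≤ m * (|z.re| + 1) := by gcongr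
    gcongr
  have h1 := Complex.hasSum_deriv_of_summable_norm hsum hdU hUo hb hzU
  have h2 := (Complex.differentiableOn_tsum_of_summable_norm hsum hdU hUo hb).differentiableAt (hUo.mem_nhds hzU)
  have h3 := h2.hasDerivAt
  rw [← h1.tsum_eq] at h3
  have h4 : ∀ k : ℤ, deriv (fun w : ℂ => s (w - (k * T : ℝ))) z = s' (z - (k * T : ℝ)) := fun k => (hd k z hz).deriv
  simp only [h4] at h3
  exact h3

theorem perz_cell (h : Decay m B s) (hm : 1 ≤ m) (hT : 1 ≤ T) {σ : ℂ}
    (hpar : ∀ z, s (-z) = σ * s z) (hreal : ∀ z, s ((starRingEnd ℂ) z) = (starRingEnd ℂ) (s z)) :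
    CellFun T σ 1 (perz T s) := by
  refine ⟨fun z hz => ?_, fun z hz => ?_, fun z hz => ?_, fun z hz => ?_⟩
  · exact (h.hasDerivAt_perz hm hT (s' := deriv s) (fun z hz =>
      (h.diff.differentiableAt ((isOpen_strip 1).mem_nhds hz)).hasDerivAt) hz).differentiableAt.differentiableWithinAt
  · rw [perz, perz, ← (Equiv.addRight (1 : ℤ)).tsum_eq]
    refine tsum_congr fun k => ?_
    congr 1
    simp only [Equiv.coe_addRight]; push_cast; ring
  · rw [perz, perz, ← (Equiv.neg ℤ).tsum_eq, ← tsum_mul_left]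
    refine tsum_congr fun k => ?_
    rw [← hpar]
    congr 1
    simp only [Equiv.neg_apply]; push_cast; ring
  · rw [perz, perz, Complex.conj_tsum]
    refine tsum_congr fun k => ?_
    rw [← hreal, map_sub, Complex.conj_ofReal]

end Decay

theorem re_le_re_perz {T m B : ℝ} {s : ℂ → ℂ} (h : Decay m B s) (hm : 1 ≤ m) (hT : 1 ≤ T)
    (h0 : ∀ z ∈ strip 1, 0 ≤ (s z).re) {z : ℂ} (hz : z ∈ strip 1) : (s z).re ≤ (perz T s z).re := by
  have hs := h.summable hm hT hz
  have h1 : (perz T s z).re = ∑' k : ℤ, (s (z - (k * T : ℝ))).re := Complex.reCLM.map_tsum hs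
  rw [h1]
  have h2 := (Complex.reCLM.summable hs).le_tsum (0 : ℤ) fun k _ => h0 _ ((sub_ofReal_mem_strip _).2 hz)
  simpa using h2

theorem Complex.norm_cosh_le (z : ℂ) : ‖Complex.cosh z‖ ≤ Real.cosh z.re := by
  have h := norm_add_le (Complex.exp z) (Complex.exp (-z))
  rw [Complex.norm_exp, Complex.norm_exp, Complex.neg_re] at h
  rw [Complex.cosh, Real.cosh_eq, norm_div]
  simpa using div_le_div_of_nonneg_right h zero_le_two

theorem Complex.norm_sinh_le (z : ℂ) : ‖Complex.sinh z‖ ≤ Real.cosh z.re := by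
  have h := norm_sub_le (Complex.exp z) (Complex.exp (-z))
  rw [Complex.norm_exp, Complex.norm_exp, Complex.neg_re] at h
  rw [Complex.sinh, Real.cosh_eq, norm_div]
  simpa using div_le_div_of_nonneg_right h zero_le_two

theorem Complex.cosh_re_eq (z : ℂ) : (Complex.cosh z).re = Real.cosh z.re * Real.cos z.im := by
  conv_lhs => rw [← Complex.re_add_im z, Complex.cosh_add, Complex.cosh_mul_I, Complex.sinh_mul_I,
    ← Complex.ofReal_cosh, ← Complex.ofReal_sinh, ← Complex.ofReal_cos, ← Complex.ofReal_sin]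
  simp [-Complex.ofReal_cosh, -Complex.ofReal_sinh, -Complex.ofReal_cos, -Complex.ofReal_sin]

theorem half_le_cos {x : ℝ} (hx : |x| ≤ 1) : 1 / 2 ≤ Real.cos x := by
  have := Real.one_sub_sq_div_two_le_cos (x := x)
  nlinarith [abs_le.1 hx, sq_abs x, abs_nonneg x]

/-- The complex hyperbolic secant. -/
def csech (z : ℂ) : ℂ := (Complex.cosh z)⁻¹

theorem half_cosh_le {z : ℂ} (hz : z ∈ strip 1) : Real.cosh z.re / 2 ≤ (Complex.cosh z).re := by
  rw [Complex.cosh_re_eq]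
  nlinarith [half_le_cos (le_of_lt hz), Real.cosh_pos z.re]

theorem cosh_ne_zero_of_strip {z : ℂ} (hz : z ∈ strip 1) : Complex.cosh z ≠ 0 := fun h => by
  have := half_cosh_le hz
  rw [h, Complex.zero_re] at this
  linarith [Real.cosh_pos z.re]

theorem half_exp_le_cosh (x : ℝ) : exp |x| / 2 ≤ Real.cosh x := by
  rw [← Real.cosh_abs, Real.cosh_eq]
  linarith [exp_pos (-|x|)]

theorem cosh_le_exp_abs (x : ℝ) : Real.cosh x ≤ exp |x| := by
  rw [← Real.cosh_abs, Real.cosh_eq]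
  have : exp (-|x|) ≤ exp |x| := Real.exp_le_exp.2 (by linarith [abs_nonneg x])
  linarith

theorem norm_csech_le_inv {z : ℂ} (hz : z ∈ strip 1) : ‖csech z‖ ≤ 2 * (Real.cosh z.re)⁻¹ := by
  rw [csech, norm_inv]
  have h1 := (half_cosh_le hz).trans (Complex.re_le_norm _)
  have := Real.cosh_pos z.re
  refine (inv_anti₀ (by positivity) h1).trans (le_of_eq ?_)
  field_simp

theorem inv_cosh_le (x : ℝ) : (Real.cosh x)⁻¹ ≤ 2 * exp (-|x|) := by
  refine (inv_anti₀ (by positivity) (half_exp_le_cosh x)).trans (le_of_eq ?_)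
  rw [Real.exp_neg]; field_simp

theorem norm_csech_le {z : ℂ} (hz : z ∈ strip 1) : ‖csech z‖ ≤ 4 * exp (-|z.re|) := by
  linarith [norm_csech_le_inv hz, inv_cosh_le z.re]

theorem half_exp_le_re_csech {z : ℂ} (hz : z ∈ strip 1) : exp (-|z.re|) / 2 ≤ (csech z).re := by
  have hc := Real.cosh_pos z.re
  have h1 := half_cosh_le hz
  have h2 := Complex.norm_cosh_le z
  rw [csech, Complex.inv_re, Complex.normSq_eq_norm_sq]
  have hn : 0 < ‖Complex.cosh z‖ := norm_pos_iff.2 (cosh_ne_zero_of_strip hz)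
  rw [le_div_iff₀ (by positivity)]
  have h3 : exp (-|z.re|) * Real.cosh z.re ≤ 1 := by
    have := cosh_le_exp_abs z.re
    calc exp (-|z.re|) * Real.cosh z.re ≤ exp (-|z.re|) * exp |z.re| := by gcongr
      _ = 1 := by rw [← Real.exp_add]; simp
  calc exp (-|z.re|) / 2 * ‖Complex.cosh z‖ ^ 2 ≤ exp (-|z.re|) / 2 * Real.cosh z.re ^ 2 := by gcongr
    _ = (exp (-|z.re|) * Real.cosh z.re) * (Real.cosh z.re / 2) := by ring
    _ ≤ 1 * (Real.cosh z.re / 2) := by gcongr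
    _ ≤ _ := by linarith

theorem csech_neg (z : ℂ) : csech (-z) = 1 * csech z := by simp [csech, Complex.cosh_neg]

theorem csech_conj (z : ℂ) : csech ((starRingEnd ℂ) z) = (starRingEnd ℂ) (csech z) := by
  simp [csech, Complex.cosh_conj]

theorem hasDerivAt_csech {z : ℂ} (hz : z ∈ strip 1) :
    HasDerivAt csech (-(Complex.sinh z * csech z ^ 2)) z := by
  refine ((Complex.hasDerivAt_cosh z).fun_inv (cosh_ne_zero_of_strip hz)).congr_deriv ?_
  rw [csech]; field_simp

theorem hasDerivAt_neg_sinh_mul_csech_sq {z : ℂ} (hz : z ∈ strip 1) :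
    HasDerivAt (fun z => -(Complex.sinh z * csech z ^ 2)) (csech z - 2 * csech z ^ 3) z := by
  refine ((Complex.hasDerivAt_sinh z).fun_mul ((hasDerivAt_csech hz).fun_pow 2)).fun_neg.congr_deriv ?_
  have h1 := Complex.cosh_sq z
  have h2 : csech z * Complex.cosh z = 1 := inv_mul_cancel₀ (cosh_ne_zero_of_strip hz)
  push_cast
  linear_combination (2 * csech z ^ 3) * (-h1) + (csech z * (-1 + 2 * (csech z * Complex.cosh z) + 2)) * h2

theorem decay_csech : Decay 1 4 csech :=
  ⟨fun _ hz => (hasDerivAt_csech hz).differentiableAt.differentiableWithinAt, fun _ hz => by simpa using norm_csech_le hz⟩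

theorem decay_deriv_csech : Decay 1 8 (fun z => -(Complex.sinh z * csech z ^ 2)) := by
  refine ⟨fun z hz => (hasDerivAt_neg_sinh_mul_csech_sq hz).differentiableAt.differentiableWithinAt, fun z hz => ?_⟩
  rw [norm_neg, norm_mul, norm_pow]
  have hc := Real.cosh_pos z.re
  calc _ ≤ Real.cosh z.re * (2 * (Real.cosh z.re)⁻¹) ^ 2 := by
        gcongr
        · exact Complex.norm_sinh_le z
        · exact norm_csech_le_inv hz
    _ = 4 * (Real.cosh z.re)⁻¹ := by field_simp; norm_num
    _ ≤ 8 * exp (-|z.re|) := by linarith [inv_cosh_le z.re]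
    _ = _ := by rw [one_mul]

theorem decay_csech_cube : Decay 3 64 (fun z => csech z ^ 3) := by
  refine ⟨fun z hz => ((hasDerivAt_csech hz).fun_pow 3).differentiableAt.differentiableWithinAt, fun z hz => ?_⟩
  rw [norm_pow]
  calc _ ≤ (4 * exp (-|z.re|)) ^ 3 := by gcongr; exact norm_csech_le hz
    _ = _ := by rw [mul_pow, ← Real.exp_nat_mul]; norm_num

/-- The periodized separatrix velocity (up to a factor `2`). -/
def phi (T : ℝ) : ℂ → ℂ := perz T csech

theorem profile_phi {T : ℝ} (hT : 1 ≤ T) : Profile T 1 (phi T) := by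
  refine ⟨decay_csech.perz_cell le_rfl hT csech_neg csech_conj, fun z hz h1 h2 => ?_, fun z hz h1 h2 => ?_⟩
  · have := half_exp_le_re_csech hz
    rw [abs_of_nonneg h1] at this
    exact this.trans (re_le_re_perz decay_csech le_rfl hT
      (fun z hz => (by positivity : 0 ≤ exp (-|z.re|) / 2).trans (half_exp_le_re_csech hz)) hz)
  · have e1 := decay_csech.norm_perz_sub_le le_rfl hT hz
    have e2 := norm_csech_le hz
    rw [abs_of_nonneg h1] at e1 e2
    have e3 := norm_add_le (perz T csech z - csech z) (csech z)
    rw [sub_add_cancel] at e3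
    have : exp (1 * z.re - 1 * T) ≤ exp (-z.re) := Real.exp_le_exp.2 (by linarith)
    rw [phi]; linarith

theorem hasDerivAt_phi (hT : 1 ≤ T) {z : ℂ} (hz : z ∈ strip 1) :
    HasDerivAt (phi T) (perz T (fun z => -(Complex.sinh z * csech z ^ 2)) z) z :=
  decay_csech.hasDerivAt_perz le_rfl hT (fun _ hz => hasDerivAt_csech hz) hz

theorem deriv_deriv_phi (hT : 1 ≤ T) {z : ℂ} (hz : z ∈ strip 1) :
    deriv (deriv (phi T)) z = phi T z - 2 * perz T (fun z => csech z ^ 3) z := by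
  have h1 : deriv (phi T) =ᶠ[nhds z] perz T (fun z => -(Complex.sinh z * csech z ^ 2)) := by
    filter_upwards [(isOpen_strip 1).mem_nhds hz] with w hw using (hasDerivAt_phi hT hw).deriv
  rw [h1.deriv_eq, (decay_deriv_csech.hasDerivAt_perz le_rfl hT (fun _ hz => hasDerivAt_neg_sinh_mul_csech_sq hz) hz).deriv]
  have s1 := decay_csech.summable le_rfl hT hz
  have s2 := (decay_csech_cube.summable (by norm_num) hT hz).mul_left 2
  rw [phi, perz, perz, perz, s1.tsum_sub s2, tsum_mul_left]

theorem CellFun.deriv {T ρ : ℝ} {σ : ℂ} {f : ℂ → ℂ} (hf : CellFun T σ ρ f) : CellFun T (-σ) ρ (deriv f) := by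
  refine ⟨hf.diff.deriv (isOpen_strip ρ), fun z hz => ?_, fun z hz => ?_, fun z hz => deriv_conj_of_strip hf.real hz⟩
  · have : (fun w => f (w + T)) =ᶠ[nhds z] f := by
      filter_upwards [(isOpen_strip ρ).mem_nhds hz] with w hw using hf.per w hw
    rw [← deriv_comp_add_const]
    exact this.deriv_eq
  · have : (fun w => f (-w)) =ᶠ[nhds z] fun w => σ * f w := by
      filter_upwards [(isOpen_strip ρ).mem_nhds hz] with w hw using hf.par w hw
    have h1 := this.deriv_eq
    rw [deriv_comp_neg, deriv_const_mul _ (hf.diff.differentiableAt ((isOpen_strip ρ).mem_nhds hz))] at h1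
    linear_combination -h1

/-- Odd holomorphic lifts of degree-one circle maps, real on the real axis, in the time variable. -/
structure QuasiFun (T ρ : ℝ) (X : ℂ → ℂ) : Prop where
  diff : DifferentiableOn ℂ X (strip ρ)
  per : ∀ z ∈ strip ρ, X (z + T) = X z + (2 * π : ℝ)
  par : ∀ z ∈ strip ρ, X (-z) = -X z
  real : ∀ z ∈ strip ρ, X ((starRingEnd ℂ) z) = (starRingEnd ℂ) (X z)

/-- The second difference quotient. -/
def secDiff (h : ℝ) (f : ℂ → ℂ) (z : ℂ) : ℂ := (f (z + h) - 2 * f z + f (z - h)) / h ^ 2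

namespace QuasiFun
variable {T ρ : ℝ} {X v : ℂ → ℂ}

theorem mono (h : QuasiFun T ρ X) {ρ' : ℝ} (hρ : ρ' ≤ ρ) : QuasiFun T ρ' X :=
  ⟨h.diff.mono (strip_mono hρ), fun z hz => h.per z (strip_mono hρ hz), fun z hz => h.par z (strip_mono hρ hz),
    fun z hz => h.real z (strip_mono hρ hz)⟩

theorem add_cell (hX : QuasiFun T ρ X) (hv : CellFun T (-1) ρ v) : QuasiFun T ρ (fun z => X z + v z) :=
  ⟨hX.diff.fun_add hv.diff, fun z hz => by rw [hX.per z hz, hv.per z hz]; ring,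
    fun z hz => by rw [hX.par z hz, hv.par z hz]; ring,
    fun z hz => by rw [hX.real z hz, hv.real z hz, map_add]⟩

theorem sin (hX : QuasiFun T ρ X) : CellFun T (-1) ρ (fun z => Complex.sin (X z)) :=
  ⟨fun z hz => (hX.diff z hz).csin, fun z hz => by
      rw [hX.per z hz]; push_cast; rw [Complex.sin_add_two_pi],
    fun z hz => by rw [hX.par z hz, Complex.sin_neg]; ring,
    fun z hz => by rw [hX.real z hz, Complex.sin_conj]⟩

theorem cos (hX : QuasiFun T ρ X) : CellFun T 1 ρ (fun z => Complex.cos (X z)) :=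
  ⟨fun z hz => (hX.diff z hz).ccos, fun z hz => by
      rw [hX.per z hz]; push_cast; rw [Complex.cos_add_two_pi],
    fun z hz => by rw [hX.par z hz, Complex.cos_neg]; ring,
    fun z hz => by rw [hX.real z hz, Complex.cos_conj]⟩

theorem deriv (hX : QuasiFun T ρ X) : CellFun T 1 ρ (deriv X) := by
  refine ⟨hX.diff.deriv (isOpen_strip ρ), fun z hz => ?_, fun z hz => ?_, fun z hz => deriv_conj_of_strip hX.real hz⟩
  · have : (fun w => X (w + T)) =ᶠ[nhds z] fun w => X w + (2 * π : ℝ) := by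
      filter_upwards [(isOpen_strip ρ).mem_nhds hz] with w hw using hX.per w hw
    rw [← deriv_comp_add_const, this.deriv_eq, deriv_add_const]
  · have : (fun w => X (-w)) =ᶠ[nhds z] fun w => -X w := by
      filter_upwards [(isOpen_strip ρ).mem_nhds hz] with w hw using hX.par w hw
    have h1 := this.deriv_eq
    rw [deriv_comp_neg, deriv.fun_neg] at h1
    linear_combination -h1

theorem secDiff (hX : QuasiFun T ρ X) (h : ℝ) : CellFun T (-1) ρ (secDiff h X) := by
  have hp : ∀ z ∈ strip ρ, z + h ∈ strip ρ := fun z hz => (add_ofReal_mem_strip h).2 hz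
  have hm : ∀ z ∈ strip ρ, z - h ∈ strip ρ := fun z hz => (sub_ofReal_mem_strip h).2 hz
  refine ⟨?_, fun z hz => ?_, fun z hz => ?_, fun z hz => ?_⟩
  · exact (((hX.diff.comp (by fun_prop) hp).sub (hX.diff.const_mul 2)).add
      (hX.diff.comp (by fun_prop) hm)).div_const _
  · rw [_root_.secDiff, _root_.secDiff, add_right_comm, add_sub_right_comm, hX.per _ (hp z hz), hX.per _ (hm z hz), hX.per z hz]
    ring
  · rw [_root_.secDiff, _root_.secDiff, show -z + h = -(z - h) by ring, show -z - h = -(z + h) by ring,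
      hX.par _ (hp z hz), hX.par _ (hm z hz), hX.par z hz]
    ring
  · rw [_root_.secDiff, _root_.secDiff, map_div₀, map_add, map_sub, map_mul, ← hX.real z hz, ← hX.real _ (hp z hz), ← hX.real _ (hm z hz)]
    simp [map_ofNat]

theorem im_eq_zero (hX : QuasiFun T ρ X) (hρ : 0 < ρ) (x : ℝ) : (X x).im = 0 := by
  have := hX.real x (ofReal_mem_strip hρ x)
  rw [Complex.conj_ofReal] at this
  exact Complex.conj_eq_iff_im.1 this.symm

end QuasiFun

theorem convex_abs_im_le_one : Convex ℝ {z : ℂ | |z.im| ≤ 1} := by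
  have : {z : ℂ | |z.im| ≤ 1} = Complex.imLm ⁻¹' (Icc (-1) 1) := by
    ext z; simp [abs_le]
  rw [this]
  exact (convex_Icc _ _).linear_preimage _

theorem exp_abs_im_le {z : ℂ} (hz : |z.im| ≤ 1) : exp |z.im| ≤ 3 := by
  have h1 : exp |z.im| ≤ exp 1 := Real.exp_le_exp.2 hz
  linarith [Real.exp_one_lt_d9]

theorem Complex.norm_sin_sub_sin_le {x y : ℂ} (hx : |x.im| ≤ 1) (hy : |y.im| ≤ 1) :
    ‖Complex.sin x - Complex.sin y‖ ≤ 3 * ‖x - y‖ :=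
  convex_abs_im_le_one.norm_image_sub_le_of_norm_hasDerivWithin_le
    (fun z _ => (Complex.hasDerivAt_sin z).hasDerivWithinAt)
    (fun z hz => (Complex.norm_cos_le_exp z).trans (exp_abs_im_le hz)) hy hx

theorem Complex.norm_cos_sub_cos_le {x y : ℂ} (hx : |x.im| ≤ 1) (hy : |y.im| ≤ 1) :
    ‖Complex.cos x - Complex.cos y‖ ≤ 3 * ‖x - y‖ :=
  convex_abs_im_le_one.norm_image_sub_le_of_norm_hasDerivWithin_le
    (fun z _ => (Complex.hasDerivAt_cos z).hasDerivWithinAt)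
    (fun z hz => by rw [norm_neg]; exact (Complex.norm_sin_le_exp z).trans (exp_abs_im_le hz)) hy hx

theorem IsPrim.cos_sin_eq {K : ℂ → ℂ} (hK : IsPrim 1 (fun z => 2 * csech z) K) {z : ℂ} (hz : z ∈ strip 1) :
    Complex.cos (K z) = 2 * csech z ^ 2 - 1 ∧ Complex.sin (K z) = 2 * (Complex.sinh z * csech z ^ 2) := by
  set c : ℂ → ℂ := fun z => 2 * csech z ^ 2 - 1 with hc
  set s : ℂ → ℂ := fun z => 2 * (Complex.sinh z * csech z ^ 2) with hs
  have hcd : ∀ z ∈ strip 1, HasDerivAt c (-(2 * csech z) * s z) z := fun z hz => by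
    refine ((((hasDerivAt_csech hz).fun_pow 2).const_mul 2).sub_const 1).congr_deriv ?_
    simp only [s]; push_cast; ring
  have hsd : ∀ z ∈ strip 1, HasDerivAt s (2 * csech z * c z) z := fun z hz => by
    have h := (hasDerivAt_neg_sinh_mul_csech_sq hz).const_mul (-2)
    have h2 : s = fun z => -2 * -(Complex.sinh z * csech z ^ 2) := by funext w; simp only [s]; ring
    rw [h2]
    refine h.congr_deriv ?_
    simp only [c]; ring
  have hsq : ∀ z ∈ strip 1, c z ^ 2 + s z ^ 2 = 1 := fun z hz => by
    have h1 := Complex.cosh_sq z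
    have h2 : csech z * Complex.cosh z = 1 := inv_mul_cancel₀ (cosh_ne_zero_of_strip hz)
    simp only [c, s]
    linear_combination (-4 * csech z ^ 4) * h1 + 4 * csech z ^ 2 * (csech z * Complex.cosh z + 1) * h2
  have hE : ∀ z ∈ strip 1, HasDerivAt (fun z => Complex.exp (-(Complex.I * K z)) * (c z + Complex.I * s z)) 0 z := by
    intro z hz
    have h1 := (((hK.hasDerivAt z hz).const_mul Complex.I).fun_neg).cexp.fun_mul ((hcd z hz).fun_add ((hsd z hz).const_mul Complex.I))
    refine h1.congr_deriv ?_
    linear_combination (-2 * csech z * s z * Complex.exp (-(Complex.I * K z))) * Complex.I_sq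
  have h0 : (0 : ℂ) ∈ strip 1 := by simp [mem_strip]
  have h1 := IsPrim.eq_of_hasDerivAt hE (G := fun _ => 1) (fun z _ => hasDerivAt_const z (1 : ℂ)) h0
    (by simp [hK.zero, c, s, csech]; norm_num) hz
  have hexp : Complex.exp (-(Complex.I * K z)) * Complex.exp (Complex.I * K z) = 1 := by
    rw [← Complex.exp_add]; simp
  have e1 : Complex.exp (Complex.I * K z) = c z + Complex.I * s z := by
    linear_combination (-Complex.exp (Complex.I * K z)) * h1 + (c z + Complex.I * s z) * hexp
  have e2 : Complex.exp (-(Complex.I * K z)) = c z - Complex.I * s z := by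
    linear_combination (c z - Complex.I * s z) * h1 - Complex.exp (-(Complex.I * K z)) * (hsq z hz)
      + Complex.exp (-(Complex.I * K z)) * s z ^ 2 * Complex.I_sq
  constructor
  · rw [Complex.cos, show K z * Complex.I = Complex.I * K z by ring, show -K z * Complex.I = -(Complex.I * K z) by ring, e1, e2]
    simp only [c]; ring
  · rw [Complex.sin, show K z * Complex.I = Complex.I * K z by ring, show -K z * Complex.I = -(Complex.I * K z) by ring, e1, e2]
    linear_combination (-s z) * Complex.I_sq

theorem IsPrim.csech_ofReal {K : ℂ → ℂ} (hK : IsPrim 1 (fun z => 2 * csech z) K) (t : ℝ) :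
    K t = (2 * arctan (Real.sinh t) : ℝ) := by
  have hd : ∀ t : ℝ, HasDerivAt (fun t : ℝ => K t - ((2 * arctan (Real.sinh t) : ℝ) : ℂ)) 0 t := fun t => by
    have h1 := (hK.hasDerivAt t (ofReal_mem_strip one_pos t)).comp_ofReal
    have h2 := (((Real.hasDerivAt_sinh t).arctan).const_mul 2).ofReal_comp
    refine (h1.fun_sub h2).congr_deriv ?_
    rw [csech, add_comm 1, ← Real.cosh_sq]
    have : (Complex.cosh t) ≠ 0 := cosh_ne_zero_of_strip (ofReal_mem_strip one_pos t)
    push_cast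
    field_simp
    ring
  have := is_const_of_deriv_eq_zero (fun t => (hd t).differentiableAt) (fun t => (hd t).deriv) t 0
  simp only [Complex.ofReal_zero, hK.zero, Real.sinh_zero, arctan_zero, mul_zero, sub_zero] at this
  exact sub_eq_zero.1 this

theorem tendsto_two_mul_arctan_sinh : Tendsto (fun T : ℝ => 2 * arctan (Real.sinh (T / 2))) atTop (nhds π) := by
  have h1 : Tendsto Real.sinh atTop atTop := by
    refine tendsto_atTop_mono' atTop ?_ tendsto_id
    filter_upwards [eventually_ge_atTop 0] with x hx using Real.self_le_sinh_iff.2 hx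
  have h2 : Tendsto (fun T : ℝ => T / 2) atTop atTop := tendsto_id.atTop_div_const two_pos
  have h3 := ((tendsto_nhds_of_tendsto_nhdsWithin tendsto_arctan_atTop).comp (h1.comp h2)).const_mul 2
  rw [show (2 : ℝ) * (π / 2) = π by ring] at h3
  exact h3

theorem norm_le_of_half_cell_sub {F : ℂ → ℂ} {f : ℂ → ℂ} {M A : ℝ} (hM : 0 ≤ M) (h0 : F 0 = 0)
    (hF : ∀ z ∈ strip 1, HasDerivAt F (f z) z)
    (hf : ∀ z ∈ strip 1, 0 ≤ z.re → z.re ≤ A → ‖f z‖ ≤ M * exp (z.re - 2 * A)) {z : ℂ}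
    (hz : z ∈ strip 1) (h1 : 0 ≤ z.re) (h2 : z.re ≤ A) : ‖F z‖ ≤ 2 * M * exp (-A) := by
  have e1 := norm_sub_re_le_of_strip hF hz (C := M * exp (z.re - 2 * A)) fun w hw hwr => by
    rw [← hwr] at h1 h2 ⊢; exact hf w hw h1 h2
  have e2 := norm_sub_le_of_strip one_pos hF h1 (B := fun t => M * exp (t - 2 * A)) (b := fun t => M * exp (t - 2 * A))
    (fun t => by
      have := (((hasDerivAt_id t).sub_const (2 * A)).exp).const_mul M
      refine this.congr_deriv ?_; simp)
    (fun t ht => by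
      have := hf t (ofReal_mem_strip one_pos t) (by simpa using ht.1) (by simpa using ht.2.trans h2)
      simpa using this)
  rw [Complex.ofReal_zero, h0, sub_zero] at e2
  have e4 := norm_add_le (F z - F (z.re : ℝ)) (F (z.re : ℝ))
  rw [sub_add_cancel] at e4
  have : M * exp (z.re - 2 * A) * |z.im| ≤ M * exp (z.re - 2 * A) * 1 :=
    mul_le_mul_of_nonneg_left (le_of_lt hz) (by positivity)
  have : 0 ≤ M * exp (0 - 2 * A) := by positivity
  have : M * exp (z.re - 2 * A) ≤ M * exp (-A) :=
    mul_le_mul_of_nonneg_left (Real.exp_le_exp.2 (by linarith)) hM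
  linarith

/-- `X` is a lift of a rotation of the pendulum `X'' = -sin X` up to an error `η`, close to the
separatrix. -/
structure PendApprox (T η : ℝ) (X : ℂ → ℂ) : Prop where
  quasi : QuasiFun T 1 X
  deriv_le : ∀ z ∈ strip 1, ‖deriv X z‖ ≤ 80
  pot : ∀ z ∈ strip (1 / 200), ‖deriv (deriv (phi T)) z / phi T z + Complex.cos (X z)‖ ≤ η
  eqn : ∀ z ∈ strip (1 / 200), ‖deriv (deriv X) z + Complex.sin (X z)‖ ≤ η
  deriv_ge : ∀ t : ℝ, |t| ≤ 3 → 1 / 25 ≤ (deriv X t).re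
  cos_le : ∀ t : ℝ, 2 ≤ t → t ≤ T - 2 → (Complex.cos (X t)).re ≤ -(1 / 2)

theorem QuasiFun.abs_im_le {T ρ C : ℝ} {X : ℂ → ℂ} (hX : QuasiFun T ρ X) (hC : ∀ z ∈ strip ρ, ‖_root_.deriv X z‖ ≤ C)
    {z : ℂ} (hz : z ∈ strip ρ) : |(X z).im| ≤ C * |z.im| := by
  have h1 := norm_sub_re_le_of_strip (fun z hz => (hX.diff.differentiableAt ((isOpen_strip ρ).mem_nhds hz)).hasDerivAt)
    hz fun w hw _ => hC w hw
  have h2 := Complex.abs_im_le_norm (X z - X (z.re : ℝ))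
  rw [Complex.sub_im, hX.im_eq_zero ((abs_nonneg _).trans_lt hz), sub_zero] at h2
  exact h2.trans h1

theorem exists_pendApprox_of_small {T δ : ℝ} (hδ : δ ≤ 1 / 1000) (hT : 10 ≤ T)
    (h1 : |2 * arctan (Real.sinh (T / 2)) - π| ≤ δ / 2) (h2 : 64 * exp (-(T / 2)) ≤ δ / 2) :
    ∃ X, PendApprox T (100 * δ) X := by
  have hT1 : 1 ≤ T := by linarith
  have hT0 : 0 < T := by linarith
  have hδ0 : 0 < δ := by linarith [exp_pos (-(T / 2))]
  have ho := isOpen_strip 1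
  have hφ := profile_phi hT1
  have hsub : strip (1 / 200) ⊆ strip 1 := strip_mono (by norm_num)
  obtain ⟨K, hK⟩ := exists_isPrim (ρ := 1) (f := fun z => 2 * csech z) (decay_csech.diff.const_mul 2)
  obtain ⟨Y, hY⟩ := exists_isPrim (ρ := 1) (f := fun z => 2 * phi T z) (hφ.cell.diff.const_mul 2)
  have hTm : ((T / 2 : ℝ) : ℂ) ∈ strip 1 := ofReal_mem_strip one_pos _
  have hYpar : ∀ z ∈ strip 1, Y (-z) = -Y z := fun z hz => by
    simpa using hY.neg_eq one_pos (σ := 1) (by norm_num) (fun z hz => by rw [hφ.cell.par z hz]; ring) hz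
  have hYreal : ∀ z ∈ strip 1, Y ((starRingEnd ℂ) z) = (starRingEnd ℂ) (Y z) := fun z hz =>
    hY.conj one_pos (fun z hz => by rw [hφ.cell.real z hz]; simp [map_ofNat]) hz
  have hYK : ∀ z ∈ strip 1, 0 ≤ z.re → z.re ≤ T / 2 → ‖Y z - K z‖ ≤ δ / 2 := by
    intro z hz ha hb
    have := norm_le_of_half_cell_sub (F := fun z => Y z - K z) (f := fun z => 2 * phi T z - 2 * csech z) (M := 32) (A := T / 2)
      (by norm_num) (by simp [hY.zero, hK.zero]) (fun z hz => (hY.hasDerivAt z hz).fun_sub (hK.hasDerivAt z hz))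
      (fun z hz ha _ => ?_) hz ha hb
    · linarith
    · have h := decay_csech.norm_perz_sub_le le_rfl hT1 hz
      rw [abs_of_nonneg ha, one_mul, one_mul] at h
      rw [← mul_sub, norm_mul, Complex.norm_ofNat, show z.re - 2 * (T / 2) = z.re - T by ring, phi]
      linarith
  set y : ℝ := (Y (T / 2 : ℝ)).re with hydef
  have hy : Y (T / 2 : ℝ) = (y : ℝ) := by
    have := hYreal _ hTm
    rw [Complex.conj_ofReal] at this
    exact Complex.ext rfl (by simpa using Complex.conj_eq_iff_im.1 this.symm)
  have hyπ : |y - π| ≤ δ := by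
    have h3 := hYK _ hTm (by simp; linarith) (by simp)
    rw [hy, hK.csech_ofReal, ← Complex.ofReal_sub, Complex.norm_real, Real.norm_eq_abs] at h3
    have := abs_sub_le y (2 * arctan (Real.sinh (T / 2))) π
    linarith
  have hy1 : 1 ≤ y := by linarith [(abs_le.1 hyπ).1, Real.pi_gt_three]
  set l : ℝ := π / y with hl
  have hl1 : |l - 1| ≤ δ := by
    rw [hl, div_sub_one (by linarith), abs_div, abs_of_pos (by linarith : 0 < y), abs_sub_comm]
    exact div_le_of_le_mul₀ (by linarith) hδ0.le (by nlinarith)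
  have hlb := abs_le.1 hl1
  have hln : ‖(l : ℂ)‖ ≤ 2 := by
    rw [Complex.norm_real, Real.norm_eq_abs, abs_of_nonneg] <;> linarith
  have hln1 : ‖(l : ℂ) - 1‖ ≤ δ := by
    rw [← Complex.ofReal_one, ← Complex.ofReal_sub, Complex.norm_real]; exact hl1
  set X : ℂ → ℂ := fun z => l * Y z with hXdef
  have hXd : ∀ z ∈ strip 1, HasDerivAt X (l * (2 * phi T z)) z := fun z hz => (hY.hasDerivAt z hz).const_mul _
  have hX : QuasiFun T 1 X := by
    refine ⟨fun z hz => (hXd z hz).differentiableAt.differentiableWithinAt, fun z hz => ?_, fun z hz => ?_, fun z hz => ?_⟩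
    · have := IsPrim.add_period hY.hasDerivAt one_pos (T := T) (fun z hz => by rw [hφ.cell.per z hz]) hz
      rw [Complex.ofReal_neg, hYpar _ hTm, hy] at this
      simp only [X, this, hl]
      have : (y : ℂ) ≠ 0 := by exact_mod_cast (by linarith : y ≠ 0)
      push_cast; field_simp; ring
    · simp only [X, hYpar z hz]; ring
    · simp only [X, hYreal z hz, map_mul, Complex.conj_ofReal]
  have hdX : ∀ z ∈ strip 1, deriv X z = l * (2 * phi T z) := fun z hz => (hXd z hz).deriv
  have hdXb : ∀ z ∈ strip 1, ‖deriv X z‖ ≤ 80 := by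
    intro z hz
    refine hX.deriv.norm_le (by simp) hT0 (fun z hz ha hb => ?_) hz
    rw [hdX z hz, norm_mul, norm_mul, Complex.norm_ofNat]
    have h3 := hφ.upper z hz ha hb
    have h4 : exp (-z.re) ≤ 1 := by rw [Real.exp_le_one_iff]; linarith
    calc ‖(l : ℂ)‖ * (2 * ‖phi T z‖) ≤ 2 * (2 * (20 * 1)) := by gcongr; linarith
      _ = 80 := by norm_num
  have hXim : ∀ z ∈ strip (1 / 200), |(X z).im| ≤ 1 := by
    intro z hz
    have := hX.abs_im_le hdXb (hsub hz)
    rw [mem_strip] at hz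
    linarith
  have hKim : ∀ z ∈ strip (1 / 200), |(K z).im| ≤ 1 ∧ ‖K z‖ ≤ 12 := by
    intro z hz
    have e1 := norm_sub_re_le_of_strip hK.hasDerivAt (hsub hz) (C := 8) fun w hw _ => by
      have := norm_csech_le hw
      have h4 : exp (-|w.re|) ≤ 1 := by rw [Real.exp_le_one_iff]; linarith [abs_nonneg w.re]
      rw [norm_mul, Complex.norm_ofNat]; linarith
    have e2 := Complex.abs_im_le_norm (K z - K (z.re : ℝ))
    have e3 := norm_add_le (K z - K (z.re : ℝ)) (K (z.re : ℝ))
    rw [sub_add_cancel] at e3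
    rw [hK.csech_ofReal] at e1 e2 e3
    rw [Complex.sub_im, Complex.ofReal_im, sub_zero] at e2
    rw [Complex.norm_real, Real.norm_eq_abs, abs_mul, abs_two] at e3
    have e4 : |arctan (Real.sinh z.re)| ≤ 2 := by
      rw [abs_le]
      constructor <;> linarith [neg_pi_div_two_lt_arctan (Real.sinh z.re), arctan_lt_pi_div_two (Real.sinh z.re), Real.pi_lt_four]
    rw [mem_strip] at hz
    constructor <;> linarith
  have hXK : ∀ z ∈ strip (1 / 200), 0 ≤ z.re → z.re ≤ T / 2 → ‖X z - K z‖ ≤ 14 * δ := by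
    intro z hz ha hb
    have e1 := hYK z (hsub hz) ha hb
    have e2 := norm_add_le (Y z - K z) (K z)
    rw [sub_add_cancel] at e2
    have e3 : X z - K z = (l - 1) * Y z + (Y z - K z) := by simp only [X]; ring
    have e4 : ‖Y z‖ ≤ 13 := by linarith [(hKim z hz).2]
    rw [e3]
    refine (norm_add_le _ _).trans ?_
    rw [norm_mul]
    have : ‖(l : ℂ) - 1‖ * ‖Y z‖ ≤ δ * 13 := by gcongr
    linarith
  have hcos : ∀ z ∈ strip (1 / 200), 0 ≤ z.re → z.re ≤ T / 2 → ‖Complex.cos (X z) - Complex.cos (K z)‖ ≤ 42 * δ :=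
    fun z hz ha hb => (Complex.norm_cos_sub_cos_le (hXim z hz) (hKim z hz).1).trans (by linarith [hXK z hz ha hb])
  have hsin : ∀ z ∈ strip (1 / 200), 0 ≤ z.re → z.re ≤ T / 2 → ‖Complex.sin (X z) - Complex.sin (K z)‖ ≤ 42 * δ :=
    fun z hz ha hb => (Complex.norm_sin_sub_sin_le (hXim z hz) (hKim z hz).1).trans (by linarith [hXK z hz ha hb])
  have hne : ∀ z ∈ strip 1, phi T z ≠ 0 := fun z hz => hφ.ne_zero hT0 hz
  refine ⟨X, hX, hdXb, fun z hz => ?_, fun z hz => ?_, fun t ht => ?_, fun t ht1 ht2 => ?_⟩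
  · have hcell : CellFun T 1 (1 / 200) (fun z => deriv (deriv (phi T)) z * (phi T z)⁻¹ + Complex.cos (X z)) := by
      refine CellFun.mono (ρ := 1) ?_ (by norm_num)
      have := hφ.cell.deriv.deriv.mul (hφ.cell.inv hne)
      rw [neg_neg, one_mul] at this
      exact this.add hX.cos
    have := hcell.norm_le (by simp) hT0 (M := 100 * δ) (fun z hz ha hb => ?_) hz
    · simpa [div_eq_mul_inv] using this
    have hz1 := hsub hz
    have hφ0 := hne z hz1
    set P := perz T (fun z => csech z ^ 3) z with hP
    have e1 : deriv (deriv (phi T)) z * (phi T z)⁻¹ + Complex.cos (X z) =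
        2 * (csech z ^ 2 * (phi T z - csech z) - (P - csech z ^ 3)) * (phi T z)⁻¹ + (Complex.cos (X z) - Complex.cos (K z)) := by
      rw [deriv_deriv_phi hT1 hz1, (hK.cos_sin_eq hz1).1, ← hP]
      field_simp; ring
    rw [e1]
    have b1 := decay_csech.norm_perz_sub_le le_rfl hT1 hz1
    have b2 := decay_csech_cube.norm_perz_sub_le (by norm_num) hT1 hz1
    have b3 := norm_csech_le hz1
    have b4 : ‖(phi T z)⁻¹‖ ≤ 2 * exp z.re := by
      rw [norm_inv]
      refine inv_le_of_inv_le₀ (by positivity) (le_trans (le_of_eq ?_) (hφ.norm_lower hz1 ha hb))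
      rw [mul_inv, Real.exp_neg]; ring
    rw [abs_of_nonneg ha] at b1 b2 b3
    have hE : 2048 * exp (-T) ≤ 16 * δ := by
      have : exp (-T) ≤ exp (-(T / 2)) := Real.exp_le_exp.2 (by linarith)
      linarith
    have b5 : ‖2 * (csech z ^ 2 * (phi T z - csech z) - (P - csech z ^ 3)) * (phi T z)⁻¹‖ ≤ 2048 * exp (-T) := by
      rw [norm_mul, norm_mul, Complex.norm_ofNat]
      have c1 : ‖csech z ^ 2 * (phi T z - csech z) - (P - csech z ^ 3)‖ ≤
          (4 * exp (-z.re)) ^ 2 * (4 * 4 * exp (1 * z.re - 1 * T)) + 4 * 64 * exp (3 * z.re - 3 * T) := by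
        refine (norm_sub_le _ _).trans (add_le_add ?_ b2)
        rw [norm_mul, norm_pow]
        exact mul_le_mul (by gcongr) b1 (norm_nonneg _) (by positivity)
      calc _ ≤ 2 * ((4 * exp (-z.re)) ^ 2 * (4 * 4 * exp (1 * z.re - 1 * T)) + 4 * 64 * exp (3 * z.re - 3 * T)) * (2 * exp z.re) := by gcongr
        _ = 1024 * (exp (-z.re) ^ 2 * exp (1 * z.re - 1 * T) * exp z.re) + 1024 * (exp (3 * z.re - 3 * T) * exp z.re) := by ring
        _ = 1024 * exp (-T) + 1024 * exp (4 * z.re - 3 * T) := by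
            rw [← Real.exp_nat_mul, ← Real.exp_add, ← Real.exp_add, ← Real.exp_add]
            congr 3 <;> push_cast <;> ring
        _ ≤ 1024 * exp (-T) + 1024 * exp (-T) := by
            gcongr; linarith
        _ = _ := by ring
    refine (norm_add_le _ _).trans ?_
    linarith [hcos z hz ha hb]
  · have hcell : CellFun T (-1) (1 / 200) (fun z => deriv (deriv X) z + Complex.sin (X z)) :=
      CellFun.mono (ρ := 1) (hX.deriv.deriv.add hX.sin) (by norm_num)
    refine hcell.norm_le (by simp) hT0 (fun z hz ha hb => ?_) hz
    have hz1 := hsub hz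
    have hdd : deriv (deriv X) z = l * (2 * perz T (fun z => -(Complex.sinh z * csech z ^ 2)) z) := by
      have h3 : deriv X =ᶠ[nhds z] fun z => l * (2 * phi T z) := by
        filter_upwards [ho.mem_nhds hz1] with w hw using hdX w hw
      rw [h3.deriv_eq]
      exact (((hasDerivAt_phi hT1 hz1).const_mul 2).const_mul (l : ℂ)).deriv
    have b1 := decay_deriv_csech.norm_perz_sub_le le_rfl hT1 hz1
    have b2 := decay_deriv_csech.bound z hz1
    rw [abs_of_nonneg ha] at b1 b2
    set p := perz T (fun z => -(Complex.sinh z * csech z ^ 2)) z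
    set p₀ := -(Complex.sinh z * csech z ^ 2) with hp₀
    have e1 : deriv (deriv X) z + Complex.sin (X z) = 2 * ((l - 1) * p) + 2 * (p - p₀) + (Complex.sin (X z) - Complex.sin (K z)) := by
      rw [hdd, (hK.cos_sin_eq hz1).2, hp₀]; ring
    have h3 : exp (1 * z.re - 1 * T) ≤ exp (-(T / 2)) := Real.exp_le_exp.2 (by linarith)
    have h4 : exp (-(1 * z.re)) ≤ 1 := by rw [Real.exp_le_one_iff]; linarith
    have h5 := norm_add_le (p - p₀) p₀
    rw [sub_add_cancel] at h5
    have h6 : ‖p‖ ≤ 9 := by linarith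
    rw [e1]
    refine (norm_add₃_le).trans ?_
    rw [norm_mul, norm_mul, norm_mul, Complex.norm_ofNat]
    have h7 : ‖(l : ℂ) - 1‖ * ‖p‖ ≤ δ * 9 := by gcongr
    linarith [hsin z hz ha hb]
  · have hcell := hX.deriv
    have key : ∀ s : ℝ, 0 ≤ s → s ≤ 3 → 1 / 25 ≤ (deriv X s).re := by
      intro s hs0 hs3
      rw [hdX _ (ofReal_mem_strip one_pos s)]
      have h3 := hφ.lower s (ofReal_mem_strip one_pos s) (by simpa using hs0) (by simp; linarith)
      rw [Complex.ofReal_re] at h3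
      have h4 : ((l : ℂ) * (2 * phi T s)).re = l * (2 * (phi T s).re) := by
        rw [Complex.re_ofReal_mul]; simp
      rw [h4]
      have h5 : 1 / 21 ≤ exp (-s) := by
        have h6 : exp (-3) ≤ exp (-s) := Real.exp_le_exp.2 (by linarith)
        refine le_trans ?_ h6
        rw [Real.exp_neg, one_div]
        refine inv_anti₀ (exp_pos _) ?_
        have h7 := Real.exp_one_lt_d9
        calc exp 3 = exp 1 ^ 3 := by rw [← Real.exp_nat_mul]; norm_num
          _ ≤ 2.7182818286 ^ 3 := by gcongr
          _ ≤ 21 := by norm_num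
      nlinarith
    rcases le_total 0 t with h0 | h0
    · exact key t h0 (le_trans (le_abs_self t) ht)
    · have := key (-t) (by linarith) (le_trans (neg_le_abs t) ht)
      rwa [Complex.ofReal_neg, hcell.par _ (ofReal_mem_strip one_pos t), one_mul] at this
  · have key : ∀ s : ℝ, 2 ≤ s → s ≤ T / 2 → (Complex.cos (X s)).re ≤ -(1 / 2) := by
      intro s hs1 hs2
      have h3 := hcos s (ofReal_mem_strip (by norm_num) s) (by simp; linarith) (by simpa using hs2)
      have h4 := (Complex.re_le_norm _).trans h3
      rw [(hK.cos_sin_eq (ofReal_mem_strip one_pos s)).1] at h4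
      have h5 : csech (s : ℂ) = ((Real.cosh s)⁻¹ : ℝ) := by rw [csech]; push_cast; rfl
      have h6 : 2 * csech (s : ℂ) ^ 2 - 1 = ((2 * (Real.cosh s)⁻¹ ^ 2 - 1 : ℝ) : ℂ) := by rw [h5]; push_cast; rfl
      rw [h6, Complex.sub_re, Complex.ofReal_re] at h4
      have h7 : (Real.cosh s)⁻¹ ≤ 1 / 3 := by
        rw [one_div]
        refine inv_anti₀ (by norm_num) (le_trans ?_ (half_exp_le_cosh s))
        have : exp 2 ≤ exp |s| := Real.exp_le_exp.2 (hs1.trans (le_abs_self s))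
        have h8 : exp 2 = exp 1 * exp 1 := by rw [← Real.exp_add]; norm_num
        nlinarith [Real.exp_one_gt_d9]
      have h9 : (Real.cosh s)⁻¹ ^ 2 ≤ (1 / 3) ^ 2 := by
        have := Real.cosh_pos s
        gcongr
      linarith
    rcases le_total t (T / 2) with h0 | h0
    · exact key t ht1 h0
    · have h3 := key (T - t) (by linarith) (by linarith)
      have h4 := hX.cos.per (-(t : ℂ)) (neg_mem_strip.2 (ofReal_mem_strip one_pos t))
      rw [hX.par _ (ofReal_mem_strip one_pos t), Complex.cos_neg] at h4
      rw [← h4]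
      convert h3 using 5
      push_cast; ring

theorem exists_pendApprox {η : ℝ} (hη : 0 < η) : ∃ T₀ : ℝ, 10 ≤ T₀ ∧ ∀ T, T₀ ≤ T → ∃ X, PendApprox T η X := by
  set δ := min (1 / 1000) (η / 100) with hδ
  have hδ0 : 0 < δ := by positivity
  have h1 : ∀ᶠ T : ℝ in atTop, |2 * arctan (Real.sinh (T / 2)) - π| ≤ δ / 2 := by
    have := tendsto_two_mul_arctan_sinh.eventually (Metric.closedBall_mem_nhds π (half_pos hδ0))
    filter_upwards [this] with T hT
    simpa [Metric.mem_closedBall, Real.dist_eq] using hT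
  have h2 : ∀ᶠ T : ℝ in atTop, 64 * exp (-(T / 2)) ≤ δ / 2 := by
    have h3 : Tendsto (fun T : ℝ => 64 * exp (-(T / 2))) atTop (nhds (64 * 0)) :=
      (Real.tendsto_exp_neg_atTop_nhds_zero.comp (tendsto_id.atTop_div_const two_pos)).const_mul 64
    rw [mul_zero] at h3
    exact (h3.eventually (Iic_mem_nhds (half_pos hδ0)))
  obtain ⟨T₀, hT₀⟩ := eventually_atTop.1 (h1.and h2)
  refine ⟨max 10 T₀, le_max_left _ _, fun T hT => ?_⟩
  obtain ⟨a, b⟩ := hT₀ T ((le_max_right _ _).trans hT)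
  obtain ⟨X, hX⟩ := exists_pendApprox_of_small (min_le_left _ _) ((le_max_left _ _).trans hT) a b
  have hle : 100 * δ ≤ η := by linarith [min_le_right (1 / 1000) (η / 100)]
  exact ⟨X, hX.quasi, hX.deriv_le, fun z hz => (hX.pot z hz).trans hle, fun z hz => (hX.eqn z hz).trans hle,
    hX.deriv_ge, hX.cos_le⟩

theorem norm_secDiff_sub_le {ρ h M : ℝ} {v : ℂ → ℂ} (hh : 0 < h) (hv : DifferentiableOn ℂ v (strip ρ))
    (hM : ∀ z ∈ strip ρ, ‖deriv (deriv (deriv v)) z‖ ≤ M) {z : ℂ} (hz : z ∈ strip ρ) :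
    ‖secDiff h v z - deriv (deriv v) z‖ ≤ 2 * h * M := by
  have ho := isOpen_strip ρ
  have hM0 : 0 ≤ M := (norm_nonneg _).trans (hM z hz)
  have hd1 : DifferentiableOn ℂ (deriv v) (strip ρ) := hv.deriv ho
  have hd2 : DifferentiableOn ℂ (deriv (deriv v)) (strip ρ) := hd1.deriv ho
  have e0 : ∀ w ∈ strip ρ, HasDerivAt v (deriv v w) w := fun w hw =>
    (hv.differentiableAt (ho.mem_nhds hw)).hasDerivAt
  have e1 : ∀ w ∈ strip ρ, HasDerivAt (deriv v) (deriv (deriv v) w) w := fun w hw =>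
    (hd1.differentiableAt (ho.mem_nhds hw)).hasDerivAt
  have hp : ∀ s : ℝ, z + s ∈ strip ρ := fun s => (add_ofReal_mem_strip s).2 hz
  have hm : ∀ s : ℝ, z - s ∈ strip ρ := fun s => (sub_ofReal_mem_strip s).2 hz
  have hL : ∀ w ∈ strip ρ, ‖deriv (deriv v) w - deriv (deriv v) z‖ ≤ M * ‖w - z‖ := fun w hw =>
    (convex_strip ρ).norm_image_sub_le_of_norm_deriv_le
      (fun u hu => hd2.differentiableAt (ho.mem_nhds hu)) hM hz hw
  have ep : ∀ s : ℝ, HasDerivAt (fun s : ℝ => z + (s : ℂ)) 1 s := fun s =>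
    ((hasDerivAt_id (s : ℂ)).comp_ofReal).const_add z
  have em : ∀ s : ℝ, HasDerivAt (fun s : ℝ => z - (s : ℂ)) (-1) s := fun s =>
    ((hasDerivAt_id (s : ℂ)).comp_ofReal).const_sub z
  have es : ∀ s : ℝ, HasDerivAt (fun s : ℝ => (s : ℂ)) 1 s := fun s => (hasDerivAt_id (s : ℂ)).comp_ofReal
  set c := deriv (deriv v) z with hc
  have g1 : ∀ s ∈ Icc (0 : ℝ) h, ‖deriv v (z + s) - deriv v (z - s) - 2 * s * c‖ ≤ 2 * h * M * h := by
    intro s hs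
    have := (convex_Icc (0 : ℝ) h).norm_image_sub_le_of_norm_hasDerivWithin_le
      (f := fun s : ℝ => deriv v (z + s) - deriv v (z - s) - 2 * s * c)
      (f' := fun s : ℝ => deriv (deriv v) (z + s) + deriv (deriv v) (z - s) - 2 * c) (C := 2 * h * M)
      (fun x hx => by
        have a1 := (e1 _ (hp x)).comp x (ep x)
        have a2 := (e1 _ (hm x)).comp x (em x)
        exact (((a1.sub a2).sub (((es x).const_mul 2).mul_const c)).congr_deriv (by ring)).hasDerivWithinAt)
      (fun x hx => by
        have b1 := hL _ (hp x)
        have b2 := hL _ (hm x)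
        have n1 : ‖z + (x : ℂ) - z‖ = x := by
          rw [add_sub_cancel_left, Complex.norm_real, Real.norm_of_nonneg hx.1]
        have n2 : ‖z - (x : ℂ) - z‖ = x := by
          rw [sub_sub_cancel_left, norm_neg, Complex.norm_real, Real.norm_of_nonneg hx.1]
        rw [n1] at b1; rw [n2] at b2
        have : deriv (deriv v) (z + x) + deriv (deriv v) (z - x) - 2 * c =
          (deriv (deriv v) (z + x) - c) + (deriv (deriv v) (z - x) - c) := by ring
        rw [this]
        refine (norm_add_le _ _).trans ?_
        have := mul_le_mul_of_nonneg_left hx.2 hM0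
        linarith) (left_mem_Icc.2 hh.le) hs
    simp only [Complex.ofReal_zero, add_zero, sub_zero, sub_self, mul_zero, zero_mul] at this
    refine this.trans ?_
    rw [Real.norm_of_nonneg hs.1]
    exact mul_le_mul_of_nonneg_left hs.2 (by positivity)
  have g0 := (convex_Icc (0 : ℝ) h).norm_image_sub_le_of_norm_hasDerivWithin_le
      (f := fun s : ℝ => v (z + s) - 2 * v z + v (z - s) - s * s * c)
      (f' := fun s : ℝ => deriv v (z + s) - deriv v (z - s) - 2 * s * c)
      (fun x hx => by
        have a1 := (e0 _ (hp x)).comp x (ep x)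
        have a2 := (e0 _ (hm x)).comp x (em x)
        exact ((((a1.sub_const (2 * v z)).add a2).sub (((es x).mul (es x)).mul_const c)).congr_deriv
          (by ring)).hasDerivWithinAt)
      g1 (left_mem_Icc.2 hh.le) (right_mem_Icc.2 hh.le)
  simp only [Complex.ofReal_zero, add_zero, sub_zero, mul_zero, zero_mul] at g0
  rw [show v z - 2 * v z + v z = 0 by ring, sub_zero, Real.norm_of_nonneg hh.le] at g0
  have hne : (h : ℂ) ≠ 0 := by exact_mod_cast hh.ne'
  have : secDiff h v z - c = (v (z + h) - 2 * v z + v (z - h) - h * h * c) / (h ^ 2 : ℝ) := by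
    rw [secDiff]; push_cast; field_simp
  rw [this, norm_div, Complex.norm_real, Real.norm_of_nonneg (by positivity), div_le_iff₀ (by positivity)]
  linarith

theorem secDiff_add (h : ℝ) (f g : ℂ → ℂ) (z : ℂ) :
    secDiff h (fun z => f z + g z) z = secDiff h f z + secDiff h g z := by
  simp only [secDiff]; ring

/-- One step of the quasi-Newton iteration for the equation `secDiff h X + sin X = 0`. -/
theorem PendApprox.exists_step {T h ρ e : ℝ} {X₀ X : ℂ → ℂ} (hX₀ : PendApprox T (5 / 10 ^ 19) X₀)
    (hT : 10 ≤ T) (hh : 0 < h) (hρ0 : 0 < ρ) (hρ : ρ ≤ 1 / 200) (he : e ≤ 1 / 10 ^ 18)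
    (hX : QuasiFun T ρ X) (hd : ∀ z ∈ strip ρ, ‖X z - X₀ z‖ ≤ 2 / 10 ^ 10)
    (hE : ∀ z ∈ strip ρ, ‖secDiff h X z + Complex.sin (X z)‖ ≤ e) :
    ∃ Y, QuasiFun T ρ Y ∧ (∀ z ∈ strip ρ, ‖Y z - X z‖ ≤ 10 ^ 8 * e) ∧
      ∀ z ∈ strip (ρ - 10 ^ 10 * h), ‖secDiff h Y z + Complex.sin (Y z)‖ ≤ e / 2 := by
  have he0 : 0 ≤ e := (norm_nonneg _).trans (hE 0 (by simpa [mem_strip] using hρ0))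
  have hprof : Profile T ρ (phi T) := (profile_phi (by linarith)).mono (by linarith)
  obtain ⟨v, hv, hvb, hveq⟩ := hprof.exists_solution (by linarith) hρ0 (by linarith)
    ((hX.secDiff h).add hX.sin).neg (M := e) fun z hz => by rw [norm_neg]; exact hE z hz
  have himX : ∀ z ∈ strip ρ, |(X z).im| ≤ 1 := by
    intro z hz
    have hz' : z ∈ strip (1 / 200) := strip_mono hρ hz
    have h1 := hX₀.quasi.abs_im_le hX₀.deriv_le (strip_mono (by norm_num) hz')
    have h2 := (Complex.abs_im_le_norm _).trans (hd z hz)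
    rw [mem_strip] at hz'
    rw [Complex.sub_im] at h2
    have h3 := abs_add_le ((X z).im - (X₀ z).im) (X₀ z).im
    rw [sub_add_cancel] at h3
    norm_num at *
    linarith
  have himX0 : ∀ z ∈ strip ρ, |(X₀ z).im| ≤ 1 := by
    intro z hz
    have hz' : z ∈ strip (1 / 200) := strip_mono hρ hz
    have h1 := hX₀.quasi.abs_im_le hX₀.deriv_le (strip_mono (by norm_num) hz')
    rw [mem_strip] at hz'
    linarith
  have hq : ∀ z ∈ strip ρ, ‖deriv (deriv (phi T)) z / phi T z‖ ≤ 4 := by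
    intro z hz
    have h1 := hX₀.pot z (strip_mono hρ hz)
    have h2 := (Complex.norm_cos_le_exp (X₀ z)).trans (exp_abs_im_le (himX0 z hz))
    have h3 := norm_sub_le (deriv (deriv (phi T)) z / phi T z + Complex.cos (X₀ z)) (Complex.cos (X₀ z))
    rw [add_sub_cancel_right] at h3
    have : (5 / 10 ^ 19 : ℝ) ≤ 1 := by norm_num
    linarith
  have hv2 : ∀ z ∈ strip ρ, ‖deriv (deriv v) z‖ ≤ 10 ^ 9 * e := by
    intro z hz
    rw [hveq z hz]
    refine (norm_add_le _ _).trans ?_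
    rw [norm_mul, norm_neg]
    have h1 := mul_le_mul (hq z hz) (hvb z hz) (norm_nonneg _) (by norm_num)
    have h2 := hE z hz
    linarith
  have ho := isOpen_strip ρ
  have hδ : 0 < 10 ^ 10 * h := by positivity
  have hv3 : ∀ z ∈ strip (ρ - 10 ^ 10 * h), ‖deriv (deriv (deriv v)) z‖ ≤ 10 ^ 9 * e / (10 ^ 10 * h) := fun z hz =>
    norm_deriv_le_of_strip hδ ((hv.diff.deriv ho).deriv ho) hv2 hz
  refine ⟨fun z => X z + v z, hX.add_cell hv, fun z hz => by simpa using hvb z hz, fun z hz => ?_⟩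
  have hz' : z ∈ strip ρ := strip_mono (by linarith) hz
  have hsd := norm_secDiff_sub_le hh (hv.diff.mono (strip_mono (by linarith))) hv3 hz
  have hsd' : 2 * h * (10 ^ 9 * e / (10 ^ 10 * h)) = e / 5 := by field_simp; ring
  rw [hsd'] at hsd
  have hvz := hvb z hz'
  have hv1 : ‖v z‖ ≤ 1 := by norm_num at *; linarith
  have hquad := Complex.norm_sin_add_sub_le (x := X z) hv1
  have hq1 : 2 * exp |(X z).im| * ‖v z‖ ^ 2 ≤ e / 16 := by
    have a1 := exp_abs_im_le (himX z hz')
    have a2 : ‖v z‖ ^ 2 ≤ (10 ^ 8 * e) ^ 2 := pow_le_pow_left₀ (norm_nonneg _) hvz 2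
    have a3 : e * e ≤ 1 / 10 ^ 18 * e := mul_le_mul_of_nonneg_right he he0
    have a4 := mul_le_mul (by linarith : 2 * exp |(X z).im| ≤ 6) a2 (by positivity) (by norm_num)
    nlinarith
  have hc1 := Complex.norm_cos_sub_cos_le (himX z hz') (himX0 z hz')
  have hc2 := hd z hz'
  have hc3 := hX₀.pot z (strip_mono hρ hz')
  have hc4 : ‖deriv (deriv (phi T)) z / phi T z + Complex.cos (X z)‖ ≤ 7 / 10 ^ 10 := by
    have : deriv (deriv (phi T)) z / phi T z + Complex.cos (X z) =
      (deriv (deriv (phi T)) z / phi T z + Complex.cos (X₀ z)) + (Complex.cos (X z) - Complex.cos (X₀ z)) := by ring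
    rw [this]
    refine (norm_add_le _ _).trans ?_
    norm_num at *
    linarith
  have hc5 : ‖(deriv (deriv (phi T)) z / phi T z + Complex.cos (X z)) * v z‖ ≤ 7 / 100 * e := by
    rw [norm_mul]
    have := mul_le_mul hc4 hvz (norm_nonneg _) (by norm_num)
    linarith
  have key : secDiff h (fun z => X z + v z) z + Complex.sin (X z + v z) =
      (deriv (deriv (phi T)) z / phi T z + Complex.cos (X z)) * v z +
      (secDiff h v z - deriv (deriv v) z) +
      (Complex.sin (X z + v z) - Complex.sin (X z) - Complex.cos (X z) * v z) := by
    rw [secDiff_add, hveq z hz']; ring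
  rw [key]
  refine (norm_add₃_le).trans ?_
  linarith

theorem PendApprox.exists_iterate {T h : ℝ} {X₀ : ℂ → ℂ} (hX₀ : PendApprox T (5 / 10 ^ 19) X₀)
    (hT : 10 ≤ T) (hh : 0 < h) (hh1 : h ≤ 1 / 10 ^ 22) (n : ℕ) (hn : n * (10 ^ 10 * h) ≤ 1 / 400) :
    ∃ X, QuasiFun T (1 / 200 - n * (10 ^ 10 * h)) X ∧
      (∀ z ∈ strip (1 / 200 - n * (10 ^ 10 * h)), ‖X z - X₀ z‖ ≤ 2 / 10 ^ 10 * (1 - (1 / 2) ^ n)) ∧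
      ∀ z ∈ strip (1 / 200 - n * (10 ^ 10 * h)), ‖secDiff h X z + Complex.sin (X z)‖ ≤
        1 / 10 ^ 18 * (1 / 2) ^ n := by
  induction n with
  | zero =>
    have ho := isOpen_strip 1
    have hd := hX₀.quasi.diff.deriv ho
    have h2 : ∀ z ∈ strip (1 - 1 / 2), ‖deriv (deriv X₀) z‖ ≤ 80 / (1 / 2) := fun z hz =>
      norm_deriv_le_of_strip (by norm_num) hd hX₀.deriv_le hz
    have h3 : ∀ z ∈ strip (1 - 1 / 2 - 1 / 4), ‖deriv (deriv (deriv X₀)) z‖ ≤ 80 / (1 / 2) / (1 / 4) := fun z hz =>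
      norm_deriv_le_of_strip (by norm_num) ((hd.deriv ho).mono (strip_mono (by norm_num))) h2 hz
    refine ⟨X₀, hX₀.quasi.mono (by norm_num), fun z _ => by simp, fun z hz => ?_⟩
    have hz' : z ∈ strip (1 / 200) := by simpa using hz
    have h4 := norm_secDiff_sub_le hh (hX₀.quasi.diff.mono (strip_mono (by norm_num))) h3
      (strip_mono (by norm_num) hz')
    have h5 := hX₀.eqn z hz'
    have : secDiff h X₀ z + Complex.sin (X₀ z) =
      (secDiff h X₀ z - deriv (deriv X₀) z) + (deriv (deriv X₀) z + Complex.sin (X₀ z)) := by ring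
    rw [this]
    refine (norm_add_le _ _).trans ?_
    norm_num at *
    linarith
  | succ n ih =>
    push_cast at hn ⊢
    have hδ : 0 < 10 ^ 10 * h := by positivity
    obtain ⟨X, hX, hd, hE⟩ := ih (by linarith)
    have hp : (0 : ℝ) < (1 / 2) ^ n := by positivity
    have hp1 : (1 / 2 : ℝ) ^ n ≤ 1 := pow_le_one₀ (by norm_num) (by norm_num)
    obtain ⟨Y, hY, hYd, hYE⟩ := hX₀.exists_step hT hh (ρ := 1 / 200 - n * (10 ^ 10 * h)) (by linarith)
      (by have : 0 ≤ n * (10 ^ 10 * h) := by positivity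
          linarith) (e := 1 / 10 ^ 18 * (1 / 2) ^ n) (by linarith) hX
      (fun z hz => (hd z hz).trans (by linarith)) hE
    have hρ : 1 / 200 - (n + 1) * (10 ^ 10 * h) = 1 / 200 - n * (10 ^ 10 * h) - 10 ^ 10 * h := by ring
    rw [hρ]
    refine ⟨Y, hY.mono (by linarith), fun z hz => ?_, fun z hz => ?_⟩
    · have hz' := strip_mono (by linarith : 1 / 200 - n * (10 ^ 10 * h) - 10 ^ 10 * h ≤ 1 / 200 - n * (10 ^ 10 * h)) hz
      have := norm_add_le (Y z - X z) (X z - X₀ z)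
      rw [sub_add_sub_cancel] at this
      have h1 := hYd z hz'
      have h2 := hd z hz'
      rw [pow_succ (1 / 2 : ℝ) n]
      linarith
    · rw [pow_succ (1 / 2 : ℝ) n]
      exact (hYE z hz).trans (by linarith)

/-- `X` is a lift of a rotation of the standard map with step `h`, up to an exponentially small error. -/
structure MapApprox (T h : ℝ) (X : ℂ → ℂ) : Prop where
  quasi : QuasiFun T (1 / 800) X
  deriv_le : ∀ z ∈ strip (1 / 800), ‖deriv X z‖ ≤ 100
  deriv_ge : ∀ t : ℝ, |t| ≤ 3 → 1 / 50 ≤ (deriv X t).re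
  cos_le : ∀ t : ℝ, 2 ≤ t → t ≤ T - 2 → (Complex.cos (X t)).re ≤ 0
  err : ∀ z ∈ strip (1 / 800), ‖secDiff h X z + Complex.sin (X z)‖ ≤ exp (-(1 / (10 ^ 13 * h)))

theorem exists_mapApprox : ∃ T₀, 10 ≤ T₀ ∧ ∀ T, T₀ ≤ T → ∀ h, 0 < h → h ≤ 1 / 10 ^ 22 → ∃ X, MapApprox T h X := by
  obtain ⟨T₀, hT₀, H⟩ := exists_pendApprox (η := 5 / 10 ^ 19) (by norm_num)
  refine ⟨T₀, hT₀, fun T hT h hh hh1 => ?_⟩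
  obtain ⟨X₀, hX₀⟩ := H T hT
  have hδ : 0 < 10 ^ 10 * h := by positivity
  set n := ⌊1 / 400 / (10 ^ 10 * h)⌋₊ with hn
  have hn1 : n * (10 ^ 10 * h) ≤ 1 / 400 := by
    rw [← le_div_iff₀ hδ]; exact Nat.floor_le (by positivity)
  have hn2 : 1 / 400 / (10 ^ 10 * h) < n + 1 := Nat.lt_floor_add_one _
  obtain ⟨X, hX, hd, hE⟩ := hX₀.exists_iterate (hT₀.trans hT) hh hh1 n hn1
  have hs : ∀ z ∈ strip (1 / 400), z ∈ strip (1 / 200 - n * (10 ^ 10 * h)) := fun z hz =>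
    strip_mono (by linarith) hz
  have hs' : ∀ z ∈ strip (1 / 800), z ∈ strip (1 / 400) := fun z hz => strip_mono (by norm_num) hz
  have hs1 : ∀ z ∈ strip (1 / 400), z ∈ strip 1 := fun z hz => strip_mono (by norm_num) hz
  have hp : (0 : ℝ) < (1 / 2) ^ n := by positivity
  have hd' : ∀ z ∈ strip (1 / 400), ‖X z - X₀ z‖ ≤ 2 / 10 ^ 10 := fun z hz =>
    (hd z (hs z hz)).trans (by linarith)
  have hdX : ∀ z ∈ strip (1 / 400), DifferentiableAt ℂ X z := fun z hz =>
    hX.diff.differentiableAt ((isOpen_strip _).mem_nhds (hs z hz))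
  have hdX0 : ∀ z ∈ strip (1 / 400), DifferentiableAt ℂ X₀ z := fun z hz =>
    hX₀.quasi.diff.differentiableAt ((isOpen_strip _).mem_nhds (hs1 z hz))
  have hdd : ∀ z ∈ strip (1 / 800), ‖deriv X z - deriv X₀ z‖ ≤ 1 / 1000 := by
    intro z hz
    have h1 := norm_deriv_le_of_strip (f := fun z => X z - X₀ z) (δ := 1 / 800) (by norm_num)
      (fun z hz => ((hdX z hz).sub (hdX0 z hz)).differentiableWithinAt) hd' (z := z)
      (strip_mono (by norm_num) hz)
    rw [deriv_fun_sub (hdX z (hs' z hz)) (hdX0 z (hs' z hz))] at h1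
    exact h1.trans (by norm_num)
  refine ⟨X, hX.mono (by linarith), fun z hz => ?_, fun t ht => ?_, fun t ht1 ht2 => ?_, fun z hz => ?_⟩
  · have h1 := hdd z hz
    have h2 := hX₀.deriv_le z (hs1 z (hs' z hz))
    have h3 := norm_add_le (deriv X z - deriv X₀ z) (deriv X₀ z)
    rw [sub_add_cancel] at h3
    linarith
  · have h1 := (Complex.abs_re_le_norm _).trans (hdd t (ofReal_mem_strip (by norm_num) t))
    have h2 := hX₀.deriv_ge t ht
    rw [Complex.sub_re] at h1
    linarith [neg_abs_le ((deriv X t).re - (deriv X₀ t).re)]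
  · have h0 := hd' t (ofReal_mem_strip (by norm_num) t)
    have i1 : (X t).im = 0 := hX.im_eq_zero (by linarith) t
    have i0 : (X₀ t).im = 0 := hX₀.quasi.im_eq_zero (by norm_num) t
    have h1 := (Complex.abs_re_le_norm _).trans
      (Complex.norm_cos_sub_cos_le (x := X t) (y := X₀ t) (by simp [i1]) (by simp [i0]))
    have h2 := hX₀.cos_le t ht1 ht2
    rw [Complex.sub_re] at h1
    have h3 := le_abs_self ((Complex.cos (X t)).re - (Complex.cos (X₀ t)).re)
    norm_num at *
    linarith
  · refine (hE z (hs z (hs' z hz))).trans ?_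
    have h1 : (1 / 2 : ℝ) ≤ exp (-(1 / 2)) := by linarith [add_one_le_exp (-(1 / 2 : ℝ))]
    have h2 : (1 / 2 : ℝ) ^ n ≤ exp (-(1 / 2) * n) := by
      rw [mul_comm, Real.exp_nat_mul]; exact pow_le_pow_left₀ (by norm_num) h1 n
    have h3 : exp (-(1 / 2) * n) ≤ exp (1 + -(1 / (10 ^ 13 * h))) := by
      apply Real.exp_le_exp.2
      have a : 1 / 400 / (10 ^ 10 * h) = 5 / 2 * (1 / (10 ^ 13 * h)) := by field_simp; norm_num
      have : 0 < 1 / (10 ^ 13 * h) := by positivity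
      linarith
    rw [Real.exp_add] at h3
    have h4 := Real.exp_one_lt_d9
    have h5 := exp_pos (-(1 / (10 ^ 13 * h)))
    nlinarith

theorem MapApprox.secDiff_deriv {T h : ℝ} {X : ℂ → ℂ} (hX : MapApprox T h X) (t : ℝ) :
    |(secDiff h (deriv X) t + Complex.cos (X t) * deriv X t).re| ≤ 1600 * exp (-(1 / (10 ^ 13 * h))) := by
  have ho := isOpen_strip (1 / 800)
  have ht : (t : ℂ) ∈ strip (1 / 800) := ofReal_mem_strip (by norm_num) t
  have hD : ∀ z ∈ strip (1 / 800), HasDerivAt X (deriv X z) z := fun z hz =>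
    (hX.quasi.diff.differentiableAt (ho.mem_nhds hz)).hasDerivAt
  have h1 := norm_deriv_le_of_strip (δ := 1 / 1600) (by norm_num)
    ((hX.quasi.secDiff h).diff.fun_add hX.quasi.sin.diff) hX.err (z := t) (ofReal_mem_strip (by norm_num) t)
  have h2 : HasDerivAt (fun z => secDiff h X z + Complex.sin (X z))
      (secDiff h (deriv X) t + Complex.cos (X t) * deriv X t) t := by
    have a1 := (hD _ ((add_ofReal_mem_strip h).2 ht)).comp_add_const (t : ℂ) (h : ℂ)
    have a2 := (hD _ ((sub_ofReal_mem_strip h).2 ht)).comp_sub_const (t : ℂ) (h : ℂ)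
    exact (((a1.sub ((hD _ ht).const_mul 2)).add a2).div_const _).add (hD _ ht).csin
  rw [h2.deriv] at h1
  exact (Complex.abs_re_le_norm _).trans (h1.trans (by linarith))

theorem MapApprox.deriv_re_ge {T h : ℝ} {X : ℂ → ℂ} (hX : MapApprox T h X) (hT : 10 ≤ T) (hh : 0 < h)
    (hh1 : h ≤ 1) (hsm : 1600 * exp (-(1 / (10 ^ 13 * h))) ≤ exp (-2 * T) / 100) (t : ℝ) :
    exp (-2 * T) / 100 ≤ (deriv X t).re := by
  have hc := hX.quasi.deriv
  set w : ℝ → ℝ := fun t => (deriv X t).re with hw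
  have hper : ∀ t, w (t + T) = w t := fun t => by
    simp only [hw]; push_cast; rw [hc.per _ (ofReal_mem_strip (by norm_num) t)]
  have hwc : Continuous w := by
    have : Continuous fun t : ℝ => deriv X t :=
      hc.diff.continuousOn.comp_continuous Complex.continuous_ofReal fun t => ofReal_mem_strip (by norm_num) t
    exact Complex.continuous_re.comp this
  have hexp1 : ∀ t, 0 ≤ t → exp (-2 * t) ≤ 1 := fun t ht => Real.exp_le_one_iff.2 (by linarith)
  have hmid : ∀ t, 2 ≤ t → t ≤ T - 2 → exp (-2 * t) / 100 ≤ w t := by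
    obtain ⟨t₀, ht₀, hmin⟩ := (isCompact_Icc (a := (2 : ℝ)) (b := T - 2)).exists_isMinOn
      ⟨2, by constructor <;> linarith⟩ (f := fun t => w t - exp (-2 * t) / 100)
      (by fun_prop)
    have hmin' : ∀ t, 2 ≤ t → t ≤ T - 2 → w t₀ - exp (-2 * t₀) / 100 ≤ w t - exp (-2 * t) / 100 :=
      fun t h1 h2 => hmin ⟨h1, h2⟩
    suffices 0 ≤ w t₀ - exp (-2 * t₀) / 100 by
      intro t h1 h2; linarith [hmin' t h1 h2]
    by_contra! hneg
    have hl : w t₀ - exp (-2 * t₀) / 100 ≤ w (t₀ - h) - exp (-2 * (t₀ - h)) / 100 := by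
      rcases le_total 2 (t₀ - h) with h1 | h1
      · exact hmin' _ h1 (by linarith [ht₀.2])
      · have := hX.deriv_ge (t₀ - h) (by rw [abs_le]; constructor <;> linarith [ht₀.1])
        have h2 := hexp1 (t₀ - h) (by linarith [ht₀.1])
        simp only [hw] at *
        linarith
    have hr : w t₀ - exp (-2 * t₀) / 100 ≤ w (t₀ + h) - exp (-2 * (t₀ + h)) / 100 := by
      rcases le_total (t₀ + h) (T - 2) with h1 | h1
      · exact hmin' _ (by linarith [ht₀.1]) h1
      · have h3 := hX.deriv_ge (t₀ + h - T) (by rw [abs_le]; constructor <;> linarith [ht₀.2])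
        have h2 := hexp1 (t₀ + h) (by linarith [ht₀.1])
        have h4 := hper (t₀ + h - T)
        rw [sub_add_cancel] at h4
        rw [h4]
        simp only [hw] at *
        linarith
    have hconv : exp (-2 * t₀) * (4 * h ^ 2) ≤
        exp (-2 * (t₀ - h)) + exp (-2 * (t₀ + h)) - 2 * exp (-2 * t₀) := by
      have e1 : exp (-2 * (t₀ - h)) = exp (-2 * t₀) * exp (2 * h) := by rw [← Real.exp_add]; ring_nf
      have e2 : exp (-2 * (t₀ + h)) = exp (-2 * t₀) * exp (-(2 * h)) := by rw [← Real.exp_add]; ring_nf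
      have e3 : h ≤ Real.sinh h := Real.self_le_sinh_iff.2 hh.le
      have e4 := Real.cosh_eq (2 * h)
      rw [Real.cosh_two_mul, Real.cosh_sq] at e4
      have e5 := pow_le_pow_left₀ hh.le e3 2
      rw [e1, e2]
      have e6 : exp (2 * h) + exp (-(2 * h)) = 2 + 4 * sinh h ^ 2 := by linarith
      have e7 := mul_le_mul_of_nonneg_left e5 (exp_pos (-2 * t₀)).le
      linear_combination 4 * e7 - exp (-2 * t₀) * e6
    have hE := (abs_le.1 (hX.secDiff_deriv t₀)).2
    have i0 : (X t₀).im = 0 := hX.quasi.im_eq_zero (by norm_num) t₀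
    have i1 : (Complex.cos (X t₀)).im = 0 := by
      rw [show X t₀ = ((X t₀).re : ℂ) from Complex.ext rfl (by simpa using i0), ← Complex.ofReal_cos,
        Complex.ofReal_im]
    have c1 : -1 ≤ (Complex.cos (X t₀)).re := by
      rw [show X t₀ = ((X t₀).re : ℂ) from Complex.ext rfl (by simpa using i0), ← Complex.ofReal_cos,
        Complex.ofReal_re]
      exact Real.neg_one_le_cos _
    have c0 := hX.cos_le t₀ ht₀.1 ht₀.2
    have hre : (secDiff h (deriv X) t₀ + Complex.cos (X t₀) * deriv X t₀).re =
        (w (t₀ + h) - 2 * w t₀ + w (t₀ - h)) / h ^ 2 + (Complex.cos (X t₀)).re * w t₀ := by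
      rw [Complex.add_re, Complex.mul_re, i1, zero_mul, sub_zero, secDiff, ← Complex.ofReal_pow,
        Complex.div_ofReal_re]
      simp [hw]
    rw [hre] at hE
    have hh2 : 0 < h ^ 2 := by positivity
    have h5 : exp (-2 * t₀) / 100 * 4 ≤ (w (t₀ + h) - 2 * w t₀ + w (t₀ - h)) / h ^ 2 := by
      rw [le_div_iff₀ hh2]; linarith
    have h6 : exp (-2 * T) ≤ exp (-2 * t₀) := Real.exp_le_exp.2 (by linarith [ht₀.2])
    have h7 := exp_pos (-2 * T)
    nlinarith
  have hcell : ∀ t, 0 ≤ t → t ≤ T → exp (-2 * T) / 100 ≤ w t := by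
    intro t h0 h1
    have h3 := hexp1 T (by linarith)
    rcases le_total t 2 with h2 | h2
    · have := hX.deriv_ge t (by rw [abs_le]; constructor <;> linarith)
      simp only [hw]; linarith
    rcases le_total t (T - 2) with h4 | h4
    · have : exp (-2 * T) ≤ exp (-2 * t) := Real.exp_le_exp.2 (by linarith)
      linarith [hmid t h2 h4]
    · have := hX.deriv_ge (t - T) (by rw [abs_le]; constructor <;> linarith)
      have h5 := hper (t - T)
      rw [sub_add_cancel] at h5
      rw [h5]; simp only [hw]; linarith
  have hT0 : 0 < T := by linarith
  have hp : Function.Periodic w T := hper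
  have hmem := toIcoMod_mem_Ico' hT0 t
  have h1 := hcell _ hmem.1 hmem.2.le
  rw [toIcoMod, hp.sub_zsmul_eq] at h1
  exact h1

theorem MapApprox.deriv_re_ge_of_strip {T h : ℝ} {X : ℂ → ℂ} (hX : MapApprox T h X) (hT : 10 ≤ T) (hh : 0 < h)
    (hh1 : h ≤ 1) (hsm : 1600 * exp (-(1 / (10 ^ 13 * h))) ≤ exp (-2 * T) / 100) {z : ℂ}
    (hz : z ∈ strip (1 / 1600)) : exp (-2 * T) / 100 - 160000 * |z.im| ≤ (deriv X z).re := by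
  have ho := isOpen_strip (1 / 800)
  have hs : ∀ z ∈ strip (1 / 1600), z ∈ strip (1 / 800) := fun z hz => strip_mono (by norm_num) hz
  have hd := hX.quasi.diff.deriv ho
  have h1 := norm_sub_re_le_of_strip (F := deriv X) (f := deriv (deriv X)) (C := 160000)
    (fun z hz => (hd.differentiableAt (ho.mem_nhds (hs z hz))).hasDerivAt) hz
    (fun w hw _ => (norm_deriv_le_of_strip (δ := 1 / 1600) (by norm_num) hd hX.deriv_le (by
      convert hw using 2; norm_num)).trans (by norm_num))
  have h2 := (Complex.abs_re_le_norm _).trans h1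
  rw [Complex.sub_re] at h2
  linarith [neg_abs_le ((deriv X z).re - (deriv X (z.re : ℝ)).re), hX.deriv_re_ge hT hh hh1 hsm z.re]

theorem le_abs_mul_inv_add_sqrt_two_sub {N : ℕ} {R : ℝ} (hR : R = N + √2) {k : ℤ} (hk : k ≠ 0) (m : ℤ) :
    1 / (7 * R * |(k : ℝ)|) ≤ |k * (1 / R) - m| := by
  have h2 : √2 ^ 2 = 2 := Real.sq_sqrt (by norm_num)
  have h2a : 1 ≤ √2 := Real.one_le_sqrt.2 (by norm_num)
  have h2b : √2 ≤ 3 / 2 := by rw [Real.sqrt_le_left (by norm_num)]; norm_num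
  have hN : (0 : ℝ) ≤ N := N.cast_nonneg
  have hR1 : 1 ≤ R := by linarith
  have hk1 : 1 ≤ |(k : ℝ)| := by exact_mod_cast Int.one_le_abs hk
  set n : ℤ := k - m * N with hn
  have hnR : (n : ℝ) - m * √2 = k - m * R := by rw [hn, hR]; push_cast; ring
  have hkR : |(k : ℝ) * (1 / R) - m| = |(n : ℝ) - m * √2| / R := by
    rw [hnR, eq_div_iff (by linarith), ← abs_of_nonneg (by linarith : 0 ≤ R), ← abs_mul,
      abs_of_nonneg (by linarith : 0 ≤ R)]
    congr 1
    field_simp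
  rw [hkR, mul_right_comm, ← div_div]
  gcongr
  rcases le_or_gt 1 |(n : ℝ) - m * √2| with h1 | h1
  · refine le_trans ?_ h1
    rw [div_le_one (by positivity)]; linarith
  have hm : |(m : ℝ)| ≤ 2 * |(k : ℝ)| := by
    have h3 : |(m : ℝ) * R| ≤ |(k : ℝ)| + 1 := by
      have := abs_sub (k : ℝ) ((n : ℝ) - m * √2)
      rw [hnR, sub_sub_cancel] at this
      rw [hnR] at h1
      linarith
    rw [abs_mul, abs_of_nonneg (by linarith : 0 ≤ R)] at h3
    nlinarith [abs_nonneg (m : ℝ)]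
  have hplus : |(n : ℝ) + m * √2| ≤ 7 * |(k : ℝ)| := by
    have h3 := abs_add_le ((n : ℝ) - m * √2) (2 * (m * √2))
    rw [show (n : ℝ) - m * √2 + 2 * (m * √2) = n + m * √2 by ring, abs_mul, abs_mul,
      abs_of_nonneg (by linarith : 0 ≤ √2), abs_two] at h3
    have h4 := mul_le_mul hm h2b (by linarith) (by positivity)
    linarith
  have hprod : 1 ≤ |(n : ℝ) - m * √2| * |(n : ℝ) + m * √2| := by
    rw [← abs_mul, show ((n : ℝ) - m * √2) * (n + m * √2) = n ^ 2 - m ^ 2 * √2 ^ 2 by ring, h2]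
    have hne : n ^ 2 - m ^ 2 * 2 ≠ 0 := by
      intro h0
      have h5 : (n : ℝ) ^ 2 = (m * √2) ^ 2 := by
        rw [mul_pow, h2]; exact_mod_cast sub_eq_zero.1 h0
      have hm0 : m ≠ 0 := by
        rintro rfl
        simp only [hn] at h0
        apply hk
        simpa using h0
      have hirr : Irrational (m * √2) := irrational_sqrt_two.intCast_mul hm0
      rcases sq_eq_sq_iff_eq_or_eq_neg.1 h5 with h6 | h6
      · exact hirr.ne_int n h6.symm
      · exact hirr.ne_int (-n) (by push_cast; linarith)
    exact_mod_cast Int.one_le_abs hne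
  rw [div_le_iff₀ (by positivity)]
  exact hprod.trans (mul_le_mul_of_nonneg_left hplus (abs_nonneg _))

theorem kamErr_rescale {h s α : ℝ} {X : ℂ → ℂ} (hh : h ≠ 0) (hα : s * α = h) (z : ℂ) :
    kamErr (h ^ 2) α (fun z => π + X (s * z) - z) z =
      (h ^ 2 : ℝ) * (secDiff h X (s * z) + Complex.sin (X (s * z))) := by
  have e1 : (s : ℂ) * (z + α) = s * z + h := by rw [mul_add, ← Complex.ofReal_mul, hα]
  have e2 : (s : ℂ) * (z - α) = s * z - h := by rw [mul_sub, ← Complex.ofReal_mul, hα]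
  have hne : (h : ℂ) ≠ 0 := by exact_mod_cast hh
  simp only [kamErr]
  rw [e1, e2, add_sub_cancel, add_comm (π : ℂ) (X (s * z)), Complex.sin_add_pi, secDiff]
  push_cast
  field_simp
  ring

/-- An approximate rotation solution whose period `T` is comparable to `1 / h` yields an invariant
circle with rotation number `h / T`. -/
theorem MapApprox.hasInvCircle {T h R : ℝ} {N : ℕ} {X : ℂ → ℂ} (hX : MapApprox T h X) (hR : R = N + √2)
    (hT : T = h * R) (hh : 0 < h) (hh1 : h ≤ 1) (hT1 : 10 ^ 16 ≤ T) (hT2 : 1 ≤ 10 ^ 16 * h * T)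
    (hT3 : 10 ^ 16 * h * T ≤ 2) : HasInvCircle (h ^ 2) (1 / R) := by
  have hT0 : 0 < T := by linarith
  have hT10 : 10 ≤ T := by linarith
  have hR0 : 0 < R := by rw [hR]; positivity
  have hπ := Real.pi_gt_three
  have hπ' := Real.pi_lt_four
  have hexp : exp (-(1 / (10 ^ 13 * h))) ≤ exp (-(300 * T)) := by
    apply Real.exp_le_exp.2
    rw [neg_le_neg_iff, le_div_iff₀ (by positivity)]
    linarith
  have hlin : ∀ x : ℝ, x ≤ exp x := fun x => by linarith [add_one_le_exp x]
  have hE2 : T ^ 2 ≤ exp (2 * T) := by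
    rw [mul_comm, Real.exp_mul, Real.rpow_two]; exact pow_le_pow_left₀ hT0.le (hlin T) 2
  have hE4 : T ^ 4 ≤ exp (4 * T) := by
    rw [mul_comm, show (4 : ℝ) = (4 : ℕ) by norm_num, Real.exp_mul, Real.rpow_natCast]
    exact pow_le_pow_left₀ hT0.le (hlin T) 4
  have hsq : exp (4 * T) = exp (2 * T) * exp (2 * T) := by rw [← Real.exp_add]; ring_nf
  have hE2' : 10 ^ 16 * T ≤ exp (2 * T) := le_trans (by nlinarith) hE2
  have hinv2 : exp (-2 * T) = (exp (2 * T))⁻¹ := by rw [← Real.exp_neg]; ring_nf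
  have hp2 := exp_pos (2 * T)
  have hΛ0 := exp_pos (4 * T)
  obtain ⟨P, hP⟩ : ∃ P, P = exp (2 * T) := ⟨_, rfl⟩
  rw [← hP] at hE2 hsq hE2' hinv2 hp2
  obtain ⟨Λ, hΛ⟩ : ∃ Λ, Λ = exp (4 * T) := ⟨_, rfl⟩
  rw [← hΛ] at hE4 hsq hΛ0
  have hΛT : 10 ^ 16 * T ≤ Λ := by rw [hsq]; nlinarith
  have hΛ1 : 1 ≤ Λ := by linarith
  have hsm : 1600 * exp (-(1 / (10 ^ 13 * h))) ≤ exp (-2 * T) / 100 := by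
    have h1 : exp (-(300 * T)) ≤ exp (-2 * T) * exp (-2 * T) := by
      rw [← Real.exp_add]; exact Real.exp_le_exp.2 (by linarith)
    have h2 : exp (-2 * T) ≤ 1 / 10 ^ 16 := by
      rw [hinv2, inv_eq_one_div]; exact one_div_le_one_div_of_le (by norm_num) (by linarith)
    have h3 := mul_le_mul_of_nonneg_left h2 (exp_pos (-2 * T)).le
    have h4 := exp_pos (-2 * T)
    linarith
  set s : ℝ := T / (2 * π) with hs
  have hs0 : 0 < s := by positivity
  have hs1 : 1 ≤ s := by rw [hs, le_div_iff₀ (by positivity)]; linarith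
  have hsT : s ≤ T := by rw [hs]; exact div_le_self hT0.le (by linarith)
  have hsπ : s * (2 * π) = T := by rw [hs]; field_simp
  have hst : ∀ z ∈ strip (1 / Λ), (s : ℂ) * z ∈ strip (1 / 1600) ∧
      160000 * |((s : ℂ) * z).im| ≤ exp (-2 * T) / 200 := by
    intro z hz
    rw [mem_strip] at hz
    have him : |((s : ℂ) * z).im| = s * |z.im| := by
      rw [Complex.im_ofReal_mul, abs_mul, abs_of_pos hs0]
    have h1 : s * |z.im| ≤ T * (1 / Λ) := mul_le_mul hsT hz.le (abs_nonneg _) hT0.le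
    have h2 : 160000 * (T * (1 / Λ)) ≤ exp (-2 * T) / 200 := by
      rw [hinv2, hsq]
      field_simp
      linarith
    have h3 : exp (-2 * T) ≤ 1 := Real.exp_le_one_iff.2 (by linarith)
    rw [mem_strip, him]
    constructor <;> linarith
  have hst8 : ∀ z ∈ strip (1 / Λ), (s : ℂ) * z ∈ strip (1 / 800) := fun z hz =>
    strip_mono (by norm_num) (hst z hz).1
  have hder : ∀ z ∈ strip (1 / Λ), HasDerivAt (fun z => π + X (s * z) - z) (s * deriv X (s * z) - 1) z := by
    intro z hz
    have h1 : HasDerivAt X (deriv X (s * z)) (s * z) :=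
      (hX.quasi.diff.differentiableAt ((isOpen_strip _).mem_nhds (hst8 z hz))).hasDerivAt
    have h2 := h1.comp z ((hasDerivAt_id z).const_mul (s : ℂ))
    exact ((h2.const_add (π : ℂ)).sub (hasDerivAt_id z)).congr_deriv (by simp [mul_comm])
  refine hasInvCircle_of_approx (Λ := Λ) (u := fun z => π + X (s * z) - z) (by positivity) (pow_le_one₀ hh.le hh1)
    (by linarith) (fun k hk m => ?_) ⟨fun z hz => (hder z hz).differentiableAt.differentiableWithinAt,
      fun z hz => ?_, fun z hz => ?_⟩ (fun z hz => ?_) (fun z hz => ?_) (fun z hz => ?_) (fun z hz => ?_)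
  · refine le_trans ?_ (le_abs_mul_inv_add_sqrt_two_sub hR hk m)
    have hk1 : 1 ≤ |(k : ℝ)| := by exact_mod_cast Int.one_le_abs hk
    have hRΛ : 7 * R ≤ Λ := by
      have h1 : R ≤ 10 ^ 16 * T ^ 2 := by nlinarith
      have h2 : 7 * (10 ^ 16 * T ^ 2) ≤ T ^ 4 := by
        have : (10 ^ 16 : ℝ) ^ 2 ≤ T ^ 2 := pow_le_pow_left₀ (by norm_num) hT1 2
        nlinarith [sq_nonneg T]
      linarith
    gcongr
  · have h1 := hX.quasi.per _ (hst8 z hz)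
    have h2 : (s : ℂ) * (z + (2 * π : ℝ)) = s * z + T := by rw [mul_add, ← Complex.ofReal_mul, hsπ]
    rw [h2, h1]; ring
  · have h1 := hX.quasi.real _ (hst8 z hz)
    rw [map_mul, Complex.conj_ofReal] at h1
    rw [h1, map_sub, map_add, Complex.conj_ofReal]
  · have h1 := hX.deriv_re_ge_of_strip hT10 hh hh1 hsm (hst z hz).1
    have h2 := (hst z hz).2
    rw [(hder z hz).deriv, Complex.sub_re, Complex.re_ofReal_mul,
      Complex.one_re, add_sub_cancel]
    have h3 : 1 / Λ ≤ exp (-2 * T) / 200 := by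
      rw [hinv2, hsq]
      field_simp
      linarith
    have h4 := exp_pos (-2 * T)
    nlinarith
  · rw [(hder z hz).deriv, add_sub_cancel, norm_mul, Complex.norm_real, Real.norm_of_nonneg hs0.le]
    have := mul_le_mul hsT (hX.deriv_le _ (hst8 z hz)) (norm_nonneg _) hT0.le
    linarith
  · rw [add_sub_cancel, Complex.add_im, Complex.ofReal_im, zero_add]
    have h1 := hX.quasi.abs_im_le hX.deriv_le (hst8 z hz)
    have h2 := (hst z hz).1
    rw [mem_strip] at h2
    linarith
  · have hα : s * (2 * π * (1 / R)) = h := by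
      rw [← mul_assoc, hsπ, hT]; field_simp
    have e3 := kamErr_rescale (X := X) hh.ne' hα z
    rw [e3, norm_mul, Complex.norm_real, Real.norm_of_nonneg (by positivity)]
    have h1 := hX.err _ (hst8 z hz)
    have h2 : h ^ 2 * ‖secDiff h X (s * z) + Complex.sin (X (s * z))‖ ≤ exp (-(300 * T)) := by
      exact (mul_le_of_le_one_left (norm_nonneg _) (pow_le_one₀ hh.le hh1)).trans (h1.trans hexp)
    refine h2.trans ?_
    have h3 : 1 / (32 * Λ) = exp (-4 * T) * (1 / 32) := by
      rw [show -4 * T = -(4 * T) by ring, Real.exp_neg, ← hΛ]; field_simp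
    have h4 : exp (-T) ≤ 1 / 32 := by
      rw [Real.exp_neg, inv_eq_one_div]
      exact one_div_le_one_div_of_le (by norm_num) (by linarith [hlin T])
    have h5 : exp (-(5 * T)) ≤ 1 / (32 * Λ) := by
      rw [h3, show -(5 * T) = -4 * T + -T by ring, Real.exp_add]
      exact mul_le_mul_of_nonneg_left h4 (exp_pos _).le
    rw [← one_div_pow]
    refine le_trans ?_ (pow_le_pow_left₀ (exp_pos _).le h5 31)
    rw [← Real.exp_nat_mul]
    apply Real.exp_le_exp.2
    push_cast
    linarith

theorem exists_hasInvCircle_near_zero : ∃ ε₀ : ℝ, 0 < ε₀ ∧ ∀ ε, 0 < ε → ε < ε₀ →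
    ∃ ω, 0 < ω ∧ ω ≤ 10 ^ 16 * ε ∧ HasInvCircle ε ω := by
  obtain ⟨T₀, hT₀, H⟩ := exists_mapApprox
  set h₀ : ℝ := min (1 / 10 ^ 32) (1 / (10 ^ 16 * T₀)) with hh₀
  have hh₀0 : 0 < h₀ := by positivity
  refine ⟨h₀ ^ 2, by positivity, fun ε hε hε0 => ?_⟩
  set h := √ε with hh
  have hh0 : 0 < h := Real.sqrt_pos.2 hε
  have hhε : h ^ 2 = ε := Real.sq_sqrt hε.le
  have hhh : h ≤ h₀ := by rw [hh, Real.sqrt_le_left hh₀0.le]; exact hε0.le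
  have hh1 : h ≤ 1 / 10 ^ 32 := hhh.trans (min_le_left _ _)
  have hh2 : h ≤ 1 / (10 ^ 16 * T₀) := hhh.trans (min_le_right _ _)
  obtain ⟨N, hN⟩ : ∃ N : ℕ, N = ⌈1 / (10 ^ 16 * h ^ 2)⌉₊ := ⟨_, rfl⟩
  have hN1 : 1 / (10 ^ 16 * h ^ 2) ≤ N := hN ▸ Nat.le_ceil _
  have hN2 : (N : ℝ) < 1 / (10 ^ 16 * h ^ 2) + 1 := hN ▸ Nat.ceil_lt_add_one (by positivity)
  obtain ⟨R, hR⟩ : ∃ R : ℝ, R = N + √2 := ⟨_, rfl⟩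
  have h2a : 0 ≤ √2 := Real.sqrt_nonneg 2
  have h2b : √2 ≤ 2 := by rw [Real.sqrt_le_left (by norm_num)]; norm_num
  have hd : 0 < 10 ^ 16 * h ^ 2 := by positivity
  have hR1 : 1 ≤ R * (10 ^ 16 * h ^ 2) := by
    rw [← div_le_iff₀ hd]; linarith
  have hsq : h ^ 2 ≤ 1 / 10 ^ 32 * h := by nlinarith
  have hR2 : R * (10 ^ 16 * h ^ 2) ≤ 2 := by
    have h3 : R * (10 ^ 16 * h ^ 2) ≤ (1 / (10 ^ 16 * h ^ 2) + 3) * (10 ^ 16 * h ^ 2) :=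
      mul_le_mul_of_nonneg_right (by linarith) hd.le
    rw [add_mul, one_div_mul_cancel hd.ne'] at h3
    linarith
  have hR0 : 0 < R := by by_contra! hc; nlinarith
  have hlow : 1 / (10 ^ 16 * h) ≤ h * R := by
    rw [div_le_iff₀ (by positivity)]; linarith
  have hT₀' : 0 < T₀ := by linarith
  have hbig : T₀ ≤ 1 / (10 ^ 16 * h) := by
    rw [le_div_iff₀ (by positivity)]
    rw [le_div_iff₀ (by positivity)] at hh2
    linarith
  have hbig' : (10 : ℝ) ^ 16 ≤ 1 / (10 ^ 16 * h) := by
    rw [le_div_iff₀ (by positivity)]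
    linarith
  obtain ⟨X, hX⟩ := H (h * R) (hbig.trans hlow) h hh0 (hh1.trans (by norm_num))
  have := hX.hasInvCircle hR rfl hh0 (hh1.trans (by norm_num)) (hbig'.trans hlow) (by linarith) (by linarith)
  rw [hhε] at this
  refine ⟨1 / R, by positivity, ?_, this⟩
  rw [div_le_iff₀ hR0, ← hhε]
  linarith

theorem stdMap_neg (ε : ℝ) (p : ℝ × ℝ) : stdMap ε (-p) = -stdMap ε p := by
  ext <;> simp [stdMap] <;> ring

theorem HasInvCircle.neg {ε ω : ℝ} (H : HasInvCircle ε ω) : HasInvCircle ε (-ω) := by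
  obtain ⟨γ, h1, h2, h3, h4, h5, h6⟩ := H
  have hr : Set.range (fun s => -γ (-s)) = Neg.neg '' Set.range γ := by
    ext p
    simp only [Set.mem_range, Set.mem_image, exists_exists_eq_and]
    exact ⟨fun ⟨s, hs⟩ => ⟨-s, hs⟩, fun ⟨s, hs⟩ => ⟨-s, by rwa [neg_neg]⟩⟩
  have hit : ∀ n p, (stdMap ε)^[n] (-p) = -(stdMap ε)^[n] p := fun n p =>
    (Function.Semiconj.iterate_right (f := Neg.neg) (fun q => (stdMap_neg ε q).symm) n p).symm
  refine ⟨fun s => -γ (-s), (h1.comp contDiff_neg).neg, fun s => ?_, fun s t hst => ?_, fun s => ?_, ?_, ?_⟩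
  · rw [deriv.fun_neg, deriv_comp_neg, neg_neg]; exact h2 _
  · obtain ⟨k, hk⟩ := h3 _ _ (neg_injective hst)
    exact ⟨-k, by push_cast; linarith⟩
  · have := h4 (-(s + 2 * π))
    rw [show -(s + 2 * π) + 2 * π = -s by ring] at this
    simp only
    rw [this]; abel
  · rw [hr, Set.image_image]
    simp only [stdMap_neg]
    rw [← Set.image_image Neg.neg (stdMap ε), h5]
  · rw [hr]
    rintro _ ⟨p, hp, rfl⟩
    have := (h6 p hp).neg
    rw [mul_neg]
    refine this.congr fun n => ?_
    rw [hit, Prod.fst_neg, Prod.fst_neg, ← neg_div]; ring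

theorem omegaMinus_eq_neg (ε : ℝ) : omegaMinus ε = -omegaPlus ε := by
  rw [omegaMinus, omegaPlus, Real.sInf_def, neg_neg]
  congr 1
  ext ω
  simp only [Set.mem_neg, Set.mem_ofPred_eq, Left.neg_pos_iff]
  exact and_congr_right fun _ => ⟨fun h => h.neg, fun h => by simpa using h.neg⟩

/-- For small `ε > 0` the standard map has two invariant circles with rotation numbers
`ω_l < 0 < ω_b` and `|ω_b − ω_l| < cε`; consequently `|ω±(ε)| < cε`,
i.e. `ln ε − ln |ω±(ε)| > −ln c`. -/
theorem invariant_circles_close_to_zero_rotation :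
    ∃ c : ℝ, 0 < c ∧ ∃ ε₀ : ℝ, 0 < ε₀ ∧ ∀ ε : ℝ, 0 < ε → ε < ε₀ →
      (∃ ωl ωb : ℝ, HasInvCircle ε ωl ∧ HasInvCircle ε ωb ∧
        ωl < 0 ∧ 0 < ωb ∧ |ωb - ωl| < c * ε) ∧
      |omegaPlus ε| < c * ε ∧ |omegaMinus ε| < c * ε ∧
      Real.log ε - Real.log (|omegaPlus ε|) > -Real.log c ∧
      Real.log ε - Real.log (|omegaMinus ε|) > -Real.log c := by
  obtain ⟨ε₀, hε₀, H⟩ := exists_hasInvCircle_near_zero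
  refine ⟨3 * 10 ^ 16, by norm_num, ε₀, hε₀, fun ε hε hlt => ?_⟩
  obtain ⟨ω, hω, hωε, hc⟩ := H ε hε hlt
  obtain ⟨δ, hδ, hmin⟩ := exists_pos_le_of_hasInvCircle hε
  have hmem : ω ∈ {ω : ℝ | 0 < ω ∧ HasInvCircle ε ω} := ⟨hω, hc⟩
  have hpos : 0 < omegaPlus ε := hδ.trans_le (le_csInf ⟨ω, hmem⟩ fun x hx => hmin x hx.1 hx.2)
  have hle : omegaPlus ε ≤ ω := csInf_le ⟨0, fun x hx => hx.1.le⟩ hmem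
  have habs : |omegaPlus ε| < 3 * 10 ^ 16 * ε := by rw [abs_of_pos hpos]; linarith
  have hlog : Real.log ε - Real.log (|omegaPlus ε|) > -Real.log (3 * 10 ^ 16) := by
    have := Real.log_lt_log (abs_pos.2 hpos.ne') habs
    rw [Real.log_mul (by norm_num) hε.ne'] at this
    linarith
  have hm : |omegaMinus ε| = |omegaPlus ε| := by rw [omegaMinus_eq_neg, abs_neg]
  rw [hm]
  refine ⟨⟨-ω, ω, hc.neg, hc, by linarith, hω, ?_⟩, habs, habs, hlog, hlog⟩
  rw [abs_of_pos (by linarith)]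
  linarith
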